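/- Let k be an algebraically closed field of characteristic zero and let R be a noetherian cocommutative Hopf k-algebra of finite Gelfand-Kirillov dimension that is a domain. Then R⊗_k R is a domain. -/

import Mathlib

open scoped TensorProduct ENNReal

/-- The Gelfand–Kirillov dimension of a `k`-algebra `R`:
`GKdim R = sup_V limsup_n log(dim_k(k + V + V² + ⋯ + Vⁿ)) / log n`,
the supremum running over finite-dimensional subspaces `V ⊆ R`.  (Here
`(1 ⊔ V)ⁿ = k + V + V² + ⋯ + Vⁿ` as a subspace of `R`, since `k·V = V`.) -/
noncomputable def gkDim (k R : Type*) [Field k] [Ring R] [Algebra k R] : ℝ≥0∞ :=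
  ⨆ (V : Submodule k R) (_ : FiniteDimensional k ↥V),
    Filter.limsup
      (fun n : ℕ => ENNReal.ofReal
        (Real.log (Module.finrank k ↥(((1 : Submodule k R) ⊔ V) ^ n)) / Real.log n))
      Filter.atTop

namespace GW
open Finset

lemma xlog_aux {x m : ℝ} (hx : 0 ≤ x) (hm : 0 < m) :
    2 * (x - √x * √m) ≤ x * Real.log x - x * Real.log m := by
  rcases hx.eq_or_lt with rfl | hx
  · simp
  have h1 : Real.log (√m / √x) ≤ √m / √x - 1 := Real.log_le_sub_one_of_pos (by positivity)
  rw [Real.log_div (by positivity) (by positivity), Real.log_sqrt hm.le, Real.log_sqrt hx.le] at h1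
  have h2 : x * (√m / √x) = √x * √m := by
    have : √x ≠ 0 := by positivity
    field_simp
    rw [Real.sq_sqrt hx.le]
  have h3 := mul_le_mul_of_nonneg_left h1 hx.le
  have : x * (√m / √x - 1) = √x * √m - x := by rw [mul_sub, h2, mul_one]
  rw [this] at h3
  linarith

lemma phi_gap {a b : ℝ} (ha : 0 ≤ a) (hb : 0 ≤ b) :
    (a - b) ^ 2 / (8 * (a + b)) ≤
      Real.negMulLog ((a + b) / 2) - (Real.negMulLog a + Real.negMulLog b) / 2 := by
  rcases (add_nonneg ha hb).eq_or_lt with h0 | hpos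
  · have : a = 0 := by linarith
    have : b = 0 := by linarith
    subst_vars; simp
  set m := (a + b) / 2 with hm
  have hmp : 0 < m := by positivity
  have h1 := xlog_aux ha hmp
  have h2 := xlog_aux hb hmp
  have key : Real.negMulLog m - (Real.negMulLog a + Real.negMulLog b) / 2 =
     ((a * Real.log a - a * Real.log m) + (b * Real.log b - b * Real.log m)) / 2 := by
    simp only [Real.negMulLog]; rw [hm]; ring
  rw [key]
  have sa := Real.sq_sqrt ha
  have sb := Real.sq_sqrt hb
  have sm := Real.sq_sqrt hmp.le
  have pa := Real.sqrt_nonneg a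
  have pb := Real.sqrt_nonneg b
  have pm := Real.sqrt_pos.2 hmp
  set A := √a
  set B := √b
  set M := √m
  have hMM : 2 * M ^ 2 = A ^ 2 + B ^ 2 := by rw [sa, sb, sm, hm]; ring
  have hAB : A + B ≤ 2 * M := by
    nlinarith [sq_nonneg (A - B)]
  have hg : (A - B) ^ 2 / 4 ≤ M * (2 * M - A - B) := by
    have : (2 * M - A - B) * (2 * M + A + B) = (A - B) ^ 2 := by nlinarith
    nlinarith
  have h3 : (a - b) ^ 2 / (8 * (a + b)) ≤ (A - B) ^ 2 / 4 := by
    rw [div_le_iff₀ (by positivity), ← sa, ← sb]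
    nlinarith [sq_nonneg (A - B), mul_nonneg (sq_nonneg (A-B)) (sq_nonneg (A-B))]
  nlinarith

variable {ι : Type*} [Fintype ι] [Nonempty ι]

/-- Jensen gap for an average, detecting two indices. -/
lemma jensen_gap (a : ι → ℝ) (ha : ∀ i, 0 ≤ a i) (i j : ι) :
    (Fintype.card ι : ℝ)⁻¹ * ((a i - a j) ^ 2 / (4 * (a i + a j))) +
      (Fintype.card ι : ℝ)⁻¹ * ∑ l, Real.negMulLog (a l) ≤
      Real.negMulLog ((Fintype.card ι : ℝ)⁻¹ * ∑ l, a l) := by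
  classical
  have hc : (0 : ℝ) < Fintype.card ι := by exact_mod_cast Fintype.card_pos
  have J : ∀ b : ι → ℝ, (∀ l, 0 ≤ b l) → (Fintype.card ι : ℝ)⁻¹ * ∑ l, Real.negMulLog (b l) ≤
      Real.negMulLog ((Fintype.card ι : ℝ)⁻¹ * ∑ l, b l) := by
    intro b hb
    have := Real.concaveOn_negMulLog.le_map_sum (t := univ) (w := fun _ : ι => (Fintype.card ι : ℝ)⁻¹)
      (p := b) (by intros; positivity) (by simp) (by intro l _; exact hb l)
    simpa [Finset.mul_sum] using this
  rcases eq_or_ne i j with rfl | hij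
  · simpa using J a ha
  let m := (a i + a j) / 2
  let b : ι → ℝ := Function.update (Function.update a i m) j m
  have hm : 0 ≤ m := by have := ha i; have := ha j; positivity
  have hb : ∀ l, 0 ≤ b l := by
    intro l
    simp only [b, Function.update_apply]
    split_ifs <;> first | exact hm | exact ha l
  have hsum : ∀ f : ℝ → ℝ, ∑ l, f (b l) = ∑ l, f (a l) + (2 * f m - f (a i) - f (a j)) := by
    intro f
    have h1 : ∀ c : ι → ℝ, ∑ l, f (c l) = f (c i) + (f (c j) + ∑ l ∈ (univ.erase i).erase j, f (c l)) := by
      intro c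
      rw [Finset.add_sum_erase (univ.erase i) (fun l => f (c l)) (by simp [hij.symm]),
        Finset.add_sum_erase univ (fun l => f (c l)) (by simp)]
    rw [h1 a, h1 b]
    have : ∑ l ∈ (univ.erase i).erase j, f (b l) = ∑ l ∈ (univ.erase i).erase j, f (a l) := by
      apply Finset.sum_congr rfl
      intro l hl
      simp only [Finset.mem_erase] at hl
      simp [b, hl.1, hl.2.1]
    rw [this]
    simp [b, hij]
    ring
  have h1 := J b hb
  have h2 : ∑ l, b l = ∑ l, a l := by
    have := hsum id
    simp only [id] at this
    rw [this]; simp [m]; ring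
  rw [h2, hsum] at h1
  refine le_trans ?_ h1
  rw [← mul_add]
  have := phi_gap (ha i) (ha j)
  have h4 : (a i - a j) ^ 2 / (4 * (a i + a j)) = 2 * ((a i - a j) ^ 2 / (8 * (a i + a j))) := by
    rcases eq_or_ne (a i + a j) 0 with h | h
    · simp [h]
    · field_simp; ring
  apply mul_le_mul_of_nonneg_left _ (by positivity)
  rw [h4]
  simp only [m]
  linarith

end GW

namespace GW
open Finset

variable {G : Type*} [Group G] {ι : Type*} [Fintype ι] [Nonempty ι] (σ : ι → G)

open Classical in
/-- the n-step distribution of the random walk -/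
noncomputable def mu : ℕ → G → ℝ
  | 0 => fun x => if x = 1 then 1 else 0
  | n + 1 => fun x => (Fintype.card ι : ℝ)⁻¹ * ∑ i, mu n ((σ i)⁻¹ * x)

/-- averaging operator -/
noncomputable def PP (u : G → ℝ) : G → ℝ := fun x => (Fintype.card ι : ℝ)⁻¹ * ∑ i, u (x * σ i)

lemma card_pos' : (0 : ℝ) < Fintype.card ι := by exact_mod_cast Fintype.card_pos

lemma mu_succ (n : ℕ) (x : G) : mu σ (n+1) x = (Fintype.card ι : ℝ)⁻¹ * ∑ i, mu σ n ((σ i)⁻¹ * x) := rfl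

lemma mu_succ_right (n : ℕ) (x : G) :
    mu σ (n+1) x = (Fintype.card ι : ℝ)⁻¹ * ∑ i, mu σ n (x * (σ i)⁻¹) := by
  induction n generalizing x with
  | zero =>
    simp only [mu]
    congr 1; apply Finset.sum_congr rfl; intro i _
    congr 1
    rw [mul_eq_one_iff_eq_inv, inv_inj, mul_inv_eq_one]
    exact propext eq_comm
  | succ n ih =>
    rw [mu_succ]
    conv_rhs =>
      enter [2, 2, i]
      rw [mu_succ]
    simp_rw [ih, ← Finset.mul_sum]
    rw [Finset.sum_comm]
    simp_rw [mul_assoc]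

lemma mu_nonneg (n : ℕ) (x : G) : 0 ≤ mu σ n x := by
  induction n generalizing x with
  | zero => simp only [mu]; split_ifs <;> norm_num
  | succ n ih =>
    rw [mu_succ]
    exact mul_nonneg (by positivity) (Finset.sum_nonneg fun i _ => ih _)

open Classical in
/-- finite set supporting mu -/
noncomputable def supp : ℕ → Finset G
  | 0 => {1}
  | n + 1 => Finset.image (fun p : ι × G => σ p.1 * p.2) (univ ×ˢ supp n)

lemma mu_eq_zero {n : ℕ} {x : G} (h : x ∉ supp σ n) : mu σ n x = 0 := by
  classical
  induction n generalizing x with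
  | zero => simp [supp] at h; simp [mu, h]
  | succ n ih =>
    rw [mu_succ]
    rw [Finset.sum_eq_zero, mul_zero]
    intro i _
    apply ih
    intro hx
    apply h
    simp only [supp, Finset.mem_image]
    exact ⟨(i, (σ i)⁻¹ * x), by simp [hx], by simp⟩

lemma summ {n : ℕ} (f : G → ℝ) : Summable (fun x => mu σ n x * f x) :=
  summable_of_ne_finset_zero (s := supp σ n) (fun b hb => by rw [mu_eq_zero σ hb, zero_mul])

lemma summ_mu {n : ℕ} : Summable (mu σ n) := by simpa using summ σ (n := n) (fun _ => 1)

/-- expectation -/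
noncomputable def EE (n : ℕ) (f : G → ℝ) : ℝ := ∑' x, mu σ n x * f x

lemma EE_add (n : ℕ) (f g : G → ℝ) : EE σ n (fun x => f x + g x) = EE σ n f + EE σ n g := by
  unfold EE
  rw [← (summ σ f).tsum_add (summ σ g)]
  simp_rw [mul_add]

lemma EE_smul (n : ℕ) (c : ℝ) (f : G → ℝ) : EE σ n (fun x => c * f x) = c * EE σ n f := by
  unfold EE
  rw [← tsum_mul_left]
  congr; ext x; ring

lemma EE_mono (n : ℕ) {f g : G → ℝ} (h : ∀ x, f x ≤ g x) : EE σ n f ≤ EE σ n g :=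
  (summ σ f).tsum_le_tsum (fun x => mul_le_mul_of_nonneg_left (h x) (mu_nonneg σ n x)) (summ σ g)

lemma EE_zero (f : G → ℝ) : EE σ 0 f = f 1 := by
  unfold EE
  rw [tsum_eq_single 1]
  · simp [mu]
  · intro b hb; simp [mu, hb]

lemma EE_sum (n : ℕ) {κ : Type*} (t : Finset κ) (f : κ → G → ℝ) :
    EE σ n (fun x => ∑ i ∈ t, f i x) = ∑ i ∈ t, EE σ n (f i) := by
  unfold EE
  rw [← Summable.tsum_finsetSum (fun i _ => summ σ (f i))]
  simp_rw [Finset.mul_sum]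

lemma tsum_shift_left (n : ℕ) (s : G) (f : G → ℝ) :
    ∑' x, mu σ n (s⁻¹ * x) * f x = EE σ n (fun x => f (s * x)) := by
  rw [← (Equiv.mulLeft s).tsum_eq]
  simp [EE]

lemma summ_shift (n : ℕ) (s : G) (f : G → ℝ) : Summable fun x => mu σ n (s⁻¹ * x) * f x := by
  rw [← (Equiv.mulLeft s).summable_iff]
  simpa [Function.comp_def] using summ σ (n := n) (fun x => f (s * x))

lemma EE_succ_left (n : ℕ) (f : G → ℝ) :
    EE σ (n+1) f = (Fintype.card ι : ℝ)⁻¹ * ∑ i, EE σ n (fun x => f (σ i * x)) := by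
  simp_rw [← tsum_shift_left]
  rw [← Summable.tsum_finsetSum (fun i _ => summ_shift σ n (σ i) f), ← tsum_mul_left]
  unfold EE
  congr; ext x
  rw [mu_succ, ← Finset.sum_mul, mul_assoc]

lemma EE_succ (n : ℕ) (f : G → ℝ) : EE σ (n+1) f = EE σ n (PP σ f) := by
  have hs : ∀ i, Summable fun x => mu σ n (x * (σ i)⁻¹) * f x := by
    intro i
    rw [← (Equiv.mulRight (σ i)).summable_iff]
    simpa [Function.comp_def] using summ σ (n := n) (fun x => f (x * σ i))
  have ht : ∀ i, ∑' x, mu σ n (x * (σ i)⁻¹) * f x = EE σ n (fun x => f (x * σ i)) := by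
    intro i
    rw [← (Equiv.mulRight (σ i)).tsum_eq]
    simp [EE]
  have : PP σ f = fun x => (Fintype.card ι : ℝ)⁻¹ * ∑ i, f (x * σ i) := rfl
  rw [this, EE_smul, EE_sum]
  simp_rw [← ht]
  rw [← Summable.tsum_finsetSum (fun i _ => hs i), ← tsum_mul_left]
  unfold EE
  congr; ext x
  rw [mu_succ_right, ← Finset.sum_mul, mul_assoc]

lemma PP_const (c : ℝ) : PP σ (fun _ => c) = fun _ => c := by
  ext x
  have := card_pos' (ι := ι)
  simp [PP]

lemma EE_const (n : ℕ) (c : ℝ) : EE σ n (fun _ => c) = c := by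
  induction n with
  | zero => rw [EE_zero]
  | succ n ih => rw [EE_succ, PP_const, ih]

lemma tsum_mu (n : ℕ) : ∑' x, mu σ n x = 1 := by simpa [EE] using EE_const σ n 1

/-- harmonic: expectation -/
lemma EE_harm (n : ℕ) {u : G → ℝ} (hu : PP σ u = u) (s : G) :
    EE σ n (fun x => u (s * x)) = u s := by
  induction n with
  | zero => rw [EE_zero, mul_one]
  | succ n ih =>
    rw [EE_succ, ← ih]
    congr
    ext x
    conv_rhs => rw [← hu]
    simp [PP, mul_assoc]

/-- the energy density -/
noncomputable def en (u v : G → ℝ) : G → ℝ := fun x =>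
  (Fintype.card ι : ℝ)⁻¹ * ∑ i, (u (x * σ i) - u x) * (v (x * σ i) - v x)

lemma PP_sq {u : G → ℝ} (hu : PP σ u = u) (c : ℝ) (x : G) :
    PP σ (fun x => (u x - c)^2) x = (u x - c)^2 + en σ u u x := by
  have h0 : (Fintype.card ι : ℝ)⁻¹ * ∑ i, u (x * σ i) = u x := congrFun hu x
  have hc := card_pos' (ι := ι)
  have h1 : ∑ i, u (x * σ i) = Fintype.card ι * u x := by rw [← h0]; field_simp
  unfold PP en
  have : ∀ i, (u (x * σ i) - c)^2 = (u (x * σ i) - u x) * (u (x * σ i) - u x) + (2 * (u x - c)) * u (x * σ i) +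
     ((u x - c)^2 - 2 * (u x - c) * u x) := by intro i; ring
  simp_rw [this]
  rw [Finset.sum_add_distrib, Finset.sum_add_distrib, ← Finset.mul_sum, h1]
  simp
  field_simp
  ring

/-- time average -/
noncomputable def AA (n : ℕ) (f : G → ℝ) : ℝ := (n : ℝ)⁻¹ * ∑ k ∈ range n, EE σ k f

lemma EE_sq (n : ℕ) {u : G → ℝ} (hu : PP σ u = u) :
    EE σ n (fun x => (u x - u 1)^2) = ∑ k ∈ range n, EE σ k (en σ u u) := by
  induction n with
  | zero => rw [EE_zero]; simp
  | succ n ih =>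
    rw [EE_succ, Finset.sum_range_succ, ← ih, ← EE_add]
    congr
    ext x
    rw [PP_sq σ hu]

end GW

namespace GW
open Finset

variable {G : Type*} [Group G] {ι : Type*} [Fintype ι] [Nonempty ι] (σ : ι → G)

noncomputable def HH (n : ℕ) : ℝ := ∑' x, Real.negMulLog (mu σ n x)

/-- D -/
noncomputable def DD (n : ℕ) (s : G) : ℝ :=
  ∑' x, (mu σ n (s⁻¹ * x) - mu σ n x)^2 / (mu σ n (s⁻¹ * x) + mu σ n x)

lemma summ_fun (n : ℕ) (φ : ℝ → ℝ) (h0 : φ 0 = 0) (s : G) : Summable fun x => φ (mu σ n (s⁻¹ * x)) := by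
  have h : Summable fun x => φ (mu σ n x) :=
    summable_of_ne_finset_zero (s := supp σ n) (fun b hb => by rw [mu_eq_zero σ hb, h0])
  exact (Equiv.mulLeft s⁻¹).summable_iff.2 h

lemma tsum_fun (n : ℕ) (φ : ℝ → ℝ) (s : G) : ∑' x, φ (mu σ n (s⁻¹ * x)) = ∑' x, φ (mu σ n x) :=
  (Equiv.mulLeft s⁻¹).tsum_eq (fun x => φ (mu σ n x))

lemma summ_fun2 (n : ℕ) (φ : ℝ → ℝ → ℝ) (h0 : φ 0 0 = 0) (s t : G) :
    Summable fun x => φ (mu σ n (s⁻¹ * x)) (mu σ n (t⁻¹ * x)) := by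
  classical
  apply summable_of_ne_finset_zero (s := (supp σ n).image (s * ·) ∪ (supp σ n).image (t * ·))
  intro b hb
  simp only [mem_union, mem_image, not_or, not_exists, not_and] at hb
  rw [mu_eq_zero σ (fun h => hb.1 _ h (by simp)), mu_eq_zero σ (fun h => hb.2 _ h (by simp)), h0]

lemma summ_D (n : ℕ) (s : G) :
    Summable fun x => (mu σ n (s⁻¹ * x) - mu σ n x)^2 / (mu σ n (s⁻¹ * x) + mu σ n x) := by
  simpa using summ_fun2 σ n (fun a b => (a-b)^2/(a+b)) (by simp) s 1

lemma HH_le (n : ℕ) : HH σ n ≤ Real.log (supp σ n).card := by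
  set S := supp σ n with hS
  have hne : S.Nonempty := by
    rw [Finset.nonempty_iff_ne_empty]
    intro h
    have := tsum_mu σ n
    rw [tsum_eq_sum (s := S) (fun b hb => mu_eq_zero σ hb), h] at this
    simp at this
  have hc : (0:ℝ) < S.card := by exact_mod_cast hne.card_pos
  have h1 : ∑ x ∈ S, mu σ n x = 1 := by
    rw [← tsum_mu σ n, tsum_eq_sum (s := S) (fun b hb => mu_eq_zero σ hb)]
  have h2 : HH σ n = ∑ x ∈ S, Real.negMulLog (mu σ n x) := by
    unfold HH
    rw [tsum_eq_sum (s := S) (fun b hb => by rw [mu_eq_zero σ hb]; simp)]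
  have := Real.concaveOn_negMulLog.le_map_sum (t := S) (w := fun _ => (S.card : ℝ)⁻¹)
      (p := mu σ n) (by intros; positivity) (by simp; field_simp) (by intro l _; exact mu_nonneg σ n l)
  simp only [smul_eq_mul, ← Finset.mul_sum, h1, ← h2, mul_one] at this
  rw [Real.negMulLog, Real.log_inv] at this
  have := mul_le_mul_of_nonneg_left this hc.le
  field_simp at this
  linarith

lemma HH_gap (n : ℕ) {i0 : ι} (h0 : σ i0 = 1) (j : ι) :
    DD σ n (σ j) ≤ 4 * Fintype.card ι * (HH σ (n+1) - HH σ n) := by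
  have hc := card_pos' (ι := ι)
  have h1 : (Fintype.card ι : ℝ)⁻¹ * (1/4) * DD σ n (σ j) + HH σ n ≤ HH σ (n+1) := by
    have e1 : HH σ n = (Fintype.card ι : ℝ)⁻¹ * ∑ i, ∑' x, Real.negMulLog (mu σ n ((σ i)⁻¹ * x)) := by
      simp_rw [tsum_fun]
      simp [HH]
    rw [e1, ← Summable.tsum_finsetSum (fun i _ => summ_fun σ n _ (by simp) (σ i)), ← tsum_mul_left, DD,
      ← tsum_mul_left, ← Summable.tsum_add, HH]
    · apply Summable.tsum_le_tsum
      · intro x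
        have := jensen_gap (fun i => mu σ n ((σ i)⁻¹ * x)) (fun i => mu_nonneg σ n _) j i0
        simp only [h0, inv_one, one_mul] at this
        rw [mu_succ]
        refine le_trans (le_of_eq ?_) this
        congr 1
        rw [mul_comm 4 (_ + _), ← div_div]
        ring
      · apply Summable.add
        · exact (summ_D σ n (σ j)).mul_left _
        · apply Summable.mul_left
          exact summable_sum (fun i _ => summ_fun σ n _ (by simp) (σ i))
      · simpa using summ_fun σ (n+1) _ (by simp) (1:G)
    · exact (summ_D σ n (σ j)).mul_left _
    · apply Summable.mul_left
      exact summable_sum (fun i _ => summ_fun σ n _ (by simp) (σ i))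
  have h2 : (Fintype.card ι : ℝ)⁻¹ * (1/4) * DD σ n (σ j) ≤ HH σ (n+1) - HH σ n := by linarith
  have h3 := mul_le_mul_of_nonneg_left h2 (by positivity : (0:ℝ) ≤ 4 * Fintype.card ι)
  refine le_trans (le_of_eq ?_) h3
  field_simp

open Filter in
lemma good_freq {C : ℝ} {d : ℕ} (hg : ∀ n, 1 ≤ n → ((supp σ n).card : ℝ) ≤ C * n^d) :
    ∃ᶠ n : ℕ in atTop, (n:ℝ) * (HH σ (n+1) - HH σ n) ≤ d + 1 := by
  by_contra hcon
  rw [not_frequently] at hcon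
  obtain ⟨N, hN⟩ := eventually_atTop.1 (hcon.and (eventually_ge_atTop 1))
  have h1 : ∀ n, N ≤ n → HH σ N + (d+1) * (Real.log n - Real.log N) ≤ HH σ n := by
    intro n hn
    induction n, hn using Nat.le_induction with
    | base => simp
    | succ n hn ih =>
      obtain ⟨h2, h3⟩ := hN n hn
      rw [not_le] at h2
      have hn0 : (0:ℝ) < n := by exact_mod_cast h3
      have h4 : Real.log ((n+1:ℕ)) - Real.log n ≤ 1 / n := by
        rw [← Real.log_div (by positivity) (by positivity)]
        refine (Real.log_le_sub_one_of_pos (by positivity)).trans (le_of_eq ?_)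
        push_cast; field_simp; ring
      have h5 : (d+1) / (n:ℝ) ≤ HH σ (n+1) - HH σ n := by
        rw [div_le_iff₀ hn0]; linarith
      have h6 : (d+1) * (Real.log ((n+1:ℕ)) - Real.log n) ≤ (d+1) / (n:ℝ) := by
        have := mul_le_mul_of_nonneg_left h4 (by positivity : (0:ℝ) ≤ d+1)
        refine this.trans (le_of_eq (by ring))
      linarith
  have hCpos : ∀ n, 1 ≤ n → HH σ n ≤ Real.log C + d * Real.log n := by
    intro n hn
    have hn0 : (0:ℝ) < n := by exact_mod_cast hn
    have hc1 : (1:ℝ) ≤ (supp σ n).card := by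
      have : (supp σ n).Nonempty := by
        rw [Finset.nonempty_iff_ne_empty]
        intro h
        have := tsum_mu σ n
        rw [tsum_eq_sum (s := supp σ n) (fun b hb => mu_eq_zero σ hb), h] at this
        simp at this
      exact_mod_cast this.card_pos
    have hC : 0 < C := by
      by_contra hC
      have := hg n hn
      have : C * (n:ℝ)^d ≤ 0 := mul_nonpos_of_nonpos_of_nonneg (not_lt.1 hC) (by positivity)
      linarith
    refine (HH_le σ n).trans ?_
    refine (Real.log_le_log (by linarith) (hg n hn)).trans (le_of_eq ?_)
    rw [Real.log_mul hC.ne' (by positivity), Real.log_pow]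
  have hlim : Tendsto (fun n : ℕ => Real.log n) atTop atTop :=
    Real.tendsto_log_atTop.comp tendsto_natCast_atTop_atTop
  obtain ⟨n, hn1, hn2⟩ := ((hlim.eventually_gt_atTop (Real.log C - HH σ N + (d+1) * Real.log N)).and
    (eventually_ge_atTop (max N 1))).exists
  have a1 := h1 n (le_trans (le_max_left _ _) hn2)
  have a2 := hCpos n (le_trans (le_max_right _ _) hn2)
  linarith

/-- ℓ¹ defect of invariance -/
noncomputable def LL (n : ℕ) (s : G) : ℝ := ∑' x, |mu σ n (s⁻¹ * x) - mu σ n x|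

lemma summ_L (n : ℕ) (s t : G) : Summable fun x => |mu σ n (s⁻¹ * x) - mu σ n (t⁻¹ * x)| :=
  summ_fun2 σ n (fun a b => |a - b|) (by simp) s t

lemma LL_nonneg (n : ℕ) (s : G) : 0 ≤ LL σ n s := tsum_nonneg fun _ => abs_nonneg _

lemma LL_anti (n : ℕ) (s : G) : LL σ (n+1) s ≤ LL σ n s := by
  have hs0 : Summable fun x => |mu σ n (s⁻¹ * x) - mu σ n x| := by simpa using summ_L σ n s 1
  have hs : ∀ i, Summable fun x => |mu σ n (s⁻¹ * (x * (σ i)⁻¹)) - mu σ n (x * (σ i)⁻¹)| := by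
    intro i
    exact (Equiv.mulRight (σ i)⁻¹).summable_iff.2 hs0
  have ht : ∀ i, ∑' x, |mu σ n (s⁻¹ * (x * (σ i)⁻¹)) - mu σ n (x * (σ i)⁻¹)| = LL σ n s := by
    intro i
    exact (Equiv.mulRight (σ i)⁻¹).tsum_eq (fun x => |mu σ n (s⁻¹ * x) - mu σ n x|)
  have h1 : LL σ n s = (Fintype.card ι : ℝ)⁻¹ *
      ∑ i, ∑' x, |mu σ n (s⁻¹ * (x * (σ i)⁻¹)) - mu σ n (x * (σ i)⁻¹)| := by
    simp_rw [ht]; simp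
  rw [h1, ← Summable.tsum_finsetSum (fun i _ => hs i), ← tsum_mul_left, LL]
  apply Summable.tsum_le_tsum
  · intro x
    rw [mu_succ_right, mu_succ_right, ← mul_sub, ← Finset.sum_sub_distrib, abs_mul,
      abs_of_nonneg (by positivity : (0:ℝ) ≤ (Fintype.card ι : ℝ)⁻¹)]
    apply mul_le_mul_of_nonneg_left _ (by positivity)
    simp_rw [mul_assoc]
    exact Finset.abs_sum_le_sum_abs _ _
  · simpa using summ_L σ (n+1) s 1
  · apply Summable.mul_left
    exact summable_sum (fun i _ => hs i)

/-- weighted Cauchy–Schwarz -/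
lemma cs_D (n : ℕ) (s : G) (f : G → ℝ) :
    (∑' x, (mu σ n (s⁻¹ * x) - mu σ n x) * f x)^2 ≤
      DD σ n s * (EE σ n (fun x => f (s*x)^2) + EE σ n (fun x => f x^2)) := by
  classical
  set S := (supp σ n).image (s * ·) ∪ (supp σ n)
  have hz : ∀ x, x ∉ S → mu σ n (s⁻¹ * x) = 0 ∧ mu σ n x = 0 := by
    intro b hb
    simp only [S, mem_union, mem_image, not_or, not_exists, not_and] at hb
    exact ⟨mu_eq_zero σ (fun h => hb.1 _ h (by simp)), mu_eq_zero σ hb.2⟩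
  have e1 : EE σ n (fun x => f (s*x)^2) + EE σ n (fun x => f x^2) =
      ∑ x ∈ S, (mu σ n (s⁻¹ * x) + mu σ n x) * f x^2 := by
    rw [← tsum_shift_left σ n s (fun x => f x ^2), EE, ← (summ_shift σ n s _).tsum_add (summ σ _),
      tsum_eq_sum (s := S)]
    · apply Finset.sum_congr rfl; intros; ring
    · intro b hb; simp [hz b hb]
  rw [e1, DD, tsum_eq_sum (s := S) (by intro b hb; simp [hz b hb]),
    tsum_eq_sum (s := S) (by intro b hb; simp [hz b hb])]
  apply Finset.sum_sq_le_sum_mul_sum_of_sq_le_mul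
  · intro x _
    have := mu_nonneg σ n (s⁻¹ * x); have := mu_nonneg σ n x
    positivity
  · intro x _
    have := mu_nonneg σ n (s⁻¹ * x); have := mu_nonneg σ n x
    positivity
  · intro x _
    have := mu_nonneg σ n (s⁻¹ * x); have := mu_nonneg σ n x
    apply le_of_eq
    rcases eq_or_ne (mu σ n (s⁻¹ * x) + mu σ n x) 0 with h | h
    · have h1 : mu σ n (s⁻¹ * x) = 0 := by linarith
      have h2 : mu σ n x = 0 := by linarith
      simp [h1, h2]
    · field_simp

lemma LL_sq_le (n : ℕ) (s : G) : LL σ n s ^ 2 ≤ 2 * DD σ n s := by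
  have := cs_D σ n s (fun x => SignType.sign (mu σ n (s⁻¹ * x) - mu σ n x))
  have e : ∀ x, (mu σ n (s⁻¹ * x) - mu σ n x) * ((SignType.sign (mu σ n (s⁻¹ * x) - mu σ n x) : SignType) : ℝ)
     = |mu σ n (s⁻¹ * x) - mu σ n x| := by intro x; rw [mul_comm]; exact sign_mul_self _
  simp_rw [e] at this
  refine this.trans ?_
  have hD : 0 ≤ DD σ n s := tsum_nonneg fun x => by
    have := mu_nonneg σ n (s⁻¹ * x); have := mu_nonneg σ n x
    positivity
  have hs : ∀ y : SignType, ((y:ℝ))^2 ≤ 1 := by intro y; cases y <;> simp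
  have b1 : EE σ n (fun x => ((SignType.sign (mu σ n (s⁻¹ * (s*x)) - mu σ n (s * x)) : SignType) : ℝ)^2) ≤ 1 := by
    rw [← EE_const σ n 1]; exact EE_mono σ n fun x => hs _
  have b2 : EE σ n (fun x => ((SignType.sign (mu σ n (s⁻¹ * x) - mu σ n x) : SignType) : ℝ)^2) ≤ 1 := by
    rw [← EE_const σ n 1]; exact EE_mono σ n fun x => hs _
  nlinarith

end GW

namespace GW
open Finset Filter Topology

variable {G : Type*} [Group G] {ι : Type*} [Fintype ι] [Nonempty ι] (σ : ι → G)

lemma EE_shift_sub (n : ℕ) (s : G) (f : G → ℝ) :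
    EE σ n (fun x => f (s * x)) - EE σ n f = ∑' x, (mu σ n (s⁻¹ * x) - mu σ n x) * f x := by
  rw [← tsum_shift_left, EE, ← (summ_shift σ n s f).tsum_sub (summ σ f)]
  simp_rw [sub_mul]

lemma summ_sub_mul (n : ℕ) (s : G) (f : G → ℝ) :
    Summable fun x => |mu σ n (s⁻¹ * x) - mu σ n x| * f x := by
  classical
  apply summable_of_ne_finset_zero (s := (supp σ n).image (s * ·) ∪ (supp σ n))
  intro b hb
  simp only [mem_union, mem_image, not_or, not_exists, not_and] at hb
  rw [mu_eq_zero σ (fun h => hb.1 _ h (by simp)), mu_eq_zero σ hb.2]; simp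

lemma EE_shift_le (n : ℕ) (s : G) (f : G → ℝ) {C : ℝ} (hf : ∀ x, |f x| ≤ C) :
    |EE σ n (fun x => f (s * x)) - EE σ n f| ≤ LL σ n s * C := by
  rw [EE_shift_sub, LL, ← tsum_mul_right]
  have h1 : Summable fun x => ‖(mu σ n (s⁻¹ * x) - mu σ n x) * f x‖ :=
    (summ_sub_mul σ n s (fun x => |f x|)).congr (fun x => by rw [Real.norm_eq_abs, abs_mul])
  have h2 : Summable fun x => |mu σ n (s⁻¹ * x) - mu σ n x| * C := summ_sub_mul σ n s (fun _ => C)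
  have h3 := norm_tsum_le_tsum_norm h1
  have h4 : ∑' x, ‖(mu σ n (s⁻¹ * x) - mu σ n x) * f x‖ ≤ ∑' x, |mu σ n (s⁻¹ * x) - mu σ n x| * C := by
    refine Summable.tsum_le_tsum (fun x => ?_) h1 h2
    rw [Real.norm_eq_abs, abs_mul]
    exact mul_le_mul_of_nonneg_left (hf x) (abs_nonneg _)
  exact h3.trans h4

/-- hypotheses package -/
structure Good (K : ℝ) (ω : Ultrafilter ℕ) : Prop where
  le : (ω : Filter ℕ) ≤ atTop
  good : ∀ᶠ n : ℕ in (ω : Filter ℕ), ∀ j, (n:ℝ) * DD σ n (σ j) ≤ K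
  gen : Subgroup.closure (Set.range σ) = ⊤

lemma exists_good {C : ℝ} {d : ℕ} (hg : ∀ n, 1 ≤ n → ((supp σ n).card : ℝ) ≤ C * n^d)
    {i0 : ι} (h0 : σ i0 = 1) (hgen : Subgroup.closure (Set.range σ) = ⊤) :
    ∃ ω : Ultrafilter ℕ, Good σ (4 * Fintype.card ι * (d+1)) ω := by
  have h1 := good_freq σ hg
  rw [Filter.frequently_iff_neBot] at h1
  refine ⟨Ultrafilter.of (atTop ⊓ 𝓟 {n : ℕ | (n:ℝ) * (HH σ (n+1) - HH σ n) ≤ d + 1}), ⟨(Ultrafilter.of_le _).trans inf_le_left, ?_, hgen⟩⟩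
  have h2 : {n : ℕ | (n:ℝ) * (HH σ (n+1) - HH σ n) ≤ d + 1} ∈ (Ultrafilter.of (atTop ⊓ 𝓟 {n : ℕ | (n:ℝ) * (HH σ (n+1) - HH σ n) ≤ d + 1}) : Filter ℕ) :=
    (Ultrafilter.of_le _) (mem_inf_of_right (mem_principal_self _))
  filter_upwards [h2] with n hn j
  have hn' : (n:ℝ) * (HH σ (n+1) - HH σ n) ≤ d + 1 := hn
  have h3 := mul_le_mul_of_nonneg_left (HH_gap σ n h0 j) (by positivity : (0:ℝ) ≤ n)
  have hc := card_pos' (ι := ι)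
  nlinarith

variable {σ} {K : ℝ} {ω : Ultrafilter ℕ}

lemma LL_tendsto (hω : Good σ K ω) (s : G) : Tendsto (fun n => LL σ n s) atTop (𝓝 0) := by
  have hs : s ∈ Subgroup.closure (Set.range σ) := by rw [hω.gen]; trivial
  induction hs using Subgroup.closure_induction with
  | mem s hs =>
    obtain ⟨j, rfl⟩ := hs
    have hanti : Antitone fun n => LL σ n (σ j) := antitone_nat_of_succ_le (fun n => LL_anti σ n _)
    rw [Metric.tendsto_atTop]
    intro ε hε
    have hlim : Tendsto (fun n : ℕ => (2 * K + 1) / (n:ℝ)) (ω : Filter ℕ) (𝓝 0) :=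
      (tendsto_const_div_atTop_nhds_zero_nat _).mono_left hω.le
    obtain ⟨N, ⟨h1, h2⟩, h3⟩ := ((hω.good.and (hlim.eventually_lt_const (by positivity : 0 < ε^2))).and
      (hω.le (eventually_ge_atTop 1))).exists
    refine ⟨N, fun n hn => ?_⟩
    rw [Real.dist_eq, sub_zero, abs_of_nonneg (LL_nonneg σ _ _)]
    refine (hanti hn).trans_lt ?_
    have hN : (0:ℝ) < N := by exact_mod_cast h3
    have h4 := LL_sq_le σ N (σ j)
    have h5 : DD σ N (σ j) ≤ K / N := by rw [le_div_iff₀ hN]; linarith [h1 j]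
    have h6 : LL σ N (σ j) ^ 2 < ε ^ 2 := by
      have : (2*K+1)/(N:ℝ) = 2 * (K/N) + 1/N := by ring
      have : 0 < 1/(N:ℝ) := by positivity
      linarith
    exact lt_of_pow_lt_pow_left₀ 2 hε.le h6
  | one => simp [LL]
  | mul s t _ _ h1 h2 =>
    refine squeeze_zero (fun n => LL_nonneg σ n _) (fun n => ?_) (by simpa using h1.add h2)
    have e : LL σ n t = ∑' x, |mu σ n ((s*t)⁻¹ * x) - mu σ n (s⁻¹ * x)| := by
      rw [LL, ← (Equiv.mulLeft s⁻¹).tsum_eq]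
      simp [mul_assoc]
    rw [e, LL, LL, ← Summable.tsum_add]
    · apply Summable.tsum_le_tsum
      · intro x
        rw [add_comm]
        exact abs_sub_le _ _ _
      · simpa using summ_L σ n (s*t) 1
      · exact Summable.add (by simpa using summ_L σ n s 1) (summ_L σ n (s*t) s)
    · simpa using summ_L σ n s 1
    · exact summ_L σ n (s*t) s
  | inv s _ h =>
    convert h using 2 with n
    rw [LL, LL, ← (Equiv.mulLeft s⁻¹).tsum_eq]
    simp [abs_sub_comm]

lemma AA_bdd {f : G → ℝ} {C : ℝ} (hf : ∀ x, |f x| ≤ C) (n : ℕ) : |AA σ n f| ≤ C := by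
  have hC : 0 ≤ C := (abs_nonneg _).trans (hf 1)
  have h1 : ∀ k, |EE σ k f| ≤ C := by
    intro k
    rw [abs_le]
    constructor
    · rw [← EE_const σ k (-C)]; exact EE_mono σ k fun x => (abs_le.1 (hf x)).1
    · rw [← EE_const σ k C]; exact EE_mono σ k fun x => (abs_le.1 (hf x)).2
  rcases Nat.eq_zero_or_pos n with rfl | hn
  · simp [AA, hC]
  have hn' : (0:ℝ) < n := by exact_mod_cast hn
  rw [AA, abs_mul, abs_of_nonneg (by positivity), inv_mul_le_iff₀ hn']
  refine (Finset.abs_sum_le_sum_abs _ _).trans ?_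
  refine (Finset.sum_le_sum fun k _ => h1 k).trans ?_
  simp

/-- the mean -/
noncomputable def MM (σ : ι → G) (ω : Ultrafilter ℕ) (f : G → ℝ) : ℝ := limUnder (ω : Filter ℕ) (fun n => AA σ n f)

lemma MM_tendsto {f : G → ℝ} {C : ℝ} (hf : ∀ x, |f x| ≤ C) :
    Tendsto (fun n => AA σ n f) ω (𝓝 (MM σ ω f)) := by
  apply tendsto_nhds_limUnder
  have hc : IsCompact (Set.Icc (-C) C) := isCompact_Icc
  obtain ⟨x, _, hx⟩ := hc.ultrafilter_le_nhds (ω.map fun n => AA σ n f) (by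
    rw [le_principal_iff]
    refine Filter.mem_map.2 (Filter.univ_mem' fun n => ?_)
    exact abs_le.1 (AA_bdd hf n))
  exact ⟨x, hx⟩

lemma MM_shift (hω : Good σ K ω) {f : G → ℝ} {C : ℝ} (hf : ∀ x, |f x| ≤ C) (s : G) :
    MM σ ω (fun x => f (s * x)) = MM σ ω f := by
  have h1 := MM_tendsto (σ := σ) (ω := ω) hf
  have h2 := MM_tendsto (σ := σ) (ω := ω) (f := fun x => f (s * x)) (C := C) (fun x => hf _)
  have h3 : Tendsto (fun n => AA σ n (fun x => f (s * x)) - AA σ n f) ω (𝓝 0) := by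
    have hc := (LL_tendsto hω s).cesaro.mul_const C
    rw [zero_mul] at hc
    refine squeeze_zero_norm (fun n => ?_) (hc.mono_left hω.le)
    rw [Real.norm_eq_abs, AA, AA, ← mul_sub, ← Finset.sum_sub_distrib, abs_mul,
      abs_of_nonneg (by positivity : (0:ℝ) ≤ (n:ℝ)⁻¹), mul_assoc, Finset.sum_mul]
    apply mul_le_mul_of_nonneg_left _ (by positivity)
    refine (Finset.abs_sum_le_sum_abs _ _).trans ?_
    exact Finset.sum_le_sum fun k _ => EE_shift_le σ k s f hf
  have := tendsto_nhds_unique h3 (h2.sub h1)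
  linarith

/-- Lipschitz harmonic functions vanishing at 1 -/
def LH (σ : ι → G) : Submodule ℝ (G → ℝ) where
  carrier := {u | PP σ u = u ∧ u 1 = 0 ∧ ∃ C, ∀ x i, |u (x * σ i) - u x| ≤ C}
  add_mem' := by
    rintro u v ⟨hu, hu1, C, hC⟩ ⟨hv, hv1, D, hD⟩
    refine ⟨?_, by simp [hu1, hv1], C + D, fun x i => ?_⟩
    · conv_rhs => rw [← hu, ← hv]
      ext x; simp [PP, Finset.sum_add_distrib, mul_add]
    · simp only [Pi.add_apply]
      calc _ = |(u (x * σ i) - u x) + (v (x * σ i) - v x)| := by congr 1; ring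
        _ ≤ _ := (abs_add_le _ _).trans (add_le_add (hC x i) (hD x i))
  zero_mem' := ⟨by ext x; simp [PP], rfl, 0, by simp⟩
  smul_mem' := by
    rintro c u ⟨hu, hu1, C, hC⟩
    refine ⟨?_, by simp [hu1], |c| * C, fun x i => ?_⟩
    · conv_rhs => rw [← hu]
      ext x; simp [PP, ← Finset.mul_sum]; ring
    · simp only [Pi.smul_apply, smul_eq_mul, ← mul_sub, abs_mul]
      exact mul_le_mul_of_nonneg_left (hC x i) (abs_nonneg c)

lemma en_bdd {u v : G → ℝ} (hu : u ∈ LH σ) (hv : v ∈ LH σ) : ∃ C, ∀ x, |en σ u v x| ≤ C := by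
  obtain ⟨-, -, C, hC⟩ := hu
  obtain ⟨-, -, D, hD⟩ := hv
  refine ⟨C * D, fun x => ?_⟩
  have hc := card_pos' (ι := ι)
  rw [en, abs_mul, abs_of_nonneg (by positivity), inv_mul_le_iff₀ hc]
  refine (Finset.abs_sum_le_sum_abs _ _).trans ?_
  refine (Finset.sum_le_sum fun i _ => ?_).trans (le_of_eq ?_) (b := ∑ i : ι, C * D)
  · rw [abs_mul]
    exact mul_le_mul (hC x i) (hD x i) (abs_nonneg _) ((abs_nonneg _).trans (hC x i))
  · simp

lemma AA_add (n : ℕ) (f g : G → ℝ) : AA σ n (fun x => f x + g x) = AA σ n f + AA σ n g := by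
  simp_rw [AA, EE_add, Finset.sum_add_distrib, mul_add]

lemma AA_smul (n : ℕ) (c : ℝ) (f : G → ℝ) : AA σ n (fun x => c * f x) = c * AA σ n f := by
  simp_rw [AA, EE_smul, ← Finset.mul_sum]; ring

lemma MM_tendsto' {u v : G → ℝ} (hu : u ∈ LH σ) (hv : v ∈ LH σ) :
    Tendsto (fun n => AA σ n (en σ u v)) ω (𝓝 (MM σ ω (en σ u v))) := by
  obtain ⟨C, hC⟩ := en_bdd hu hv
  exact MM_tendsto hC

lemma en_comm (u v : G → ℝ) : en σ u v = en σ v u := by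
  ext x; simp only [en]; congr 1; apply Finset.sum_congr rfl; intros; ring

lemma en_add (u v w : G → ℝ) : en σ (u + v) w = fun x => en σ u w x + en σ v w x := by
  ext x; simp only [en, ← mul_add, ← Finset.sum_add_distrib]
  congr 1; apply Finset.sum_congr rfl; intros; simp; ring

lemma en_smul (c : ℝ) (u w : G → ℝ) : en σ (c • u) w = fun x => c * en σ u w x := by
  ext x
  simp only [en]
  rw [mul_left_comm, Finset.mul_sum (a := c)]
  congr 1; apply Finset.sum_congr rfl; intros; simp; ring

/-- the quadratic form -/
noncomputable def BB (σ : ι → G) (ω : Ultrafilter ℕ) : LinearMap.BilinForm ℝ (LH σ) := by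
  have hadd : ∀ u v w : LH σ, MM σ ω (en σ (u + v : LH σ) w) = MM σ ω (en σ u w) + MM σ ω (en σ v w) := by
    intro u v w
    refine tendsto_nhds_unique (MM_tendsto' (u+v : LH σ).2 w.2) ?_
    convert (MM_tendsto' u.2 w.2).add (MM_tendsto' v.2 w.2) using 2 with n
    rw [← AA_add, ← en_add]; rfl
  have hsmul : ∀ (c : ℝ) (u w : LH σ), MM σ ω (en σ (c • u : LH σ) w) = c * MM σ ω (en σ u w) := by
    intro c u w
    refine tendsto_nhds_unique (MM_tendsto' (c • u : LH σ).2 w.2) ?_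
    convert (MM_tendsto' u.2 w.2).const_mul c using 2 with n
    rw [← AA_smul, ← en_smul]; rfl
  refine LinearMap.mk₂ ℝ (fun u v => MM σ ω (en σ u v)) hadd hsmul ?_ ?_
  · intro u v w
    rw [en_comm, hadd, en_comm, en_comm (v := (w : G → ℝ))]
  · intro c u w
    rw [en_comm, hsmul, en_comm]; rfl

lemma BB_apply (u v : LH σ) : BB σ ω u v = MM σ ω (en σ u v) := rfl

/-- translation -/
lemma trans_mem {u : G → ℝ} (hu : u ∈ LH σ) (z : G) : (fun x => u (z * x) - u z) ∈ LH σ := by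
  obtain ⟨hu, hu1, C, hC⟩ := hu
  refine ⟨?_, by simp, C, fun x i => ?_⟩
  · ext x
    have h := congrFun hu (z * x)
    have hc := card_pos' (ι := ι)
    simp only [PP] at h ⊢
    rw [Finset.sum_sub_distrib, mul_sub]
    simp_rw [← mul_assoc]
    rw [h]
    simp
  · have := hC (z*x) i
    simpa [mul_assoc] using this

lemma BB_trans (hω : Good σ K ω) (u : LH σ) (z : G) : BB σ ω ⟨_, trans_mem u.2 z⟩ ⟨_, trans_mem u.2 z⟩ = BB σ ω u u := by
  obtain ⟨C, hC⟩ := en_bdd u.2 u.2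
  rw [BB_apply, BB_apply, ← MM_shift hω hC z]
  congr 1
  ext x
  simp [en, mul_assoc]

lemma key_ineq (hω : Good σ K ω) (u : LH σ) (j : ι) : (u.1 (σ j))^2 ≤ 3 * K * BB σ ω u u := by
  have hu := u.2.1
  have hu1 : u.1 1 = 0 := u.2.2.1
  set s := σ j
  let v : LH σ := ⟨_, trans_mem u.2 s⟩
  have t1 : Tendsto (fun n => AA σ n (en σ u u)) ω (𝓝 (BB σ ω u u)) := MM_tendsto' u.2 u.2
  have t2 : Tendsto (fun n => AA σ n (en σ v v)) ω (𝓝 (BB σ ω u u)) := by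
    rw [← BB_trans hω u s]; exact MM_tendsto' v.2 v.2
  have t3 : Tendsto (fun n : ℕ => 2 * (u.1 s)^2 / (n:ℝ)) ω (𝓝 0) :=
    (tendsto_const_div_atTop_nhds_zero_nat _).mono_left hω.le
  have t4 := ((t2.const_mul 2).add (t3.add t1)).const_mul K
  have e : K * (2 * BB σ ω u u + (0 + BB σ ω u u)) = 3 * K * BB σ ω u u := by ring
  rw [e] at t4
  refine ge_of_tendsto t4 ?_
  filter_upwards [hω.good, hω.le (eventually_ge_atTop 1)] with n hn hn1
  have hn0 : (0:ℝ) < n := by exact_mod_cast hn1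
  have c1 : u.1 s = ∑' x, (mu σ n (s⁻¹ * x) - mu σ n x) * u.1 x := by
    rw [← EE_shift_sub, EE_harm σ n hu]
    have := EE_harm σ n hu 1
    simp only [one_mul] at this
    rw [this, hu1, sub_zero]
  have c2 := cs_D σ n s u.1
  rw [← c1] at c2
  have c3 : EE σ n (fun x => u.1 x ^ 2) = n * AA σ n (en σ u u) := by
    have := EE_sq σ n hu
    rw [hu1] at this
    simp only [sub_zero] at this
    rw [this, AA]; field_simp
  have c4 : EE σ n (fun x => (u.1 (s*x) - u.1 s) ^ 2) = n * AA σ n (en σ v v) := by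
    have := EE_sq σ n v.2.1
    rw [v.2.2.1] at this
    simp only [sub_zero] at this
    change EE σ n (fun x => (v.1 x)^2) = _
    rw [this, AA]; field_simp
  have c5 : EE σ n (fun x => u.1 (s*x)^2) ≤ 2 * (u.1 s)^2 + 2 * (n * AA σ n (en σ v v)) := by
    rw [← c4, ← EE_smul, ← EE_const σ n (2 * (u.1 s)^2), ← EE_add]
    apply EE_mono
    intro x
    nlinarith [sq_nonneg (u.1 (s*x) - u.1 s - u.1 s)]
  have hD : 0 ≤ DD σ n s := tsum_nonneg fun x => by
    have := mu_nonneg σ n (s⁻¹ * x); have := mu_nonneg σ n x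
    positivity
  have hA : 0 ≤ EE σ n (fun x => u.1 x ^ 2) := by
    rw [← EE_const σ n 0]; exact EE_mono σ n fun x => sq_nonneg _
  have hA' : 0 ≤ EE σ n (fun x => (u.1 (s*x) - u.1 s) ^ 2) := by
    rw [← EE_const σ n 0]; exact EE_mono σ n fun x => sq_nonneg _
  rw [c4] at hA'
  rw [c3] at hA c2
  have h7 := hn j
  change (n:ℝ) * DD σ n s ≤ K at h7
  have c6 : (u.1 s)^2 ≤ DD σ n s * (2 * (u.1 s)^2 + 2 * (n * AA σ n (en σ v v)) + n * AA σ n (en σ u u)) :=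
    c2.trans (mul_le_mul_of_nonneg_left (by linarith) hD)
  have c7 : DD σ n s * (2 * (u.1 s)^2 + 2 * (n * AA σ n (en σ v v)) + n * AA σ n (en σ u u)) =
      (n * DD σ n s) * (2 * AA σ n (en σ v v) + (2 * (u.1 s)^2 / n + AA σ n (en σ u u))) := by
    field_simp; ring
  rw [c7] at c6
  refine c6.trans (mul_le_mul_of_nonneg_right h7 ?_)
  have : 0 ≤ AA σ n (en σ v v) := nonneg_of_mul_nonneg_right hA' hn0
  have : 0 ≤ AA σ n (en σ u u) := nonneg_of_mul_nonneg_right hA hn0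
  positivity

lemma key_ineq' (hω : Good σ K ω) (u : LH σ) (z : G) (j : ι) : (u.1 (z * σ j) - u.1 z)^2 ≤ 3 * K * BB σ ω u u := by
  rw [← BB_trans hω u z]
  exact key_ineq hω ⟨_, trans_mem u.2 z⟩ j

lemma const_of_incr (hgen : Subgroup.closure (Set.range σ) = ⊤) {u : G → ℝ}
    (h : ∀ x i, u (x * σ i) = u x) (x : G) : u x = u 1 := by
  have : ∀ g : G, ∀ x, u (x * g) = u x := by
    intro g
    have hg : g ∈ Subgroup.closure (Set.range σ) := by rw [hgen]; trivial
    induction hg using Subgroup.closure_induction with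
    | mem g hg => obtain ⟨i, rfl⟩ := hg; exact fun x => h x i
    | one => simp
    | mul a b _ _ ha hb => intro x; rw [← mul_assoc, hb, ha]
    | inv a _ ha => intro x; rw [← ha (x * a⁻¹)]; simp
  simpa using this x 1

lemma BB_pos (hω : Good σ K ω) (u : LH σ) (hu : u ≠ 0) : 0 < BB σ ω u u := by
  have h0 : 0 ≤ BB σ ω u u := by
    refine ge_of_tendsto' (MM_tendsto' u.2 u.2) fun n => ?_
    rw [AA]
    refine mul_nonneg (by positivity) (Finset.sum_nonneg fun k _ => ?_)
    rw [← EE_const σ k 0]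
    refine EE_mono σ k fun x => ?_
    exact mul_nonneg (by positivity) (Finset.sum_nonneg fun i _ => mul_self_nonneg _)
  refine lt_of_le_of_ne h0 fun h => hu ?_
  ext x
  have : u.1 x = u.1 1 := const_of_incr hω.gen (fun x i => by
    have := key_ineq' hω u x i
    rw [← h, mul_zero] at this
    have := pow_eq_zero_iff (two_ne_zero) |>.1 (le_antisymm this (sq_nonneg _))
    linarith) x
  rw [this, u.2.2.1]; rfl

lemma finrank_le (hω : Good σ K ω) (W : Submodule ℝ (LH σ)) [FiniteDimensional ℝ W] : (Module.finrank ℝ W : ℝ) ≤ 3 * K := by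
  have hsymm : LinearMap.IsSymm ((BB σ ω).restrict W) := ⟨fun u v => by
    change BB σ ω _ _ = BB σ ω _ _
    rw [BB_apply, BB_apply, en_comm]⟩
  obtain ⟨v, hv⟩ := LinearMap.BilinForm.exists_orthogonal_basis (K := ℝ) (V := W) (B := (BB σ ω).restrict W) hsymm
  have hort : ∀ a b, a ≠ b → BB σ ω (v a) (v b) = 0 := fun a b hab => hv hab
  set b : Fin (Module.finrank ℝ W) → ℝ := fun l => BB σ ω (v l) (v l) with hb
  have hbpos : ∀ l, 0 < b l := fun l => BB_pos hω _ (by simpa using v.ne_zero l)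
  have hpt : ∀ z j, ∑ l, ((v l).1.1 (z * σ j) - (v l).1.1 z)^2 / b l ≤ 3 * K := by
    intro z j
    set a : Fin (Module.finrank ℝ W) → ℝ := fun l => (v l).1.1 (z * σ j) - (v l).1.1 z with ha
    set T := ∑ l, (a l)^2 / b l with hT
    let w : LH σ := ∑ l, (a l / b l) • (v l).1
    have hw1 : w.1 (z * σ j) - w.1 z = T := by
      simp only [w, Submodule.coe_sum, Submodule.coe_smul, Finset.sum_apply, Pi.smul_apply, smul_eq_mul,
        ← Finset.sum_sub_distrib, ← mul_sub, hT]
      apply Finset.sum_congr rfl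
      intro l _
      simp only [ha]; ring
    have hw2 : BB σ ω w w = T := by
      simp only [w, map_sum, LinearMap.sum_apply, map_smul, LinearMap.smul_apply, smul_eq_mul, hT]
      apply Finset.sum_congr rfl
      intro l _
      rw [Finset.sum_eq_single l]
      · have := (hbpos l).ne'
        change a l / b l * (a l / b l * b l) = _
        field_simp
      · intro m _ hm; rw [hort _ _ hm]; simp
      · simp
    have h1 := key_ineq' hω w z j
    rw [hw1, hw2] at h1
    by_contra hcon
    rw [not_le] at hcon
    have hT0 : 0 ≤ T := Finset.sum_nonneg fun l _ => div_nonneg (sq_nonneg _) (hbpos l).le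
    rcases hT0.eq_or_lt with h | h
    · have hK : 0 ≤ 3 * K := by
        by_contra hK
        obtain ⟨n, hn, hn1⟩ := (hω.good.and (hω.le (eventually_ge_atTop 1))).exists
        have hD : 0 ≤ DD σ n (σ j) := tsum_nonneg fun x => by
          have := mu_nonneg σ n ((σ j)⁻¹ * x); have := mu_nonneg σ n x
          positivity
        have := hn j
        have : 0 ≤ (n:ℝ) * DD σ n (σ j) := by positivity
        linarith
      linarith
    · nlinarith
  have hsum : ∀ z, ∑ l, (b l)⁻¹ * en σ (v l).1.1 (v l).1.1 z ≤ 3 * K := by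
    intro z
    have hc := card_pos' (ι := ι)
    have : ∑ l, (b l)⁻¹ * en σ (v l).1.1 (v l).1.1 z = (Fintype.card ι : ℝ)⁻¹ *
        ∑ j, ∑ l, ((v l).1.1 (z * σ j) - (v l).1.1 z)^2 / b l := by
      rw [Finset.sum_comm, Finset.mul_sum]
      apply Finset.sum_congr rfl
      intro l _
      rw [en, ← Finset.sum_div]
      rw [div_eq_inv_mul, mul_left_comm]
      congr 2
      congr 1
      funext i; ring
    rw [this, inv_mul_le_iff₀ hc]
    refine (Finset.sum_le_sum fun j _ => hpt z j).trans ?_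
    simp
  have hlim : Tendsto (fun n => ∑ l, (b l)⁻¹ * AA σ n (en σ (v l).1.1 (v l).1.1)) ω
      (𝓝 (∑ l, (b l)⁻¹ * b l)) :=
    tendsto_finsetSum _ fun l _ => (MM_tendsto' (v l).1.2 (v l).1.2).const_mul _
  have e1 : ∑ l, (b l)⁻¹ * b l = Module.finrank ℝ W := by
    rw [Finset.sum_congr rfl (fun l _ => inv_mul_cancel₀ (hbpos l).ne')]; simp
  rw [e1] at hlim
  refine le_of_tendsto hlim ?_
  filter_upwards [hω.le (eventually_ge_atTop 1)] with n hn1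
  have hn0 : (0:ℝ) < n := by exact_mod_cast hn1
  have : ∑ l, (b l)⁻¹ * AA σ n (en σ (v l).1.1 (v l).1.1) =
      (n:ℝ)⁻¹ * ∑ k ∈ range n, EE σ k (fun x => ∑ l, (b l)⁻¹ * en σ (v l).1.1 (v l).1.1 x) := by
    simp_rw [EE_sum, EE_smul, AA]
    rw [Finset.sum_comm, Finset.mul_sum]
    apply Finset.sum_congr rfl
    intro l _
    rw [← Finset.mul_sum]; ring
  rw [this, inv_mul_le_iff₀ hn0]
  have : ∀ k ∈ range n, EE σ k (fun x => ∑ l, (b l)⁻¹ * en σ (v l).1.1 (v l).1.1 x) ≤ 3 * K := by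
    intro k _
    rw [← EE_const σ k (3*K)]
    exact EE_mono σ k hsum
  refine (Finset.sum_le_sum this).trans ?_
  simp

theorem finite_LH {C : ℝ} {d : ℕ} (hg : ∀ n, 1 ≤ n → ((supp σ n).card : ℝ) ≤ C * n^d)
    {i0 : ι} (h0 : σ i0 = 1) (hgen : Subgroup.closure (Set.range σ) = ⊤) :
    Module.Finite ℝ (LH σ) := by
  obtain ⟨ω, hω⟩ := exists_good σ hg h0 hgen
  have : Module.rank ℝ (LH σ) ≤ (⌊3 * (4 * Fintype.card ι * ((d:ℝ)+1))⌋₊ : ℕ) := by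
    apply rank_le
    intro s hs
    have h1 := finrank_le hω (Submodule.span ℝ (s : Set (LH σ)))
    have h2 := finrank_span_finset_eq_card hs
    rw [h2] at h1
    exact Nat.le_floor h1
  rw [← Module.rank_lt_aleph0_iff]
  exact this.trans_lt (Cardinal.natCast_lt_aleph0)

end GW

namespace GW
open Finset Filter Topology

variable {G : Type*} [Group G] {ι : Type*} [Fintype ι] [Nonempty ι] (σ : ι → G)

/-- squared displacement -/
noncomputable def NN (n : ℕ) (g : G) : ℝ := ∑' x, (mu σ n (g⁻¹ * x) - mu σ n x)^2

lemma summ_NN (n : ℕ) (g h : G) : Summable fun x => (mu σ n (g⁻¹ * x) - mu σ n (h⁻¹ * x))^2 :=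
  summ_fun2 σ n (fun a b => (a-b)^2) (by simp) g h

lemma NN_nonneg (n : ℕ) (g : G) : 0 ≤ NN σ n g := tsum_nonneg fun _ => sq_nonneg _

lemma NN_mul (n : ℕ) (g h : G) : NN σ n (g * h) ≤ 2 * NN σ n g + 2 * NN σ n h := by
  have e : NN σ n h = ∑' x, (mu σ n ((g*h)⁻¹ * x) - mu σ n (g⁻¹ * x))^2 := by
    rw [NN, ← (Equiv.mulLeft g⁻¹).tsum_eq]; simp [mul_assoc]
  have s1 : Summable fun x => (mu σ n (g⁻¹ * x) - mu σ n x)^2 := by simpa using summ_NN σ n g 1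
  have s2 := summ_NN σ n (g*h) g
  have s3 : Summable fun x => (mu σ n ((g*h)⁻¹ * x) - mu σ n x)^2 := by simpa using summ_NN σ n (g*h) 1
  rw [e, NN, NN, ← tsum_mul_left, ← tsum_mul_left, ← (s1.mul_left 2).tsum_add (s2.mul_left 2)]
  refine Summable.tsum_le_tsum (fun x => ?_) s3 ((s1.mul_left 2).add (s2.mul_left 2))
  nlinarith [sq_nonneg ((mu σ n ((g*h)⁻¹ * x) - mu σ n (g⁻¹ * x)) - (mu σ n (g⁻¹ * x) - mu σ n x))]

lemma NN_inv (n : ℕ) (g : G) : NN σ n g⁻¹ = NN σ n g := by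
  rw [NN, NN, ← (Equiv.mulLeft g⁻¹).tsum_eq]
  simp
  congr; ext x; ring

/-- symmetric lazy generating family -/
structure Sym (i0 : ι) (e : ι ≃ ι) : Prop where
  one : σ i0 = 1
  inv : ∀ i, σ (e i) = (σ i)⁻¹
  gen : Subgroup.closure (Set.range σ) = ⊤

/-- ip of walks -/
noncomputable def qq (n : ℕ) : ℝ := mu σ n 1

variable {σ} {i0 : ι} {e : ι ≃ ι}

lemma ip_step (h : Sym σ i0 e) (m n : ℕ) : ∑' x, mu σ (m+1) x * mu σ n x = ∑' x, mu σ m x * mu σ (n+1) x := by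
  have h1 := EE_succ_left σ m (mu σ n)
  unfold EE at h1
  rw [h1]
  have h2 : ∑' x, mu σ m x * mu σ (n+1) x = (Fintype.card ι : ℝ)⁻¹ * ∑ i, EE σ m (fun x => mu σ n ((σ i)⁻¹ * x)) := by
    rw [← EE_sum, ← EE_smul]; rfl
  rw [h2, ← e.sum_comp]
  congr 1
  apply Finset.sum_congr rfl
  intro i _
  simp only [h.inv, EE]

lemma ip_eq (h : Sym σ i0 e) (m n : ℕ) : ∑' x, mu σ m x * mu σ n x = qq σ (m+n) := by
  induction m generalizing n with
  | zero =>
    rw [zero_add]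
    exact EE_zero σ (mu σ n)
  | succ m ih => rw [ip_step h, ih]; congr 1; ring

/-- the doubled family -/
def dbl (σ : ι → G) : ι × ι → G := fun p => σ p.1 * σ p.2

lemma mu_two (n : ℕ) (x : G) :
    mu σ (n+2) x = (Fintype.card (ι × ι) : ℝ)⁻¹ * ∑ p, mu σ n ((dbl σ p)⁻¹ * x) := by
  rw [mu_succ]
  simp_rw [mu_succ]
  rw [← Finset.mul_sum, ← mul_assoc, Fintype.sum_prod_type, Fintype.card_prod]
  push_cast
  rw [mul_inv]
  congr 1
  simp only [dbl, mul_inv_rev, mul_assoc]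

/-- expansion of NN -/
lemma NN_eq (h : Sym σ i0 e) (n : ℕ) (g : G) :
    NN σ n g = 2 * qq σ (2*n) - 2 * ∑' x, mu σ n x * mu σ n (g⁻¹ * x) := by
  have s1 : Summable fun x => (mu σ n (g⁻¹ * x))^2 := summ_fun σ n (fun a => a^2) (by simp) g
  have s2 : Summable fun x => (mu σ n x)^2 := by simpa using summ_fun σ n (fun a => a^2) (by simp) 1
  have s3 := summ σ (n := n) (fun x => mu σ n (g⁻¹ * x))
  have e1 : ∑' x, (mu σ n x)^2 = qq σ (2*n) := by
    rw [two_mul, ← ip_eq h]; simp_rw [sq]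
  have e2 : ∑' x, (mu σ n (g⁻¹*x))^2 = qq σ (2*n) := by
    rw [← e1]; exact tsum_fun σ n (fun a => a^2) g
  calc NN σ n g = ∑' x, (((mu σ n (g⁻¹ * x))^2 + (mu σ n x)^2) - 2 * (mu σ n x * mu σ n (g⁻¹ * x))) := by
        rw [NN]; congr; ext x; ring
    _ = _ := by
      rw [(s1.add s2).tsum_sub (s3.mul_left 2), s1.tsum_add s2, e1, e2, tsum_mul_left]; ring

lemma avg_NN (h : Sym σ i0 e) (n : ℕ) :
    (Fintype.card (ι × ι) : ℝ)⁻¹ * ∑ p, NN σ n (dbl σ p) = 2 * (qq σ (2*n) - qq σ (2*n+2)) := by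
  have hc := card_pos' (ι := ι × ι)
  simp_rw [NN_eq h]
  rw [Finset.sum_sub_distrib, ← Finset.mul_sum]
  have : (Fintype.card (ι × ι) : ℝ)⁻¹ * ∑ p, ∑' x, mu σ n x * mu σ n ((dbl σ p)⁻¹ * x) = qq σ (2*n+2) := by
    rw [two_mul, add_assoc, ← ip_eq h]
    change _ = EE σ n (mu σ (n+2))
    have : mu σ (n+2) = fun x => (Fintype.card (ι × ι) : ℝ)⁻¹ * ∑ p, mu σ n ((dbl σ p)⁻¹ * x) := funext (mu_two n)
    rw [this, EE_smul, EE_sum]; rfl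
  rw [← this, Finset.sum_const, card_univ, nsmul_eq_mul, ← Finset.mul_sum]
  field_simp

lemma lap_sq (h : Sym σ i0 e) (n : ℕ) :
    ∑' x, (mu σ (n+2) x - mu σ n x)^2 = (qq σ (2*n) - qq σ (2*n+2)) - (qq σ (2*(n+1)) - qq σ (2*(n+1)+2)) := by
  have s1 := summ σ (n := n) (mu σ n)
  have s2 := summ σ (n := n) (mu σ (n+2))
  have s3 := summ σ (n := n+2) (mu σ (n+2))
  calc _ = ∑' x, ((mu σ (n+2) x * mu σ (n+2) x - 2 * (mu σ n x * mu σ (n+2) x)) + mu σ n x * mu σ n x) := by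
        congr; ext x; ring
    _ = _ := by
      rw [(s3.sub (s2.mul_left 2)).tsum_add s1, s3.tsum_sub (s2.mul_left 2), tsum_mul_left, ip_eq h, ip_eq h, ip_eq h]
      ring_nf

/-- c_j -/
noncomputable def cc (σ : ι → G) (n : ℕ) : ℝ := qq σ (2*n) - qq σ (2*n+2)

lemma NN_le (h : Sym σ i0 e) (n : ℕ) (p : ι × ι) : NN σ n (dbl σ p) ≤ 2 * Fintype.card (ι × ι) * cc σ n := by
  have hc := card_pos' (ι := ι × ι)
  have h1 := avg_NN h n
  have h2 : ∑ p, NN σ n (dbl σ p) = 2 * Fintype.card (ι × ι) * cc σ n := by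
    unfold cc; rw [mul_right_comm, ← h1]; field_simp
  rw [← h2]
  exact Finset.single_le_sum (f := fun p => NN σ n (dbl σ p)) (fun p _ => NN_nonneg σ n _) (mem_univ p)

lemma exists_NN_ge (h : Sym σ i0 e) (n : ℕ) : ∃ p : ι × ι, 2 * cc σ n ≤ NN σ n (dbl σ p) := by
  by_contra! hcon
  have hc := card_pos' (ι := ι × ι)
  have h1 := avg_NN h n
  have h2 : ∑ p, NN σ n (dbl σ p) < ∑ p : ι × ι, 2 * cc σ n :=
    Finset.sum_lt_sum_of_nonempty univ_nonempty fun p _ => hcon p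
  have h3 : ∑ p, NN σ n (dbl σ p) = 2 * Fintype.card (ι × ι) * cc σ n := by
    unfold cc; rw [mul_right_comm, ← h1]; field_simp
  rw [h3, Finset.sum_const, card_univ, nsmul_eq_mul] at h2
  linarith

lemma cc_nonneg (h : Sym σ i0 e) (n : ℕ) : 0 ≤ cc σ n := by
  have h1 := avg_NN h n
  have : 0 ≤ (Fintype.card (ι × ι) : ℝ)⁻¹ * ∑ p, NN σ n (dbl σ p) :=
    mul_nonneg (by positivity) (Finset.sum_nonneg fun p _ => NN_nonneg σ n _)
  unfold cc; linarith

lemma dbl_gen (h : Sym σ i0 e) : Subgroup.closure (Set.range (dbl σ)) = ⊤ := by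
  rw [eq_top_iff, ← h.gen]
  apply Subgroup.closure_mono
  rintro _ ⟨i, rfl⟩
  exact ⟨(i, i0), by simp [dbl, h.one]⟩

lemma NN_bound (h : Sym σ i0 e) (g : G) : ∃ L, 0 ≤ L ∧ ∀ n, NN σ n g ≤ L * cc σ n := by
  have hg : g ∈ Subgroup.closure (Set.range (dbl σ)) := by rw [dbl_gen h]; trivial
  induction hg using Subgroup.closure_induction with
  | mem g hg => obtain ⟨p, rfl⟩ := hg; exact ⟨_, by positivity, fun n => NN_le h n p⟩
  | one => exact ⟨0, le_rfl, fun n => by simp [NN]⟩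
  | mul a b _ _ ha hb =>
    obtain ⟨L, hL0, hL⟩ := ha
    obtain ⟨M, hM0, hM⟩ := hb
    refine ⟨2 * L + 2 * M, by positivity, fun n => (NN_mul σ n a b).trans ?_⟩
    have := hL n; have := hM n; linarith
  | inv a _ ha =>
    obtain ⟨L, hL0, hL⟩ := ha
    exact ⟨L, hL0, fun n => by rw [NN_inv]; exact hL n⟩

lemma pt_le (n : ℕ) (g x : G) : (mu σ n (g⁻¹ * x) - mu σ n x)^2 ≤ NN σ n g := by
  have s1 : Summable fun x => (mu σ n (g⁻¹ * x) - mu σ n x)^2 := by simpa using summ_NN σ n g 1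
  exact s1.le_tsum x (fun _ _ => sq_nonneg _)

lemma cc_pos [Infinite G] (h : Sym σ i0 e) (n : ℕ) : 0 < cc σ n := by
  refine lt_of_le_of_ne (cc_nonneg h n) fun h0 => ?_
  have hz : ∀ g x, mu σ n (g⁻¹ * x) = mu σ n x := by
    intro g x
    obtain ⟨L, -, hL⟩ := NN_bound h g
    have h1 := (pt_le n g x).trans (hL n)
    rw [← h0, mul_zero] at h1
    have := pow_eq_zero_iff (two_ne_zero) |>.1 (le_antisymm h1 (sq_nonneg _))
    linarith
  obtain ⟨y, hy⟩ := Infinite.exists_notMem_finset (supp σ n)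
  have hall : ∀ x, mu σ n x = 0 := by
    intro x
    rw [← mu_eq_zero σ hy, ← hz (x * y⁻¹) x]; simp
  have := tsum_mu σ n
  simp [hall] at this

lemma bb_anti (h : Sym σ i0 e) : Antitone fun n => qq σ (2*n) :=
  antitone_nat_of_succ_le fun n => by have := cc_nonneg h n; unfold cc at this; rw [mul_add]; linarith

lemma bb_tendsto [Infinite G] (h : Sym σ i0 e) : Tendsto (fun n => qq σ (2*n)) atTop (𝓝 0) := by
  have hb : BddBelow (Set.range fun n => qq σ (2*n)) := ⟨0, by rintro _ ⟨n, rfl⟩; exact mu_nonneg σ _ _⟩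
  have hlim := tendsto_atTop_ciInf (bb_anti h) hb
  set l := ⨅ n, qq σ (2*n) with hl
  have hcc : Tendsto (cc σ) atTop (𝓝 0) := by
    have := hlim.sub (hlim.comp (tendsto_add_atTop_nat 1))
    rw [sub_self] at this
    convert this using 2
    rfl
  have hcc2 : Tendsto (fun n => cc σ (2*n)) atTop (𝓝 0) :=
    hcc.comp (tendsto_id.const_mul_atTop' (by norm_num : 0 < 2))
  have hpt : ∀ g : G, Tendsto (fun n => mu σ (2*n) g) atTop (𝓝 l) := by
    intro g
    obtain ⟨L, hL0, hL⟩ := NN_bound h g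
    have h1 : Tendsto (fun n => (mu σ (2*n) 1 - mu σ (2*n) g)^2) atTop (𝓝 0) := by
      refine squeeze_zero (fun n => sq_nonneg _) (fun n => ?_) (by simpa using hcc2.const_mul L)
      refine le_trans ?_ (hL (2*n))
      simpa using pt_le (2*n) g g
    have h2 : Tendsto (fun n => mu σ (2*n) 1 - mu σ (2*n) g) atTop (𝓝 0) := by
      rw [tendsto_zero_iff_abs_tendsto_zero]
      have := h1.sqrt
      simpa [Real.sqrt_sq_eq_abs, Function.comp_def] using this
    have := hlim.sub h2
    rw [sub_zero] at this
    convert this using 2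
    simp [qq]
  have hl0 : 0 ≤ l := ge_of_tendsto' hlim fun n => mu_nonneg σ _ _
  have hN : ∀ N : ℕ, N * l ≤ 1 := by
    intro N
    obtain ⟨A, hA⟩ := Infinite.exists_subset_card_eq G N
    have h1 : Tendsto (fun n => ∑ g ∈ A, mu σ (2*n) g) atTop (𝓝 (∑ g ∈ A, l)) :=
      tendsto_finsetSum _ fun g _ => hpt g
    have h2 := le_of_tendsto' h1 (fun n => (summ_mu σ).sum_le_tsum A (fun x _ => mu_nonneg σ _ x) |>.trans (tsum_mu σ (2*n)).le)
    simpa [hA] using h2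
  have : l = 0 := by
    by_contra hne
    have hp : 0 < l := lt_of_le_of_ne hl0 (Ne.symm hne)
    obtain ⟨N, hN'⟩ := exists_nat_gt (1 / l)
    rw [div_lt_iff₀ hp] at hN'
    linarith [hN N]
  rwa [this] at hlim

lemma bb_ge (h : Sym σ i0 e) (n : ℕ) : 1 ≤ (supp σ n).card * qq σ (2*n) := by
  have h1 : ∑ x ∈ supp σ n, mu σ n x = 1 := by
    rw [← tsum_mu σ n, tsum_eq_sum (s := supp σ n) (fun b hb => mu_eq_zero σ hb)]
  have h2 : ∑ x ∈ supp σ n, mu σ n x ^ 2 = qq σ (2*n) := by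
    rw [two_mul, ← ip_eq h, tsum_eq_sum (s := supp σ n) (fun b hb => by rw [mu_eq_zero σ hb]; simp)]
    simp_rw [sq]
  have := sq_sum_le_card_mul_sum_sq (s := supp σ n) (f := mu σ n)
  rw [h1, h2] at this
  simpa using this

lemma ratio [Infinite G] (h : Sym σ i0 e) {C : ℝ} {d : ℕ} (hg : ∀ n, 1 ≤ n → ((supp σ n).card : ℝ) ≤ C * n^d)
    {ε : ℝ} (hε : 0 < ε) (hε1 : ε < 1) : ∃ j, (1 - ε) * cc σ j < cc σ (j+1) := by
  by_contra! hcon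
  set r := 1 - ε with hr
  have hr0 : 0 < r := by linarith
  have hr1 : r < 1 := by linarith
  have h1 : ∀ j, cc σ j ≤ cc σ 0 * r^j := by
    intro j
    induction j with
    | zero => simp
    | succ j ih =>
      refine (hcon j).trans ?_
      rw [pow_succ]
      nlinarith
  have h2 : ∀ m k, qq σ (2*m) ≤ cc σ 0 * r^m / (1-r) - cc σ 0 * r^(m+k)/(1-r) + qq σ (2*(m+k)) := by
    intro m k
    induction k with
    | zero => simp
    | succ k ih =>
      have h3 := h1 (m+k)
      have h4 : qq σ (2*(m+k)) = cc σ (m+k) + qq σ (2*(m+(k+1))) := by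
        unfold cc
        rw [show 2 * (m+(k+1)) = 2*(m+k)+2 by ring]; ring
      have h5 : cc σ 0 * r^(m+k)/(1-r) = cc σ 0 * r^(m+k) + cc σ 0 * r^(m+(k+1))/(1-r) := by
        have : 1 - r ≠ 0 := by linarith
        field_simp
        rw [← add_assoc, pow_succ]; ring
      linarith
  have h3 : ∀ m, qq σ (2*m) ≤ cc σ 0 * r^m / (1-r) := by
    intro m
    have hl : Tendsto (fun k => cc σ 0 * r^m / (1-r) + qq σ (2*(m+k))) atTop (𝓝 (cc σ 0 * r^m / (1-r) + 0)) :=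
      tendsto_const_nhds.add ((bb_tendsto h).comp (tendsto_add_atTop_nat m |>.congr fun k => by ring))
    rw [add_zero] at hl
    refine ge_of_tendsto' hl fun k => (h2 m k).trans ?_
    have : 0 ≤ cc σ 0 * r^(m+k)/(1-r) := by
      have := cc_nonneg h 0
      have : 0 < 1 - r := by linarith
      positivity
    linarith
  have h4 : ∀ m : ℕ, 1 ≤ m → 1 ≤ (C * cc σ 0 / (1-r)) * ((m:ℝ)^d * r^m) := by
    intro m hm
    have a1 := bb_ge h m
    have a2 := hg m hm
    have a3 := h3 m
    have a4 : 0 ≤ cc σ 0 * r^m / (1-r) := by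
      have := cc_nonneg h 0
      have : 0 < 1 - r := by linarith
      positivity
    calc 1 ≤ _ := a1
      _ ≤ (supp σ m).card * (cc σ 0 * r^m / (1-r)) := mul_le_mul_of_nonneg_left a3 (by positivity)
      _ ≤ C * m^d * (cc σ 0 * r^m / (1-r)) := mul_le_mul_of_nonneg_right a2 a4
      _ = _ := by ring
  have h5 := (tendsto_pow_const_mul_const_pow_of_abs_lt_one d (r := r) (by rw [abs_of_pos hr0]; exact hr1)).const_mul (C * cc σ 0 / (1-r))
  rw [mul_zero] at h5
  obtain ⟨m, hm1, hm2⟩ := ((h5.eventually_lt_const one_pos).and (eventually_ge_atTop 1)).exists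
  linarith [h4 m hm2]

lemma ratio_pair [Infinite G] (h : Sym σ i0 e) {C : ℝ} {d : ℕ} (hg : ∀ n, 1 ≤ n → ((supp σ n).card : ℝ) ≤ C * n^d) :
    ∃ p : ι × ι, ∀ ε : ℝ, 0 < ε → ∃ j, (1 - ε) * cc σ j < cc σ (j+1) ∧ 2 * cc σ j ≤ NN σ j (dbl σ p) := by
  by_contra! hcon
  choose ε hε hcon using hcon
  set δ := min (univ.inf' univ_nonempty ε) (1/2) with hδ
  have hδ0 : 0 < δ := by
    rw [hδ, lt_min_iff, Finset.lt_inf'_iff]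
    exact ⟨fun p _ => hε p, by norm_num⟩
  obtain ⟨j, hj⟩ := ratio h hg hδ0 (lt_of_le_of_lt (min_le_right _ _) (by norm_num))
  obtain ⟨p, hp⟩ := exists_NN_ge h j
  have h1 : δ ≤ ε p := (min_le_left _ _).trans (Finset.inf'_le _ (mem_univ p))
  have h2 := cc_pos h j
  have := hcon p j (by nlinarith)
  linarith

/-- translation defect -/
noncomputable def ff (σ : ι → G) (n : ℕ) (g : G) : G → ℝ := fun x => mu σ n (g⁻¹ * x) - mu σ n x

lemma summ_ff (n : ℕ) (g : G) (f : G → ℝ) : Summable fun x => ff σ n g x * f x := by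
  simp_rw [ff, sub_mul]
  exact (summ_shift σ n g f).sub (summ σ f)

lemma cs (F : G → ℝ) (n : ℕ) (p : G) (hF : Summable fun x => F x ^2) :
    (∑' x, ff σ n p x * F x)^2 ≤ NN σ n p * ∑' x, F x ^2 := by
  classical
  set S := (supp σ n).image (p * ·) ∪ (supp σ n)
  have hz : ∀ x, x ∉ S → ff σ n p x = 0 := by
    intro b hb
    simp only [S, mem_union, mem_image, not_or, not_exists, not_and] at hb
    rw [ff, mu_eq_zero σ (fun h => hb.1 _ h (by simp)), mu_eq_zero σ hb.2, sub_zero]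
  rw [tsum_eq_sum (s := S) (by intro b hb; simp [hz b hb])]
  have h1 : NN σ n p = ∑ x ∈ S, ff σ n p x ^ 2 := by
    change ∑' x, ff σ n p x ^ 2 = _
    rw [tsum_eq_sum (s := S) (by intro b hb; simp [hz b hb])]
  rw [h1]
  refine (Finset.sum_mul_sq_le_sq_mul_sq S _ _).trans ?_
  exact mul_le_mul_of_nonneg_left (hF.sum_le_tsum S fun _ _ => sq_nonneg _) (Finset.sum_nonneg fun _ _ => sq_nonneg _)

set_option maxHeartbeats 1000000 in
theorem exists_LH [Infinite G] (h : Sym σ i0 e) {C : ℝ} {d : ℕ}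
    (hg : ∀ n, 1 ≤ n → ((supp σ n).card : ℝ) ≤ C * n^d) : ∃ u ∈ LH (dbl σ), ∃ g, u g ≠ 0 := by
  obtain ⟨p, hp⟩ := ratio_pair h hg
  choose J hJ using fun k : ℕ => hp (1/((k:ℝ)+1)) (by positivity)
  set s := dbl σ p
  let U : ℕ → G → ℝ := fun k g => (∑' x, ff σ (J k) s x * ff σ (J k) g x) / cc σ (J k)
  have hcard := card_pos' (ι := ι × ι)
  set κ : ℝ := 2 * Fintype.card (ι × ι) with hκ
  have hs2 : ∀ n g a, Summable fun x => (mu σ n (g⁻¹ * x) - mu σ n (a⁻¹ * x))^2 := fun n g a => summ_NN σ n g a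
  -- general estimate
  have est : ∀ k (F : G → ℝ) (M : ℝ), (Summable fun x => F x ^2) → ∑' x, F x ^2 ≤ M * cc σ (J k) →
      ((∑' x, ff σ (J k) s x * F x) / cc σ (J k))^2 ≤ κ * M := by
    intro k F M hF hM
    have hc := cc_pos h (J k)
    rw [div_pow, div_le_iff₀ (by positivity)]
    refine (cs F (J k) s hF).trans ?_
    have h1 := NN_le h (J k) p
    have h2 := NN_nonneg σ (J k) s
    have h3 : 0 ≤ ∑' x, F x ^2 := tsum_nonneg fun _ => sq_nonneg _
    calc NN σ (J k) s * ∑' x, F x ^2 ≤ (κ * cc σ (J k)) * (M * cc σ (J k)) :=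
          mul_le_mul h1 hM h3 (by positivity)
      _ = _ := by ring
  have bddU : ∀ g, ∃ M, ∀ k, |U k g| ≤ M := by
    intro g
    obtain ⟨L, hL0, hL⟩ := NN_bound h g
    refine ⟨√(κ * L), fun k => ?_⟩
    rw [← Real.sqrt_sq_eq_abs]
    apply Real.sqrt_le_sqrt
    apply est
    · simpa [ff] using hs2 (J k) g 1
    · exact hL (J k)
  have diff : ∀ k g t, U k (g * t) - U k g = (∑' x, ff σ (J k) s x * (mu σ (J k) ((g*t)⁻¹ * x) - mu σ (J k) (g⁻¹ * x))) / cc σ (J k) := by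
    intro k g t
    simp only [U]
    rw [← sub_div, ← (summ_ff _ _ _).tsum_sub (summ_ff _ _ _)]
    congr 2; ext x; simp only [ff]; ring
  have lip : ∀ k g (q : ι × ι), |U k (g * dbl σ q) - U k g| ≤ √(κ * κ) := by
    intro k g q
    rw [diff, ← Real.sqrt_sq_eq_abs]
    apply Real.sqrt_le_sqrt
    apply est
    · exact hs2 _ _ _
    · refine le_trans (le_of_eq ?_) (NN_le h (J k) q)
      have := (Equiv.mulLeft g⁻¹).tsum_eq (fun x => (mu σ (J k) ((dbl σ q)⁻¹ * x) - mu σ (J k) x)^2)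
      rw [NN, ← this]
      simp [mul_assoc]
  have harm : ∀ k g, |PP (dbl σ) (U k) g - U k g| ≤ √(κ * (1 / ((k:ℝ)+1))) := by
    intro k g
    have e1 : PP (dbl σ) (U k) g - U k g = (Fintype.card (ι × ι) : ℝ)⁻¹ * ∑ q, (U k (g * dbl σ q) - U k g) := by
      rw [Finset.sum_sub_distrib, mul_sub, PP, Finset.sum_const, card_univ, nsmul_eq_mul, inv_mul_cancel_left₀ hcard.ne']
    have e2 : PP (dbl σ) (U k) g - U k g =
        (∑' x, ff σ (J k) s x * (mu σ (J k + 2) (g⁻¹ * x) - mu σ (J k) (g⁻¹ * x))) / cc σ (J k) := by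
      rw [e1]
      simp_rw [diff]
      rw [← Finset.sum_div, ← Summable.tsum_finsetSum (fun q _ => summ_ff _ _ _), ← mul_div_assoc, ← tsum_mul_left]
      congr 2
      ext x
      rw [mu_two, ← Finset.mul_sum, mul_left_comm, Finset.sum_sub_distrib, mul_sub]
      congr 2
      · simp only [mul_inv_rev, mul_assoc]
      · rw [Finset.sum_const, card_univ, nsmul_eq_mul, inv_mul_cancel_left₀ hcard.ne']
    rw [e2, ← Real.sqrt_sq_eq_abs]
    apply Real.sqrt_le_sqrt
    have e3 : ∑' x, (mu σ (J k + 2) (g⁻¹ * x) - mu σ (J k) (g⁻¹ * x))^2 = cc σ (J k) - cc σ (J k + 1) := by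
      unfold cc
      rw [← lap_sq h, ← (Equiv.mulLeft g).tsum_eq]; simp
    apply est
    · have := (((summ σ (n := J k+2) (fun x => mu σ (J k + 2) x)).sub ((summ σ (n := J k+2) (fun x => mu σ (J k) x)).mul_left 2)).add (summ σ (n := J k) (fun x => mu σ (J k) x)))
      have h2 : Summable fun x => (mu σ (J k + 2) x - mu σ (J k) x)^2 := this.congr fun x => by ring
      have h3 := (Equiv.mulLeft g⁻¹).summable_iff.2 h2
      simpa only [Function.comp_def, Equiv.coe_mulLeft] using h3
    · rw [e3]
      have := (hJ k).1
      linarith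
  -- limit
  let ω : Ultrafilter ℕ := hyperfilter ℕ
  have hω : (ω : Filter ℕ) ≤ atTop := by
    rw [← Nat.cofinite_eq_atTop]; exact hyperfilter_le_cofinite
  have hlim : ∀ g, ∃ y, Tendsto (fun k => U k g) ω (𝓝 y) := by
    intro g
    obtain ⟨M, hM⟩ := bddU g
    have hc : IsCompact (Set.Icc (-M) M) := isCompact_Icc
    obtain ⟨x, _, hx⟩ := hc.ultrafilter_le_nhds (ω.map fun k => U k g) (by
      rw [le_principal_iff]
      refine Filter.mem_map.2 (Filter.univ_mem' fun n => ?_)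
      exact abs_le.1 (hM n))
    exact ⟨x, hx⟩
  choose u hu using hlim
  refine ⟨u, ⟨?_, ?_, √(κ * κ), ?_⟩, s, ?_⟩
  · ext g
    have h1 : Tendsto (fun k => PP (dbl σ) (U k) g) ω (𝓝 (PP (dbl σ) u g)) :=
      (tendsto_finsetSum _ fun q _ => hu (g * dbl σ q)).const_mul _
    have h2 : Tendsto (fun k => PP (dbl σ) (U k) g - U k g) ω (𝓝 0) := by
      have h3 : Tendsto (fun k : ℕ => √(κ * (1 / ((k:ℝ)+1)))) atTop (𝓝 0) := by
        have := (tendsto_one_div_add_atTop_nhds_zero_nat (𝕜 := ℝ)).const_mul κ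
        simpa using this.sqrt
      exact squeeze_zero_norm (fun k => harm k g) (h3.mono_left hω)
    have := tendsto_nhds_unique h2 (h1.sub (hu g))
    linarith
  · have h1 : ∀ k, U k 1 = 0 := by intro k; simp [U, ff]
    have h2 := hu 1
    simp_rw [h1] at h2
    exact (tendsto_nhds_unique h2 tendsto_const_nhds)
  · intro g q
    exact le_of_tendsto' ((hu (g * dbl σ q)).sub (hu g)).abs (fun k => lip k g q)
  · have h1 : ∀ k, 2 ≤ U k s := by
      intro k
      have hc := cc_pos h (J k)
      have := (hJ k).2
      simp only [U]
      rw [le_div_iff₀ hc]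
      refine this.trans (le_of_eq ?_)
      rw [NN]; congr; ext x; simp only [ff]; ring
    have := ge_of_tendsto' (hu s) h1
    intro h0
    linarith

end GW

namespace GW

/-- virtually indicable -/
def VZ (G : Type*) [Group G] : Prop :=
  ∃ H : Subgroup G, H.FiniteIndex ∧ ∃ φ : H →* Multiplicative ℤ, φ ≠ 1

lemma acc_subgroup {G : Type*} [Group G] [WellFoundedGT (Subgroup G)] (H : Subgroup G) :
    WellFoundedGT (Subgroup H) := by
  have : StrictMono (Subgroup.map H.subtype) :=
    (Subgroup.gc_map_comap H.subtype).monotone_l.strictMono_of_injective (Subgroup.map_injective H.subtype_injective)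
  exact this.wellFoundedGT

lemma acc_surj {G Q : Type*} [Group G] [Group Q] [WellFoundedGT (Subgroup G)] (f : G →* Q)
    (hf : Function.Surjective f) : WellFoundedGT (Subgroup Q) := by
  have : StrictMono (Subgroup.comap f) :=
    (Subgroup.gc_map_comap f).monotone_u.strictMono_of_injective (Subgroup.comap_injective hf)
  exact this.wellFoundedGT

/-- any generating set contains a finite generating subset -/
lemma fg_of_acc {G : Type*} [Group G] [WellFoundedGT (Subgroup G)] (U : Set G) :
    ∃ S : Finset G, (S : Set G) ⊆ U ∧ Subgroup.closure (S : Set G) = Subgroup.closure U := by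
  classical
  obtain ⟨m, ⟨S, hS, rfl⟩, hmax⟩ := (wellFounded_gt (α := Subgroup G)).has_min
    {K | ∃ S : Finset G, (S : Set G) ⊆ U ∧ Subgroup.closure (S : Set G) = K} ⟨_, ∅, by simp, rfl⟩
  refine ⟨S, hS, le_antisymm (Subgroup.closure_mono hS) ?_⟩
  rw [Subgroup.closure_le]
  intro x hx
  by_contra hne
  refine hmax _ ⟨insert x S, ?_, rfl⟩ ?_
  · rw [Finset.coe_insert]; exact Set.insert_subset hx hS
  · refine lt_of_le_of_ne (Subgroup.closure_mono (by simp)) fun h => hne ?_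
    rw [h]; exact Subgroup.subset_closure (by simp)

lemma group_fg_of_acc {G : Type*} [Group G] [WellFoundedGT (Subgroup G)] : Group.FG G := by
  obtain ⟨S, -, hS⟩ := fg_of_acc (Set.univ : Set G)
  exact ⟨⟨S, by rw [hS]; exact Subgroup.closure_univ⟩⟩

lemma VZ.of_subgroup {G : Type*} [Group G] (H : Subgroup G) [H.FiniteIndex] (h : VZ H) : VZ G := by
  obtain ⟨K, hK, φ, hφ⟩ := h
  let E := K.equivMapOfInjective H.subtype H.subtype_injective
  refine ⟨K.map H.subtype, ⟨?_⟩, φ.comp E.symm.toMonoidHom, ?_⟩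
  · rw [Subgroup.index_map_subtype]
    exact mul_ne_zero hK.index_ne_zero Subgroup.FiniteIndex.index_ne_zero
  · intro h0
    apply hφ
    ext x
    have := DFunLike.congr_fun h0 (E x)
    simp at this
    simp [this]

lemma VZ.of_surj {G Q : Type*} [Group G] [Group Q] (f : G →* Q) (hf : Function.Surjective f) (h : VZ Q) : VZ G := by
  obtain ⟨K, hK, φ, hφ⟩ := h
  refine ⟨K.comap f, ⟨?_⟩, φ.comp (f.subgroupComap K), ?_⟩
  · rw [Subgroup.index_comap_of_surjective _ hf]; exact hK.index_ne_zero
  · intro h0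
    apply hφ
    ext x
    obtain ⟨y, hy⟩ := hf x
    have := DFunLike.congr_fun h0 ⟨y, by simp [hy]⟩
    have e : (f.subgroupComap K) ⟨y, by simp [hy]⟩ = x := Subtype.ext hy
    simp only [MonoidHom.comp_apply, e] at this
    simp [this]

lemma VZ_comm (A : Type*) [CommGroup A] [Group.FG A] [Infinite A] : VZ A := by
  obtain ⟨ι, j, _, _, p, hp, e, ⟨E⟩⟩ := CommGroup.equiv_free_prod_prod_multiplicative_zmod A
  have : ∀ i, NeZero (p i ^ e i) := fun i => ⟨pow_ne_zero _ (hp i).ne_zero⟩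
  have : ∀ i, Finite (Multiplicative (ZMod (p i ^ e i))) := fun i => inferInstanceAs (Finite (ZMod _))
  have hne : Nonempty j := by
    by_contra h
    rw [not_nonempty_iff] at h
    have : Finite ((j → Multiplicative ℤ) × ((i : ι) → Multiplicative (ZMod (p i ^ e i)))) := inferInstance
    have : Finite A := Finite.of_equiv _ E.symm.toEquiv
    exact not_finite A
  obtain ⟨j0⟩ := hne
  classical
  refine VZ.of_surj (Q := Multiplicative ℤ) (((Pi.evalMonoidHom _ j0).comp (MonoidHom.fst _ _)).comp E.toMonoidHom) ?_ ?_
  · intro z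
    exact ⟨E.symm (fun _ => z, 1), by simp⟩
  · refine ⟨⊤, inferInstance, (⊤ : Subgroup (Multiplicative ℤ)).subtype, fun h => ?_⟩
    have := DFunLike.congr_fun h ⟨Multiplicative.ofAdd 1, trivial⟩
    simp at this


lemma VZ_solv_aux (n : ℕ) : ∀ (Q : Type*) [Group Q] [WellFoundedGT (Subgroup Q)] [Infinite Q],
    derivedSeries Q n = ⊥ → VZ Q := by
  induction n with
  | zero =>
    intro Q _ _ _ h
    exfalso
    have : (⊤ : Subgroup Q) = ⊥ := h
    have := Subgroup.subsingleton_iff.1 (subsingleton_of_bot_eq_top this.symm)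
    exact not_finite Q
  | succ n ih =>
    intro Q _ _ _ h
    by_cases hfin : Finite (Abelianization Q)
    · have hfi : (commutator Q).FiniteIndex := by
        rw [Subgroup.finiteIndex_iff_finite_quotient]; exact hfin
      have := acc_subgroup (commutator Q)
      have : Infinite (commutator Q) := by
        by_contra hf
        rw [not_infinite_iff_finite] at hf
        have : Finite (Q ⧸ commutator Q) := hfin
        have : Finite Q := Finite.of_equiv _ (Subgroup.groupEquivQuotientProdSubgroup (s := commutator Q)).symm
        exact not_finite Q
      refine VZ.of_subgroup (commutator Q) (ih _ ?_)
      have key : ∀ m, (derivedSeries (commutator Q) m).map (commutator Q).subtype ≤ derivedSeries Q (m+1) := by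
        intro m
        induction m with
        | zero =>
          rw [derivedSeries_zero, derivedSeries_one]
          rintro _ ⟨x, -, rfl⟩; exact x.2
        | succ m ihm =>
          rw [derivedSeries_succ, derivedSeries_succ, Subgroup.map_commutator]
          exact Subgroup.commutator_mono ihm ihm
      have := key n
      rw [h, le_bot_iff, Subgroup.map_eq_bot_iff_of_injective _ (commutator Q).subtype_injective] at this
      exact this
    · rw [not_finite_iff_infinite] at hfin
      have hs : Function.Surjective (Abelianization.of (G := Q)) := QuotientGroup.mk_surjective
      have := acc_surj _ hs
      have := group_fg_of_acc (G := Abelianization Q)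
      exact VZ.of_surj _ hs (VZ_comm _)

lemma VZ_solv (Q : Type*) [Group Q] [WellFoundedGT (Subgroup Q)] [Infinite Q] [Group.IsSolvable Q] : VZ Q := by
  obtain ⟨n, hn⟩ := (Group.isSolvable_def Q).1 inferInstance
  exact VZ_solv_aux n Q hn

open Classical in
open Pointwise in
/-- uniform polynomial growth of degree d -/
def PG (G : Type*) [Group G] (d : ℕ) : Prop :=
  ∀ F : Finset G, ∃ C : ℝ, ∀ n : ℕ, 1 ≤ n → ((F ^ n).card : ℝ) ≤ C * (n:ℝ)^d

lemma PG.inj {G H : Type*} [Group G] [Group H] {d : ℕ} (h : PG G d) (f : H →* G) (hf : Function.Injective f) : PG H d := by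
  classical
  intro F
  obtain ⟨C, hC⟩ := h (F.image f)
  refine ⟨C, fun n hn => ?_⟩
  have := hC n hn
  rw [← Finset.image_pow f F n, Finset.card_image_of_injective _ hf] at this
  convert this

open scoped commutatorElement in
/-- nilpotency criterion -/
lemma nilp_of_comm {Q : Type*} [Group Q] (T : Set Q) (hT : Subgroup.closure T = ⊤) (cm : ℕ → Set Q)
    (h0 : cm 0 = T) (hs : ∀ k, ∀ c ∈ cm k, ∀ t ∈ T, ⁅c, t⁆ ∈ cm (k+1)) (m : ℕ) (hm : ∀ c ∈ cm m, c = 1) :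
    Group.IsNilpotent Q := by
  have key : ∀ k, k ≤ m → ∀ c ∈ cm (m - k), c ∈ Subgroup.upperCentralSeries Q k := by
    intro k
    induction k with
    | zero => intro _ c hc; rw [hm c (by simpa using hc)]; exact one_mem _
    | succ k ih =>
      intro hk c hc
      rw [Subgroup.mem_upperCentralSeries_succ_iff]
      have hn : (Subgroup.upperCentralSeries Q k).Normal := inferInstance
      intro y
      have hy : y ∈ Subgroup.closure T := by rw [hT]; trivial
      induction hy using Subgroup.closure_induction with
      | mem t ht =>
        apply ih (by omega)
        have := hs _ c hc t ht
        rwa [show m - (k+1) + 1 = m - k by omega] at this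
      | one => rw [commutatorElement_one_right]; exact one_mem _
      | mul a b _ _ ha hb =>
        have : ⁅c, a * b⁆ = ⁅c, a⁆ * (a * ⁅c, b⁆ * a⁻¹) := by simp only [commutatorElement_def]; group
        rw [this]
        exact mul_mem ha (hn.conj_mem _ hb a)
      | inv a _ ha =>
        have : ⁅c, a⁻¹⁆ = a⁻¹ * ⁅c, a⁆⁻¹ * a⁻¹⁻¹ := by simp only [commutatorElement_def]; group
        rw [this]
        exact hn.conj_mem _ (inv_mem ha) a⁻¹
  refine ⟨⟨m, ?_⟩⟩
  rw [eq_top_iff, ← hT, Subgroup.closure_le]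
  intro t ht
  exact key m le_rfl t (by rw [Nat.sub_self, h0]; exact ht)

end GW

namespace GW
open Classical
open scoped Pointwise commutatorElement

variable {G : Type*} [Group G] {A : Type*} [NormedRing A]

/-- distance to the identity -/
noncomputable def dd (ρ : G →* A) (g : G) : ℝ := ‖ρ g - 1‖

section
variable [NormedAlgebra ℝ A] (ρ : G →* A)

lemma dd_nonneg (g : G) : 0 ≤ dd ρ g := norm_nonneg _

lemma nml (hρ : ∀ g, ‖ρ g‖ ≤ 1) (g : G) (a : A) : ‖ρ g * a‖ ≤ ‖a‖ :=
  (norm_mul_le _ _).trans (mul_le_of_le_one_left (norm_nonneg _) (hρ g))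

lemma nmr (hρ : ∀ g, ‖ρ g‖ ≤ 1) (g : G) (a : A) : ‖a * ρ g‖ ≤ ‖a‖ :=
  (norm_mul_le _ _).trans (mul_le_of_le_one_right (norm_nonneg _) (hρ g))

lemma ρinv (g : G) : ρ g⁻¹ * ρ g = 1 := by rw [← map_mul]; simp

lemma dd_inv (hρ : ∀ g, ‖ρ g‖ ≤ 1) (g : G) : dd ρ g⁻¹ ≤ dd ρ g := by
  have : ρ g⁻¹ - 1 = - (ρ g⁻¹ * (ρ g - 1)) := by rw [mul_sub, ρinv]; simp
  rw [dd, this, norm_neg]; exact nml ρ hρ _ _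

lemma dd_mul (hρ : ∀ g, ‖ρ g‖ ≤ 1) (g h : G) : dd ρ (g * h) ≤ dd ρ g + dd ρ h := by
  have : ρ (g * h) - 1 = ρ g * (ρ h - 1) + (ρ g - 1) := by rw [map_mul, mul_sub]; simp
  rw [dd, this, add_comm (dd ρ g)]
  exact (norm_add_le _ _).trans (add_le_add_left (nml ρ hρ _ _) _)

lemma dd_one : dd ρ 1 = 0 := by simp [dd]

lemma dd_pow (hρ : ∀ g, ‖ρ g‖ ≤ 1) (g : G) (n : ℕ) : dd ρ (g ^ n) ≤ n * dd ρ g := by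
  induction n with
  | zero => simp [dd_one]
  | succ n ih => rw [pow_succ]; refine (dd_mul ρ hρ _ _).trans ?_; push_cast; linarith

lemma dd_comm (hρ : ∀ g, ‖ρ g‖ ≤ 1) (g h : G) : dd ρ ⁅g, h⁆ ≤ 2 * dd ρ g * dd ρ h := by
  have e : ρ ⁅g, h⁆ - 1 = ((ρ g - 1) * (ρ h - 1) - (ρ h - 1) * (ρ g - 1)) * ρ (g⁻¹ * h⁻¹) := by
    have h1 : (ρ g - 1) * (ρ h - 1) - (ρ h - 1) * (ρ g - 1) = ρ (g * h) - ρ (h * g) := by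
      rw [map_mul, map_mul]; noncomm_ring
    rw [h1, sub_mul, ← map_mul, ← map_mul, commutatorElement_def]
    congr 2
    · simp [mul_assoc]
    · rw [show h * g * (g⁻¹ * h⁻¹) = 1 by group]; simp
  rw [dd, e]
  refine (nmr ρ hρ _ _).trans ((norm_sub_le _ _).trans ?_)
  have h1 := norm_mul_le (ρ g - 1) (ρ h - 1)
  have h2 := norm_mul_le (ρ h - 1) (ρ g - 1)
  unfold dd; linarith

/-- lower bound for powers; note only `aδ ≤ 1/2` is needed -/
lemma dd_pow_ge (hρ : ∀ g, ‖ρ g‖ ≤ 1) (g : G) (n : ℕ) (hn : 1 ≤ n) (h : n * dd ρ g ≤ 1/2) :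
    dd ρ g ≤ 2 * dd ρ (g ^ n) := by
  have hd := dd_nonneg ρ g
  have key : ∀ m : ℕ, m ≤ n → ‖(ρ (g^m) - 1) - m • (ρ g - 1)‖ ≤ m * (dd ρ g * (1/2)) := by
    intro m
    induction m with
    | zero => simp
    | succ m ih =>
      intro hm
      have h1 := ih (by omega)
      have e : (ρ (g^(m+1)) - 1) - (m+1) • (ρ g - 1) = ((ρ (g^m) - 1) - m • (ρ g - 1)) + (ρ (g^m) - 1) * (ρ g - 1) := by
        rw [pow_succ, map_mul, succ_nsmul]; noncomm_ring
      rw [e]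
      refine (norm_add_le _ _).trans ?_
      have h2 := norm_mul_le (ρ (g^m) - 1) (ρ g - 1)
      have h3 : ‖ρ (g^m) - 1‖ ≤ 1/2 := (dd_pow ρ hρ g m).trans (le_trans (by gcongr; omega) h)
      have h4 : ‖ρ (g^m) - 1‖ * ‖ρ g - 1‖ ≤ 1/2 * dd ρ g := mul_le_mul_of_nonneg_right h3 hd
      push_cast
      linarith
  have h1 := key n le_rfl
  rw [← Nat.cast_smul_eq_nsmul ℝ] at h1
  have h2 := norm_sub_norm_le ((n:ℝ) • (ρ g - 1)) (ρ (g^n) - 1)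
  rw [norm_sub_rev ((n:ℝ) • (ρ g - 1))] at h2
  rw [norm_smul, Real.norm_natCast] at h2
  have h3 : (1:ℝ) ≤ n := by exact_mod_cast hn
  have h4 : dd ρ g ≤ n * dd ρ g := le_mul_of_one_le_left hd h3
  unfold dd at *
  linarith

/-- products of powers -/
noncomputable def WW (N : ℕ) : ℕ → (ℕ → G) → Finset G
  | 0, _ => {1}
  | n+1, h => Finset.image (fun p : ℕ × G => h 0 ^ p.1 * p.2) (Finset.range N ×ˢ WW N n (fun k => h (k+1)))

lemma WW_card (hρ : ∀ g, ‖ρ g‖ ≤ 1) (N : ℕ) (hN : 1 ≤ N) (ε : ℝ) (hε : ε * N ≤ 1/32) (n : ℕ) : ∀ (h : ℕ → G),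
    dd ρ (h 0) ≤ ε → (∀ k, dd ρ (h (k+1)) ≤ 2 * ε * dd ρ (h k)) → (∀ k < n, 0 < dd ρ (h k)) →
    (WW N n h).card = N ^ n ∧ ∀ w ∈ WW N n h, dd ρ w ≤ 2 * N * dd ρ (h 0) := by
  induction n with
  | zero =>
    intro h _ _ _
    refine ⟨by simp [WW], fun w hw => ?_⟩
    simp [WW] at hw
    rw [hw, dd_one]
    have := dd_nonneg ρ (h 0); positivity
  | succ n ih =>
    intro h h0 hs hp
    have hd := hp 0 (by omega)
    have hN' : (1:ℝ) ≤ N := by exact_mod_cast hN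
    have hε0 : 0 < ε := lt_of_lt_of_le hd h0
    have hε1 : 2 * ε ≤ 1 := by nlinarith
    obtain ⟨ih1, ih2⟩ := ih (fun k => h (k+1)) (by
      refine (hs 0).trans ?_
      nlinarith) (fun k => hs (k+1)) (fun k hk => hp (k+1) (by omega))
    have ih3 : ∀ w ∈ WW N n (fun k => h (k+1)), dd ρ w ≤ dd ρ (h 0) / 8 := by
      intro w hw
      refine (ih2 w hw).trans ?_
      have := hs 0
      calc 2 * N * dd ρ (h (0+1)) ≤ 2 * N * (2 * ε * dd ρ (h 0)) := by gcongr
        _ = 4 * (ε * N) * dd ρ (h 0) := by ring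
        _ ≤ 4 * (1/32) * dd ρ (h 0) := by gcongr
        _ = _ := by ring
    have hNd : N * dd ρ (h 0) ≤ 1/2 := by nlinarith
    constructor
    · rw [WW, Finset.card_image_of_injOn, Finset.card_product, ih1, Finset.card_range, pow_succ']
      have main : ∀ i j w w', i < j → j < N → w ∈ WW N n (fun k => h (k+1)) → w' ∈ WW N n (fun k => h (k+1)) →
          h 0 ^ i * w = h 0 ^ j * w' → False := by
        intro i j w w' hij hj hw hw' heq
        have e : h 0 ^ (j - i) = w * w'⁻¹ := by
          have : h 0 ^ j = h 0 ^ i * h 0 ^ (j-i) := by rw [← pow_add]; congr 1; omega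
          rw [this, mul_assoc] at heq
          rw [mul_left_cancel heq]; simp
        have h1 := dd_pow_ge ρ hρ (h 0) (j-i) (by omega) (le_trans (by gcongr; omega) hNd)
        rw [e] at h1
        have h2 := dd_mul ρ hρ w w'⁻¹
        have h3 := dd_inv ρ hρ w'
        have h4 := ih3 w hw
        have h5 := ih3 w' hw'
        linarith
      rintro ⟨i, w⟩ hi ⟨j, w'⟩ hj heq
      simp only [Finset.coe_product, Set.mem_prod, Finset.mem_coe, Finset.mem_range] at hi hj heq
      rcases lt_trichotomy i j with hij | hij | hij
      · exact (main i j w w' hij hj.1 hi.2 hj.2 heq).elim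
      · subst hij; rw [mul_left_cancel heq]
      · exact (main j i w' w hij hi.1 hj.2 hi.2 heq.symm).elim
    · intro w hw
      simp only [WW, Finset.mem_image, Finset.mem_product, Finset.mem_range, Prod.exists] at hw
      obtain ⟨i, w', ⟨hi, hw'⟩, rfl⟩ := hw
      have h1 := dd_mul ρ hρ (h 0 ^ i) w'
      have h2 := dd_pow ρ hρ (h 0) i
      have h3 := ih3 w' hw'
      have h4 : (i:ℝ) * dd ρ (h 0) ≤ N * dd ρ (h 0) := by gcongr
      nlinarith

end

lemma WW_sub (B : Finset G) (h1 : (1:G) ∈ B) (N n : ℕ) : ∀ (c : ℕ) (h : ℕ → G), (∀ k, h k ∈ B ^ (c * 4^k)) →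
    WW N n h ⊆ B ^ (N * c * ∑ k ∈ Finset.range n, 4^k) := by
  induction n with
  | zero => intro c h _; simp [WW]
  | succ n ih =>
    intro c h hh
    have := ih (c*4) (fun k => h (k+1)) (fun k => by have := hh (k+1); rwa [pow_succ', ← mul_assoc] at this)
    intro x hx
    simp only [WW, Finset.mem_image, Finset.mem_product, Finset.mem_range, Prod.exists] at hx
    obtain ⟨i, w, ⟨hi, hw⟩, rfl⟩ := hx
    have e : N * c * ∑ k ∈ Finset.range (n+1), 4^k = (c * N) + N * (c*4) * ∑ k ∈ Finset.range n, 4^k := by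
      rw [Finset.sum_range_succ']
      simp_rw [pow_succ]; rw [← Finset.sum_mul]; ring
    rw [e, pow_add]
    refine Finset.mul_mem_mul ?_ (this hw)
    have h2 := Finset.pow_mem_pow (hh 0) (n := i)
    rw [← pow_mul] at h2
    refine Finset.pow_subset_pow_right h1 ?_ h2
    simp; gcongr

/-- iterated commutators -/
def hs (t : ℕ → G) : ℕ → G
  | 0 => t 0
  | k+1 => ⁅hs t k, t (k+1)⁆

lemma hs_congr (t t' : ℕ → G) (k : ℕ) (h : ∀ j ≤ k, t j = t' j) : hs t k = hs t' k := by
  induction k with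
  | zero => exact h 0 le_rfl
  | succ k ih => rw [hs, hs, ih (fun j hj => h j (by omega)), h (k+1) le_rfl]

lemma hs_mem (B : Finset G) (h1 : (1:G) ∈ B) (hi : B⁻¹ = B) (t : ℕ → G) (ht : ∀ k, t k ∈ B) (k : ℕ) : hs t k ∈ B ^ (4^k) := by
  induction k with
  | zero => simpa [hs] using ht 0
  | succ k ih =>
    have hinv : (B ^ (4^k))⁻¹ = B ^ (4^k) := by rw [← inv_pow, hi]
    have a : (hs t k)⁻¹ ∈ B ^ (4^k) := by rw [← hinv]; exact Finset.inv_mem_inv ih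
    have b : (t (k+1))⁻¹ ∈ B := by rw [← hi]; exact Finset.inv_mem_inv (ht _)
    have : hs t (k+1) ∈ B ^ (4^k) * B * B^(4^k) * B := by
      rw [hs, commutatorElement_def]
      exact Finset.mul_mem_mul (Finset.mul_mem_mul (Finset.mul_mem_mul ih (ht _)) a) b
    rw [← pow_succ, ← pow_add, ← pow_succ] at this
    refine Finset.pow_subset_pow_right h1 ?_ this
    have : 1 ≤ 4^k := Nat.one_le_pow _ _ (by norm_num)
    rw [pow_succ]; omega

variable [NormedAlgebra ℝ A]

theorem jordan_fg {d : ℕ} (hG : PG G d) (ρ : G →* A) (hρ : ∀ g, ‖ρ g‖ ≤ 1) (B : Finset G) (h1 : (1:G) ∈ B) (hi : B⁻¹ = B)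
    (hgen : Subgroup.closure (B : Set G) = ⊤) (ε : ℝ) (hε : ε * (2 * 4^d : ℕ) ≤ 1/32) (hB : ∀ b ∈ B, dd ρ b ≤ ε) :
    Group.IsNilpotent (G ⧸ ρ.ker) := by
  set N := 2 * 4^d with hN
  have hN1 : 1 ≤ N := by have : 1 ≤ 4^d := Nat.one_le_pow _ _ (by norm_num); omega
  have hε0 : 0 ≤ ε := (dd_nonneg ρ 1).trans (hB 1 h1)
  have main : ∃ m, ∀ t : ℕ → G, (∀ k, t k ∈ B) → ρ (hs t m) = 1 := by
    by_contra! hcon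
    obtain ⟨C, hC⟩ := hG B
    have hb : ∀ m : ℕ, (2:ℝ)^m ≤ C * N^d := by
      intro m
      obtain ⟨t, ht, hne⟩ := hcon m
      have hstep : ∀ k, dd ρ (hs t (k+1)) ≤ 2 * ε * dd ρ (hs t k) := by
        intro k
        have := dd_comm ρ hρ (hs t k) (t (k+1))
        rw [hs]
        have h2 := hB _ (ht (k+1))
        have h3 := dd_nonneg ρ (hs t k)
        nlinarith
      have hpos : ∀ k ≤ m, 0 < dd ρ (hs t (m - k)) := by
        intro k
        induction k with
        | zero => intro _; exact norm_pos_iff.2 (sub_ne_zero.2 hne)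
        | succ k ih =>
          intro hk
          have := ih (by omega)
          have h2 := hstep (m - (k+1))
          rw [show m - (k+1) + 1 = m - k by omega] at h2
          refine lt_of_le_of_ne (dd_nonneg _ _) fun h0 => ?_
          rw [← h0] at h2; linarith
      have hc := (WW_card ρ hρ N hN1 ε hε m (hs t) (hB _ (ht 0)) hstep (fun k hk => by
        have := hpos (m - k) (by omega)
        rwa [show m - (m - k) = k by omega] at this)).1
      have hsub := WW_sub B h1 N m 1 (hs t) (fun k => by rw [one_mul]; exact hs_mem B h1 hi t ht k)
      have hle : ∑ k ∈ Finset.range m, 4^k ≤ 4^m := by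
        clear hsub hc hpos hne
        induction m with
        | zero => simp
        | succ m ih => rw [Finset.sum_range_succ, pow_succ]; omega
      have hsub2 := hsub.trans (Finset.pow_subset_pow_right h1 (show N * 1 * ∑ k ∈ Finset.range m, 4^k ≤ N * 4^m by
        rw [mul_one]; gcongr))
      have h3 := Finset.card_le_card hsub2
      rw [hc] at h3
      have h4 := hC (N * 4^m) (Nat.mul_pos (by omega) (by positivity))
      have h5 : ((N:ℝ))^m ≤ C * ((N:ℝ) * 4^m)^d := by
        refine le_trans ?_ (le_trans h4 (by push_cast; rfl))
        exact_mod_cast h3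
      have e1 : (N:ℝ)^m = 2^m * (4^d)^m := by rw [hN]; push_cast; rw [mul_pow]
      have e2 : C * ((N:ℝ) * 4^m)^d = C * N^d * (4^d)^m := by rw [mul_pow, ← pow_mul, ← pow_mul, mul_comm m d]; ring
      rw [e1, e2] at h5
      exact le_of_mul_le_mul_right h5 (by positivity)
    obtain ⟨m, hm⟩ := pow_unbounded_of_one_lt (C * N^d) (by norm_num : (1:ℝ) < 2)
    linarith [hb m]
  obtain ⟨m, hm⟩ := main
  let π := QuotientGroup.mk' ρ.ker
  refine nilp_of_comm (π '' B) ?_ (fun k => {c | ∃ t : ℕ → G, (∀ k, t k ∈ B) ∧ π (hs t k) = c}) ?_ ?_ m ?_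
  · rw [← MonoidHom.map_closure, hgen]
    exact Subgroup.map_top_of_surjective _ (QuotientGroup.mk'_surjective _)
  · ext c
    constructor
    · rintro ⟨t, ht, rfl⟩; exact ⟨_, ht 0, rfl⟩
    · rintro ⟨b, hb, rfl⟩; exact ⟨fun _ => b, fun _ => hb, rfl⟩
  · rintro k _ ⟨t, ht, rfl⟩ _ ⟨b, hb, rfl⟩
    refine ⟨Function.update t (k+1) b, fun j => ?_, ?_⟩
    · by_cases hj : j = k+1
      · subst hj; simpa using hb
      · simpa [hj] using ht j
    · rw [hs, hs_congr _ t k (fun j hj => by rw [Function.update_of_ne (by omega)])]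
      simp [map_commutatorElement]
  · rintro _ ⟨t, ht, rfl⟩
    exact (QuotientGroup.eq_one_iff _).2 (hm t ht)

theorem jordan [ProperSpace A] [WellFoundedGT (Subgroup G)] {d : ℕ} (hG : PG G d) (ρ : G →* A) (hρ : ∀ g, ‖ρ g‖ ≤ 1)
    (hinf : (Set.range ρ).Infinite) : VZ G := by
  set N := 2 * 4^d with hN
  have hN1 : (1:ℝ) ≤ N := by
    have : 1 ≤ 4^d := Nat.one_le_pow _ _ (by norm_num)
    exact_mod_cast (by omega : 1 ≤ N)
  set ε : ℝ := 1/(32*N) with hε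
  have hε0 : 0 < ε := by positivity
  let U : Set G := {g | dd ρ g ≤ ε}
  let H := Subgroup.closure U
  obtain ⟨S, hSU, hSH⟩ := fg_of_acc U
  have hfi : H.FiniteIndex := by
    obtain ⟨t, -, htf, htc⟩ := (isCompact_closedBall (0:A) 1).finite_cover_balls (e := ε/2) (by positivity)
    have hx : ∀ g : G, ∃ x ∈ t, ρ g ∈ Metric.ball x (ε/2) := by
      intro g
      have := htc (show ρ g ∈ Metric.closedBall (0:A) 1 by simpa using hρ g)
      simpa using this
    choose x hxt hx using hx
    have := htf.to_subtype
    rw [Subgroup.finiteIndex_iff_finite_quotient]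
    refine Finite.of_injective (fun q : G ⧸ H => (⟨x q.out, hxt _⟩ : t)) ?_
    intro p q hpq
    rw [← p.out_eq', ← q.out_eq']
    rw [QuotientGroup.eq]
    apply Subgroup.subset_closure
    change ‖_‖ ≤ _
    have h1 : x p.out = x q.out := by simpa using hpq
    have h2 := hx p.out
    have h3 := hx q.out
    rw [← h1] at h3
    have h4 : ‖ρ q.out - ρ p.out‖ ≤ ε := by
      rw [← dist_eq_norm]
      rw [Metric.mem_ball] at h2 h3
      have := dist_triangle_right (ρ q.out) (ρ p.out) (x p.out)
      linarith
    have e : ρ (p.out⁻¹ * q.out) - 1 = ρ (p.out⁻¹) * (ρ q.out - ρ p.out) := by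
      rw [mul_sub, ρinv, map_mul]
    rw [e]
    exact (nml ρ hρ _ _).trans h4
  let ρ' : H →* A := ρ.comp H.subtype
  let B : Finset H := (insert 1 (S ∪ S⁻¹)).preimage H.subtype H.subtype_injective.injOn
  have hSB : ∀ s ∈ insert 1 (S ∪ S⁻¹), s ∈ U := by
    intro s hs
    simp only [Finset.mem_insert, Finset.mem_union, Finset.mem_inv'] at hs
    rcases hs with rfl | hs | hs
    · change dd ρ 1 ≤ _; rw [dd_one]; exact hε0.le
    · exact hSU hs
    · have h1 : dd ρ s⁻¹ ≤ ε := hSU hs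
      have h2 := dd_inv ρ hρ s⁻¹
      rw [inv_inv] at h2
      exact h2.trans h1
  have hnil : Group.IsNilpotent (H ⧸ ρ'.ker) := by
    refine jordan_fg (hG.inj H.subtype H.subtype_injective) ρ' (fun g => hρ _) B ?_ ?_ ?_ ε ?_ ?_
    · simp [B]
    · ext x; simp [B, or_comm]
    · have : H.subtype '' (B : Set H) = insert 1 (S ∪ S⁻¹ : Set G) := by
        ext x
        simp only [B, Finset.coe_preimage, Finset.coe_insert, Finset.coe_union, Finset.coe_inv, Set.mem_image, Set.mem_preimage]
        constructor
        · rintro ⟨y, hy, rfl⟩; exact hy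
        · intro hx
          exact ⟨⟨x, Subgroup.subset_closure (hSB x (by simpa using hx))⟩, hx, rfl⟩
      apply Subgroup.map_injective H.subtype_injective
      rw [MonoidHom.map_closure, this, ← MonoidHom.range_eq_map, H.range_subtype]
      apply le_antisymm
      · rw [Subgroup.closure_le]
        intro x hx
        exact Subgroup.subset_closure (hSB x (by simpa using hx))
      · change Subgroup.closure U ≤ _
        rw [← hSH]
        exact Subgroup.closure_mono (fun x hx => by simp at hx ⊢; tauto)
    · rw [hε]; apply le_of_eq
      rw [← hN]; field_simp
    · intro b hb
      exact hSB b (by simpa [B] using hb)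
  have : Infinite (H ⧸ ρ'.ker) := by
    by_contra hf
    rw [not_infinite_iff_finite] at hf
    have hk : ρ'.ker.FiniteIndex := Subgroup.finiteIndex_iff_finite_quotient.2 hf
    have hk2 : (ρ'.ker.map H.subtype).FiniteIndex := ⟨by
      rw [Subgroup.index_map_subtype]
      exact mul_ne_zero hk.index_ne_zero hfi.index_ne_zero⟩
    have := Subgroup.finiteIndex_iff_finite_quotient.1 hk2
    apply hinf
    refine (Set.finite_range (fun q : G ⧸ (ρ'.ker.map H.subtype) => ρ q.out)).subset ?_
    rintro _ ⟨g, rfl⟩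
    refine ⟨(g : G ⧸ (ρ'.ker.map H.subtype)), ?_⟩
    have := QuotientGroup.mk_out_eq_mul (ρ'.ker.map H.subtype) g
    obtain ⟨h, hh⟩ := this
    obtain ⟨y, hy, hy2⟩ := h.2
    have : ρ (h : G) = 1 := by rw [← hy2]; exact hy
    simp only [hh, map_mul, this, mul_one]
  have := acc_subgroup H
  have := acc_surj (QuotientGroup.mk' ρ'.ker) (QuotientGroup.mk'_surjective _)
  have hv : VZ (H ⧸ ρ'.ker) := VZ_solv _
  exact VZ.of_subgroup H (VZ.of_surj _ (QuotientGroup.mk'_surjective _) hv)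

end GW

namespace GW
open Classical
open scoped Pointwise

lemma jordan_lin {G : Type*} [Group G] [WellFoundedGT (Subgroup G)] {d : ℕ} (hG : PG G d)
    {E F : Type*} [AddCommGroup E] [Module ℝ E] [Module.Finite ℝ E] [NormedAddCommGroup F] [NormedSpace ℝ F]
    (T : E →ₗ[ℝ] F) (hT : Function.Injective T) (ρ : G →* Module.End ℝ E) (hρ : ∀ g u, ‖T (ρ g u)‖ ≤ ‖T u‖)
    (hinf : (Set.range ρ).Infinite) : VZ G := by
  let _ : NormedAddCommGroup E := NormedAddCommGroup.induced E F T hT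
  let _ : NormedSpace ℝ E := NormedSpace.induced ℝ E F T
  have hn : ∀ u : E, ‖u‖ = ‖T u‖ := fun _ => rfl
  let Φ : Module.End ℝ E →* (E →L[ℝ] E) :=
    { toFun := fun f => LinearMap.toContinuousLinearMap f
      map_one' := by ext; rfl
      map_mul' := fun f g => by ext; rfl }
  have hΦ : Function.Injective Φ := fun f g h => LinearMap.toContinuousLinearMap.injective h
  have : ProperSpace (E →L[ℝ] E) := FiniteDimensional.proper ℝ _
  refine jordan (A := E →L[ℝ] E) hG (Φ.comp ρ) (fun g => ?_) ?_
  · refine ContinuousLinearMap.opNorm_le_bound _ zero_le_one fun u => ?_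
    rw [one_mul]
    exact hρ g u
  · rw [MonoidHom.coe_comp, Set.range_comp]
    exact hinf.image hΦ.injOn

variable {G : Type*} [Group G] {ι : Type*} [Fintype ι] [Nonempty ι] (τ : ι → G)

/-- translation action on Lipschitz harmonic functions -/
noncomputable def act : G →* Module.End ℝ (LH τ) where
  toFun g :=
    { toFun := fun u => ⟨fun x => u.1 (g⁻¹ * x) - u.1 g⁻¹, trans_mem u.2 g⁻¹⟩
      map_add' := fun u v => by ext x; simp; ring
      map_smul' := fun c u => by ext x; simp; ring }
  map_one' := by
    ext u x
    have := u.2.2.1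
    simp [this]
  map_mul' g h := by
    ext u x
    simp [mul_assoc]

lemma act_apply (g : G) (u : LH τ) (x : G) : (act τ g u).1 x = u.1 (g⁻¹ * x) - u.1 g⁻¹ := rfl

/-- discrete gradient as an element of the Banach space of bounded functions -/
noncomputable def grad : LH τ →ₗ[ℝ] lp (fun _ : G × ι => ℝ) ⊤ where
  toFun u := ⟨fun p => u.1 (p.1 * τ p.2) - u.1 p.1, by
    obtain ⟨C, hC⟩ := u.2.2.2
    refine memℓp_infty ⟨C, ?_⟩
    rintro _ ⟨p, rfl⟩
    exact hC p.1 p.2⟩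
  map_add' u v := by
    ext p
    change u.1 _ + v.1 _ - (u.1 _ + v.1 _) = (u.1 _ - u.1 _) + (v.1 _ - v.1 _)
    ring
  map_smul' c u := by
    ext p
    change c * u.1 _ - c * u.1 _ = c * (u.1 _ - u.1 _)
    ring

lemma grad_apply (u : LH τ) (p : G × ι) : (grad τ u : ∀ _ : G × ι, ℝ) p = u.1 (p.1 * τ p.2) - u.1 p.1 := rfl

lemma grad_inj (hgen : Subgroup.closure (Set.range τ) = ⊤) : Function.Injective (grad τ) := by
  rw [← LinearMap.ker_eq_bot, LinearMap.ker_eq_bot']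
  intro u hu
  ext x
  rw [const_of_incr hgen (u := u.1) (fun x i => ?_) x, u.2.2.1]
  · rfl
  · have := congrArg (fun f : lp (fun _ : G × ι => ℝ) ⊤ => (f : ∀ _ : G × ι, ℝ) (x, i)) hu
    simp only [grad_apply] at this
    simpa [sub_eq_zero] using this

lemma grad_act (g : G) (u : LH τ) : ‖grad τ (act τ g u)‖ ≤ ‖grad τ u‖ := by
  refine lp.norm_le_of_forall_le (norm_nonneg _) fun p => ?_
  have := lp.norm_apply_le_norm (by simp) (grad τ u) (g⁻¹ * p.1, p.2)
  refine le_trans (le_of_eq ?_) this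
  rw [grad_apply, grad_apply, act_apply, act_apply]
  simp [mul_assoc]

/-- maximum principle -/
lemma max_princ (e : ι ≃ ι) (hinv : ∀ i, τ (e i) = (τ i)⁻¹) (hgen : Subgroup.closure (Set.range τ) = ⊤)
    (u : LH τ) (hfin : (Set.range u.1).Finite) : u = 0 := by
  obtain ⟨x0, hx0⟩ : ∃ x0, ∀ x, u.1 x ≤ u.1 x0 := by
    have : (Set.range u.1).Nonempty := ⟨_, 1, rfl⟩
    obtain ⟨_, ⟨x0, rfl⟩, h⟩ := Set.exists_max_image _ id hfin this
    exact ⟨x0, fun x => h _ ⟨x, rfl⟩⟩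
  have step : ∀ i x, u.1 x = u.1 x0 → u.1 (x * τ i) = u.1 x0 := by
    intro i x hx
    have h1 : PP τ u.1 x = u.1 x := congrFun u.2.1 x
    have hc := card_pos' (ι := ι)
    unfold PP at h1
    rw [inv_mul_eq_iff_eq_mul₀ hc.ne', hx] at h1
    by_contra hne
    have : ∑ i, u.1 (x * τ i) < ∑ i : ι, u.1 x0 :=
      Finset.sum_lt_sum (fun i _ => hx0 _) ⟨i, Finset.mem_univ _, lt_of_le_of_ne (hx0 _) hne⟩
    simp [h1] at this
  have all : ∀ g x, (u.1 x = u.1 x0 → u.1 (x * g) = u.1 x0) ∧ (u.1 x = u.1 x0 → u.1 (x * g⁻¹) = u.1 x0) := by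
    intro g
    have hg : g ∈ Subgroup.closure (Set.range τ) := by rw [hgen]; trivial
    induction hg using Subgroup.closure_induction with
    | mem g hg => obtain ⟨i, rfl⟩ := hg; exact fun x => ⟨step i x, by rw [← hinv]; exact step _ x⟩
    | one => simp
    | mul a b _ _ ha hb =>
      intro x
      rw [← mul_assoc, mul_inv_rev, ← mul_assoc]
      exact ⟨fun h => (hb _).1 ((ha _).1 h), fun h => (ha _).2 ((hb _).2 h)⟩
    | inv a _ ha => intro x; rw [inv_inv]; exact ⟨(ha x).2, (ha x).1⟩
  have h2 : ∀ g, u.1 g = u.1 x0 := by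
    intro g
    have := (all (x0⁻¹ * g) x0).1 rfl
    simpa using this
  ext g
  rw [h2, ← h2 1, u.2.2.1]; rfl

lemma VZ_of_real {K : Type*} [Group K] [WellFoundedGT (Subgroup K)] (f : K →* Multiplicative ℝ) (g : K) (hg : f g ≠ 1) : VZ K := by
  have hs := f.rangeRestrict_surjective
  have := acc_surj _ hs
  have := group_fg_of_acc (G := f.range)
  have : Infinite f.range := by
    refine Infinite.of_injective (fun n : ℕ => f.rangeRestrict g ^ n) fun a b hab => ?_
    have h := congrArg (fun x : f.range => Multiplicative.toAdd x.1) hab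
    simp at h
    rcases h with h | h
    · exact h
    · exact (hg h).elim
  exact VZ.of_surj _ hs (VZ_comm _)

theorem virt_indicable [Infinite G] [WellFoundedGT (Subgroup G)] {d : ℕ} (hG : PG G d) : VZ G := by
  obtain ⟨S, -, hS⟩ := fg_of_acc (Set.univ : Set G)
  rw [Subgroup.closure_univ] at hS
  let B : Finset G := insert 1 (S ∪ S⁻¹)
  have hB1 : (1:G) ∈ B := by simp [B]
  have hBi : ∀ b ∈ B, b⁻¹ ∈ B := by
    intro b hb
    simp [B] at hb ⊢; tauto
  have : Nonempty B := ⟨1, hB1⟩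
  let σ : B → G := fun b => b.1
  let i0 : B := ⟨1, hB1⟩
  let e : B ≃ B :=
    { toFun := fun b => ⟨b.1⁻¹, hBi _ b.2⟩
      invFun := fun b => ⟨b.1⁻¹, hBi _ b.2⟩
      left_inv := fun b => by simp
      right_inv := fun b => by simp }
  have hsym : Sym σ i0 e := ⟨rfl, fun _ => rfl, by
    rw [eq_top_iff, ← hS]
    apply Subgroup.closure_mono
    intro x hx
    exact ⟨⟨x, by simp [B]; tauto⟩, rfl⟩⟩
  obtain ⟨C, hC⟩ := hG B
  have hsub : ∀ n, supp σ n ⊆ B ^ n := by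
    intro n
    induction n with
    | zero => simp [supp]
    | succ n ih =>
      intro x hx
      simp only [supp, Finset.mem_image, Finset.mem_product, Prod.exists] at hx
      obtain ⟨b, y, ⟨-, hy⟩, rfl⟩ := hx
      rw [pow_succ']
      exact Finset.mul_mem_mul b.2 (ih hy)
  have hg : ∀ n, 1 ≤ n → ((supp σ n).card : ℝ) ≤ C * n^d := fun n hn =>
    le_trans (by exact_mod_cast Finset.card_le_card (hsub n)) (hC n hn)
  have hsub2 : ∀ n, supp (dbl σ) n ⊆ B ^ (2*n) := by
    intro n
    induction n with
    | zero => simp [supp]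
    | succ n ih =>
      intro x hx
      simp only [supp, Finset.mem_image, Finset.mem_product, Prod.exists] at hx
      obtain ⟨b, c, y, ⟨-, hy⟩, rfl⟩ := hx
      rw [mul_add, mul_one, add_comm, pow_add, pow_two]
      exact Finset.mul_mem_mul (Finset.mul_mem_mul b.2 c.2) (ih hy)
  have hg2 : ∀ n, 1 ≤ n → ((supp (dbl σ) n).card : ℝ) ≤ (C * 2^d) * n^d := fun n hn => by
    refine le_trans (by exact_mod_cast Finset.card_le_card (hsub2 n)) ((hC (2*n) (by omega)).trans (le_of_eq ?_))
    push_cast; ring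
  have hgen := dbl_gen hsym
  have hfd : Module.Finite ℝ (LH (dbl σ)) := finite_LH (σ := dbl σ) hg2 (i0 := (i0, i0)) (by simp [dbl, σ, i0]) hgen
  obtain ⟨u, hu, g, hug⟩ := exists_LH hsym hg
  by_cases hfin : (Set.range (act (dbl σ))).Finite
  · set K := (act (dbl σ)).ker with hK
    have := acc_subgroup K
    have hKfi : K.FiniteIndex := by
      rw [Subgroup.finiteIndex_iff_finite_quotient]
      have := hfin.to_subtype
      refine Finite.of_injective (fun q : G ⧸ K => (⟨act (dbl σ) q.out, _, rfl⟩ : Set.range (act (dbl σ)))) ?_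
      intro p q hpq
      rw [← p.out_eq', ← q.out_eq', QuotientGroup.eq]
      change act (dbl σ) _ = 1
      rw [map_mul]
      have h1 : act (dbl σ) p.out = act (dbl σ) q.out := congrArg Subtype.val hpq
      rw [← h1, ← map_mul]; simp
    have hom : ∀ k ∈ K, ∀ (v : LH (dbl σ)) x, v.1 (k * x) = v.1 k + v.1 x := by
      intro k hk v x
      have h1 : act (dbl σ) k⁻¹ = 1 := K.inv_mem hk
      have h2 : (act (dbl σ) k⁻¹ v).1 x = v.1 x := by rw [h1]; rfl
      rw [act_apply, inv_inv] at h2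
      linarith
    by_cases hz : ∃ k ∈ K, u k ≠ 0
    · obtain ⟨k, hk, hne⟩ := hz
      refine VZ.of_subgroup K (VZ_of_real
        { toFun := fun x : K => Multiplicative.ofAdd (u x.1)
          map_one' := by simp [hu.2.1]
          map_mul' := fun x y => by
            have := hom x.1 x.2 ⟨u, hu⟩ y.1
            change u _ = _ + _ at this
            simp [this] } ⟨k, hk⟩ ?_)
      intro h
      exact hne h
    · push Not at hz
      exfalso
      have h0 := max_princ (dbl σ) ((Equiv.prodComm _ _).trans (e.prodCongr e)) (fun i => by
        simp [dbl, e, σ]) hgen ⟨u, hu⟩ (by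
          refine (Set.finite_range (fun q : G ⧸ K => u (q.out⁻¹))).subset ?_
          rintro _ ⟨x, rfl⟩
          refine ⟨(x⁻¹ : G), ?_⟩
          obtain ⟨h, hh⟩ := QuotientGroup.mk_out_eq_mul K x⁻¹
          have h3 := hom (h.1⁻¹) (K.inv_mem h.2) ⟨u, hu⟩ x
          change u _ = u _ + u _ at h3
          simp only [hh, mul_inv_rev, inv_inv, h3, hz _ (K.inv_mem h.2), zero_add])
      apply hug
      exact congrFun (congrArg Subtype.val h0) g
  · exact jordan_lin hG (grad (dbl σ)) (grad_inj _ hgen) (act (dbl σ)) (grad_act _) hfin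

end GW

namespace GW
open Classical
open scoped Pointwise

/-- poly-infinite-cyclic subgroups -/
inductive PZ {G : Type*} [Group G] : Subgroup G → Prop
  | bot : PZ ⊥
  | step (K : Subgroup G) (t : G) : PZ K → (∀ x, x ∈ K ↔ t * x * t⁻¹ ∈ K) → (∀ n : ℤ, t ^ n ∈ K → n = 0) →
      PZ (K ⊔ Subgroup.zpowers t)

lemma PZ.map {G H : Type*} [Group G] [Group H] (f : G →* H) (hf : Function.Injective f) {K : Subgroup G} (h : PZ K) :
    PZ (K.map f) := by
  induction h with
  | bot => rw [Subgroup.map_bot]; exact PZ.bot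
  | step K t hK h1 h2 ih =>
    rw [Subgroup.map_sup, MonoidHom.map_zpowers]
    refine PZ.step _ _ ih (fun x => ⟨?_, ?_⟩) (fun n hn => ?_)
    · rintro ⟨y, hy, rfl⟩
      exact ⟨t * y * t⁻¹, (h1 y).1 hy, by simp⟩
    · rintro ⟨y, hy, hyx⟩
      have e : t * (t⁻¹ * y * t) * t⁻¹ = y := by group
      refine ⟨t⁻¹ * y * t, (h1 _).2 (by rw [e]; exact hy), ?_⟩
      simp [hyx, mul_assoc]
    · rw [← map_zpow] at hn
      exact h2 n ((Subgroup.mem_map_iff_mem hf).1 hn)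

lemma finite_index_subgroups {K : Type*} [Group K] [Group.FG K] (m : ℕ) (hm : m ≠ 0) :
    {H : Subgroup K | H.index = m}.Finite := by
  obtain ⟨S, hS⟩ := Group.fg_def.1 (inferInstance : Group.FG K)
  have hfin : Finite (K →* Equiv.Perm (Fin m)) := by
    refine Finite.of_injective (fun f : K →* Equiv.Perm (Fin m) => fun s : S => f s.1) ?_
    intro f g hfg
    refine MonoidHom.eq_of_eqOn_dense (s := (S : Set K)) hS ?_
    intro x hx
    exact congrFun hfg ⟨x, hx⟩
  refine (Set.finite_range (fun p : (K →* Equiv.Perm (Fin m)) × Fin m =>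
    (MulAction.stabilizer (Equiv.Perm (Fin m)) p.2).comap p.1)).subset ?_
  intro H hH
  have hH : H.index = m := hH
  have : H.FiniteIndex := ⟨by rw [hH]; exact hm⟩
  have hfq : Finite (K ⧸ H) := Subgroup.finiteIndex_iff_finite_quotient.1 this
  let E : (K ⧸ H) ≃ Fin m := Finite.equivFinOfCardEq (by rw [← hH]; rfl)
  refine ⟨((E.permCongrHom.toMonoidHom).comp (MulAction.toPermHom K (K ⧸ H)), E (1 : K)), ?_⟩
  ext x
  simp only [Subgroup.mem_comap, MulAction.mem_stabilizer_iff]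
  change E (x • (E.symm (E _))) = _ ↔ _
  rw [E.symm_apply_apply, E.injective.eq_iff]
  change ((x * 1 : K) : K ⧸ H) = ((1 : K) : K ⧸ H) ↔ _
  rw [mul_one, QuotientGroup.eq]
  simp

lemma exists_gen {Γ : Type*} [Group Γ] (φ : Γ →* Multiplicative ℤ) (hφ : φ ≠ 1) :
    ∃ t : Γ, (∀ γ, ∃ c : ℤ, φ γ = φ t ^ c) ∧ ∀ n : ℤ, φ t ^ n = 1 → n = 0 := by
  have : IsCyclic φ.range := inferInstance
  obtain ⟨⟨_, t, rfl⟩, ht⟩ := IsCyclic.exists_generator (α := φ.range)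
  have h1 : ∀ γ, ∃ c : ℤ, φ γ = φ t ^ c := by
    intro γ
    obtain ⟨c, hc⟩ := ht ⟨φ γ, γ, rfl⟩
    exact ⟨c, by simpa using (congrArg Subtype.val hc).symm⟩
  refine ⟨t, h1, fun n hn => ?_⟩
  have h2 : n * Multiplicative.toAdd (φ t) = 0 := by
    have := congrArg Multiplicative.toAdd hn
    simpa using this
  rcases mul_eq_zero.1 h2 with h | h
  · exact h
  · exfalso; apply hφ
    have h3 : φ t = 1 := h
    ext γ
    obtain ⟨c, hc⟩ := h1 γ
    simp [hc, h3]

lemma growth_ker {Γ : Type*} [Group Γ] {d : ℕ} (hG : PG Γ (d+1)) (φ : Γ →* Multiplicative ℤ) (hφ : φ ≠ 1) : PG φ.ker d := by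
  obtain ⟨t, -, ht⟩ := exists_gen φ hφ
  intro F
  let F' : Finset Γ := insert 1 (insert t (F.image φ.ker.subtype))
  obtain ⟨C, hC⟩ := hG F'
  refine ⟨C * 2^(d+1), fun n hn => ?_⟩
  have hsub : ((F^n) ×ˢ Finset.range n).image (fun p : φ.ker × ℕ => (p.1 : Γ) * t ^ p.2) ⊆ F' ^ (2*n) := by
    intro x hx
    simp only [Finset.mem_image, Finset.mem_product, Finset.mem_range, Prod.exists] at hx
    obtain ⟨y, i, ⟨hy, hi⟩, rfl⟩ := hx
    rw [two_mul, pow_add]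
    refine Finset.mul_mem_mul ?_ ?_
    · have h1 : (F.image φ.ker.subtype) ^ n ⊆ F' ^ n := Finset.pow_subset_pow_left (fun z hz => Finset.mem_insert_of_mem (Finset.mem_insert_of_mem hz))
      apply h1
      rw [← Finset.image_pow]
      exact Finset.mem_image_of_mem _ hy
    · exact Finset.pow_subset_pow_right (by simp [F']) hi.le (Finset.pow_mem_pow (by simp [F']))
  have hcard := Finset.card_le_card hsub
  rw [Finset.card_image_of_injective, Finset.card_product, Finset.card_range] at hcard
  · have h1 := hC (2*n) (by omega)
    have h2 : ((F^n).card : ℝ) * n ≤ C * 2^(d+1) * n^d * n := by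
      calc ((F^n).card : ℝ) * n ≤ _ := by exact_mod_cast hcard
        _ ≤ _ := h1
        _ = _ := by push_cast; ring
    have h3 := le_of_mul_le_mul_right h2 (by exact_mod_cast hn : (0:ℝ) < n)
    refine le_trans (le_of_eq ?_) h3
    congr!
  · rintro ⟨y, i⟩ ⟨z, j⟩ h
    have h : (y : Γ) * t^i = z * t^j := h
    have h1 := congrArg φ h
    rw [map_mul, map_mul, show φ y = 1 from y.2, show φ z = 1 from z.2, one_mul, one_mul, map_pow, map_pow] at h1
    have h2 : ((i:ℤ) - j) = 0 := ht _ (by rw [zpow_sub, zpow_natCast, zpow_natCast, h1]; simp)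
    have h3 : i = j := by omega
    subst h3
    have := mul_right_cancel h
    simp [Subtype.ext_iff, this]

lemma ext_step {Γ : Type*} [Group Γ] [WellFoundedGT (Subgroup Γ)] (φ : Γ →* Multiplicative ℤ) (hφ : φ ≠ 1)
    (M : Subgroup φ.ker) (hM : PZ M) (hfi : M.FiniteIndex) : ∃ N : Subgroup Γ, PZ N ∧ N.FiniteIndex := by
  obtain ⟨t, hgen, ht⟩ := exists_gen φ hφ
  have := acc_subgroup φ.ker
  have := group_fg_of_acc (G := φ.ker)
  have hfin := finite_index_subgroups (K := φ.ker) M.index hfi.index_ne_zero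
  have := hfin.to_subtype
  -- conjugation by t
  have hconj : ∃ j : ℕ, 0 < j ∧ ∀ x : Γ, x ∈ M.map φ.ker.subtype ↔ t^j * x * (t^j)⁻¹ ∈ M.map φ.ker.subtype := by
    let c : ℕ → φ.ker ≃* φ.ker := fun j => MulAut.conjNormal (t^j)
    let f : ℕ → {H : Subgroup φ.ker | H.index = M.index} := fun j => ⟨M.comap (c j).toMonoidHom, by
      exact Subgroup.index_comap_of_surjective M (c j).surjective⟩
    obtain ⟨a, b, hab, hfab⟩ := Finite.exists_ne_map_eq_of_infinite f
    have key : ∀ a b, a < b → f a = f b →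
        ∃ j : ℕ, 0 < j ∧ ∀ x : Γ, x ∈ M.map φ.ker.subtype ↔ t^j * x * (t^j)⁻¹ ∈ M.map φ.ker.subtype := by
      intro a b hab hfab
      refine ⟨b - a, by omega, fun x => ?_⟩
      have h1 : M.comap (c a).toMonoidHom = M.comap (c b).toMonoidHom := congrArg Subtype.val hfab
      have mem : ∀ y : Γ, y ∈ M.map φ.ker.subtype ↔ ∃ hy : φ y = 1, (⟨y, hy⟩ : φ.ker) ∈ M := by
        intro y
        constructor
        · rintro ⟨z, hz, rfl⟩; exact ⟨z.2, hz⟩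
        · rintro ⟨hy, h⟩; exact ⟨_, h, rfl⟩
      have hcm : ∀ j (y : φ.ker), ((c j y : φ.ker) : Γ) = t^j * y * (t^j)⁻¹ := fun j y => MulAut.conjNormal_apply _ _
      -- element z with t^a z t^-a = x
      by_cases hx : φ x = 1
      · obtain ⟨z, hz⟩ := (c a).surjective ⟨x, hx⟩
        have h2 : z ∈ M.comap (c a).toMonoidHom ↔ z ∈ M.comap (c b).toMonoidHom := by rw [h1]
        rw [Subgroup.mem_comap, Subgroup.mem_comap] at h2
        change c a z ∈ M ↔ c b z ∈ M at h2
        have e : t^(b-a) * x * (t^(b-a))⁻¹ = (c b z : Γ) := by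
          have h3 : t^a * z * (t^a)⁻¹ = x := by rw [← hcm, hz]
          rw [hcm, show t^b = t^(b-a) * t^a by rw [← pow_add]; congr 1; omega, ← h3]
          group
        rw [e, mem, mem]
        constructor
        · rintro ⟨_, h⟩; exact ⟨(c b z).2, h2.1 (by rw [hz]; exact h)⟩
        · rintro ⟨_, h⟩; exact ⟨hx, by rw [← hz]; exact h2.2 h⟩
      · rw [mem, mem]
        constructor
        · rintro ⟨h, _⟩; exact (hx h).elim
        · rintro ⟨h, _⟩; exfalso; apply hx; simpa using h
    rcases lt_or_gt_of_ne hab with h | h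
    · exact key a b h hfab
    · exact key b a h hfab.symm
  obtain ⟨j, hj, hn⟩ := hconj
  refine ⟨M.map φ.ker.subtype ⊔ Subgroup.zpowers (t^j), PZ.step _ _ (hM.map _ φ.ker.subtype_injective) hn ?_, ?_⟩
  · rintro n ⟨y, -, hy⟩
    have h1 : φ ((t^j)^n) = 1 := by rw [← hy]; exact y.2
    rw [map_zpow, map_pow, ← zpow_natCast, ← zpow_mul] at h1
    have := ht _ h1
    rcases mul_eq_zero.1 this with h | h
    · omega
    · exact h
  · set N := M.map φ.ker.subtype ⊔ Subgroup.zpowers (t^j) with hN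
    have hfq : Finite (φ.ker ⧸ M) := Subgroup.finiteIndex_iff_finite_quotient.1 hfi
    rw [Subgroup.finiteIndex_iff_finite_quotient]
    refine Finite.of_surjective (fun p : Fin j × (φ.ker ⧸ M) => ((t ^ p.1.1 * (p.2.out : Γ) : Γ) : Γ ⧸ N)) ?_
    intro q
    obtain ⟨γ, rfl⟩ := QuotientGroup.mk_surjective q
    obtain ⟨c, hc⟩ := hgen γ
    have hjz : (0:ℤ) < j := by exact_mod_cast hj
    have hr0 := Int.emod_nonneg c hjz.ne'
    have hr1 := Int.emod_lt_of_pos c hjz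
    obtain ⟨r, hr⟩ := Int.eq_ofNat_of_zero_le hr0
    have hk : φ (t^(-r:ℤ) * γ * (t^j)^(-(c / j))) = 1 := by
      rw [map_mul, map_mul, hc, map_zpow, map_zpow, map_pow, ← zpow_natCast, ← zpow_mul, ← zpow_add, ← zpow_add]
      have := Int.emod_add_mul_ediv c j
      rw [hr] at this
      rw [show (-(r:ℤ)) + c + j * (-(c/j)) = 0 by linarith]; simp
    refine ⟨(⟨r, by omega⟩, ((⟨_, hk⟩ : φ.ker) : φ.ker ⧸ M)), ?_⟩
    rw [QuotientGroup.eq]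
    obtain ⟨h, hh⟩ := QuotientGroup.mk_out_eq_mul M (⟨_, hk⟩ : φ.ker)
    simp only [hh]
    have h1 : ((h : φ.ker) : Γ) ∈ N := (le_sup_left : _ ≤ N) ⟨_, h.2, rfl⟩
    have h2 : (t^j)^(c / j) ∈ N := (le_sup_right : _ ≤ N) (Subgroup.zpow_mem_zpowers _ _)
    have : (t ^ r * (((⟨_, hk⟩ : φ.ker) * (h : φ.ker) : φ.ker) : Γ))⁻¹ * γ = (((h : φ.ker) : Γ))⁻¹ * (t^j)^(c / j) := by
      simp only [Subgroup.coe_mul]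
      rw [zpow_neg, zpow_neg, zpow_natCast]
      group
    rw [this]
    exact mul_mem (inv_mem h1) h2

lemma trivial_of_finite {G : Type*} [Group G] (htf : ∀ g : G, ∀ n : ℕ, 0 < n → g ^ n = 1 → g = 1) [Finite G] :
    ∃ N : Subgroup G, PZ N ∧ N.FiniteIndex := by
  refine ⟨⊥, PZ.bot, ?_⟩
  rw [Subgroup.finiteIndex_iff_finite_quotient]; infer_instance

theorem gromov (d : ℕ) : ∀ (G : Type*) [Group G] [WellFoundedGT (Subgroup G)],
    (∀ g : G, ∀ n : ℕ, 0 < n → g ^ n = 1 → g = 1) → PG G d → ∃ N : Subgroup G, PZ N ∧ N.FiniteIndex := by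
  induction d with
  | zero =>
    intro G _ _ htf hG
    have : Subsingleton G := by
      refine subsingleton_of_forall_eq 1 fun g => ?_
      by_contra hg
      obtain ⟨C, hC⟩ := hG {1, g}
      obtain ⟨n, hn⟩ := exists_nat_gt C
      have hsub : (Finset.range (n+1)).image (fun i => g^i) ⊆ ({1, g} : Finset G) ^ (n+1) := by
        intro x hx
        simp only [Finset.mem_image, Finset.mem_range] at hx
        obtain ⟨i, hi, rfl⟩ := hx
        exact Finset.pow_subset_pow_right (by simp) hi.le (Finset.pow_mem_pow (by simp))
      have := Finset.card_le_card hsub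
      rw [Finset.card_image_of_injective, Finset.card_range] at this
      · have h2 := hC (n+1) (by omega)
        rw [pow_zero, mul_one] at h2
        have h3 : ((n + 1 : ℕ):ℝ) ≤ C := le_trans (by exact_mod_cast this) h2
        push_cast at h3; linarith
      · have key : ∀ a b : ℕ, a < b → g^a = g^b → False := by
          intro a b hab h
          apply hg
          apply htf g (b-a) (by omega)
          have : g^b = g^a * g^(b-a) := by rw [← pow_add]; congr 1; omega
          rw [this] at h
          exact (mul_eq_left.1 h.symm)
        intro a b h
        rcases lt_trichotomy a b with h1 | h1 | h1
        · exact (key a b h1 h).elim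
        · exact h1
        · exact (key b a h1 h.symm).elim
    exact trivial_of_finite htf
  | succ d ih =>
    intro G _ _ htf hG
    by_cases hf : Finite G
    · exact trivial_of_finite htf
    rw [not_finite_iff_infinite] at hf
    obtain ⟨H, hH, φ, hφ⟩ := virt_indicable hG
    have := acc_subgroup H
    have := acc_subgroup φ.ker
    obtain ⟨M, hM, hMf⟩ := ih φ.ker (fun g n hn h => by
      have := htf (g : H) n hn (by
        have := congrArg (fun x : φ.ker => ((x : H) : G)) h
        simpa using this)
      exact Subtype.ext (Subtype.ext this)) (growth_ker (hG.inj H.subtype H.subtype_injective) φ hφ)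
    obtain ⟨N, hN, hNf⟩ := ext_step φ hφ M hM hMf
    refine ⟨N.map H.subtype, hN.map _ H.subtype_injective, ⟨?_⟩⟩
    rw [Subgroup.index_map_subtype]
    exact mul_ne_zero hNf.index_ne_zero hH.index_ne_zero

end GW

namespace GW
open Classical
universe w

lemma schanuel {B E1 E2 Y F : Type*} [Ring B] [AddCommGroup E1] [AddCommGroup E2] [AddCommGroup Y] [AddCommGroup F]
    [Module B E1] [Module B E2] [Module B Y] [Module B F] [Module.Projective B E1] [Module.Projective B E2]
    [Module.Projective B F] (i : E2 →ₗ[B] E1) (p : E1 →ₗ[B] Y) (hi : Function.Injective i)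
    (hp : Function.Surjective p) (hex : LinearMap.ker p = LinearMap.range i) (g : F →ₗ[B] Y) (hg : Function.Surjective g) :
    Module.Projective B (LinearMap.ker g) := by
  obtain ⟨s, hs⟩ := Module.projective_lifting_property p g hp
  obtain ⟨u, hu⟩ := Module.projective_lifting_property g p hg
  have hs' : ∀ f, p (s f) = g f := fun f => LinearMap.congr_fun hs f
  have hu' : ∀ f, g (u f) = p f := fun f => LinearMap.congr_fun hu f
  have hpi : ∀ e, p (i e) = 0 := fun e => by
    have : i e ∈ LinearMap.ker p := by rw [hex]; exact ⟨e, rfl⟩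
    exact this
  let ie := LinearEquiv.ofInjective i hi
  have hmem : ∀ f : LinearMap.ker g, s f.1 ∈ LinearMap.range i := fun f => by
    rw [← hex, LinearMap.mem_ker, hs']; exact f.2
  let j : LinearMap.ker g →ₗ[B] E2 := ie.symm.toLinearMap ∘ₗ LinearMap.codRestrict (LinearMap.range i) (s ∘ₗ (LinearMap.ker g).subtype) hmem
  have hj : ∀ f, i (j f) = s f.1 := fun f => by
    have : ie (j f) = ⟨s f.1, hmem f⟩ := ie.apply_symm_apply _
    exact congrArg Subtype.val this
  let β : F × E2 →ₗ[B] LinearMap.ker g := LinearMap.codRestrict (LinearMap.ker g)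
    (LinearMap.fst B F E2 - u ∘ₗ (s ∘ₗ LinearMap.fst B F E2 + i ∘ₗ LinearMap.snd B F E2)) (by
      intro c
      simp [hu', hs', hpi])
  refine Module.Projective.of_split (((LinearMap.ker g).subtype).prod (-j)) β ?_
  ext f
  simp [β, hj]

/-- projective over `B` via restriction along a ring map -/
def ProjVia {B C : Type*} [Ring B] [Ring C] (f : B →+* C) (Y : Type w) [AddCommGroup Y] [Module C Y] : Prop :=
  @Module.Projective B _ Y _ (Module.compHom Y f)

/-- all `d`-th `C`-syzygies of `Y` are `B`-projective -/
def PDm {B C : Type*} [Ring B] [Ring C] (f : B →+* C) : ℕ → ∀ (Y : Type w) [AddCommGroup Y] [Module C Y], Prop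
  | 0, Y, _, _ => ProjVia f Y
  | d+1, Y, _, _ => ∀ (F : Type w) [AddCommGroup F] [Module C F] (_ : Module.Projective C F) (g : F →ₗ[C] Y),
      Function.Surjective g → PDm f d (LinearMap.ker g)

lemma projVia_of_projective {B C : Type*} [Ring B] [Ring C] (f : B →+* C) (hC : ProjVia f C) (Y : Type w) [AddCommGroup Y] [Module C Y]
    (hY : Module.Projective C Y) : ProjVia f Y := by
  unfold ProjVia at *
  let _ : Module B Y := Module.compHom Y f
  let _ : Module B C := Module.compHom C f
  obtain ⟨s, hs⟩ := Module.projective_def'.1 hY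
  let s' : Y →ₗ[B] (Y →₀ C) := { toFun := s, map_add' := s.map_add, map_smul' := fun b y =>
    (by
      change s (f b • y) = _
      rw [s.map_smul]; ext z; simp; rfl) }
  let r := Finsupp.linearCombination C (id : Y → Y)
  let r' : (Y →₀ C) →ₗ[B] Y := { toFun := r, map_add' := r.map_add, map_smul' := fun b y => (by
    have : b • y = f b • y := by ext z; simp; rfl
    rw [this, r.map_smul]; rfl) }
  have : Module.Projective B C := hC
  have : Module.Projective B (Y →₀ C) := Module.Projective.of_equiv (finsuppLequivDFinsupp B).symm
  refine Module.Projective.of_split s' r' ?_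
  ext y
  exact LinearMap.congr_fun hs y

lemma PDm_mono_hom {A' B C : Type*} [Ring A'] [Ring B] [Ring C] (f : A' →+* B) (h : B →+* C) (hC : ProjVia h C) :
    ∀ (d : ℕ) (Y : Type w) [AddCommGroup Y] [Module C Y], (@PDm _ _ _ _ f d Y _ (Module.compHom Y h)) → PDm (h.comp f) d Y
  | 0, Y, _, _, hY => hY
  | d+1, Y, _, _, hY => by
    intro F _ _ hF g hg
    refine PDm_mono_hom f h hC d _ ?_
    let _ : Module B Y := Module.compHom Y h
    let _ : Module B F := Module.compHom F h
    let g' : F →ₗ[B] Y := { toFun := g, map_add' := g.map_add, map_smul' := fun b y => g.map_smul (h b) y }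
    exact hY F (projVia_of_projective h hC F hF) g' hg

lemma PDm_step {B C D : Type*} [Ring B] [Ring C] [Ring D] (f : B →+* D) (h : C →+* D)
    (hstep : ∀ (Y : Type w) [AddCommGroup Y] [Module D Y], ProjVia f Y → PDm h 1 Y) :
    ∀ (d : ℕ) (Y : Type w) [AddCommGroup Y] [Module D Y], PDm f d Y → PDm h (d+1) Y
  | 0, Y, _, _, hY => hstep Y hY
  | d+1, Y, _, _, hY => fun F _ _ hF g hg => PDm_step f h hstep d _ (hY F hF g hg)

lemma PDm_step0 {B C D : Type*} [Ring B] [Ring C] [Ring D] (f : B →+* D) (h : C →+* D)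
    (hstep : ∀ (Y : Type w) [AddCommGroup Y] [Module D Y], ProjVia f Y → ProjVia h Y) :
    ∀ (d : ℕ) (Y : Type w) [AddCommGroup Y] [Module D Y], PDm f d Y → PDm h d Y
  | 0, Y, _, _, hY => hstep Y hY
  | d+1, Y, _, _, hY => fun F _ _ hF g hg => PDm_step0 f h hstep d _ (hY F hF g hg)

open Polynomial in
/-- universal property of `PolynomialModule` -/
noncomputable def pmLift {B : Type*} [CommRing B] {Y Q : Type*} [AddCommGroup Y] [Module B Y] [AddCommGroup Q] [Module B Q] [Module B[X] Q]
    [IsScalarTower B B[X] Q] (h : Y →ₗ[B] Q) : PolynomialModule B Y →ₗ[B[X]] Q :=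
  let T : PolynomialModule B Y →+ Q := (Finsupp.liftAddHom (fun n : ℕ =>
      ((DistribSMul.toAddMonoidHom Q ((X : B[X])^n)).comp h.toAddMonoidHom))).comp (PolynomialModule.coeffAddEquiv (R := B) (M := Y)).toAddMonoidHom
  have hT : ∀ n y, T (PolynomialModule.single B n y) = (X : B[X])^n • h y := fun n y => by
    change (Finsupp.liftAddHom _) (Finsupp.single n y) = _
    rw [Finsupp.liftAddHom_apply_single]; rfl
  { toFun := T, map_add' := T.map_add, map_smul' := fun f m => (by
      induction f using Polynomial.induction_on' with
      | add p q hp hq => rw [add_smul, map_add, hp, hq, RingHom.id_apply, RingHom.id_apply, RingHom.id_apply, add_smul]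
      | monomial i r =>
        induction m using PolynomialModule.induction_linear with
        | zero => simp
        | add p q hp hq => rw [smul_add, map_add, hp, hq, map_add, smul_add]
        | single j m =>
          rw [PolynomialModule.monomial_smul_single, hT, hT, h.map_smul, RingHom.id_apply, smul_smul, ← C_mul_X_pow_eq_monomial,
            mul_assoc, ← pow_add, mul_smul]
          have e : ∀ q : Q, C r • q = r • q := fun q => by
            conv_rhs => rw [← one_smul B[X] q, ← smul_assoc, Polynomial.smul_eq_C_mul, mul_one]
          rw [← e, smul_smul, smul_smul, mul_comm]) }
open Polynomial in
lemma pmLift_single {B : Type*} [CommRing B] {Y Q : Type*} [AddCommGroup Y] [Module B Y] [AddCommGroup Q] [Module B Q] [Module B[X] Q]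
    [IsScalarTower B B[X] Q] (h : Y →ₗ[B] Q) (n : ℕ) (y : Y) :
    pmLift h (PolynomialModule.single B n y) = (X : B[X])^n • h y := by
  change (Finsupp.liftAddHom _) (Finsupp.single n y) = _
  rw [Finsupp.liftAddHom_apply_single]; rfl

open Polynomial in
lemma pm_projective {B : Type*} [CommRing B] {Y : Type*} [AddCommGroup Y] [Module B Y] [Module.Projective B Y] :
    Module.Projective B[X] (PolynomialModule B Y) := by
  refine Module.Projective.of_lifting_property'' (fun f hf => ?_)
  let f' : (PolynomialModule B Y →₀ B[X]) →ₗ[B] PolynomialModule B Y := f.restrictScalars B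
  obtain ⟨h, hh⟩ := Module.projective_lifting_property f' (PolynomialModule.lsingle B 0) hf
  refine ⟨pmLift h, ?_⟩
  ext z : 1
  induction z using PolynomialModule.induction_linear with
  | zero => simp
  | add p q hp hq => rw [map_add, hp, hq, map_add]
  | single j m =>
    rw [LinearMap.comp_apply, pmLift_single, f.map_smul]
    have : f (h m) = PolynomialModule.single B 0 m := LinearMap.congr_fun hh m
    rw [this, ← monomial_one_right_eq_X_pow, PolynomialModule.monomial_smul_single]
    simp

/-- step for polynomial rings -/
lemma poly_step {B : Type*} [CommRing B] (Y : Type w) [AddCommGroup Y] [Module (Polynomial B) Y]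
    (hY : ProjVia (Polynomial.C : B →+* Polynomial B) Y) : PDm (RingHom.id (Polynomial B)) 1 Y := by
  intro F _ _ hF g hg
  let _ : Module B Y := Module.compHom Y Polynomial.C
  have hY' : Module.Projective B Y := hY
  have hst : IsScalarTower B (Polynomial B) Y := ⟨fun b p y => by
    change _ = Polynomial.C b • p • y
    rw [smul_smul, Polynomial.smul_eq_C_mul]⟩
  change Module.Projective (Polynomial B) _
  have hX : ∀ (b : B) (y : Y), (Polynomial.X : Polynomial B) • b • y = b • (Polynomial.X : Polynomial B) • y := fun b y => by
    change _ • Polynomial.C b • y = Polynomial.C b • _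
    rw [smul_smul, smul_smul, mul_comm]
  let x : Y →ₗ[B] Y := { toFun := fun y => (Polynomial.X : Polynomial B) • y, map_add' := smul_add _, map_smul' := hX }
  let i : PolynomialModule B Y →ₗ[Polynomial B] PolynomialModule B Y :=
    pmLift (PolynomialModule.lsingle B 1 - (PolynomialModule.lsingle B 0) ∘ₗ x)
  let p : PolynomialModule B Y →ₗ[Polynomial B] Y := pmLift LinearMap.id
  have hi : ∀ n y, i (PolynomialModule.single B n y) = PolynomialModule.single B (n+1) y - PolynomialModule.single B n (x y) := by
    intro n y
    simp only [i]
    rw [pmLift_single, LinearMap.sub_apply, smul_sub, ← Polynomial.monomial_one_right_eq_X_pow]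
    change _ • PolynomialModule.single B 1 y - _ • PolynomialModule.single B 0 (x y) = _
    rw [PolynomialModule.monomial_smul_single, PolynomialModule.monomial_smul_single]
    simp
  have hp : ∀ n y, p (PolynomialModule.single B n y) = (Polynomial.X : Polynomial B)^n • y := fun n y => pmLift_single _ _ _
  have := pm_projective (B := B) (Y := Y)
  have hc : ∀ z n, (i z).coeff (n+1) = z.coeff n - x (z.coeff (n+1)) := by
    intro z n
    induction z using PolynomialModule.induction_linear with
    | zero => simp
    | add p q hp hq =>
      rw [i.map_add, PolynomialModule.coeff_add, Finsupp.add_apply, hp, hq, PolynomialModule.coeff_add, Finsupp.add_apply, Finsupp.add_apply, x.map_add]; abel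
    | single j m =>
      rw [hi]
      change (Finsupp.single (j+1) m - Finsupp.single j (x m) : ℕ →₀ Y) (n+1) = (Finsupp.single j m : ℕ →₀ Y) n - x ((Finsupp.single j m : ℕ →₀ Y) (n+1))
      simp only [Finsupp.sub_apply, Finsupp.single_apply]
      by_cases h : j = n + 1
      · subst h; simp
      · by_cases h' : j = n
        · subst h'; simp
        · simp [h, h']
  have hpi : ∀ z, p (i z) = 0 := by
    intro z
    induction z using PolynomialModule.induction_linear with
    | zero => simp
    | add p q hp hq => rw [map_add, map_add, hp, hq, add_zero]
    | single j m =>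
      rw [hi, map_sub, hp, hp]
      change _ - _ • (Polynomial.X : Polynomial B) • m = 0
      rw [smul_smul, ← pow_succ, sub_self]
  have hmem : ∀ z, z - PolynomialModule.single B 0 (p z) ∈ LinearMap.range i := by
    intro z
    induction z using PolynomialModule.induction_linear with
    | zero => simp
    | add u v hu hv =>
      have := add_mem hu hv
      rw [map_add, PolynomialModule.single_add]
      convert this using 1; abel
    | single j m =>
      induction j generalizing m with
      | zero => rw [hp]; simp
      | succ j ih =>
        have h1 := ih (x m)
        have h2 : i (PolynomialModule.single B j m) ∈ LinearMap.range i := ⟨_, rfl⟩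
        rw [hi] at h2
        have := add_mem h1 h2
        rw [hp] at this ⊢
        change _ - PolynomialModule.single B 0 (_ • (Polynomial.X : Polynomial B) • m) + _ ∈ _ at this
        rw [smul_smul, ← pow_succ] at this
        convert this using 1; abel
  refine schanuel i p ?_ ?_ ?_ g hg
  · rw [← LinearMap.ker_eq_bot, LinearMap.ker_eq_bot']
    intro z hz
    have h1 : ∀ n, z.coeff n = x (z.coeff (n+1)) := fun n => by
      have := hc z n
      rw [hz] at this
      exact (sub_eq_zero.1 this.symm)
    have h2 : ∀ m n, (∀ j ≥ n + m, z.coeff j = 0) → z.coeff n = 0 := by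
      intro m
      induction m with
      | zero => exact fun n h => h n (by simp)
      | succ m ih =>
        intro n h
        rw [h1, ih (n+1) (fun j hj => h j (by omega)), map_zero]
    rw [← PolynomialModule.coeff_eq_zero]
    ext n
    refine h2 (z.coeff.support.sup id + 1) n (fun j hj => ?_)
    by_contra hne
    have := Finset.le_sup (f := id) (Finsupp.mem_support_iff.2 hne)
    simp only [id] at this
    omega
  · intro y
    exact ⟨PolynomialModule.single B 0 y, by rw [hp]; simp⟩
  · ext z
    constructor
    · intro hz
      have := hmem z
      rw [LinearMap.mem_ker.1 hz] at this
      simpa using this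
    · rintro ⟨y, rfl⟩
      exact hpi y

lemma projVia_equiv {B C : Type*} [Ring B] [Ring C] (e : B ≃+* C) : ProjVia (e : B →+* C) C := by
  unfold ProjVia
  let _ : Module B C := Module.compHom C (e : B →+* C)
  let l : B ≃ₗ[B] C := { e.toAddEquiv with map_smul' := fun b y => e.map_mul b y }
  exact Module.Projective.of_equiv l

lemma PDm_transport {B C : Type*} [Ring B] [Ring C] (e : B ≃+* C) (d : ℕ)
    (h : ∀ (Y : Type w) [AddCommGroup Y] [Module B Y], PDm (RingHom.id B) d Y) :
    ∀ (Y : Type w) [AddCommGroup Y] [Module C Y], PDm (RingHom.id C) d Y := by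
  intro Y _ mC
  refine PDm_step0 ((e : B →+* C).comp (RingHom.id B)) (RingHom.id C) ?_ d Y
    (PDm_mono_hom (RingHom.id B) (e : B →+* C) (projVia_equiv e) d Y (@h Y _ (Module.compHom Y (e : B →+* C))))
  intro Y _ mC hY
  have h1 := @projVia_of_projective C B _ _ (e.symm : C →+* B) (projVia_equiv e.symm) Y _ (Module.compHom Y (e : B →+* C)) hY
  unfold ProjVia at h1 ⊢
  convert h1 using 1
  refine Module.ext' _ _ (fun c y => ?_)
  change c • y = e (e.symm c) • y
  rw [e.apply_symm_apply]

lemma projVia_C {B : Type*} [CommRing B] : ProjVia (Polynomial.C : B →+* Polynomial B) (Polynomial B) := by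
  have h : Module.compHom (Polynomial B) (Polynomial.C : B →+* Polynomial B) = (inferInstance : Module B (Polynomial B)) := by
    refine Module.ext' _ _ (fun c y => ?_)
    exact (Polynomial.smul_eq_C_mul c).symm
  unfold ProjVia
  rw [h]
  infer_instance

/-- finite global dimension -/
lemma gl_mv (k : Type*) [Field k] : ∀ (n : ℕ) (Y : Type w) [AddCommGroup Y] [Module (MvPolynomial (Fin n) k) Y],
    PDm (RingHom.id (MvPolynomial (Fin n) k)) n Y
  | 0 => PDm_transport (MvPolynomial.isEmptyRingEquiv k (Fin 0)).symm 0 (fun Y _ _ => by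
      change @Module.Projective k _ Y _ (Module.compHom Y _)
      infer_instance)
  | n+1 => PDm_transport (MvPolynomial.finSuccEquiv k n).symm.toRingEquiv (n+1) (fun Y _ _ => by
      have h1 := PDm_mono_hom (RingHom.id (MvPolynomial (Fin n) k)) (Polynomial.C : _ →+* Polynomial (MvPolynomial (Fin n) k)) (by
        exact projVia_C) n Y (@gl_mv k _ n Y _ (Module.compHom Y _))
      exact PDm_step _ _ (fun Y _ _ hY => poly_step Y hY) n Y h1)
end GW

namespace GW
open Classical

/-- rank additivity over a noetherian domain -/
lemma rank_add_aux {B Y : Type*} [Ring B] [IsDomain B] [StrongRankCondition B] [AddCommGroup Y] [Module B Y]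
    (Z : Submodule B Y) {a b : ℕ} (v : Fin a → Y) (w : Fin b → Y)
    (hv : ∀ y ∈ Z, ∃ c : B, c ≠ 0 ∧ c • y ∈ Submodule.span B (Set.range v))
    (hw : ∀ y, ∃ c : B, c ≠ 0 ∧ ∃ z ∈ Submodule.span B (Set.range w), c • y - z ∈ Z) {m : ℕ} (y : Fin m → Y)
    (hy : LinearIndependent B y) : m ≤ a + b := by
  have h1 : ∀ y, ∃ c : B, c ≠ 0 ∧ c • y ∈ Submodule.span B (Set.range (Sum.elim v w)) := by
    intro y
    obtain ⟨c, hc, z, hz, hcz⟩ := hw y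
    obtain ⟨d, hd, hdz⟩ := hv _ hcz
    refine ⟨d * c, mul_ne_zero hd hc, ?_⟩
    rw [Set.Sum.elim_range, Submodule.span_union]
    rw [smul_sub, smul_smul] at hdz
    have := Submodule.add_mem_sup hdz (Submodule.smul_mem _ d hz)
    simpa using this
  choose c hc hcs using fun i => h1 (y i)
  have h2 : LinearIndependent B (fun i => c i • y i) := by
    rw [Fintype.linearIndependent_iff] at hy ⊢
    intro g hg i
    have := hy (fun i => g i * c i) (by simpa [mul_smul] using hg) i
    exact (mul_eq_zero.1 this).resolve_right (hc i)
  have h3 := linearIndependent_le_span_aux' (R := B) (fun i => c i • y i) h2 (Set.range (Sum.elim v w))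
    (by rintro _ ⟨i, rfl⟩; exact hcs i)
  simp only [Fintype.card_fin] at h3
  refine h3.trans ?_
  have := Fintype.card_range_le (Sum.elim v w)
  simpa using this

lemma exists_max_indep (B : Type*) (Y : Type*) [Ring B] [IsDomain B] [StrongRankCondition B] [AddCommGroup Y] [Module B Y]
    [Module.Finite B Y] : ∃ v : Fin (Module.finrank B Y) → Y, LinearIndependent B v ∧
      ∀ y, ∃ c : B, c ≠ 0 ∧ c • y ∈ Submodule.span B (Set.range v) := by
  obtain ⟨v, hv⟩ : ∃ v : Fin (Module.finrank B Y) → Y, LinearIndependent B v := by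
    have h := Module.finrank_eq_rank B Y
    obtain ⟨s, hs, hs'⟩ := Module.le_rank_iff_exists_finset.1 h.le
    exact ⟨fun i => ((s.equivFinOfCardEq hs).symm i : Y), LinearIndependent.comp hs' _ (s.equivFinOfCardEq hs).symm.injective⟩
  refine ⟨v, hv, fun y => ?_⟩
  by_contra! hcon
  have : LinearIndependent B (Fin.cons y v : Fin (Module.finrank B Y + 1) → Y) := by
    rw [Fintype.linearIndependent_iff] at hv ⊢
    intro g hg
    rw [Fin.sum_univ_succ] at hg
    simp only [Fin.cons_zero, Fin.cons_succ] at hg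
    have h0 : g 0 = 0 := by
      by_contra h0
      apply hcon _ h0
      rw [eq_neg_of_add_eq_zero_left hg]
      exact neg_mem (sum_mem fun i _ => Submodule.smul_mem _ _ (Submodule.subset_span ⟨i, rfl⟩))
    rw [h0, zero_smul, zero_add] at hg
    have := hv _ hg
    intro i
    refine Fin.cases h0 this i
  have := this.fintype_card_le_finrank
  simp at this

lemma rank_add {B Y : Type*} [Ring B] [IsDomain B] [IsNoetherianRing B] [AddCommGroup Y] [Module B Y]
    [Module.Finite B Y] (Z : Submodule B Y) : Module.finrank B (Y ⧸ Z) + Module.finrank B Z = Module.finrank B Y := by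
  apply le_antisymm
  · have h := rank_quotient_add_rank_le Z
    rw [← Module.finrank_eq_rank, ← Module.finrank_eq_rank, ← Module.finrank_eq_rank] at h
    exact_mod_cast h
  · obtain ⟨v, -, hv⟩ := exists_max_indep B Z
    obtain ⟨w, -, hw⟩ := exists_max_indep B (Y ⧸ Z)
    obtain ⟨y, hy, -⟩ := exists_max_indep B Y
    choose w' hw' using fun i => Z.mkQ_surjective (w i)
    rw [add_comm]
    refine rank_add_aux Z (fun i => (v i : Y)) w' ?_ ?_ y hy
    · intro y hy
      obtain ⟨c, hc, hcy⟩ := hv ⟨y, hy⟩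
      refine ⟨c, hc, ?_⟩
      have := Submodule.mem_map_of_mem (f := Z.subtype) hcy
      rw [Submodule.map_span, ← Set.range_comp] at this
      exact this
    · intro y
      obtain ⟨c, hc, hcy⟩ := hw (Z.mkQ y)
      refine ⟨c, hc, ?_⟩
      have e : w = Z.mkQ ∘ w' := by ext i; exact (hw' i).symm
      rw [e, Set.range_comp, ← Submodule.map_span] at hcy
      obtain ⟨z, hz, hzy⟩ := hcy
      refine ⟨z, hz, ?_⟩
      rw [← map_smul] at hzy
      rw [← Submodule.Quotient.eq]; exact hzy.symm

/-- Strebel's class `D` -/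
def StrD {B k : Type*} [Ring B] [Field k] (ε : B →+* k) : Prop :=
  ∀ (I J : Type) [Fintype I] [Fintype J] (v : I → J → B), LinearIndependent k (fun i j => ε (v i j)) →
    ∀ c : I → B, (∀ j, ∑ i, c i * v i j = 0) → c = 0

lemma StrD_comm {B k : Type*} [CommRing B] [IsDomain B] [Field k] (ε : B →+* k) (hε : Function.Surjective ε) : StrD ε := by
  intro I J _ _ v hv c hc
  let L := Fintype.linearCombination k (fun i j => ε (v i j))
  have hL : LinearMap.ker L = ⊥ := by
    rw [LinearMap.ker_eq_bot']
    intro m hm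
    rw [Fintype.linearIndependent_iff] at hv
    ext i; exact hv m hm i
  obtain ⟨g, hg⟩ := LinearMap.exists_leftInverse_of_injective L hL
  choose W hW using fun (j : J) (i : I) => hε (g (Pi.single j 1) i)
  let M : Matrix I I B := Matrix.of fun i i' => ∑ j, v i j * W j i'
  have hM : ε.mapMatrix M = 1 := by
    ext i i'
    have h1 : g (L (Pi.single i 1)) i' = (Pi.single i (1:k) : I → k) i' := by
      have := LinearMap.congr_fun hg (Pi.single i 1)
      rw [← LinearMap.comp_apply, this]; rfl
    have h2 : L (Pi.single i 1) = ∑ j, ε (v i j) • (Pi.single j (1:k) : J → k) := by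
      have : L (Pi.single i 1) = fun j => ε (v i j) := by
        simp [L, Fintype.linearCombination_apply, Pi.single_apply]
      rw [this]
      exact pi_eq_sum_univ' _
    rw [h2, map_sum, Finset.sum_apply] at h1
    simp only [M, RingHom.mapMatrix_apply, Matrix.map_apply, Matrix.of_apply, map_sum, map_mul, hW]
    simp only [map_smul, Pi.smul_apply, smul_eq_mul] at h1
    rw [h1, Matrix.one_apply, Pi.single_apply]
    simp [eq_comm]
  have hdet : M.det ≠ 0 := by
    intro h
    have := RingHom.map_det ε M
    rw [hM, h] at this
    simp at this
  apply Matrix.eq_zero_of_vecMul_eq_zero hdet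
  ext i'
  simp only [Matrix.vecMul, dotProduct, M, Matrix.of_apply, Pi.zero_apply, Finset.mul_sum]
  rw [Finset.sum_comm]
  refine Finset.sum_eq_zero fun j _ => ?_
  simp only [← mul_assoc]
  rw [← Finset.sum_mul, hc, zero_mul]
end GW

namespace GW
open Classical

/-- `x` is of the form `∑_{i<n} t^i b_i` -/
def GG {A : Type*} [Ring A] (B : Subring A) (t : Aˣ) : ℕ → A → Prop
  | 0, x => x = 0
  | n+1, x => ∃ b ∈ B, GG B t n (x - (t:A)^n * b)

/-- `B'` is a skew Laurent extension of `B` -/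
structure IsLau {A : Type*} [Ring A] (B B' : Subring A) (t : Aˣ) : Prop where
  conj : ∀ b ∈ B, (t:A) * b * (↑t⁻¹ : A) ∈ B
  conj' : ∀ b ∈ B, (↑t⁻¹ : A) * b * (t:A) ∈ B
  le : B ≤ B'
  t_mem : (t:A) ∈ B'
  tinv_mem : (↑t⁻¹:A) ∈ B'
  span : ∀ x ∈ B', ∃ m n : ℕ, GG B t n ((t:A)^m * x)
  indep : ∀ n : ℕ, ∀ b ∈ B, GG B t n ((t:A)^n * b) → b = 0

section
variable {A : Type*} [Ring A] {B B' : Subring A} {t : Aˣ}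

lemma GG.zero : ∀ n, GG B t n 0
  | 0 => rfl
  | n+1 => ⟨0, B.zero_mem, by simpa using GG.zero n⟩

lemma GG.add : ∀ (n : ℕ) {x y : A}, GG B t n x → GG B t n y → GG B t n (x+y)
  | 0, x, y, hx, hy => by rw [GG] at *; rw [hx, hy, add_zero]
  | n+1, x, y, ⟨b, hb, h1⟩, ⟨c, hc, h2⟩ => ⟨b+c, B.add_mem hb hc, by
      have := GG.add n h1 h2
      convert this using 1; rw [mul_add]; abel⟩

lemma GG.neg : ∀ (n : ℕ) {x : A}, GG B t n x → GG B t n (-x)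
  | 0, x, hx => by rw [GG] at *; rw [hx, neg_zero]
  | n+1, x, ⟨b, hb, h1⟩ => ⟨-b, B.neg_mem hb, by
      have := GG.neg n h1
      convert this using 1; rw [mul_neg]; abel⟩

lemma GG.sub (n : ℕ) {x y : A} (hx : GG B t n x) (hy : GG B t n y) : GG B t n (x-y) := by
  rw [sub_eq_add_neg]; exact hx.add n (hy.neg n)

lemma GG.mono {n : ℕ} {x : A} (hx : GG B t n x) : ∀ {m : ℕ}, n ≤ m → GG B t m x := by
  intro m h
  induction h with
  | refl => exact hx
  | step _ ih => exact ⟨0, B.zero_mem, by simpa using ih⟩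

lemma GG.monom (n : ℕ) {b : A} (hb : b ∈ B) : GG B t (n+1) ((t:A)^n * b) := ⟨b, hb, by rw [sub_self]; exact GG.zero n⟩

lemma IsLau.conj_pow (h : IsLau B B' t) (n : ℕ) : ∀ b ∈ B, ∃ c ∈ B, (t:A)^n * b = c * (t:A)^n := by
  induction n with
  | zero => intro b hb; exact ⟨b, hb, by simp⟩
  | succ n ih =>
    intro b hb
    obtain ⟨c, hc, e⟩ := ih b hb
    refine ⟨_, h.conj c hc, ?_⟩
    rw [pow_succ', mul_assoc, e, mul_assoc, mul_assoc, ← mul_assoc (↑t⁻¹ : A), Units.inv_mul, one_mul]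

lemma IsLau.conj_pow' (h : IsLau B B' t) (n : ℕ) : ∀ b ∈ B, ∃ c ∈ B, b * (t:A)^n = (t:A)^n * c := by
  induction n with
  | zero => intro b hb; exact ⟨b, hb, by simp⟩
  | succ n ih =>
    intro b hb
    obtain ⟨c, hc, e⟩ := ih b hb
    refine ⟨_, h.conj' c hc, ?_⟩
    rw [pow_succ, ← mul_assoc, e, mul_assoc, mul_assoc, mul_assoc, ← mul_assoc (t:A) (↑t⁻¹ : A), Units.mul_inv, one_mul]

lemma IsLau.GG_smul (h : IsLau B B' t) {c : A} (hc : c ∈ B) : ∀ (n : ℕ) {x : A}, GG B t n x → GG B t n (c*x)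
  | 0, x, hx => by rw [GG] at *; rw [hx, mul_zero]
  | n+1, x, ⟨b, hb, h1⟩ => by
    obtain ⟨c', hc', e⟩ := h.conj_pow' n c hc
    refine ⟨c' * b, B.mul_mem hc' hb, ?_⟩
    have := h.GG_smul hc n h1
    rwa [mul_sub, ← mul_assoc, e, mul_assoc] at this

lemma IsLau.GG_smul_right (h : IsLau B B' t) {c : A} (hc : c ∈ B) : ∀ (n : ℕ) {x : A}, GG B t n x → GG B t n (x*c)
  | 0, x, hx => by rw [GG] at *; rw [hx, zero_mul]
  | n+1, x, ⟨b, hb, h1⟩ => by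
    refine ⟨b * c, B.mul_mem hb hc, ?_⟩
    have := h.GG_smul_right hc n h1
    rwa [sub_mul, mul_assoc] at this

lemma GG.tmul : ∀ (n : ℕ) {x : A}, GG B t n x → GG B t (n+1) ((t:A)*x)
  | 0, x, hx => by rw [GG] at hx; rw [hx, mul_zero]; exact GG.zero _
  | n+1, x, ⟨b, hb, h1⟩ => ⟨b, hb, by
    have := GG.tmul n h1
    rwa [mul_sub, ← mul_assoc, ← pow_succ'] at this⟩

lemma GG.tpow (n : ℕ) {x : A} (hx : GG B t n x) : ∀ m, GG B t (n+m) ((t:A)^m*x)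
  | 0 => by simpa using hx
  | m+1 => by rw [pow_succ', mul_assoc]; exact (GG.tpow n hx m).tmul

lemma IsLau.GG_mulT (h : IsLau B B' t) : ∀ (n : ℕ) {x : A}, GG B t n x → GG B t (n+1) (x * (t:A))
  | 0, x, hx => by rw [GG] at hx; rw [hx, zero_mul]; exact GG.zero _
  | n+1, x, ⟨b, hb, h1⟩ => by
    refine ⟨_, h.conj' b hb, ?_⟩
    have := h.GG_mulT n h1
    convert this using 1
    rw [sub_mul, pow_succ, mul_assoc, mul_assoc, mul_assoc, ← mul_assoc (t:A) (↑t⁻¹ : A), Units.mul_inv, one_mul]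

lemma IsLau.GG_tpow_right (h : IsLau B B' t) (n : ℕ) {x : A} (hx : GG B t n x) : ∀ m, GG B t (n+m) (x*(t:A)^m)
  | 0 => by simpa using hx
  | m+1 => by rw [pow_succ, ← mul_assoc]; exact h.GG_mulT _ (h.GG_tpow_right n hx m)

/-- products -/
lemma IsLau.GG_mul (h : IsLau B B' t) (n m : ℕ) {x y : A} (hx : GG B t n x) : ∀ {y : A}, GG B t (m+1) y → GG B t (n+m) (x*y) := by
  induction m with
  | zero =>
    rintro y ⟨b, hb, h1⟩
    rw [GG] at h1
    rw [pow_zero, one_mul, sub_eq_zero] at h1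
    rw [h1]; exact h.GG_smul_right hb n hx
  | succ m ih =>
    rintro y ⟨b, hb, h1⟩
    have h2 := (ih h1).mono (Nat.le_succ _)
    have h3 := h.GG_smul_right hb _ (h.GG_tpow_right n hx (m+1))
    have := GG.add _ h2 h3
    have e : x*y = x*(y - t^(m+1)*b) + x*t^(m+1)*b := by rw [mul_sub, mul_assoc]; abel
    rw [e]; exact this

lemma IsLau.GG_mul' (h : IsLau B B' t) (n m : ℕ) {x y : A} (hx : GG B t (n+1) x) (hy : GG B t m y) : GG B t (n+m) (x*y) := by
  rcases m with _ | m
  · rw [GG] at hy; rw [hy, mul_zero]; exact GG.zero _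
  · have := h.GG_mul (n+1) m (y := y) hx hy
    rwa [show n+1+m = n+(m+1) by ring] at this

lemma IsLau.exists_lead (h : IsLau B B' t) {x : A} (hx : x ∈ B') (h0 : x ≠ 0) :
    ∃ m n : ℕ, ∃ b ∈ B, b ≠ 0 ∧ GG B t n ((t:A)^m * x - (t:A)^n * b) := by
  obtain ⟨m, n, hn⟩ := h.span x hx
  have hex : ∃ n, GG B t n ((t:A)^m * x) := ⟨n, hn⟩
  have hne : (t:A)^m * x ≠ 0 := by
    intro hh
    apply h0
    rw [← Units.val_pow_eq_pow_val, Units.mul_right_eq_zero] at hh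
    exact hh
  have hs := Nat.find_spec hex
  rcases hf : Nat.find hex with _ | n
  · rw [hf, GG] at hs; exact (hne hs).elim
  · rw [hf] at hs
    obtain ⟨b, hb, h1⟩ := hs
    refine ⟨m, n, b, hb, ?_, h1⟩
    rintro rfl
    rw [mul_zero, sub_zero] at h1
    exact Nat.find_min hex (by rw [hf]; exact Nat.lt_succ_self n) h1

lemma IsLau.noZeroDivisors (h : IsLau B B' t) (hB : ∀ x ∈ B, ∀ y ∈ B, x * y = 0 → x = 0 ∨ y = 0) :
    ∀ x ∈ B', ∀ y ∈ B', x * y = 0 → x = 0 ∨ y = 0 := by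
  intro x hx y hy hxy
  by_contra! hcon
  obtain ⟨m', n', c, hc, hc0, hv⟩ := h.exists_lead hy hcon.2
  have hx' : x * (↑(t^m')⁻¹ : A) ∈ B' := by
    refine B'.mul_mem hx ?_
    rw [← inv_pow, Units.val_pow_eq_pow_val]; exact pow_mem h.tinv_mem m'
  have hx0 : x * (↑(t^m')⁻¹ : A) ≠ 0 := fun hh => hcon.1 ((Units.mul_left_eq_zero _).1 hh)
  obtain ⟨m, n, b, hb, hb0, hu⟩ := h.exists_lead hx' hx0
  set X := (t:A)^m * (x * (↑(t^m')⁻¹ : A)) with hX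
  set Y := (t:A)^m' * y with hY
  have hXY : X * Y = 0 := by
    rw [hX, hY, ← Units.val_pow_eq_pow_val t m', mul_assoc, mul_assoc, ← mul_assoc (↑(t^m')⁻¹ : A), Units.inv_mul, one_mul, hxy, mul_zero]
  obtain ⟨b', hb', e⟩ := h.conj_pow' n' b hb
  have hYG : GG B t (n'+1) Y := ⟨c, hc, hv⟩
  have h1 := h.GG_mul n n' (y := Y) hu hYG
  have h2 := h.GG_mul' n n' (GG.monom n hb) hv
  have h3 := GG.neg _ (GG.add _ h1 h2)
  have e2 : -((X - (t:A)^n*b)*Y + (t:A)^n*b*(Y - (t:A)^n' * c)) = (t:A)^(n+n') * (b'*c) := by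
    have : (t:A)^n*b*((t:A)^n'*c) = (t:A)^(n+n') * (b'*c) := by
      rw [mul_assoc, ← mul_assoc b, e, pow_add]; simp only [mul_assoc]
    rw [← this, sub_mul, mul_sub, hXY]; abel
  rw [e2] at h3
  rcases hB _ hb' _ hc (h.indep _ _ (B.mul_mem hb' hc) h3) with h4 | h4
  · rw [h4, mul_zero, ← Units.val_pow_eq_pow_val, Units.mul_left_eq_zero] at e
    exact hb0 e
  · exact hc0 h4
end
end GW

namespace GW
open Classical

lemma acc_pair {P : Type*} [PartialOrder P] [WellFoundedGT P] (f : ℕ → ℕ → P)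
    (h1 : ∀ m n n', n ≤ n' → f m n ≤ f m n') (h2 : ∀ n m m', m ≤ m' → f m n ≤ f m' n) :
    ∃ M, ∀ m, M ≤ m → ∀ n, f m n = f M n := by
  have hs := (wellFoundedGT_iff_monotone_chain_condition (α := P)).1 inferInstance
  obtain ⟨M0, hM0⟩ := hs ⟨fun m => f m m, fun a b h => (h1 a a b h).trans (h2 b a b h)⟩
  have hs' : ∀ n, ∃ M, ∀ m, M ≤ m → f M n = f m n := fun n => by
    obtain ⟨M, hM⟩ := hs ⟨fun m => f m n, fun a b h => h2 n a b h⟩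
    exact ⟨M, hM⟩
  choose g hg using hs'
  have key : ∀ m n, M0 ≤ m → M0 ≤ n → f m n = f M0 M0 := by
    intro m n hm hn
    apply le_antisymm
    · have h3 : f m n ≤ f (max m n) (max m n) := (h1 m n _ (le_max_right _ _)).trans (h2 _ _ _ (le_max_left _ _))
      have h4 := hM0 (max m n) (hm.trans (le_max_left _ _))
      have h4 : f M0 M0 = f (max m n) (max m n) := h4
      rw [h4]; exact h3
    · exact (h1 _ _ _ hn).trans (h2 _ _ _ hm)
  refine ⟨max M0 ((Finset.range M0).sup g), fun m hm n => ?_⟩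
  by_cases hn : n < M0
  · have h5 : g n ≤ (Finset.range M0).sup g := Finset.le_sup (Finset.mem_range.2 hn)
    rw [← hg n m (h5.trans ((le_max_right _ _).trans hm)), ← hg n _ (h5.trans (le_max_right _ _))]
  · push Not at hn
    rw [key m n ((le_max_left _ _).trans hm) hn, key _ n (le_max_left _ _) hn]

section
variable {A : Type*} [Ring A] {B B' : Subring A} {t : Aˣ}

/-- leading coefficient ideals -/
def LdC (h : IsLau B B' t) (J : Ideal B') (n : ℕ) : Ideal B where
  carrier := {b | ∃ x : B', x ∈ J ∧ GG B t n ((x:A) - (t:A)^n * b)}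
  zero_mem' := ⟨0, J.zero_mem, by simpa using GG.zero n⟩
  add_mem' := (by
    rintro a b ⟨x, hx, h1⟩ ⟨y, hy, h2⟩
    refine ⟨x+y, J.add_mem hx hy, ?_⟩
    have := GG.add n h1 h2
    convert this using 1
    push_cast
    rw [mul_add]; abel)
  smul_mem' := (by
    rintro c b ⟨x, hx, h1⟩
    obtain ⟨c', hc', e⟩ := h.conj_pow n c c.2
    refine ⟨⟨c', h.le hc'⟩ * x, J.mul_mem_left _ hx, ?_⟩
    have := h.GG_smul hc' n h1
    convert this using 1
    rw [mul_sub, ← mul_assoc, ← e]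
    simp [mul_assoc])

lemma LdC_mono (h : IsLau B B' t) {J J' : Ideal B'} (hJ : J ≤ J') (n : ℕ) : LdC h J n ≤ LdC h J' n :=
  fun _ ⟨x, hx, h1⟩ => ⟨x, hJ hx, h1⟩

lemma LdC_succ (h : IsLau B B' t) (J : Ideal B') (n : ℕ) : LdC h J n ≤ LdC h J (n+1) := by
  rintro b ⟨x, hx, h1⟩
  refine ⟨⟨t, h.t_mem⟩ * x, J.mul_mem_left _ hx, ?_⟩
  have := GG.tmul n h1
  convert this using 1
  rw [mul_sub, ← mul_assoc, ← pow_succ']; rfl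

lemma LdC_eq (h : IsLau B B' t) {J J' : Ideal B'} (hJ : J ≤ J') (he : ∀ n, LdC h J n = LdC h J' n) : J = J' := by
  apply le_antisymm hJ
  have key : ∀ n : ℕ, ∀ x : B', x ∈ J' → GG B t n (x:A) → x ∈ J := by
    intro n
    induction n with
    | zero =>
      intro x _ h1
      rw [GG] at h1
      have : x = 0 := Subtype.ext h1
      rw [this]; exact J.zero_mem
    | succ n ih =>
      rintro x hx ⟨b, hb, h1⟩
      have hm : (⟨b, hb⟩ : B) ∈ LdC h J' n := ⟨x, hx, h1⟩
      rw [← he n] at hm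
      obtain ⟨y, hy, h2⟩ := hm
      have h3 : x - y ∈ J := by
        apply ih _ (J'.sub_mem hx (hJ hy))
        have := GG.sub n h1 h2
        convert this using 1
        push_cast; abel
      have := J.add_mem h3 hy
      rwa [sub_add_cancel] at this
  intro x hx
  obtain ⟨m, n, hn⟩ := h.span x x.2
  have h1 : (⟨t, h.t_mem⟩ : B')^m * x ∈ J := key n _ (J'.mul_mem_left _ hx) (by simpa using hn)
  have h2 := J.mul_mem_left ((⟨_, h.tinv_mem⟩ : B')^m) h1
  have e : (⟨_, h.tinv_mem⟩ : B')^m * ((⟨t, h.t_mem⟩ : B')^m * x) = x := by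
    apply Subtype.ext
    push_cast
    rw [← mul_assoc, ← Units.val_pow_eq_pow_val, ← Units.val_pow_eq_pow_val, ← Units.val_mul]
    simp
  rwa [e] at h2

lemma IsLau.noeth (h : IsLau B B' t) [IsNoetherianRing B] : IsNoetherianRing B' := by
  rw [isNoetherianRing_iff, ← monotone_stabilizes_iff_noetherian]
  intro f
  have : WellFoundedGT (Ideal B) := inferInstanceAs (WellFoundedGT (Submodule B B))
  obtain ⟨M, hM⟩ := acc_pair (fun m n => LdC h (f m) n)
    (fun m n n' hn => monotone_nat_of_le_succ (LdC_succ h (f m)) hn)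
    (fun n m m' hm => LdC_mono h (f.monotone hm) n)
  exact ⟨M, fun m hm => LdC_eq h (f.monotone hm) fun n => (hM m hm n).symm⟩

lemma IsLau.repr (h : IsLau B B' t) : ∀ (n : ℕ) {x : A}, GG B t n x → ∃ f : ℕ → B, x = ∑ a ∈ Finset.range n, (f a : A) * (t:A)^a
  | 0, x, hx => ⟨0, by simpa [GG] using hx⟩
  | n+1, x, ⟨b, hb, h1⟩ => by
    obtain ⟨f, hf⟩ := h.repr n h1
    obtain ⟨c, hc, e⟩ := h.conj_pow n b hb
    refine ⟨Function.update f n ⟨c, hc⟩, ?_⟩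
    rw [Finset.sum_range_succ, Function.update_self]
    rw [Finset.sum_congr rfl (g := fun a => (f a : A) * (t:A)^a), ← hf]
    · simp [e]
    · intro a ha
      rw [Function.update_of_ne (Finset.mem_range.1 ha).ne]

lemma IsLau.GG_sum (h : IsLau B B' t) (f : ℕ → B) (n : ℕ) : GG B t n (∑ a ∈ Finset.range n, (f a : A) * (t:A)^a) := by
  induction n with
  | zero => simp [GG]
  | succ n ih =>
    rw [Finset.sum_range_succ]
    obtain ⟨c, hc, e⟩ := h.conj_pow' n (f n) (f n).2
    rw [e]
    exact GG.add _ (ih.mono (Nat.le_succ _)) (GG.monom n hc)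

lemma IsLau.uniq (h : IsLau B B' t) (f : ℕ → B) (n : ℕ) (h0 : ∑ a ∈ Finset.range n, (f a : A) * (t:A)^a = 0) :
    ∀ a < n, f a = 0 := by
  induction n with
  | zero => intro a ha; omega
  | succ n ih =>
    rw [Finset.sum_range_succ] at h0
    obtain ⟨c, hc, e⟩ := h.conj_pow' n (f n) (f n).2
    have hG := GG.neg _ (h.GG_sum f n)
    rw [← sub_eq_zero, sub_eq_add_neg] at h0
    have h1 : -∑ a ∈ Finset.range n, (f a : A) * (t:A)^a = (t:A)^n * c := by
      rw [← e]; rw [neg_eq_iff_add_eq_zero]; simpa using h0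
    rw [h1] at hG
    have hc0 := h.indep n c hc hG
    have hfn : f n = 0 := by
      rw [hc0, mul_zero, ← Units.val_pow_eq_pow_val, Units.mul_left_eq_zero] at e
      exact Subtype.ext e
    intro a ha
    rcases Nat.lt_succ_iff_lt_or_eq.1 ha with h2 | rfl
    · refine ih ?_ a h2
      simpa [hfn] using h0
    · exact hfn

lemma IsLau.common (h : IsLau B B' t) {I : Type*} [Fintype I] (x : I → B') :
    ∃ M N : ℕ, ∀ i, GG B t N ((t:A)^M * (x i:A)) := by
  choose m n hmn using fun i => h.span (x i) (x i).2
  refine ⟨Finset.univ.sup m, Finset.univ.sup n + Finset.univ.sup m, fun i => ?_⟩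
  have h1 : m i ≤ Finset.univ.sup m := Finset.le_sup (Finset.mem_univ i)
  have h2 : n i ≤ Finset.univ.sup n := Finset.le_sup (Finset.mem_univ i)
  have := GG.tpow _ (hmn i) (Finset.univ.sup m - m i)
  rw [← mul_assoc, ← pow_add, Nat.sub_add_cancel h1] at this
  exact this.mono (by omega)


lemma gen_rearr {I C : Type*} [Fintype I] [Ring C] (N N' : ℕ) (X : C) (F : I → ℕ → C) (W : I → ℕ → ℕ → C) :
      ∑ i, ∑ a ∈ Finset.range N', ∑ e ∈ Finset.range N, F i a * W i a e * X^(a+e) =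
      ∑ m ∈ Finset.range (N'+N), (∑ p : I × Fin N', F p.1 p.2 * ∑ e ∈ Finset.range N, if m = p.2 + e then W p.1 p.2 e else 0) * X^m := by
  simp only [Finset.sum_mul, Fintype.sum_prod_type]
  conv_rhs => rw [Finset.sum_comm]
  refine Finset.sum_congr rfl fun i _ => ?_
  conv_rhs => rw [Finset.sum_comm]
  rw [Finset.sum_range]
  refine Finset.sum_congr rfl fun a _ => ?_
  simp only [Finset.mul_sum, Finset.sum_mul]
  conv_rhs => rw [Finset.sum_comm]
  refine Finset.sum_congr rfl fun e he => ?_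
  rw [Finset.sum_eq_single ((a:ℕ) + e)]
  · simp
  · intro b _ hb; simp [hb]
  · intro hb
    exfalso; apply hb
    rw [Finset.mem_range] at he ⊢
    have := a.2
    omega

lemma IsLau.strD (h : IsLau B B' t) {k : Type*} [Field k] (ε : B' →+* k)
    (hS : StrD (ε.comp (Subring.inclusion h.le))) : StrD ε := by
  intro I J _ _ v hv c hc
  let T : B' := ⟨t, h.t_mem⟩
  let Ti : B' := ⟨_, h.tinv_mem⟩
  have hTT : T * Ti = 1 := Subtype.ext (by simp [T, Ti])
  have hTT' : Ti * T = 1 := Subtype.ext (by simp [T, Ti])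
  have hτ : ε T ≠ 0 := by
    intro h0
    have := congrArg ε hTT
    rw [map_mul, h0, zero_mul, map_one] at this
    exact zero_ne_one this
  obtain ⟨M, N, hMN⟩ := h.common (fun p : I × J => v p.1 p.2)
  obtain ⟨M', N', hMN'⟩ := h.common (fun i : I => c i * Ti^M)
  choose w hw using fun (i : I) (j : J) => h.repr _ (hMN (i,j))
  choose f hf using fun (i : I) => h.repr _ (hMN' i)
  choose S hS0 hS1 using fun (a : ℕ) (b : B) => h.conj_pow a b b.2
  let S' : ℕ → B → B := fun a b => ⟨S a b, hS0 a b⟩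
  let inc := Subring.inclusion h.le
  have hεS : ∀ a b, ε (inc (S' a b)) = ε (inc b) := by
    intro a b
    have : T^a * inc b = inc (S' a b) * T^a := Subtype.ext (by simpa [T, inc] using hS1 a b)
    have := congrArg ε this
    rw [map_mul, map_mul, map_pow, mul_comm] at this
    exact (mul_right_cancel₀ (pow_ne_zero a hτ) this).symm
  let V : I × Fin N' → J × Fin (N'+N) → B := fun p q =>
    ∑ e ∈ Finset.range N, if (q.2:ℕ) = p.2 + e then S' p.2 (w p.1 q.1 e) else 0
  have hTM : Ti ^ M * T ^ M = 1 := by rw [← Commute.mul_pow (by rw [commute_iff_eq, hTT, hTT']), hTT', one_pow]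
  have hTM' : Ti ^ M' * T ^ M' = 1 := by rw [← Commute.mul_pow (by rw [commute_iff_eq, hTT, hTT']), hTT', one_pow]
  have hW : ∀ i j, T^M * v i j = ∑ e ∈ Finset.range N, inc (w i j e) * T^e := fun i j => Subtype.ext (by
    have := hw i j
    push_cast [T, inc]
    exact this)
  have hF : ∀ i, T^M' * (c i * Ti^M) = ∑ e ∈ Finset.range N', inc (f i e) * T^e := fun i => Subtype.ext (by
    have := hf i
    push_cast [T, inc]
    push_cast at this
    exact this)
  have hrel : ∀ q, ∑ p, f p.1 p.2 * V p q = 0 := by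
    rintro ⟨j, m⟩
    let g : ℕ → B := fun m => ∑ p : I × Fin N', f p.1 p.2 * ∑ e ∈ Finset.range N, if m = p.2 + e then S' p.2 (w p.1 j e) else 0
    have hg : ∑ m ∈ Finset.range (N'+N), inc (g m) * T^m = 0 := by
      have h0 : T^M' * (∑ i, c i * v i j) = 0 := by rw [hc, mul_zero]
      have h1 : T^M' * (∑ i, c i * v i j) = ∑ i, (T^M' * (c i * Ti^M)) * (T^M * v i j) := by
        rw [Finset.mul_sum]
        refine Finset.sum_congr rfl fun i _ => ?_
        rw [mul_assoc, mul_assoc, ← mul_assoc (Ti^M), hTM, one_mul]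
      rw [h1] at h0
      simp only [hW, hF, Finset.sum_mul_sum] at h0
      have h2 := gen_rearr N N' T (fun i a => inc (f i a)) (fun i a e => inc (S' a (w i j e)))
      rw [← h0]
      rw [show (∑ m ∈ Finset.range (N'+N), inc (g m) * T^m) = ∑ m ∈ Finset.range (N'+N), (∑ p : I × Fin N', inc (f p.1 p.2) * ∑ e ∈ Finset.range N, if m = p.2 + e then inc (S' p.2 (w p.1 j e)) else 0) * T^m from ?_, ← h2]
      · refine Finset.sum_congr rfl fun i _ => Finset.sum_congr rfl fun a _ => Finset.sum_congr rfl fun e _ => ?_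
        have : T^a * inc (w i j e) = inc (S' a (w i j e)) * T^a := Subtype.ext (by simpa [T, inc] using hS1 a _)
        rw [pow_add, mul_assoc, ← mul_assoc _ (T^a), ← this]
        simp only [mul_assoc]
      · refine Finset.sum_congr rfl fun m _ => ?_
        congr 1
        simp only [g, map_sum, map_mul]
        refine Finset.sum_congr rfl fun p _ => ?_
        congr 1
        refine Finset.sum_congr rfl fun e _ => ?_
        split_ifs <;> simp
    exact h.uniq g (N'+N) (by simpa [T, inc] using congrArg Subtype.val hg) m m.2
  have hVind : LinearIndependent k (fun p q => (ε.comp inc) (V p q)) := by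
    rw [Fintype.linearIndependent_iff]
    intro d hd
    let D : I → Polynomial k := fun i => ∑ a : Fin N', Polynomial.C (d (i,a)) * Polynomial.X^(a:ℕ)
    let W : I → J → Polynomial k := fun i j => ∑ e ∈ Finset.range N, Polynomial.C (ε (inc (w i j e))) * Polynomial.X^e
    have hD : D = 0 := by
      apply StrD_comm (Polynomial.evalRingHom (ε T)) (fun x => ⟨Polynomial.C x, by simp⟩) I J W
      · have hWe : ∀ i j, Polynomial.evalRingHom (ε T) (W i j) = ε T^M * ε (v i j) := by
          intro i j
          have := congrArg ε (hW i j)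
          rw [map_mul, map_pow] at this
          rw [this]
          simp [W]
        simp only [hWe]
        rw [Fintype.linearIndependent_iff] at hv ⊢
        intro g hg
        apply hv g
        have h3 : (ε T^M) • ∑ i, g i • (fun j => ε (v i j)) = 0 := by
          rw [← hg, Finset.smul_sum]
          refine Finset.sum_congr rfl fun i _ => ?_
          ext j; simp; ring
        exact (smul_eq_zero.1 h3).resolve_left (pow_ne_zero _ hτ)
      · intro j
        let F : I → ℕ → Polynomial k := fun i a => if ha : a < N' then Polynomial.C (d (i,⟨a,ha⟩)) else 0
        have h2 := gen_rearr N N' Polynomial.X F (fun i a e => Polynomial.C (ε (inc (w i j e))))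
        have h4 : ∑ i, D i * W i j = ∑ i, ∑ a ∈ Finset.range N', ∑ e ∈ Finset.range N, F i a * Polynomial.C (ε (inc (w i j e))) * Polynomial.X^(a+e) := by
          refine Finset.sum_congr rfl fun i _ => ?_
          have : D i = ∑ a ∈ Finset.range N', F i a * Polynomial.X^a := by
            rw [Finset.sum_range]
            refine Finset.sum_congr rfl fun a _ => ?_
            simp [F]
          rw [this, Finset.sum_mul_sum]
          refine Finset.sum_congr rfl fun a _ => Finset.sum_congr rfl fun e _ => ?_
          rw [pow_add]; ring
        rw [h4, h2]
        refine Finset.sum_eq_zero fun m hm => ?_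
        rw [Finset.mem_range] at hm
        have h5 := congrFun hd (j, ⟨m, hm⟩)
        rw [Finset.sum_apply] at h5
        have h6 : (∑ p : I × Fin N', F p.1 p.2 * ∑ e ∈ Finset.range N, if m = p.2 + e then Polynomial.C (ε (inc (w p.1 j e))) else 0) = Polynomial.C (∑ p, d p * (ε.comp inc) (V p (j, ⟨m,hm⟩))) := by
          simp only [map_sum, map_mul]
          refine Finset.sum_congr rfl fun p _ => ?_
          congr 1
          · simp [F]
          · simp only [V, map_sum, RingHom.comp_apply]
            refine Finset.sum_congr rfl fun e _ => ?_
            split_ifs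
            · rw [hεS]
            · simp
        rw [h6]
        have h7 : ∑ p, d p * (ε.comp inc) (V p (j, ⟨m,hm⟩)) = 0 := by simpa using h5
        rw [h7]; simp
    rintro ⟨i, a⟩
    have h8 := congrArg (fun p => Polynomial.coeff p a) (congrFun hD i)
    simpa [D, Polynomial.finsetSum_coeff, Polynomial.coeff_X_pow, Fin.val_inj] using h8
  have hf0 := hS (I × Fin N') (J × Fin (N'+N)) V hVind (fun p => f p.1 p.2) hrel
  ext1 i
  have h9 : T^M' * (c i * Ti^M) = 0 := by
    rw [hF, Finset.sum_range]
    refine Finset.sum_eq_zero fun a _ => ?_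
    have : f i a = 0 := congrFun hf0 (i,a)
    simp [this]
  have h10 : c i = Ti^M' * (T^M' * (c i * Ti^M)) * T^M := by
    rw [← mul_assoc (Ti^M'), hTM', one_mul, mul_assoc, hTM, mul_one]
  rw [h10, h9]; simp
end
end GW

namespace GW
open Classical SkewMonoidAlgebra

section
variable {S Γ : Type*} [CommRing S] [Group Γ] [MulSemiringAction Γ S]

/-- the subring of elements supported on a subgroup -/
noncomputable def AK (S : Type*) {Γ : Type*} [CommRing S] [Group Γ] [MulSemiringAction Γ S] (K : Subgroup Γ) : Subring (SkewMonoidAlgebra S Γ) where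
  carrier := {x | ∀ g, g ∉ K → x.coeff g = 0}
  mul_mem' := (by
    intro x y hx hy g hg
    by_contra hne
    have h1 : g ∈ (x*y).support := mem_support_iff.2 hne
    obtain ⟨a, ha, b, hb, rfl⟩ := Finset.mem_mul.1 (support_mul (f := x) (g := y) h1)
    rw [mem_support_iff] at ha hb
    exact hg (K.mul_mem (by by_contra h; exact ha (hx a h)) (by by_contra h; exact hb (hy b h))))
  one_mem' := (by
    intro g hg
    rw [coeff_one, Finsupp.single_apply, if_neg]
    rintro rfl
    exact hg K.one_mem)
  add_mem' := (by
    intro x y hx hy g hg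
    rw [coeff_add, Finsupp.add_apply, hx g hg, hy g hg, add_zero])
  zero_mem' := (by intro g _; simp)
  neg_mem' := (by
    intro x hx g hg
    rw [coeff_neg, Finsupp.neg_apply, hx g hg, neg_zero])

lemma single_mem_AK {K : Subgroup Γ} {g : Γ} (hg : g ∈ K) (s : S) : single g s ∈ AK S K := by
  intro h hh
  rw [coeff_single_apply, if_neg]
  rintro rfl; exact hh hg

lemma AK_mono {K K' : Subgroup Γ} (h : K ≤ K') : AK S K ≤ AK S K' := fun _ hx g hg => hx g fun h' => hg (h h')

lemma AK_induction {K : Subgroup Γ} {P : SkewMonoidAlgebra S Γ → Prop} (h0 : P 0) (hadd : ∀ x y, P x → P y → P (x+y))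
    (hs : ∀ g ∈ K, ∀ s, P (single g s)) : ∀ x ∈ AK S K, P x := by
  intro x hx
  have hx' : x = ∑ g ∈ x.support, single g (x.coeff g) := (sum_single x).symm
  rw [hx']
  apply Finset.sum_induction _ P hadd h0
  intro g hg
  apply hs
  by_contra h
  exact (mem_support_iff.1 hg) (hx g h)

/-- group elements as units -/
noncomputable def uG (S : Type*) {Γ : Type*} [CommRing S] [Group Γ] [MulSemiringAction Γ S] : Γ →* (SkewMonoidAlgebra S Γ)ˣ := (of S Γ).toHomUnits

lemma uG_coe (g : Γ) : (uG S g : SkewMonoidAlgebra S Γ) = single g 1 := by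
  simp [uG, of_apply]

lemma uG_pow (g : Γ) (n : ℕ) : (uG S g : SkewMonoidAlgebra S Γ)^n = single (g^n) 1 := by
  rw [← uG_coe, map_pow, Units.val_pow_eq_pow_val]

lemma uG_inv (g : Γ) : (↑(uG S g)⁻¹ : SkewMonoidAlgebra S Γ) = single g⁻¹ 1 := by
  rw [← map_inv, uG_coe]

lemma isLau_AK {K : Subgroup Γ} {t : Γ} (hn : ∀ x, x ∈ K ↔ t*x*t⁻¹ ∈ K) (ht : ∀ n:ℤ, t^n ∈ K → n=0) :
    IsLau (AK S K) (AK S (K ⊔ Subgroup.zpowers t)) (uG S t) := by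
  have hdec : ∀ g ∈ K ⊔ Subgroup.zpowers t, ∃ i : ℤ, ∃ κ ∈ K, g = t^i * κ := by
    have hN : Subgroup.zpowers t ≤ Subgroup.normalizer (K : Set Γ) := by
      rw [Subgroup.zpowers_le, Subgroup.mem_normalizer_iff]
      exact hn
    intro g hg
    rw [sup_comm, ← SetLike.mem_coe, Subgroup.coe_mul_of_left_le_normalizer_right _ _ hN] at hg
    obtain ⟨a, ⟨i, rfl⟩, b, hb, rfl⟩ := hg
    exact ⟨i, b, hb, rfl⟩
  refine ⟨?_, ?_, AK_mono le_sup_left, ?_, ?_, ?_, ?_⟩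
  · intro b hb g hg
    rw [uG_inv, uG_coe, coeff_mul_single, coeff_single_mul, hb]
    · simp
    · intro h
      rw [hn] at h
      apply hg
      convert h using 1; group
  · intro b hb g hg
    rw [uG_inv, uG_coe, coeff_mul_single, coeff_single_mul, hb]
    · simp
    · intro h
      apply hg
      rw [hn]
      convert h using 1; group
  · rw [uG_coe]; exact single_mem_AK (Subgroup.mem_sup_right (Subgroup.mem_zpowers t)) _
  · rw [uG_inv]; exact single_mem_AK (inv_mem (Subgroup.mem_sup_right (Subgroup.mem_zpowers t))) _
  · apply AK_induction
    · exact ⟨0, 0, by simp [GG]⟩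
    · rintro x y ⟨m, n, h1⟩ ⟨m', n', h2⟩
      refine ⟨m+m', (n+m')+(n'+m), ?_⟩
      rw [mul_add]
      refine GG.add _ (GG.mono (n := n+m') ?_ (by omega)) (GG.mono (n := n'+m) ?_ (by omega))
      · have := GG.tpow _ h1 m'
        rwa [← mul_assoc, ← pow_add, add_comm m'] at this
      · have := GG.tpow _ h2 m
        rwa [← mul_assoc, ← pow_add] at this
    · intro g hg s
      obtain ⟨i, κ, hκ, rfl⟩ := hdec g hg
      obtain ⟨a, ha⟩ : ∃ a : ℕ, (a:ℤ) = i.natAbs + i := ⟨(i.natAbs + i).toNat, by omega⟩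
      refine ⟨i.natAbs, a+1, ?_⟩
      have := GG.monom (t := uG S t) a (single_mem_AK (S := S) hκ ((t^a)⁻¹ • (t^i.natAbs • s)))
      convert this using 1
      rw [uG_pow, uG_pow, single_mul_single, single_mul_single]
      congr 1
      · rw [← mul_assoc, ← zpow_natCast t i.natAbs, ← zpow_natCast t a, ha, zpow_add]
      · simp
  · have key : ∀ (n : ℕ) x, GG (AK S K) (uG S t) n x → ∀ m : ℕ, n ≤ m → ∀ κ ∈ K, x.coeff (t^m * κ) = 0 := by
      intro n
      induction n with
      | zero =>
        intro x hx m _ κ _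
        rw [GG] at hx; rw [hx]; simp
      | succ n ih =>
        rintro x ⟨b, hb, h1⟩ m hm κ hκ
        have h2 := ih _ h1 m (by omega) κ hκ
        rw [coeff_sub, Finsupp.sub_apply, uG_pow, coeff_single_mul, hb] at h2
        · simpa using h2
        · intro h
          have h3 := K.mul_mem h (K.inv_mem hκ)
          have h4 : t^((m:ℤ)-n) ∈ K := by
            convert h3 using 1
            rw [zpow_sub, zpow_natCast, zpow_natCast]
            rw [((Commute.refl t).pow_pow m n).inv_right.eq]; group
          have := ht _ h4
          omega
    intro n b hb h1
    ext g
    by_cases hg : g ∈ K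
    · have := key n _ h1 n le_rfl g hg
      rw [uG_pow, coeff_single_mul, one_mul, smul_eq_zero_iff_eq] at this
      simpa using this
    · rw [hb g hg]; simp

lemma AK_bot_mem (x : SkewMonoidAlgebra S Γ) (hx : x ∈ AK S (⊥ : Subgroup Γ)) : x = single 1 (x.coeff 1) := by
  ext g
  by_cases hg : g = 1
  · subst hg; simp
  · rw [hx g (by simpa using hg), coeff_single_apply, if_neg (Ne.symm hg)]

/-- the base ring -/
noncomputable def AKbot (S Γ : Type*) [CommRing S] [Group Γ] [MulSemiringAction Γ S] : S ≃+* AK S (⊥ : Subgroup Γ) :=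
  RingEquiv.ofBijective ((singleOneRingHom (k := S) (G := Γ)).codRestrict (AK S (⊥ : Subgroup Γ)) (fun s => single_mem_AK (Subgroup.one_mem _) s)) (by
    constructor
    · intro a b h
      exact single_injective 1 (congrArg Subtype.val h)
    · rintro ⟨x, hx⟩
      exact ⟨x.coeff 1, Subtype.ext (AK_bot_mem x hx).symm⟩)

lemma StrD_equiv {k B B' : Type*} [Field k] [Ring B] [Ring B'] (ε : B →+* k) (e : B' ≃+* B) (h : StrD ((ε.comp e.toRingHom))) : StrD ε := by
  intro I J _ _ v hv c hc
  have := h I J (fun i j => e.symm (v i j)) (by simpa using hv) (fun i => e.symm (c i)) (fun j => by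
    have := congrArg e.symm (hc j)
    simpa using this)
  ext1 i
  have h2 := congrFun this i
  simpa using h2

/-- augmentation -/
noncomputable def augA {k S Γ : Type*} [Field k] [CommRing S] [Group Γ] [MulSemiringAction Γ S] (ε : S →+* k) (hε : ∀ (g : Γ) s, ε (g • s) = ε s) :
    SkewMonoidAlgebra S Γ →+* k := liftNCRingHom ε (1 : Γ →* k) (by intro x y; simp [hε])

lemma augA_single {k : Type*} [Field k] (ε : S →+* k) (hε : ∀ (g : Γ) s, ε (g • s) = ε s) (g : Γ) (s : S) :
    augA ε hε (single g s) = ε s := by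
  show liftNC _ _ (single g s) = _
  rw [liftNC_single]; simp

theorem AK_PZ {k : Type*} [Field k] [IsDomain S] [IsNoetherianRing S] (ε : S →+* k) (hε : ∀ (g : Γ) s, ε (g • s) = ε s)
    (hs : Function.Surjective ε) {N : Subgroup Γ} (hN : PZ N) :
    (∀ x ∈ AK S N, ∀ y ∈ AK S N, x * y = 0 → x = 0 ∨ y = 0) ∧ IsNoetherianRing (AK S N) ∧
      StrD ((augA ε hε).comp (AK S N).subtype) := by
  induction hN with
  | bot =>
    refine ⟨?_, isNoetherianRing_of_ringEquiv S (AKbot S Γ), StrD_equiv _ (AKbot S Γ) ?_⟩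
    · intro x hx y hy hxy
      rw [AK_bot_mem x hx, AK_bot_mem y hy, single_mul_single] at hxy
      rw [single_eq_zero, one_smul] at hxy
      rcases mul_eq_zero.1 hxy with h | h
      · left; rw [AK_bot_mem x hx, h, single_zero]
      · right; rw [AK_bot_mem y hy, h, single_zero]
    · have : (((augA ε hε).comp (AK S (⊥ : Subgroup Γ)).subtype).comp (AKbot S Γ).toRingHom) = ε := by
        ext s
        exact augA_single ε hε 1 s
      rw [this]
      exact StrD_comm ε hs
  | step K t _ hn ht ih =>
    obtain ⟨h1, h2, h3⟩ := ih
    have hL := isLau_AK (S := S) hn ht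
    exact ⟨hL.noZeroDivisors h1, hL.noeth, hL.strD _ h3⟩
end
end GW

namespace GW
open Classical SkewMonoidAlgebra
universe w

/-- finitely supported functions with the diagonal action -/
def Wd (X Y : Type*) [AddCommGroup Y] := X →₀ Y

section
variable {S Γ X Y : Type*} [CommRing S] [Group Γ] [MulSemiringAction Γ S] [MulAction Γ X] [AddCommGroup Y]

noncomputable instance : AddCommGroup (Wd X Y) := inferInstanceAs (AddCommGroup (X →₀ Y))

/-- generator -/
noncomputable def Wd.sg (x : X) : Y →+ Wd X Y := Finsupp.singleAddHom x

variable [Module (SkewMonoidAlgebra S Γ) Y]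

/-- action map of a group element -/
noncomputable def Wd.act (X : Type*) {Y S Γ : Type*} [CommRing S] [Group Γ] [MulSemiringAction Γ S] [MulAction Γ X] [AddCommGroup Y] [Module (SkewMonoidAlgebra S Γ) Y] (g : Γ) (s : S) : Wd X Y →+ Wd X Y :=
  (Finsupp.mapDomain.addMonoidHom (fun x : X => g • x)).comp
    (Finsupp.mapRange.addMonoidHom (DistribSMul.toAddMonoidHom Y (single g s : SkewMonoidAlgebra S Γ)) : (X →₀ Y) →+ (X →₀ Y))

lemma Wd.act_sg (g : Γ) (s : S) (x : X) (y : Y) : Wd.act X g s (Wd.sg x y) = Wd.sg (g • x) ((single g s : SkewMonoidAlgebra S Γ) • y) := by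
  show Finsupp.mapDomain (fun x : X => g • x) (Finsupp.mapRange (DistribSMul.toAddMonoidHom Y (single g s : SkewMonoidAlgebra S Γ)) (map_zero _) (Finsupp.single x y)) = Finsupp.single _ _
  rw [Finsupp.mapRange_single, Finsupp.mapDomain_single]
  rfl

lemma Wd.hom_ext {Z : Type*} [AddCommMonoid Z] {f g : Wd X Y →+ Z} (h : ∀ x y, f (Wd.sg x y) = g (Wd.sg x y)) : f = g :=
  Finsupp.addHom_ext h

lemma Wd.act_act (g h : Γ) (s r : S) : (Wd.act X g s : Wd X Y →+ Wd X Y).comp (Wd.act X h r) = Wd.act X (g*h) (s * g • r) :=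
  Wd.hom_ext (fun x y => by
    rw [AddMonoidHom.comp_apply, Wd.act_sg, Wd.act_sg, Wd.act_sg, ← mul_smul, ← mul_smul, single_mul_single])

lemma Wd.act_add (g : Γ) (s r : S) : (Wd.act X g (s+r) : Wd X Y →+ Wd X Y) = Wd.act X g s + Wd.act X g r :=
  Wd.hom_ext (fun x y => by
    rw [AddMonoidHom.add_apply, Wd.act_sg, Wd.act_sg, Wd.act_sg, single_add, add_smul, map_add])

lemma Wd.act_one : (Wd.act X (1:Γ) (1:S) : Wd X Y →+ Wd X Y) = AddMonoidHom.id _ :=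
  Wd.hom_ext (fun x y => by
    rw [AddMonoidHom.id_apply, Wd.act_sg, one_smul, single_one_one, one_smul])

lemma Wd.act_zero (g : Γ) : (Wd.act X g (0:S) : Wd X Y →+ Wd X Y) = 0 :=
  Wd.hom_ext (fun x y => by
    rw [AddMonoidHom.zero_apply, Wd.act_sg, single_zero, zero_smul, map_zero])

/-- the scalar part -/
noncomputable def Wd.actS (S Γ X Y : Type*) [CommRing S] [Group Γ] [MulSemiringAction Γ S] [MulAction Γ X] [AddCommGroup Y] [Module (SkewMonoidAlgebra S Γ) Y] :
    S →+* AddMonoid.End (Wd X Y) where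
  toFun := fun s => (Wd.act X (1:Γ) s : Wd X Y →+ Wd X Y)
  map_one' := Wd.act_one
  map_mul' := fun s r => ((Wd.act_act (1:Γ) 1 s r).trans (by rw [one_mul, one_smul])).symm
  map_zero' := Wd.act_zero 1
  map_add' := fun s r => Wd.act_add 1 s r

/-- the group part -/
noncomputable def Wd.actG (S Γ X Y : Type*) [CommRing S] [Group Γ] [MulSemiringAction Γ S] [MulAction Γ X] [AddCommGroup Y] [Module (SkewMonoidAlgebra S Γ) Y] :
    Γ →* AddMonoid.End (Wd X Y) where
  toFun := fun g => (Wd.act X g (1:S) : Wd X Y →+ Wd X Y)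
  map_one' := Wd.act_one
  map_mul' := fun g h => ((Wd.act_act g h (1:S) 1).trans (by rw [smul_one, mul_one])).symm

lemma Wd.actSG (g : Γ) (s : S) : Wd.actS S Γ X Y s * Wd.actG S Γ X Y g = Wd.act X g s :=
  (Wd.act_act (1:Γ) g s 1).trans (by rw [one_mul, one_smul, mul_one])

lemma Wd.actGS (g : Γ) (s : S) : Wd.actG S Γ X Y g * Wd.actS S Γ X Y s = Wd.act X g (g • s) :=
  (Wd.act_act g 1 1 s).trans (by rw [one_mul, mul_one])

/-- the action ring hom -/
noncomputable def Wd.actHom (S Γ X Y : Type*) [CommRing S] [Group Γ] [MulSemiringAction Γ S] [MulAction Γ X] [AddCommGroup Y] [Module (SkewMonoidAlgebra S Γ) Y] :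
    SkewMonoidAlgebra S Γ →+* AddMonoid.End (Wd X Y) :=
  liftNCRingHom (Wd.actS S Γ X Y) (Wd.actG S Γ X Y) (by
      intro s g
      rw [Wd.actSG, Wd.actGS])

noncomputable instance : Module (SkewMonoidAlgebra S Γ) (Wd X Y) := Module.compHom (Wd X Y) (Wd.actHom S Γ X Y)

lemma Wd.single_smul (g : Γ) (s : S) (x : X) (y : Y) : (single g s : SkewMonoidAlgebra S Γ) • (Wd.sg x y : Wd X Y) = Wd.sg (g • x) ((single g s : SkewMonoidAlgebra S Γ) • y) := by
  show (Wd.actHom S Γ X Y (single g s)) (Wd.sg x y) = _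
  have : Wd.actHom S Γ X Y (single g s) = Wd.act X g s := by
    show liftNC _ _ (single g s) = _
    rw [liftNC_single]; exact Wd.actSG g s
  rw [this]
  exact Wd.act_sg g s x y

/-- linearity from generators -/
noncomputable def Wd.mkLin {Z : Type*} [AddCommGroup Z] [Module (SkewMonoidAlgebra S Γ) Z] (f : Wd X Y →+ Z)
    (h : ∀ (g : Γ) (s : S) x y, f (Wd.sg (g • x) ((single g s : SkewMonoidAlgebra S Γ) • y)) = (single g s : SkewMonoidAlgebra S Γ) • f (Wd.sg x y)) :
    Wd X Y →ₗ[SkewMonoidAlgebra S Γ] Z :=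
  { f with
    map_smul' := (by
      intro a u
      show f (a • u) = a • f u
      refine SkewMonoidAlgebra.induction_on' (p := fun a => f (a • u) = a • f u) a ?_ ?_
      · intro g s
        have : f.comp (DistribSMul.toAddMonoidHom (Wd X Y) (single g s : SkewMonoidAlgebra S Γ)) =
          (DistribSMul.toAddMonoidHom Z (single g s : SkewMonoidAlgebra S Γ)).comp f := Wd.hom_ext (fun x y => by
            simp only [AddMonoidHom.comp_apply, DistribSMul.toAddMonoidHom_apply]
            rw [Wd.single_smul, h])
        exact DFunLike.congr_fun this u
      · intro a b ha hb
        rw [add_smul, map_add, ha, hb, add_smul]) }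

/-- total sum -/
noncomputable def Wd.tot (S Γ X Y : Type*) [CommRing S] [Group Γ] [MulSemiringAction Γ S] [MulAction Γ X] [AddCommGroup Y] [Module (SkewMonoidAlgebra S Γ) Y] :
    Wd X Y →ₗ[SkewMonoidAlgebra S Γ] Y :=
  Wd.mkLin (Finsupp.liftAddHom (fun _ => AddMonoidHom.id Y)) (fun g s x y => by
    have : ∀ (x : X) (y : Y), (Finsupp.liftAddHom (fun _ : X => AddMonoidHom.id Y)) (Wd.sg x y : Wd X Y) = y := fun x y => Finsupp.liftAddHom_apply_single _ _ _
    exact (this _ _).trans (congrArg _ (this x y).symm))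

lemma Wd.tot_sg (x : X) (y : Y) : Wd.tot S Γ X Y (Wd.sg x y) = y := Finsupp.liftAddHom_apply_single _ _ _

/-- reindexing along an equivariant map -/
noncomputable def Wd.mapX (S : Type*) {Γ X : Type*} (Y : Type*) [CommRing S] [Group Γ] [MulSemiringAction Γ S] [MulAction Γ X] [AddCommGroup Y] [Module (SkewMonoidAlgebra S Γ) Y] (θ : X → X) (hθ : ∀ (g : Γ) x, θ (g • x) = g • θ x) :
    Wd X Y →ₗ[SkewMonoidAlgebra S Γ] Wd X Y :=
  Wd.mkLin (Finsupp.mapDomain.addMonoidHom θ) (fun g s x y => by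
    have : ∀ (x : X) (y : Y), (Finsupp.mapDomain.addMonoidHom θ : (X →₀ Y) →+ (X →₀ Y)) (Wd.sg x y : Wd X Y) = (Wd.sg (θ x) y : Wd X Y) := fun x y => Finsupp.mapDomain_single
    refine (this _ _).trans ?_
    rw [hθ, ← Wd.single_smul]
    exact congrArg _ (this x y).symm)

lemma Wd.mapX_apply (θ : X → X) (hθ : ∀ (g : Γ) x, θ (g • x) = g • θ x) (u : Wd X Y) : Wd.mapX S Y θ hθ u = Finsupp.mapDomain θ (u : X →₀ Y) := rfl

lemma Wd.mapX_sg (θ : X → X) (hθ : ∀ (g : Γ) x, θ (g • x) = g • θ x) (x : X) (y : Y) : Wd.mapX S Y θ hθ (Wd.sg x y) = Wd.sg (θ x) y :=  Finsupp.mapDomain_single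
end
end GW

namespace GW
open Classical SkewMonoidAlgebra
universe w

section
variable {S H Γ : Type*} [CommRing S] [Group Γ] [MulSemiringAction Γ S] [Group H] [MulSemiringAction H S]

/-- induced map of skew group rings -/
noncomputable def iot (φ : H →* Γ) (hφ : ∀ (h : H) (s : S), h • s = φ h • s) : SkewMonoidAlgebra S H →+* SkewMonoidAlgebra S Γ :=
  mapDomainRingHom (f := φ) hφ

lemma iot_single (φ : H →* Γ) (hφ : ∀ (h : H) (s : S), h • s = φ h • s) (h : H) (s : S) : iot φ hφ (single h s) = single (φ h) s :=
  mapDomain_single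

lemma iot_coeff (φ : H →* Γ) (hφ : ∀ (h : H) (s : S), h • s = φ h • s) (hinj : Function.Injective φ) (x : SkewMonoidAlgebra S H) (h : H) :
    (iot φ hφ x).coeff (φ h) = x.coeff h := by
  show (mapDomain φ x).coeff (φ h) = _
  rw [coeff_mapDomain, Finsupp.mapDomain_apply hinj]

lemma iot_coeff' (φ : H →* Γ) (hφ : ∀ (h : H) (s : S), h • s = φ h • s) (x : SkewMonoidAlgebra S H) (g : Γ) (hg : g ∉ φ.range) :
    (iot φ hφ x).coeff g = 0 := by
  show (mapDomain φ x).coeff g = _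
  rw [coeff_mapDomain, Finsupp.mapDomain_of_notMem_range]
  intro h; exact hg h

lemma iot_comp {H' : Type*} [Group H'] [MulSemiringAction H' S] (φ : H →* Γ) (hφ : ∀ (h : H) (s : S), h • s = φ h • s)
    (ψ : H' →* H) (hψ : ∀ (h : H') (s : S), h • s = ψ h • s) (hc : ∀ (h : H') (s : S), h • s = (φ.comp ψ) h • s) :
    iot (φ.comp ψ) hc = (iot φ hφ).comp (iot ψ hψ) := by
  refine RingHom.ext fun x => ?_
  refine SkewMonoidAlgebra.induction_on' (p := fun x => iot (φ.comp ψ) hc x = (iot φ hφ).comp (iot ψ hψ) x) x ?_ ?_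
  · intro g s
    rw [RingHom.comp_apply, iot_single, iot_single, iot_single]; rfl
  · intro a b ha hb
    rw [map_add, map_add, ha, hb]

/-- `S[Γ]` is free over `S[H]` -/
lemma projVia_iot (φ : H →* Γ) (hφ : ∀ (h : H) (s : S), h • s = φ h • s) (hinj : Function.Injective φ) :
    ProjVia (iot φ hφ) (SkewMonoidAlgebra S Γ) := by
  unfold ProjVia
  let _ : Module (SkewMonoidAlgebra S H) (SkewMonoidAlgebra S Γ) := Module.compHom _ (iot φ hφ)
  have hsm : ∀ (x : SkewMonoidAlgebra S H) (y : SkewMonoidAlgebra S Γ), x • y = iot φ hφ x * y := fun _ _ => rfl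
  let Q := Quotient (QuotientGroup.rightRel φ.range)
  let r : Q → Γ := Quotient.out
  let v : Q → SkewMonoidAlgebra S Γ := fun q => single (r q) 1
  have hli : LinearIndependent (SkewMonoidAlgebra S H) v := by
    rw [linearIndependent_iff']
    intro F c hc q hq
    ext h
    have h1 := congrArg (fun z : SkewMonoidAlgebra S Γ => z.coeff (φ h * r q)) hc
    simp only [coeff_zero, Finsupp.coe_zero, Pi.zero_apply] at h1
    have h2 : (∑ i ∈ F, c i • v i).coeff (φ h * r q) = ∑ i ∈ F, (c i • v i).coeff (φ h * r q) := by
      have := map_sum ((Finsupp.applyAddHom (φ h * r q)).comp (coeffAddEquiv (k := S) (G := Γ)).toAddMonoidHom) (fun i => c i • v i) F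
      exact this
    rw [h2, Finset.sum_eq_single q] at h1
    · rw [hsm, coeff_mul_single, mul_inv_cancel_right, iot_coeff φ hφ hinj, smul_one, mul_one] at h1
      simpa using h1
    · intro q' _ hne
      rw [hsm, coeff_mul_single, iot_coeff', zero_mul]
      intro hh
      apply hne
      have : r q * (r q')⁻¹ ∈ φ.range := by
        have := φ.range.mul_mem (φ.range.inv_mem ⟨h, rfl⟩) hh
        rwa [mul_assoc, inv_mul_cancel_left] at this
      have h3 : (QuotientGroup.rightRel φ.range) (r q') (r q) := QuotientGroup.rightRel_apply.2 this
      have h4 := Quotient.sound h3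
      simpa [r] using h4
    · intro h5; exact (h5 hq).elim
  have hsp : ⊤ ≤ Submodule.span (SkewMonoidAlgebra S H) (Set.range v) := by
    intro x _
    refine SkewMonoidAlgebra.induction_on' (p := fun x => x ∈ Submodule.span (SkewMonoidAlgebra S H) (Set.range v)) x ?_ ?_
    · intro g s
      have h3 : (QuotientGroup.rightRel φ.range) (r (Quotient.mk _ g)) g := Quotient.exact (Quotient.out_eq _)
      rw [QuotientGroup.rightRel_apply] at h3
      obtain ⟨h, hh⟩ := h3
      have : single g s = (single h s : SkewMonoidAlgebra S H) • v (Quotient.mk _ g) := by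
        rw [hsm, iot_single, single_mul_single, hh, smul_one, mul_one, inv_mul_cancel_right]
      rw [this]
      exact Submodule.smul_mem _ _ (Submodule.subset_span ⟨_, rfl⟩)
    · intro x y hx hy; exact Submodule.add_mem _ hx hy
  have := Module.Free.of_basis (Module.Basis.mk hli hsp)
  infer_instance

/-- lifting -/
noncomputable def Wd.lft {X Y Z : Type*} [AddCommGroup Y] [AddCommGroup Z] (f : X → Y →+ Z) : Wd X Y →+ Z := Finsupp.liftAddHom f

lemma Wd.lft_sg {X Y Z : Type*} [AddCommGroup Y] [AddCommGroup Z] (f : X → Y →+ Z) (x : X) (y : Y) : Wd.lft f (Wd.sg x y) = f x y :=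
  Finsupp.liftAddHom_apply_single _ _ _

lemma Wd_projective (φ : H →* Γ) (hφ : ∀ (h : H) (s : S), h • s = φ h • s) (Y : Type*) [AddCommGroup Y]
    [Module (SkewMonoidAlgebra S Γ) Y] (hY : ProjVia (iot φ hφ) Y) :
    Module.Projective (SkewMonoidAlgebra S Γ) (Wd (Γ ⧸ φ.range) Y) := by
  unfold ProjVia at hY
  refine Module.Projective.of_lifting_property'' ?_
  intro f hf
  let F := (Wd (Γ ⧸ φ.range) Y →₀ SkewMonoidAlgebra S Γ)
  let _ : Module (SkewMonoidAlgebra S H) F := Module.compHom _ (iot φ hφ)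
  let _ : Module (SkewMonoidAlgebra S H) Y := Module.compHom _ (iot φ hφ)
  let _ : Module (SkewMonoidAlgebra S H) (Wd (Γ ⧸ φ.range) Y) := Module.compHom _ (iot φ hφ)
  let f' : F →ₗ[SkewMonoidAlgebra S H] (Wd (Γ ⧸ φ.range) Y) := { toFun := f, map_add' := f.map_add, map_smul' := fun b y => f.map_smul (iot φ hφ b) y }
  let j : Y →ₗ[SkewMonoidAlgebra S H] (Wd (Γ ⧸ φ.range) Y) :=
    { toFun := Wd.sg (QuotientGroup.mk 1 : Γ ⧸ φ.range), map_add' := map_add _, map_smul' := fun b y => (by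
        show Wd.sg (QuotientGroup.mk 1 : Γ ⧸ φ.range) (iot φ hφ b • y) = iot φ hφ b • Wd.sg (QuotientGroup.mk 1 : Γ ⧸ φ.range) y
        refine SkewMonoidAlgebra.induction_on' (p := fun b => Wd.sg (QuotientGroup.mk 1 : Γ ⧸ φ.range) (iot φ hφ b • y) = iot φ hφ b • Wd.sg (QuotientGroup.mk 1 : Γ ⧸ φ.range) y) b ?_ ?_
        · intro h s
          rw [iot_single, Wd.single_smul]
          congr 1
          congr 1
          show _ = QuotientGroup.mk (φ h * 1)
          rw [QuotientGroup.eq]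
          exact ⟨h, by simp⟩
        · intro a b ha hb
          rw [map_add, add_smul, map_add, ha, hb, add_smul]) }
  obtain ⟨l, hl⟩ := Module.projective_lifting_property f' j hf
  have hl1 : ∀ y, f (l y) = Wd.sg (QuotientGroup.mk 1) y := fun y => LinearMap.congr_fun hl y
  have hl2 : ∀ b y, l (iot φ hφ b • y) = iot φ hφ b • l y := fun b y => l.map_smul b y
  let r : Γ ⧸ φ.range → Γ := Quotient.out
  let h0 : Wd (Γ ⧸ φ.range) Y →+ F := Wd.lft fun c =>
    { toFun := fun y => (single (r c) 1 : SkewMonoidAlgebra S Γ) • l ((single (r c)⁻¹ 1 : SkewMonoidAlgebra S Γ) • y)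
      map_zero' := (by simp)
      map_add' := (by intro a b; simp) }
  have h0s : ∀ c y, h0 (Wd.sg c y) = (single (r c) 1 : SkewMonoidAlgebra S Γ) • l ((single (r c)⁻¹ 1 : SkewMonoidAlgebra S Γ) • y) :=
    fun c y => Wd.lft_sg _ c y
  refine ⟨Wd.mkLin h0 ?_, ?_⟩
  · intro g s c y
    rw [h0s, h0s]
    have h3 : (r (g • c))⁻¹ * (g * r c) ∈ φ.range := by
      rw [← QuotientGroup.eq]
      have h4 : (QuotientGroup.mk (r (g • c)) : Γ ⧸ φ.range) = g • c := Quotient.out_eq _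
      have h5 : (QuotientGroup.mk (r c) : Γ ⧸ φ.range) = c := Quotient.out_eq _
      rw [h4]
      conv_lhs => rw [← h5]
      rfl
    obtain ⟨h, hh⟩ := h3
    have e1 : (single (r (g • c))⁻¹ 1 : SkewMonoidAlgebra S Γ) * single g s = iot φ hφ (single h ((r (g • c))⁻¹ • s)) * single (r c)⁻¹ 1 := by
      rw [iot_single, single_mul_single, single_mul_single, hh]
      simp [mul_assoc]
    have e2 : (single (r (g • c)) 1 : SkewMonoidAlgebra S Γ) * iot φ hφ (single h ((r (g • c))⁻¹ • s)) = single g s * single (r c) 1 := by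
      rw [iot_single, single_mul_single, single_mul_single, hh]
      simp
    rw [← mul_smul, e1, mul_smul, hl2, ← mul_smul, e2, mul_smul]
  · have key : f.toAddMonoidHom.comp h0 = AddMonoidHom.id _ := Wd.hom_ext (fun c y => by
      show f (h0 (Wd.sg c y)) = Wd.sg c y
      rw [h0s, map_smul, hl1, Wd.single_smul, ← mul_smul, single_mul_single]
      have h5 : (QuotientGroup.mk (r c) : Γ ⧸ φ.range) = c := Quotient.out_eq _
      have h6 : (r c • (QuotientGroup.mk 1 : Γ ⧸ φ.range)) = c := by
        conv_rhs => rw [← h5]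
        show QuotientGroup.mk (r c * 1) = _
        rw [mul_one]
      rw [h6]
      simp)
    ext1 u
    exact DFunLike.congr_fun key u
end
end GW

namespace GW
open Classical SkewMonoidAlgebra
universe w

section
variable {S H : Type*} [CommRing S] [Group H] [MulSemiringAction H S] {X : Type*} [MulAction H X]

lemma Wd.lap_inj (Y : Type*) [AddCommGroup Y] [Module (SkewMonoidAlgebra S H) Y] (θ : X → X) (hθ : ∀ (g : H) x, θ (g • x) = g • θ x)
    (pt : ℤ → X) (hpt : Function.Bijective pt) (hs : ∀ i, θ (pt i) = pt (i+1)) :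
    Function.Injective (LinearMap.id - Wd.mapX S Y θ hθ : Wd X Y →ₗ[SkewMonoidAlgebra S H] Wd X Y) := by
  rw [← LinearMap.ker_eq_bot, LinearMap.ker_eq_bot']
  intro u hu
  have h1 : u = Finsupp.mapDomain θ u := sub_eq_zero.1 hu
  clear hu
  revert u
  suffices ∀ u : X →₀ Y, u = Finsupp.mapDomain θ u → u = 0 from this
  intro u h1
  have hinj : Function.Injective θ := by
    intro a b hab
    obtain ⟨i, rfl⟩ := hpt.2 a
    obtain ⟨j, rfl⟩ := hpt.2 b
    rw [hs, hs] at hab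
    have := hpt.1 hab
    congr 1; omega
  have h2 : ∀ i, u (pt (i+1)) = u (pt i) := by
    intro i
    conv_lhs => rw [h1, ← hs, Finsupp.mapDomain_apply hinj]
  have h3 : ∀ i, u (pt i) = u (pt 0) := by
    intro i
    induction i using Int.induction_on with
    | zero => rfl
    | succ i ih => rw [h2, ih]
    | pred i ih => rw [← ih, ← h2, sub_add_cancel]
  by_contra hne
  have h4 : u (pt 0) ≠ 0 := by
    intro h0
    apply hne
    refine Finsupp.ext (fun x => ?_)
    obtain ⟨i, rfl⟩ := hpt.2 x
    rw [h3, h0]; rfl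
  have h5 : Set.range pt ⊆ (u.support : Set X) := by
    rintro _ ⟨i, rfl⟩
    simp only [Finset.mem_coe, Finsupp.mem_support_iff]
    rw [h3]; exact h4
  exact (Set.infinite_range_of_injective hpt.1) ((Finset.finite_toSet _).subset h5)

lemma Wd.lap_ker (Y : Type*) [AddCommGroup Y] [Module (SkewMonoidAlgebra S H) Y] (θ : X → X) (hθ : ∀ (g : H) x, θ (g • x) = g • θ x)
    (pt : ℤ → X) (hpt : Function.Bijective pt) (hs : ∀ i, θ (pt i) = pt (i+1)) :
    LinearMap.ker (Wd.tot S H X Y) = LinearMap.range (LinearMap.id - Wd.mapX S Y θ hθ : Wd X Y →ₗ[SkewMonoidAlgebra S H] Wd X Y) := by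
  set R := LinearMap.range (LinearMap.id - Wd.mapX S Y θ hθ : Wd X Y →ₗ[SkewMonoidAlgebra S H] Wd X Y) with hR
  have a1 : ∀ x y, (Wd.sg x y - Wd.sg (θ x) y : Wd X Y) ∈ R := fun x y => ⟨Wd.sg x y, by
    rw [LinearMap.sub_apply, Wd.mapX_sg]; rfl⟩
  have a2 : ∀ i y, (Wd.sg (pt i) y - Wd.sg (pt 0) y : Wd X Y) ∈ R := by
    intro i y
    induction i using Int.induction_on with
    | zero => rw [sub_self]; exact R.zero_mem
    | succ i ih =>
      have := R.sub_mem ih (a1 (pt i) y)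
      rw [hs] at this
      convert this using 1; abel
    | pred i ih =>
      have := R.add_mem ih (a1 (pt (-i-1)) y)
      rw [hs, sub_add_cancel] at this
      convert this using 1; abel
  have a3 : ∀ u : Wd X Y, u - Wd.sg (pt 0) (Wd.tot S H X Y u) ∈ R := by
    intro u
    let P : Wd X Y → Prop := fun u => u - Wd.sg (pt 0) (Wd.tot S H X Y u) ∈ R
    refine Finsupp.induction_linear (motive := fun u : X →₀ Y => P u) u ?_ ?_ ?_
    · have : (0 : Wd X Y) - Wd.sg (pt 0) (Wd.tot S H X Y 0) ∈ R := by simp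
      exact this
    · suffices ∀ f g : Wd X Y, P f → P g → P (f + g) from this
      intro f g hf hg
      have : (f + g) - Wd.sg (pt 0) (Wd.tot S H X Y (f + g)) ∈ R := by
        rw [map_add, map_add]
        have := R.add_mem hf hg
        convert this using 1; abel
      exact this
    · intro x y
      have : (Wd.sg x y : Wd X Y) - Wd.sg (pt 0) (Wd.tot S H X Y (Wd.sg x y)) ∈ R := by
        rw [Wd.tot_sg]
        obtain ⟨i, rfl⟩ := hpt.2 x
        exact a2 i y
      exact this
  apply le_antisymm
  · intro u hu
    have := a3 u
    rw [LinearMap.mem_ker.1 hu, map_zero, sub_zero] at this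
    exact this
  · rintro _ ⟨u, rfl⟩
    rw [LinearMap.mem_ker, LinearMap.sub_apply, map_sub, sub_eq_zero, LinearMap.id_apply]
    have : (Wd.tot S H X Y).toAddMonoidHom = ((Wd.tot S H X Y).comp (Wd.mapX S Y θ hθ)).toAddMonoidHom := Wd.hom_ext (fun x y => by
      show Wd.tot S H X Y (Wd.sg x y) = Wd.tot S H X Y (Wd.mapX S Y θ hθ (Wd.sg x y))
      rw [Wd.mapX_sg, Wd.tot_sg, Wd.tot_sg])
    exact DFunLike.congr_fun this u

lemma zstep_pt (K : Subgroup H) (t : H) (ht : ∀ x, x ∈ K ↔ t*x*t⁻¹ ∈ K) (hz : ∀ n : ℤ, t^n ∈ K → n = 0)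
    (htop : K ⊔ Subgroup.zpowers t = ⊤) : ∃ (θ : H ⧸ K → H ⧸ K) (pt : ℤ → H ⧸ K), (∀ (g : H) x, θ (g • x) = g • θ x) ∧
      Function.Bijective pt ∧ ∀ i, θ (pt i) = pt (i+1) := by
  have ht' : ∀ x, x ∈ K ↔ t⁻¹*x*t ∈ K := fun x => by
    rw [ht (t⁻¹*x*t)]; simp [mul_assoc]
  have hn : K.Normal := by
    rw [← Subgroup.normalizer_eq_top_iff, eq_top_iff, ← htop]
    refine sup_le Subgroup.le_normalizer ?_
    rw [Subgroup.zpowers_le, Subgroup.mem_normalizer_iff]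
    exact ht
  refine ⟨Quotient.map' (fun g => g * t) ?_, fun i => QuotientGroup.mk (t^i), ?_, ⟨?_, ?_⟩, ?_⟩
  · intro a b hab
    rw [QuotientGroup.leftRel_apply] at hab ⊢
    have := (ht' _).1 hab
    simpa [mul_assoc] using this
  · intro g x
    induction x using QuotientGroup.induction_on with
    | H x =>
      show QuotientGroup.mk (g * x * t) = QuotientGroup.mk (g * (x * t))
      rw [mul_assoc]
  · intro i j hij
    have := QuotientGroup.eq.1 hij
    rw [← zpow_neg, ← zpow_add] at this
    have := hz _ this
    omega
  · intro x
    induction x using QuotientGroup.induction_on with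
    | H x =>
      have hx : x ∈ K ⊔ Subgroup.zpowers t := by rw [htop]; trivial
      rw [sup_comm, Subgroup.mem_sup_of_normal_right] at hx
      obtain ⟨_, ⟨i, rfl⟩, y, hy, rfl⟩ := hx
      refine ⟨i, QuotientGroup.eq.2 ?_⟩
      simpa using hy
  · intro i
    show QuotientGroup.mk (t^i * t) = _
    simp only [zpow_add_one]
end
end GW

namespace GW
open Classical SkewMonoidAlgebra
universe w

section
variable {S H H' Γ : Type*} [CommRing S] [Group H] [MulSemiringAction H S] [Group H'] [MulSemiringAction H' S] [Group Γ] [MulSemiringAction Γ S]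

lemma z_step (φ : H' →* Γ) (hφ : ∀ (h : H') (s : S), h • s = φ h • s) (hinj : Function.Injective φ)
    (ψ : H →* H') (hψ : ∀ (h : H) (s : S), h • s = ψ h • s)
    (t : H') (ht : ∀ x, x ∈ ψ.range ↔ t*x*t⁻¹ ∈ ψ.range) (hz : ∀ n : ℤ, t^n ∈ ψ.range → n = 0)
    (htop : ψ.range ⊔ Subgroup.zpowers t = ⊤) (Y : Type w) [AddCommGroup Y] [Module (SkewMonoidAlgebra S Γ) Y]
    (hY : ProjVia ((iot φ hφ).comp (iot ψ hψ)) Y) : PDm (iot φ hφ) 1 Y := by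
  intro F _ _ hF g hg
  have hF' := projVia_of_projective (iot φ hφ) (projVia_iot φ hφ hinj) F hF
  show ProjVia (iot φ hφ) (LinearMap.ker g)
  unfold ProjVia at hF' hY ⊢
  let _ : Module (SkewMonoidAlgebra S H') Y := Module.compHom _ (iot φ hφ)
  let _ : Module (SkewMonoidAlgebra S H') F := Module.compHom _ (iot φ hφ)
  let m3 : Module (SkewMonoidAlgebra S H') (LinearMap.ker g) := Module.compHom _ (iot φ hφ)
  have hY' : ProjVia (iot ψ hψ) Y := hY
  have hE := Wd_projective ψ hψ Y hY'
  obtain ⟨θ, pt, h1, h2, h3⟩ := zstep_pt ψ.range t ht hz htop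
  let g' : F →ₗ[SkewMonoidAlgebra S H'] Y := { toFun := g, map_add' := g.map_add, map_smul' := fun b y => g.map_smul (iot φ hφ b) y }
  have key := schanuel _ _ (Wd.lap_inj (S := S) Y θ h1 pt h2 h3) (fun y => ⟨Wd.sg (pt 0) y, Wd.tot_sg _ _⟩) (Wd.lap_ker (S := S) Y θ h1 pt h2 h3) g' hg
  let e : LinearMap.ker g' ≃ₗ[SkewMonoidAlgebra S H'] LinearMap.ker g :=
    { toFun := fun x => ⟨x.1, x.2⟩, invFun := fun x => ⟨x.1, x.2⟩, map_add' := fun _ _ => rfl, map_smul' := fun _ _ => rfl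
      left_inv := fun _ => rfl, right_inv := fun _ => rfl }
  exact Module.Projective.of_equiv e

/-- skew ring of a trivial group -/
noncomputable def sBot (S H : Type*) [CommRing S] [Group H] [MulSemiringAction H S] [Subsingleton H] : S ≃+* SkewMonoidAlgebra S H :=
  RingEquiv.ofBijective (singleOneRingHom (k := S) (G := H)) (by
    constructor
    · intro a b h
      exact single_injective 1 h
    · intro x
      refine SkewMonoidAlgebra.induction_on' (p := fun x => ∃ a, singleOneRingHom (k := S) (G := H) a = x) x ?_ ?_
      · intro g s
        exact ⟨s, by rw [Subsingleton.elim g 1]; rfl⟩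
      · rintro a b ⟨x, rfl⟩ ⟨y, rfl⟩
        exact ⟨x+y, map_add _ _ _⟩)

/-- inclusion of the skew ring of a subgroup -/
noncomputable def ioK (S : Type*) {Γ : Type*} [CommRing S] [Group Γ] [MulSemiringAction Γ S] (K : Subgroup Γ) : SkewMonoidAlgebra S K →+* SkewMonoidAlgebra S Γ :=
  iot K.subtype (fun _ _ => rfl)

lemma ladder (hS : ∃ d, ∀ (Y : Type w) [AddCommGroup Y] [Module S Y], PDm (RingHom.id S) d Y) (K : Subgroup Γ) (hK : PZ K) :
    ∃ d, ∀ (Y : Type w) [AddCommGroup Y] [Module (SkewMonoidAlgebra S Γ) Y], PDm (ioK S K) d Y := by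
  induction hK with
  | bot =>
    obtain ⟨d, hd⟩ := hS
    have h1 := PDm_transport (sBot S (⊥ : Subgroup Γ)) d hd
    refine ⟨d, fun Y _ _ => ?_⟩
    have := PDm_mono_hom (RingHom.id _) (ioK S (⊥ : Subgroup Γ)) (projVia_iot _ _ (Subgroup.subtype_injective _)) d Y (@h1 Y _ (Module.compHom Y (ioK S (⊥ : Subgroup Γ))))
    exact this
  | step K t _ hn hz ih =>
    obtain ⟨d, hd⟩ := ih
    have hle : K ≤ K ⊔ Subgroup.zpowers t := le_sup_left
    have htm : t ∈ K ⊔ Subgroup.zpowers t := Subgroup.mem_sup_right (Subgroup.mem_zpowers t)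
    have hr : ∀ x : ↥(K ⊔ Subgroup.zpowers t), x ∈ (Subgroup.inclusion hle).range ↔ (x : Γ) ∈ K := by
      intro x
      constructor
      · rintro ⟨y, rfl⟩; exact y.2
      · intro h; exact ⟨⟨x, h⟩, rfl⟩
    have hcomp : ioK S K = (ioK S (K ⊔ Subgroup.zpowers t)).comp (iot (Subgroup.inclusion hle) (fun _ _ => rfl)) :=
      iot_comp (K ⊔ Subgroup.zpowers t).subtype (fun _ _ => rfl) (Subgroup.inclusion hle) (fun _ _ => rfl) (fun _ _ => rfl)
    refine ⟨d+1, fun Y _ _ => ?_⟩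
    refine PDm_step (ioK S K) (ioK S (K ⊔ Subgroup.zpowers t)) ?_ d Y (hd Y)
    intro Y _ _ hY
    rw [hcomp] at hY
    refine z_step (K ⊔ Subgroup.zpowers t).subtype (fun _ _ => rfl) (Subgroup.subtype_injective _) (Subgroup.inclusion hle) (fun _ _ => rfl) ⟨t, htm⟩ ?_ ?_ ?_ Y hY
    · intro x
      rw [hr, hr]; exact hn x
    · intro n hn'
      rw [hr] at hn'
      exact hz n (by simpa using hn')
    · rw [eq_top_iff]
      rintro ⟨x, hx⟩ _
      have h1 : Subgroup.map (K ⊔ Subgroup.zpowers t).subtype ((Subgroup.inclusion hle).range ⊔ Subgroup.zpowers ⟨t, htm⟩) = K ⊔ Subgroup.zpowers t := by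
        rw [Subgroup.map_sup, MonoidHom.map_zpowers, MonoidHom.map_range]
        congr 1
        exact Subgroup.range_subtype K
      have h2 := hx
      rw [← h1] at h2
      obtain ⟨y, hy, hy2⟩ := h2
      have : y = ⟨x, hx⟩ := Subtype.ext hy2
      rw [← this]; exact hy

lemma fin_step (N : Subgroup Γ) [N.FiniteIndex] (s0 : S) (hs0 : (N.index : S) * s0 = 1) (Y : Type w) [AddCommGroup Y] [Module (SkewMonoidAlgebra S Γ) Y]
    (hY : ProjVia (ioK S N) Y) : Module.Projective (SkewMonoidAlgebra S Γ) Y := by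
  have hE := Wd_projective N.subtype (fun _ _ => rfl) Y hY
  have hr : N.subtype.range = N := N.range_subtype
  rw [hr] at hE
  have hfix : ∀ g : Γ, g • s0 = s0 := by
    intro g
    have h1 : (N.index : S) * (g • s0) = 1 := by
      have := congrArg (fun x => g • x) hs0
      simp only [smul_mul', smul_one] at this
      have h2 : g • (N.index : S) = N.index := map_natCast (MulSemiringAction.toRingHom Γ S g) _
      rwa [h2] at this
    calc g • s0 = (s0 * N.index) * (g • s0) := by rw [mul_comm s0, hs0, one_mul]
      _ = s0 := by rw [mul_assoc, h1, mul_one]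
  let _ : Fintype (Γ ⧸ N) := Fintype.ofFinite _
  let z : SkewMonoidAlgebra S Γ := single 1 s0
  have hz : ∀ (g : Γ) (s : S), z * single g s = single g s * z := by
    intro g s
    simp only [z]
    rw [single_mul_single, single_mul_single, hfix, one_smul, one_mul, mul_one, mul_comm]
  let i0 : Y →+ Wd (Γ ⧸ N) Y := ∑ c : Γ ⧸ N, (Wd.sg c).comp (DistribSMul.toAddMonoidHom Y z)
  have hi0 : ∀ y, i0 y = ∑ c : Γ ⧸ N, Wd.sg c (z • y) := fun y => by
    simp only [i0, AddMonoidHom.finsetSum_apply]; rfl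
  let i : Y →ₗ[SkewMonoidAlgebra S Γ] Wd (Γ ⧸ N) Y := { i0 with
    map_smul' := (by
      intro a y
      show i0 (a • y) = a • i0 y
      refine SkewMonoidAlgebra.induction_on' (p := fun a => i0 (a • y) = a • i0 y) a ?_ ?_
      · intro g s
        rw [hi0, hi0, Finset.smul_sum]
        rw [← Equiv.sum_comp (MulAction.toPerm g)]
        refine Finset.sum_congr rfl (fun c _ => ?_)
        rw [Wd.single_smul, ← mul_smul, ← mul_smul, hz]
        rfl
      · intro a b ha hb
        rw [add_smul, map_add, ha, hb, add_smul]) }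
  refine Module.Projective.of_split i (Wd.tot S Γ (Γ ⧸ N) Y) ?_
  ext1 y
  show Wd.tot S Γ (Γ ⧸ N) Y (i0 y) = y
  rw [hi0, _root_.map_sum]
  simp only [Wd.tot_sg]
  rw [Finset.sum_const, Finset.card_univ, ← Nat.card_eq_fintype_card, ← Subgroup.index, ← Nat.cast_smul_eq_nsmul (SkewMonoidAlgebra S Γ), ← mul_smul]
  have : ((N.index : SkewMonoidAlgebra S Γ) * z) = 1 := by
    have h1 : (N.index : SkewMonoidAlgebra S Γ) = single 1 (N.index : S) := (map_natCast (singleOneRingHom (k := S) (G := Γ)) _).symm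
    rw [h1, single_mul_single, one_smul, one_mul, hs0]; rfl
  rw [this, one_smul]

theorem gldim (hS : ∃ d, ∀ (Y : Type w) [AddCommGroup Y] [Module S Y], PDm (RingHom.id S) d Y) (N : Subgroup Γ) (hN : PZ N) [N.FiniteIndex]
    (s0 : S) (hs0 : (N.index : S) * s0 = 1) :
    ∃ d, ∀ (Y : Type w) [AddCommGroup Y] [Module (SkewMonoidAlgebra S Γ) Y], PDm (RingHom.id (SkewMonoidAlgebra S Γ)) d Y := by
  obtain ⟨d, hd⟩ := ladder hS N hN
  refine ⟨d, fun Y _ _ => PDm_step0 (ioK S N) _ ?_ d Y (hd Y)⟩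
  intro Y _ _ hY
  have := fin_step N s0 hs0 Y hY
  exact this
end
end GW

namespace GW
open Classical
universe w

lemma sum_fixed {X M : Type*} [Fintype X] [CommRing M] (p n : ℕ) [Fact p.Prime] [CharP M p] (f : X → X) (hf : f^[p^n] = id)
    (Φ : X → M) (hΦ : ∀ x, Φ (f x) = Φ x) : ∑ x, Φ x = ∑ x with f x = x, Φ x := by
  have h1 : ∀ s : Finset X, ∑ x ∈ s, Φ x = ∑ v ∈ Finset.univ.image Φ, ((s.filter (fun x => Φ x = v)).card : M) * v := by
    intro s
    rw [← Finset.sum_fiberwise_of_maps_to (t := Finset.univ.image Φ) (g := Φ) (s := s) (fun x _ => Finset.mem_image_of_mem _ (Finset.mem_univ x))]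
    refine Finset.sum_congr rfl (fun v _ => ?_)
    rw [Finset.sum_congr rfl (g := fun _ => v) (fun x hx => (Finset.mem_filter.1 hx).2), Finset.sum_const, nsmul_eq_mul]
  rw [h1, h1]
  refine Finset.sum_congr rfl (fun v _ => ?_)
  congr 1
  let fv : Function.End {x // Φ x = v} := fun x => ⟨f x.1, by rw [hΦ, x.2]⟩
  have hit : ∀ m (x : {x // Φ x = v}), ((fv ^ m) x).1 = f^[m] x.1 := by
    intro m
    induction m with
    | zero => intro x; rfl
    | succ m ih =>
      intro x
      rw [pow_succ]
      show ((fv ^ m) (fv x)).1 = f^[m] (f x.1)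
      rw [ih]
  have hfv : fv ^ p ^ n = 1 := by
    funext x
    apply Subtype.ext
    rw [hit, hf]; rfl
  have := Equiv.Perm.card_fixedPoints_modEq hfv
  have h2 := (CharP.cast_eq_iff_mod_eq M p).2 this
  have h3 : Fintype.card {x // Φ x = v} = (Finset.univ.filter (fun x => Φ x = v)).card := Fintype.card_subtype _
  rw [← h3, h2]
  congr 1
  rw [← Fintype.card_coe]
  refine Fintype.card_congr ⟨fun x => ⟨x.1.1, ?_⟩, fun x => ⟨⟨x.1, ?_⟩, ?_⟩, fun _ => rfl, fun _ => rfl⟩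
  · have := x.2
    simp only [Finset.mem_filter, Finset.mem_univ, true_and]
    exact ⟨congrArg Subtype.val this, x.1.2⟩
  · have := x.2
    simp only [Finset.mem_filter, Finset.mem_univ, true_and] at this
    exact this.2
  · have := x.2
    simp only [Finset.mem_filter, Finset.mem_univ, true_and] at this
    exact Subtype.ext this.1

lemma sum_pow_words {A I : Type*} [Ring A] [Fintype I] (a : I → A) : ∀ n : ℕ, (∑ i, a i)^n = ∑ w : Fin n → I, (List.ofFn (fun j => a (w j))).prod
  | 0 => by simp
  | n+1 => by
    rw [pow_succ', sum_pow_words a n, ← Equiv.sum_comp (Fin.consEquiv (fun _ => I)), Fintype.sum_prod_type, Finset.sum_mul]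
    refine Finset.sum_congr rfl (fun i _ => ?_)
    rw [Finset.mul_sum]
    refine Finset.sum_congr rfl (fun w _ => ?_)
    simp [List.ofFn_succ, Fin.consEquiv]

lemma word_rot {A M : Type*} [Ring A] [AddCommMonoid M] (φ : A →+ M) (hφ : ∀ x y, φ (x*y) = φ (y*x)) (n : ℕ) (b : Fin (n+1) → A) :
    φ (List.ofFn (fun j => b (j+1))).prod = φ (List.ofFn b).prod := by
  rw [List.ofFn_succ' (f := fun j => b (j+1)), List.ofFn_succ (f := b), List.prod_concat, List.prod_cons, hφ]
  simp

open scoped Fin.NatCast Fin.CommRing in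
lemma tr_pow {A I M : Type*} [Ring A] [Fintype I] [CommRing M] (p s : ℕ) [Fact p.Prime] [CharP M p] (φ : A →+ M) (hφ : ∀ x y, φ (x*y) = φ (y*x)) (a : I → A) :
    φ ((∑ i, a i)^(p^s)) = ∑ i, φ (a i ^ (p^s)) := by
  have hp : 0 < p := (Fact.out : p.Prime).pos
  obtain ⟨n, hn⟩ : ∃ n, p^s = n+1 := ⟨p^s-1, by have := Nat.pow_pos (n := s) hp; omega⟩
  rw [sum_pow_words, map_sum]
  have key : ∀ q, q = p^s → q = n+1 → ∑ w : Fin q → I, φ (List.ofFn (fun j => a (w j))).prod = ∑ i, φ (a i ^ q) := by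
    intro q hq hq'
    subst hq'
    let f : (Fin (n+1) → I) → (Fin (n+1) → I) := fun w j => w (j+1)
    have hit : ∀ m w j, f^[m] w j = w (j + (m : Fin (n+1))) := by
      intro m
      induction m with
      | zero => intro w j; simp
      | succ m ih =>
        intro w j
        rw [Function.iterate_succ_apply, ih]
        show w (_ + 1) = _
        congr 1; push_cast; ring
    have hf : f^[p^s] = id := by
      funext w j
      rw [hit, ← hq]; simp
    rw [sum_fixed p s f hf _ (fun w => word_rot φ hφ n (fun j => a (w j)))]
    refine Finset.sum_bij' (fun w _ => w 0) (fun i _ => fun _ => i) (fun _ _ => Finset.mem_univ _) (fun i _ => by simp [f]) ?_ (fun _ _ => rfl) ?_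
    · intro w hw
      have hw' : f w = w := by simpa using hw
      funext j
      have h1 : f^[(j:ℕ)] w = w := Function.iterate_fixed hw' _
      have := congrFun h1 0
      rw [hit] at this
      simpa using this.symm
    · intro w hw
      have hw' : f w = w := by simpa using hw
      have : ∀ j, w j = w 0 := by
        intro j
        have h1 : f^[(j:ℕ)] w = w := Function.iterate_fixed hw' _
        have := congrFun h1 0
        rw [hit] at this
        simpa using this
      simp only [this, List.ofFn_const, List.prod_replicate]
  exact key _ rfl hn
end GW

namespace GW
open Classical
universe w

section
variable {K Γ : Type*} [CommRing K] [Group Γ]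

/-- functional attached to a function on the group -/
noncomputable def cT (χ : Γ → K) : MonoidAlgebra K Γ →+ K :=
  (Finsupp.liftAddHom (fun g => AddMonoidHom.mulRight (χ g))).comp (MonoidAlgebra.coeffAddEquiv (R := K) (M := Γ)).toAddMonoidHom

lemma cT_single (χ : Γ → K) (g : Γ) (c : K) : cT χ (MonoidAlgebra.single g c) = c * χ g :=
  Finsupp.liftAddHom_apply_single _ _ _

lemma cT_apply (χ : Γ → K) (x : MonoidAlgebra K Γ) : cT χ x = ∑ g ∈ x.coeff.support, x.coeff g * χ g := rfl

lemma cT_mul_comm (χ : Γ → K) (hχ : ∀ g h, χ (g*h) = χ (h*g)) (x y : MonoidAlgebra K Γ) : cT χ (x*y) = cT χ (y*x) := by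
  have : ((AddMonoidHom.mul (R := MonoidAlgebra K Γ)).compr₂ (cT χ)) = ((AddMonoidHom.mul (R := MonoidAlgebra K Γ)).compr₂ (cT χ)).flip := by
    refine MonoidAlgebra.addMonoidHom_ext (fun g c => MonoidAlgebra.addMonoidHom_ext (fun h d => ?_))
    show cT χ (MonoidAlgebra.single g c * MonoidAlgebra.single h d) = cT χ (MonoidAlgebra.single h d * MonoidAlgebra.single g c)
    rw [MonoidAlgebra.single_mul_single, MonoidAlgebra.single_mul_single, cT_single, cT_single, hχ, mul_comm c]
  exact DFunLike.congr_fun (DFunLike.congr_fun this x) y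

/-- trace functional on matrices -/
noncomputable def mT {I : Type*} [Fintype I] (χ : Γ → K) : Matrix I I (MonoidAlgebra K Γ) →+ K :=
  (cT χ).comp (Matrix.traceAddMonoidHom I (MonoidAlgebra K Γ))

lemma mT_apply {I : Type*} [Fintype I] (χ : Γ → K) (M : Matrix I I (MonoidAlgebra K Γ)) : mT χ M = ∑ i, cT χ (M i i) := by
  show cT χ (∑ i, M i i) = _
  rw [map_sum]

lemma mT_mul_comm {I : Type*} [Fintype I] (χ : Γ → K) (hχ : ∀ g h, χ (g*h) = χ (h*g)) (x y : Matrix I I (MonoidAlgebra K Γ)) : mT χ (x*y) = mT χ (y*x) := by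
  rw [mT_apply, mT_apply]
  simp only [Matrix.mul_apply, map_sum]
  rw [Finset.sum_comm]
  refine Finset.sum_congr rfl (fun i _ => Finset.sum_congr rfl (fun j _ => cT_mul_comm χ hχ _ _))

/-- indicator of a conjugacy class -/
noncomputable def clsI (K : Type*) [CommRing K] {Γ : Type*} [Group Γ] (c : ConjClasses Γ) : Γ → K := fun g => if ConjClasses.mk g = c then 1 else 0

lemma conj_mul_comm (g h : Γ) : ConjClasses.mk (g*h) = ConjClasses.mk (h*g) := by
  rw [ConjClasses.mk_eq_mk_iff_isConj, isConj_iff]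
  exact ⟨h, by group⟩

lemma clsI_comm (c : ConjClasses Γ) (g h : Γ) : clsI K c (g*h) = clsI K c (h*g) := by
  unfold clsI; rw [conj_mul_comm]

lemma single_pow_ne {R I : Type*} [Ring R] [Fintype I] (i j : I) (h : i ≠ j) (r : R) (n : ℕ) (hn : 2 ≤ n) : (Matrix.single i j r)^n = 0 := by
  obtain ⟨m, rfl⟩ : ∃ m, n = m + 2 := ⟨n-2, by omega⟩
  rw [pow_add, pow_two, Matrix.single_mul_single_of_ne, mul_zero]
  exact h.symm

lemma single_pow_eq {R I : Type*} [Ring R] [Fintype I] (i : I) (r : R) : ∀ (n : ℕ), (Matrix.single i i r)^(n+1) = Matrix.single i i (r^(n+1))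
  | 0 => by simp
  | n+1 => by rw [pow_succ, single_pow_eq i r n, Matrix.single_mul_single_same, ← pow_succ]

lemma formanek_p {I : Type*} [Fintype I] (p : ℕ) [Fact p.Prime] [CharP K p]
    (hT : ∀ (h u : Γ) (r : ℕ), 2 ≤ r → u * h^r * u⁻¹ = h → h = 1)
    (e : Matrix I I (MonoidAlgebra K Γ)) (he : e * e = e) (c : ConjClasses Γ) (hc : c ≠ ConjClasses.mk 1) : mT (clsI K c) e = 0 := by
  have hp : p.Prime := Fact.out
  by_contra hne
  let F : Finset Γ := Finset.univ.biUnion (fun i => Finset.univ.biUnion (fun j => (e i j).coeff.support))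
  let a : I × I × F → Matrix I I (MonoidAlgebra K Γ) := fun x => Matrix.single x.1 x.2.1 (MonoidAlgebra.single x.2.2.1 ((e x.1 x.2.1).coeff x.2.2.1))
  have ha : e = ∑ x, a x := by
    conv_lhs => rw [Matrix.matrix_eq_sum_single e]
    rw [Fintype.sum_prod_type]
    refine Finset.sum_congr rfl (fun i _ => ?_)
    rw [Fintype.sum_prod_type]
    refine Finset.sum_congr rfl (fun j _ => ?_)
    have h1 : e i j = ∑ g : F, MonoidAlgebra.single g.1 ((e i j).coeff g.1) := by
      conv_lhs => rw [← MonoidAlgebra.sum_coeff_single (e i j)]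
      rw [Finsupp.sum]
      rw [Finset.sum_coe_sort F (fun g => MonoidAlgebra.single g ((e i j).coeff g))]
      refine Finset.sum_subset ?_ ?_
      · intro g hg
        exact Finset.mem_biUnion.2 ⟨i, Finset.mem_univ _, Finset.mem_biUnion.2 ⟨j, Finset.mem_univ _, hg⟩⟩
      · intro g _ hg
        rw [Finsupp.notMem_support_iff.1 hg, MonoidAlgebra.single_zero]
    conv_lhs => rw [h1]
    exact map_sum (Matrix.singleAddMonoidHom i j) _ _
  have hpow : ∀ n, e^(n+1) = e := by
    intro n
    induction n with
    | zero => simp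
    | succ n ih => rw [pow_succ, ih, he]
  have hex : ∀ s : ℕ, ∃ g : F, ConjClasses.mk (g.1^(p^(s+1))) = c := by
    intro s
    obtain ⟨n, hn⟩ : ∃ n, p^(s+1) = n+1 := ⟨p^(s+1)-1, by have := Nat.pow_pos (n := s+1) hp.pos; omega⟩
    have h2 : 2 ≤ p^(s+1) := le_trans hp.two_le (Nat.le_self_pow (by omega) p)
    have h1 := tr_pow p (s+1) (mT (clsI K c)) (mT_mul_comm _ (clsI_comm c)) a
    rw [← ha, hn, hpow] at h1
    rw [h1] at hne
    obtain ⟨⟨i, j, g⟩, _, hx⟩ := Finset.exists_ne_zero_of_sum_ne_zero hne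
    by_cases hij : i = j
    · subst hij
      simp only [a] at hx
      rw [single_pow_eq, MonoidAlgebra.single_pow, mT_apply, Finset.sum_eq_single i] at hx
      · rw [Matrix.single_apply_same, cT_single] at hx
        refine ⟨g, ?_⟩
        by_contra h3
        apply hx
        rw [hn] at h3
        rw [clsI, if_neg h3, mul_zero]
      · intro j _ hj
        rw [Matrix.single_apply_of_ne, map_zero]
        intro h; exact hj h.1.symm
      · intro h; exact (h (Finset.mem_univ _)).elim
    · simp only [a] at hx
      rw [single_pow_ne _ _ hij _ _ (by omega), map_zero] at hx
      exact (hx rfl).elim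
  choose f hf using hex
  obtain ⟨s, s', hss, hfe⟩ := Finite.exists_ne_map_eq_of_infinite f
  wlog hlt : s < s' generalizing s s'
  · exact this s' s hss.symm hfe.symm (by omega)
  obtain ⟨d, rfl⟩ : ∃ d, s' = s + (d+1) := ⟨s' - s - 1, by omega⟩
  have h1 := hf s
  have h2 := hf (s+(d+1))
  rw [← hfe] at h2
  have h3 : (f s).1 ^ (p^(s+(d+1)+1)) = ((f s).1^(p^(s+1)))^(p^(d+1)) := by
    rw [← pow_mul, ← pow_add]; congr 2; ring
  rw [h3, ← h1, ConjClasses.mk_eq_mk_iff_isConj, isConj_iff] at h2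
  obtain ⟨u, hu⟩ := h2
  have := hT _ u _ (le_trans hp.two_le (Nat.le_self_pow (by omega) p)) hu
  rw [this] at h1
  exact hc h1.symm
end

lemma int_jacobson : IsJacobsonRing ℤ := by
  rw [isJacobsonRing_iff_prime_eq]
  intro P hP
  by_cases h : P = ⊥
  · subst h
    rw [eq_bot_iff]
    intro x hx
    rw [Ideal.mem_jacobson_bot] at hx
    have := Int.isUnit_iff.1 (hx 3)
    rw [Ideal.mem_bot]
    omega
  · have := hP.isMaximal h
    exact Ideal.jacobson_eq_self_of_isMaximal

lemma exists_charP_quot (Λ : Type*) [CommRing Λ] [Nontrivial Λ] [Algebra.FiniteType ℤ Λ] : ∃ (m : Ideal Λ) (_ : m.IsMaximal) (p : ℕ), p.Prime ∧ CharP (Λ ⧸ m) p := by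
  obtain ⟨m, hm⟩ := Ideal.exists_maximal Λ
  refine ⟨m, hm, ?_⟩
  let _ : Field (Λ ⧸ m) := Ideal.Quotient.field m
  have := int_jacobson
  have h1 : Module.Finite ℤ (Λ ⧸ m) := finite_of_finite_type_of_isJacobsonRing ℤ (Λ ⧸ m)
  obtain ⟨p, hp⟩ := CharP.exists (Λ ⧸ m)
  refine ⟨p, ?_, hp⟩
  rcases CharP.char_is_prime_or_zero (Λ ⧸ m) p with h | h
  · exact h
  · subst h
    have : CharZero (Λ ⧸ m) := CharP.charP_to_charZero _
    exfalso
    have hf : IsField ℤ := isField_of_isIntegral_of_isField (R := ℤ) (S := Λ ⧸ m) (FaithfulSMul.algebraMap_injective ℤ (Λ ⧸ m)) (Field.toIsField _)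
    exact Int.not_isField hf

theorem formanek {k Γ I : Type*} [Field k] [CharZero k] [Group Γ] [Fintype I]
    (hT : ∀ (h u : Γ) (r : ℕ), 2 ≤ r → u * h^r * u⁻¹ = h → h = 1)
    (e : Matrix I I (MonoidAlgebra k Γ)) (he : e * e = e) (c : ConjClasses Γ) (hc : c ≠ ConjClasses.mk 1) : mT (clsI k c) e = 0 := by
  by_contra hne
  let T : Finset k := insert (mT (clsI k c) e)⁻¹ (Finset.univ.biUnion (fun i => Finset.univ.biUnion (fun j => (e i j).coeff.support.image (e i j).coeff)))
  let Λ := Algebra.adjoin ℤ (T : Set k)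
  have hft : Algebra.FiniteType ℤ Λ := by
    rw [← Subalgebra.fg_iff_finiteType]
    exact ⟨T, rfl⟩
  have hmem : ∀ i j g, (e i j).coeff g ∈ Λ := by
    intro i j g
    by_cases h0 : (e i j).coeff g = 0
    · rw [h0]; exact Λ.zero_mem
    · refine Algebra.subset_adjoin (Finset.mem_insert_of_mem (Finset.mem_biUnion.2 ⟨i, Finset.mem_univ _, Finset.mem_biUnion.2 ⟨j, Finset.mem_univ _, ?_⟩⟩))
      exact Finset.mem_image_of_mem _ (Finsupp.mem_support_iff.2 h0)
  have hinv : (mT (clsI k c) e)⁻¹ ∈ Λ := Algebra.subset_adjoin (Finset.mem_insert_self _ _)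
  let e1 : Matrix I I (MonoidAlgebra Λ Γ) := fun i j => ∑ g ∈ (e i j).coeff.support, MonoidAlgebra.single g ⟨(e i j).coeff g, hmem i j g⟩
  let ι : MonoidAlgebra Λ Γ →+* MonoidAlgebra k Γ := MonoidAlgebra.mapRingHom Γ Λ.val.toRingHom
  have hι : Function.Injective ι := by
    intro x y hxy
    ext g
    have := congrArg (fun z => z.coeff g) hxy
    simpa [ι] using this
  have hmap : e1.map ι = e := by
    ext1 i j
    rw [Matrix.map_apply]
    simp only [e1]
    rw [map_sum]
    conv_rhs => rw [← MonoidAlgebra.sum_coeff_single (e i j)]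
    refine Finset.sum_congr rfl (fun g _ => ?_)
    simp [ι]
  have he1 : e1 * e1 = e1 := by
    have h1 : (e1 * e1).map ι = e1.map ι := by
      rw [Matrix.map_mul, hmap, he]
    exact Matrix.map_injective hι h1
  have htr : ((mT (clsI Λ c) e1 : Λ) : k) = mT (clsI k c) e := by
    rw [← hmap, mT_apply, mT_apply]
    push_cast
    refine Finset.sum_congr rfl (fun i _ => ?_)
    rw [Matrix.map_apply]
    have : (Λ.val.toRingHom.toAddMonoidHom).comp (cT (clsI Λ c)) = (cT (clsI k c)).comp ι.toAddMonoidHom := by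
      refine MonoidAlgebra.addMonoidHom_ext (fun g d => ?_)
      show ((cT (clsI Λ c) (MonoidAlgebra.single g d) : Λ) : k) = cT (clsI k c) (ι (MonoidAlgebra.single g d))
      simp only [ι, MonoidAlgebra.mapRingHom_single, cT_single, clsI]
      split_ifs <;> simp
    exact DFunLike.congr_fun this (e1 i i)
  obtain ⟨m, hm, p, hp, hcp⟩ := exists_charP_quot Λ
  have : Fact p.Prime := ⟨hp⟩
  let π : MonoidAlgebra Λ Γ →+* MonoidAlgebra (Λ ⧸ m) Γ := MonoidAlgebra.mapRingHom Γ (Ideal.Quotient.mk m)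
  have h0 := formanek_p (K := Λ ⧸ m) p hT (e1.map π) (by rw [← Matrix.map_mul, he1]) c hc
  have htr2 : mT (clsI (Λ ⧸ m) c) (e1.map π) = Ideal.Quotient.mk m (mT (clsI Λ c) e1) := by
    rw [mT_apply, mT_apply, map_sum]
    refine Finset.sum_congr rfl (fun i _ => ?_)
    rw [Matrix.map_apply]
    have : (Ideal.Quotient.mk m).toAddMonoidHom.comp (cT (clsI Λ c)) = (cT (clsI (Λ ⧸ m) c)).comp π.toAddMonoidHom := by
      refine MonoidAlgebra.addMonoidHom_ext (fun g d => ?_)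
      show Ideal.Quotient.mk m (cT (clsI Λ c) (MonoidAlgebra.single g d)) = cT (clsI (Λ ⧸ m) c) (π (MonoidAlgebra.single g d))
      simp only [π, MonoidAlgebra.mapRingHom_single, cT_single, clsI]
      split_ifs <;> simp
    exact (DFunLike.congr_fun this (e1 i i)).symm
  rw [htr2] at h0
  have h1 : (mT (clsI Λ c) e1 : Λ) * ⟨_, hinv⟩ = 1 := by
    apply Subtype.ext
    show ((mT (clsI Λ c) e1 : Λ) : k) * _ = 1
    rw [htr, mul_inv_cancel₀ hne]
  have h2 := congrArg (Ideal.Quotient.mk m) h1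
  rw [map_mul, h0, zero_mul, map_one] at h2
  let _ : Field (Λ ⧸ m) := Ideal.Quotient.field m
  exact zero_ne_one h2

/-- consequence for arbitrary class functions -/
theorem formanek_class {k Γ I : Type*} [Field k] [CharZero k] [Group Γ] [Fintype I]
    (hT : ∀ (h u : Γ) (r : ℕ), 2 ≤ r → u * h^r * u⁻¹ = h → h = 1)
    (e : Matrix I I (MonoidAlgebra k Γ)) (he : e * e = e) (χ : Γ → k) (hχ : ∀ g u, χ (u*g*u⁻¹) = χ g) :
    mT χ e = χ 1 * mT (fun _ => 1) e := by
  have key : mT (fun g => χ g - χ 1) e = 0 := by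
    let t := Matrix.trace e
    have hm : ∀ χ : Γ → k, mT χ e = ∑ g ∈ t.coeff.support, t.coeff g * χ g := fun χ => cT_apply χ t
    rw [hm, ← Finset.sum_fiberwise_of_maps_to (t := t.coeff.support.image ConjClasses.mk) (g := ConjClasses.mk) (fun x hx => Finset.mem_image_of_mem _ hx)]
    refine Finset.sum_eq_zero (fun c hc => ?_)
    by_cases h1 : c = ConjClasses.mk 1
    · refine Finset.sum_eq_zero (fun g hg => ?_)
      have := (Finset.mem_filter.1 hg).2
      rw [h1, ConjClasses.mk_eq_mk_iff_isConj, isConj_one_left] at this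
      rw [this, sub_self, mul_zero]
    · have h2 := formanek hT e he c h1
      rw [hm] at h2
      obtain ⟨h, rfl⟩ := ConjClasses.exists_rep c
      have h3 : ∀ g ∈ t.coeff.support.filter (fun g => ConjClasses.mk g = ConjClasses.mk h), t.coeff g * (χ g - χ 1) = (t.coeff g * clsI k (ConjClasses.mk h) g) * (χ h - χ 1) := by
        intro g hg
        have hg' := (Finset.mem_filter.1 hg).2
        rw [clsI, if_pos hg', mul_one]
        rw [ConjClasses.mk_eq_mk_iff_isConj, isConj_iff] at hg'
        obtain ⟨u, hu⟩ := hg'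
        rw [← hu, hχ]
      rw [Finset.sum_congr rfl h3, ← Finset.sum_mul, Finset.sum_filter_of_ne, h2, zero_mul]
      intro g _ hne
      by_contra h4
      apply hne
      rw [clsI, if_neg h4, mul_zero]
  have h5 : mT χ e = mT (fun g => χ g - χ 1) e + χ 1 * mT (fun _ => 1) e := by
    let t := Matrix.trace e
    have hm : ∀ χ : Γ → k, mT χ e = ∑ g ∈ t.coeff.support, t.coeff g * χ g := fun χ => cT_apply χ t
    rw [hm, hm, hm, Finset.mul_sum, ← Finset.sum_add_distrib]
    refine Finset.sum_congr rfl (fun g _ => by ring)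
  rw [h5, key, zero_add]
end GW

namespace GW
open Classical
universe w

lemma trace_idem {k J : Type*} [Field k] [Fintype J] (M : Matrix J J k) (hM : M * M = M) :
    Matrix.trace M = (Module.finrank k (LinearMap.range M.vecMulLinear) : k) := by
  have h1 : LinearMap.IsProj (LinearMap.range M.vecMulLinear) M.vecMulLinear := by
    refine ⟨fun x => ⟨x, rfl⟩, ?_⟩
    rintro _ ⟨y, rfl⟩
    simp only [Matrix.vecMulLinear_apply, Matrix.vecMul_vecMul, hM]
  have h2 := h1.trace
  rw [← h2]
  have h3 : M.vecMulLinear = Matrix.toLin' M.transpose := by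
    refine LinearMap.ext fun x => ?_
    rw [Matrix.toLin'_apply, Matrix.mulVec_transpose]; rfl
  rw [h3, Matrix.trace_toLin'_eq, Matrix.trace_transpose]

lemma idem_mat {A I F : Type*} [Ring A] [Fintype I] [AddCommGroup F] [Module A F] (b : Module.Basis I A F) (E : F →ₗ[A] F) (hE : E ∘ₗ E = E) :
    (Matrix.of (fun i j => b.repr (E (b i)) j)) * (Matrix.of (fun i j => b.repr (E (b i)) j)) = Matrix.of (fun i j => b.repr (E (b i)) j) := by
  ext1 i j
  rw [Matrix.mul_apply]
  simp only [Matrix.of_apply]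
  have h1 : E (b i) = ∑ l, b.repr (E (b i)) l • b l := (b.sum_repr _).symm
  have h2 : E (E (b i)) = E (b i) := LinearMap.congr_fun hE (b i)
  conv_rhs => rw [← h2, h1]
  rw [map_sum, map_sum]
  simp only [map_smul]
  rw [Finset.sum_apply']
  rfl

lemma rank_lower {B k F : Type*} {J : Type} [Ring B] [IsDomain B] [IsNoetherianRing B] [Field k] (ε : B →+* k) (hD : StrD ε) [Fintype J] [AddCommGroup F] [Module B F]
    (b : Module.Basis J B F) (E : F →ₗ[B] F) :
    Module.finrank k (LinearMap.range (Matrix.of (fun i j => ε (b.repr (E (b i)) j))).vecMulLinear) ≤ Module.finrank B (LinearMap.range E) := by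
  have hfin : Module.Finite B F := Module.Finite.of_basis b
  set M : Matrix J J k := Matrix.of (fun i j => ε (b.repr (E (b i)) j)) with hMdef
  have hr : LinearMap.range M.vecMulLinear = Submodule.span k (Set.range M.row) := by
    have : M.vecMulLinear = M.transpose.mulVecLin := by
      refine LinearMap.ext fun x => ?_
      rw [Matrix.mulVecLin_apply, Matrix.mulVec_transpose]; rfl
    rw [this, Matrix.range_mulVecLin]
    rfl
  obtain ⟨s, hs1, hs2, hs3⟩ := exists_linearIndependent k (Set.range M.row)
  have hsfin : s.Finite := (Set.finite_range M.row).subset hs1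
  let _ : Fintype s := hsfin.fintype
  have h4 : Module.finrank k (LinearMap.range M.vecMulLinear) = Fintype.card s := by
    rw [hr, ← hs2, finrank_span_set_eq_card hs3, Set.toFinset_card]
  choose f hf using fun x : s => hs1 x.2
  have hfinj : Function.Injective f := by
    intro x y hxy
    apply Subtype.ext
    rw [← hf x, ← hf y, hxy]
  let I0 := Set.range f
  have hI : LinearIndependent k (fun (i : I0) (j : J) => ε (b.repr (E (b i.1)) j)) := by
    let e : s ≃ I0 := Equiv.ofInjective f hfinj
    rw [← linearIndependent_equiv e]
    have : ((fun (i : I0) (j : J) => ε (b.repr (E (b i.1)) j)) ∘ e) = Subtype.val := by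
      funext x
      exact hf x
    rw [this]
    exact hs3
  have hcard : Fintype.card s = Fintype.card I0 := Fintype.card_congr (Equiv.ofInjective f hfinj)
  have hli : LinearIndependent B (fun i : I0 => (⟨E (b i.1), ⟨_, rfl⟩⟩ : LinearMap.range E)) := by
    rw [Fintype.linearIndependent_iff]
    intro c hc
    have := hD I0 J (fun i j => b.repr (E (b i.1)) j) hI c (fun j => by
      have h5 := congrArg (fun x : LinearMap.range E => b.repr x.1 j) hc
      simpa [Finset.sum_apply'] using h5)
    intro i
    rw [this]; rfl
  rw [h4, hcard]
  exact hli.fintype_card_le_finrank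

/-- rank equals trace -/
theorem rank_trace {B k F : Type*} {J : Type} [Ring B] [IsDomain B] [IsNoetherianRing B] [Field k] [CharZero k] (ε : B →+* k) (hD : StrD ε) [Fintype J] [AddCommGroup F] [Module B F]
    (b : Module.Basis J B F) (E : F →ₗ[B] F) (hE : E ∘ₗ E = E) :
    (Module.finrank B (LinearMap.range E) : k) = ∑ i, ε (b.repr (E (b i)) i) := by
  have hfin : Module.Finite B F := Module.Finite.of_basis b
  let m0 : (F →ₗ[B] F) → Matrix J J B := fun E => Matrix.of (fun i j => b.repr (E (b i)) j)
  let mk : (F →ₗ[B] F) → Matrix J J k := fun E => Matrix.of (fun i j => ε (b.repr (E (b i)) j))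
  have hmk : ∀ E, mk E = (m0 E).map ε := fun E => rfl
  have hidem : ∀ E : F →ₗ[B] F, E ∘ₗ E = E → mk E * mk E = mk E := by
    intro E hE
    rw [hmk, ← Matrix.map_mul]
    congr 1
    exact idem_mat b E hE
  let E' := LinearMap.id - E
  have hE' : E' ∘ₗ E' = E' := by
    simp only [E', LinearMap.sub_comp, LinearMap.comp_sub, LinearMap.id_comp, LinearMap.comp_id, hE]
    abel
  have hker : LinearMap.range E' = LinearMap.ker E := by
    ext x
    constructor
    · rintro ⟨y, rfl⟩
      have := LinearMap.congr_fun hE y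
      simp only [LinearMap.comp_apply] at this
      simp [E', this]
    · intro hx
      exact ⟨x, by simp [E', LinearMap.mem_ker.1 hx]⟩
  have h1 := trace_idem _ (hidem E hE)
  have h2 := trace_idem _ (hidem E' hE')
  have l1 := rank_lower ε hD b E
  have l2 := rank_lower ε hD b E'
  have hsum : mk E' = 1 - mk E := by
    ext1 i j
    simp only [mk, E', Matrix.of_apply, LinearMap.sub_apply, map_sub, Matrix.sub_apply, LinearMap.id_apply, Finsupp.sub_apply, b.repr_self, Finsupp.single_apply, Matrix.one_apply]
    split_ifs <;> simp
  have hrk : Module.finrank B (LinearMap.range E) + Module.finrank B (LinearMap.range E') = Fintype.card J := by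
    rw [hker, ← Module.finrank_eq_card_basis b, ← rank_add (LinearMap.ker E)]
    congr 1
    exact (LinearEquiv.finrank_eq E.quotKerEquivRange).symm
  have ht : Matrix.trace (mk E') = Fintype.card J - Matrix.trace (mk E) := by
    rw [hsum, Matrix.trace_sub, Matrix.trace_one]
  rw [h1, h2] at ht
  have ht' : Module.finrank k (LinearMap.range (mk E').vecMulLinear) + Module.finrank k (LinearMap.range (mk E).vecMulLinear) = Fintype.card J := by
    have : ((Module.finrank k (LinearMap.range (mk E').vecMulLinear) + Module.finrank k (LinearMap.range (mk E).vecMulLinear) : ℕ) : k) = (Fintype.card J : ℕ) := by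
      push_cast
      rw [ht]; ring
    exact_mod_cast this
  have heq : Module.finrank B (LinearMap.range E) = Module.finrank k (LinearMap.range (mk E).vecMulLinear) := by
    have l1' : Module.finrank k (LinearMap.range (mk E).vecMulLinear) ≤ Module.finrank B (LinearMap.range E) := l1
    have l2' : Module.finrank k (LinearMap.range (mk E').vecMulLinear) ≤ Module.finrank B (LinearMap.range E') := l2
    omega
  rw [heq, ← h1]
  rfl
end GW

namespace GW
open Classical
universe w

section
variable {A : Type w} [Ring A] (B : Subring A) [IsDomain B] [IsNoetherianRing B] {k : Type*} [Field k] [CharZero k] (ε : B →+* k) (hD : StrD ε)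
  {Q : ℕ} (b : Module.Basis (Fin Q) B A) (T : A → k) (hT : ∀ a, T a = ∑ c, ε (b.repr (b c * a) c))
  (hI : ∀ (m : ℕ) (e : Matrix (Fin m) (Fin m) A), e * e = e → ∃ d : ℕ, ∑ i, T (e i i) = Q * d)

lemma dvd_range (hD : StrD ε) (hT : ∀ a, T a = ∑ c, ε (b.repr (b c * a) c))
  (hI : ∀ (m : ℕ) (e : Matrix (Fin m) (Fin m) A), e * e = e → ∃ d : ℕ, ∑ i, T (e i i) = Q * d) (m : ℕ)
  (E : (Fin m → A) →ₗ[A] (Fin m → A)) (hE : E ∘ₗ E = E) : Q ∣ Module.finrank B (LinearMap.range E) := by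
  let bb := Pi.basis (fun _ : Fin m => b)
  have h1 := rank_trace ε hD bb (E.restrictScalars B) (by
    refine LinearMap.ext fun x => ?_
    exact LinearMap.congr_fun hE x)
  have h2 : Module.finrank B (LinearMap.range (E.restrictScalars B)) = Module.finrank B (LinearMap.range E) := rfl
  rw [h2] at h1
  obtain ⟨d, hd⟩ := hI m _ (idem_mat (Pi.basisFun A (Fin m)) E hE)
  have h3 : ∀ (j : Fin m) (c : Fin Q), bb.repr ((E.restrictScalars B) (bb ⟨j, c⟩)) ⟨j, c⟩ = b.repr (b c * E (Pi.single j 1) j) c := by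
    intro j c
    have : bb ⟨j, c⟩ = b c • (Pi.single j 1 : Fin m → A) := by
      simp only [bb, Pi.basis_apply]
      rw [← Pi.single_smul, smul_eq_mul, mul_one]
    rw [this]
    simp only [bb, Pi.basis_repr, LinearMap.coe_restrictScalars, map_smul, Pi.smul_apply, smul_eq_mul]
  rw [Fintype.sum_sigma] at h1
  simp only [h3, ← hT] at h1
  simp only [Matrix.of_apply, Pi.basisFun_repr, Pi.basisFun_apply] at hd
  rw [hd] at h1
  exact ⟨d, by exact_mod_cast h1⟩

lemma dvd_proj (hD : StrD ε) (hT : ∀ a, T a = ∑ c, ε (b.repr (b c * a) c))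
  (hI : ∀ (m : ℕ) (e : Matrix (Fin m) (Fin m) A), e * e = e → ∃ d : ℕ, ∑ i, T (e i i) = Q * d)
  (P : Type w) [AddCommGroup P] [Module A P] [Module.Finite A P] [Module.Projective A P] : Q ∣ Module.finrank B P := by
  obtain ⟨m, f, hf⟩ := Module.Finite.exists_fin' A P
  obtain ⟨s, hs⟩ := Module.projective_lifting_property f LinearMap.id hf
  have hs' : ∀ x, f (s x) = x := fun x => LinearMap.congr_fun hs x
  have h1 := dvd_range B ε b T hD hT hI m (s ∘ₗ f) (by
    refine LinearMap.ext fun x => ?_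
    simp [hs'])
  have h2 : LinearMap.range (s ∘ₗ f) = LinearMap.range s := by
    rw [LinearMap.range_comp, LinearMap.range_eq_top.2 hf, Submodule.map_top]
  rw [h2] at h1
  have hinj : Function.Injective s := fun x y h => by rw [← hs' x, h, hs']
  have e := (LinearEquiv.ofInjective s hinj).restrictScalars B
  rwa [← e.finrank_eq] at h1

lemma dvd_all (hD : StrD ε) (hT : ∀ a, T a = ∑ c, ε (b.repr (b c * a) c))
  (hI : ∀ (m : ℕ) (e : Matrix (Fin m) (Fin m) A), e * e = e → ∃ d : ℕ, ∑ i, T (e i i) = Q * d) (d : ℕ) :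
  ∀ (Y : Type w) [AddCommGroup Y] [Module A Y] [Module.Finite A Y], PDm (RingHom.id A) d Y → Q ∣ Module.finrank B Y := by
  have hBA : Module.Finite B A := Module.Finite.of_basis b
  have hA : IsNoetherianRing A := by
    have : IsNoetherian B A := isNoetherian_of_isNoetherianRing_of_finite B A
    exact isNoetherian_of_tower B this
  induction d with
  | zero =>
    intro Y _ _ _ h
    have hp : Module.Projective A Y := h
    exact dvd_proj B ε b T hD hT hI Y
  | succ d ih =>
    intro Y _ _ _ h
    obtain ⟨m, f, hf⟩ := Module.Finite.exists_fin' A Y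
    have h1 := ih (LinearMap.ker f) (h (Fin m → A) inferInstance f hf)
    have h2 := rank_add ((LinearMap.ker f).restrictScalars B)
    have h3 : Module.finrank B (Fin m → A) = m * Q := by
      rw [Module.finrank_eq_card_basis (Pi.basis (fun _ : Fin m => b))]
      simp
    have h4 : Module.finrank B ((Fin m → A) ⧸ (LinearMap.ker f).restrictScalars B) = Module.finrank B Y :=
      ((f.restrictScalars B).quotKerEquivOfSurjective hf).finrank_eq
    have h5 : Module.finrank B ((LinearMap.ker f).restrictScalars B) = Module.finrank B (LinearMap.ker f) := rfl
    rw [h3, h4, h5] at h2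
    have : Q ∣ m * Q := dvd_mul_left _ _
    rw [← h2] at this
    exact (Nat.dvd_add_left h1).1 this

theorem zero_div_abs (hD : StrD ε) (hT : ∀ a, T a = ∑ c, ε (b.repr (b c * a) c))
  (hI : ∀ (m : ℕ) (e : Matrix (Fin m) (Fin m) A), e * e = e → ∃ d : ℕ, ∑ i, T (e i i) = Q * d) (d : ℕ)
  (hgl : ∀ (Y : Type w) [AddCommGroup Y] [Module A Y], PDm (RingHom.id A) d Y) (x y : A) (hxy : x * y = 0) : x = 0 ∨ y = 0 := by
  by_contra! hne
  obtain ⟨hx, hy⟩ := hne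
  have hBA : Module.Finite B A := Module.Finite.of_basis b
  let f : A →ₗ[A] A := LinearMap.toSpanSingleton A A y
  have h1 : Q ∣ Module.finrank B (LinearMap.range f) := dvd_all B ε b T hD hT hI d _ (hgl _)
  have h2 := rank_add (LinearMap.ker (f.restrictScalars B))
  have h3 : Module.finrank B A = Q := by rw [Module.finrank_eq_card_basis b]; simp
  have h4 : Module.finrank B (A ⧸ LinearMap.ker (f.restrictScalars B)) = Module.finrank B (LinearMap.range f) :=
    (f.restrictScalars B).quotKerEquivRange.finrank_eq
  have hpos : ∀ (Z : Submodule B A) (z : A), z ∈ Z → z ≠ 0 → 0 < Module.finrank B Z := by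
    intro Z z hz hz0
    have hli : LinearIndependent B (fun _ : Unit => (⟨z, hz⟩ : Z)) := by
      rw [Fintype.linearIndependent_iff]
      intro g hg
      have h0 : g () • z = 0 := by simpa using congrArg Subtype.val hg
      obtain ⟨i, hi⟩ : ∃ i, b.repr z i ≠ 0 := by
        by_contra! h
        exact hz0 (b.repr.map_eq_zero_iff.1 (Finsupp.ext h))
      have h1 := congrArg (fun v => b.repr v i) h0
      simp only [map_smul, Finsupp.smul_apply, smul_eq_mul, map_zero, Finsupp.zero_apply] at h1
      intro u
      exact (mul_eq_zero.1 h1).resolve_right hi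
    have hn : IsNoetherian B A := isNoetherian_of_isNoetherianRing_of_finite B A
    have := hli.fintype_card_le_finrank
    simp only [Fintype.card_unit] at this
    omega
  have h5 := hpos (LinearMap.ker (f.restrictScalars B)) x (by simpa [f] using hxy) hx
  have h6 := hpos (LinearMap.range (f.restrictScalars B)) y ⟨1, by simp [f]⟩ hy
  have h7 : Module.finrank B (LinearMap.range (f.restrictScalars B)) = Module.finrank B (LinearMap.range f) := rfl
  rw [h3, h4] at h2
  have := Nat.le_of_dvd (by omega) h1
  omega
end
end GW

namespace GW
open Classical SkewMonoidAlgebra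
universe u v

section
variable {S : Type u} {Γ : Type v} [CommRing S] [Group Γ] [MulSemiringAction Γ S]

lemma cosM_mem {N : Subgroup Γ} (g : Γ) (c : Γ ⧸ N) (h : (QuotientGroup.mk g⁻¹ : Γ ⧸ N) = c) : g * Quotient.out c ∈ N := by
  have : (QuotientGroup.mk g⁻¹ : Γ ⧸ N) = QuotientGroup.mk (Quotient.out c) := by
    rw [h]; exact (QuotientGroup.out_eq' c).symm
  have := QuotientGroup.eq.1 this
  simpa using this

/-- basis over the subring of a subgroup -/
noncomputable def cosB (S : Type u) {Γ : Type v} [CommRing S] [Group Γ] [MulSemiringAction Γ S] (N : Subgroup Γ) [N.FiniteIndex] :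
    Module.Basis (Γ ⧸ N) (AK S N) (SkewMonoidAlgebra S Γ) :=
  let _ : Fintype (Γ ⧸ N) := Fintype.ofFinite _
  Module.Basis.mk (v := fun c => single (Quotient.out c)⁻¹ 1) (by
    rw [Fintype.linearIndependent_iff]
    intro β hβ c
    apply Subtype.ext
    refine SkewMonoidAlgebra.ext (fun n => ?_)
    by_cases hn : n ∈ N
    · have h1 := congrArg (fun x : SkewMonoidAlgebra S Γ => x.coeff (n * (Quotient.out c)⁻¹)) hβ
      have h2 : ∀ c' : Γ ⧸ N, (β c' • (single (Quotient.out c')⁻¹ 1 : SkewMonoidAlgebra S Γ)).coeff (n * (Quotient.out c)⁻¹) = if c' = c then (β c).1.coeff n else 0 := by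
        intro c'
        show ((β c').1 * single (Quotient.out c')⁻¹ 1).coeff _ = _
        rw [coeff_mul_single]
        simp only [inv_inv, smul_one, mul_one]
        split_ifs with h
        · subst h
          simp
        · refine (β c').2 _ (fun h' => h ?_)
          have h3 : (Quotient.out c)⁻¹ * Quotient.out c' ∈ N := by
            have := N.mul_mem (N.inv_mem hn) h'
            simpa [mul_assoc] using this
          have h4 := QuotientGroup.eq.2 h3
          rw [QuotientGroup.out_eq', QuotientGroup.out_eq'] at h4
          exact h4.symm
      have h3 : (∑ c' : Γ ⧸ N, β c' • (single (Quotient.out c')⁻¹ 1 : SkewMonoidAlgebra S Γ)).coeff (n * (Quotient.out c)⁻¹) = ∑ c' : Γ ⧸ N, (β c' • (single (Quotient.out c')⁻¹ 1 : SkewMonoidAlgebra S Γ)).coeff (n * (Quotient.out c)⁻¹) := by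
        let φ : SkewMonoidAlgebra S Γ →+ S := (Finsupp.applyAddHom (n * (Quotient.out c)⁻¹)).comp coeffAddEquiv.toAddMonoidHom
        exact _root_.map_sum φ _ _
      simp only [h3, h2] at h1
      simpa using h1
    · rw [(β c).2 n hn]; simp) (by
    intro x _
    refine SkewMonoidAlgebra.induction_on' (p := fun x => x ∈ Submodule.span (AK S N) (Set.range fun c : Γ ⧸ N => (single (Quotient.out c)⁻¹ 1 : SkewMonoidAlgebra S Γ))) x ?_ ?_
    · intro g s
      let c : Γ ⧸ N := QuotientGroup.mk g⁻¹
      have : single g s = (⟨single (g * Quotient.out c) s, single_mem_AK (cosM_mem g c rfl) s⟩ : AK S N) • (single (Quotient.out c)⁻¹ 1 : SkewMonoidAlgebra S Γ) := by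
        show _ = single (g * Quotient.out c) s * single (Quotient.out c)⁻¹ 1
        rw [single_mul_single]; simp
      rw [this]
      exact Submodule.smul_mem _ _ (Submodule.subset_span ⟨c, rfl⟩)
    · intro a b ha hb
      exact Submodule.add_mem _ ha hb)

lemma cosB_apply (N : Subgroup Γ) [N.FiniteIndex] (c : Γ ⧸ N) : cosB S N c = single (Quotient.out c)⁻¹ 1 := by
  simp [cosB]

lemma cosB_eps {k : Type*} [Field k] (ε : S →+* k) (hε : ∀ (g : Γ) s, ε (g • s) = ε s) (N : Subgroup Γ) [N.FiniteIndex] (c : Γ ⧸ N) (g : Γ) (s : S) :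
    ((augA ε hε).comp (AK S N).subtype) ((cosB S N).repr (cosB S N c * single g s) c) = if g • c = c then ε s else 0 := by
  let c' : Γ ⧸ N := g⁻¹ • c
  have h0 : (QuotientGroup.mk ((Quotient.out c)⁻¹ * g)⁻¹ : Γ ⧸ N) = c' := by
    show _ = g⁻¹ • c
    conv_rhs => rw [← QuotientGroup.out_eq' c]
    rw [mul_inv_rev, inv_inv]; rfl
  have h1 : cosB S N c * single g s = (⟨single ((Quotient.out c)⁻¹ * g * Quotient.out c') ((Quotient.out c)⁻¹ • s), single_mem_AK (cosM_mem _ c' h0) _⟩ : AK S N) • cosB S N c' := by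
    show _ = single _ _ * cosB S N c'
    rw [cosB_apply, cosB_apply, single_mul_single, single_mul_single]
    simp
  rw [h1, map_smul, Module.Basis.repr_self, Finsupp.smul_single, smul_eq_mul, mul_one, Finsupp.single_apply]
  have h2 : c' = c ↔ g • c = c := by
    show g⁻¹ • c = c ↔ _
    rw [inv_smul_eq_iff]; exact eq_comm
  by_cases h : c' = c
  · rw [if_pos h, if_pos (h2.1 h)]
    show augA ε hε (single _ _) = _
    rw [augA_single, hε]
  · rw [if_neg h, if_neg (fun h' => h (h2.2 h')), map_zero]

/-- reduction to the group algebra -/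
noncomputable def etaA {k : Type*} [Field k] (ε : S →+* k) (hε : ∀ (g : Γ) s, ε (g • s) = ε s) : SkewMonoidAlgebra S Γ →+* MonoidAlgebra k Γ :=
  liftNCRingHom ((MonoidAlgebra.singleOneRingHom (R := k) (M := Γ)).comp ε) (MonoidAlgebra.of k Γ) (by
    intro x y
    simp [hε, MonoidAlgebra.single_mul_single])

lemma etaA_single {k : Type*} [Field k] (ε : S →+* k) (hε : ∀ (g : Γ) s, ε (g • s) = ε s) (g : Γ) (s : S) :
    etaA ε hε (single g s) = MonoidAlgebra.single g (ε s) := by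
  show liftNC _ _ (single g s) = _
  rw [liftNC_single]
  simp [MonoidAlgebra.single_mul_single]

theorem zero_div_skew {k : Type*} [Field k] [CharZero k] [IsDomain S] [IsNoetherianRing S] (ε : S →+* k) (hε : ∀ (g : Γ) s, ε (g • s) = ε s)
    (hs : Function.Surjective ε) (hS : ∃ d, ∀ (Y : Type max u v) [AddCommGroup Y] [Module S Y], PDm (RingHom.id S) d Y)
    (N : Subgroup Γ) (hN : PZ N) [N.FiniteIndex] (s0 : S) (hs0 : (N.index : S) * s0 = 1)
    (hΓ : ∀ (h u : Γ) (r : ℕ), 2 ≤ r → u * h^r * u⁻¹ = h → h = 1) (x y : SkewMonoidAlgebra S Γ) (hxy : x * y = 0) : x = 0 ∨ y = 0 := by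
  obtain ⟨d, hd⟩ := gldim.{max u v} hS N hN s0 hs0
  obtain ⟨h1, h2, h3⟩ := AK_PZ ε hε hs hN
  have hdom : IsDomain (AK S N) := by
    have hnz : NoZeroDivisors (AK S N) := ⟨by
      intro a b hab
      have := h1 a.1 a.2 b.1 b.2 (congrArg Subtype.val hab)
      rcases this with h | h
      · left; exact Subtype.ext h
      · right; exact Subtype.ext h⟩
    have hnt : Nontrivial (AK S N) := RingHom.domain_nontrivial ((augA ε hε).comp (AK S N).subtype)
    exact NoZeroDivisors.to_isDomain _
  let _ : Fintype (Γ ⧸ N) := Fintype.ofFinite _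
  let e : Γ ⧸ N ≃ Fin N.index := Finite.equivFinOfCardEq rfl
  let b := (cosB S N).reindex e
  let χ : Γ → k := fun g => ((Finset.univ.filter (fun c : Γ ⧸ N => g • c = c)).card : k)
  refine zero_div_abs (AK S N) ((augA ε hε).comp (AK S N).subtype) b (fun a => cT χ (etaA ε hε a)) h3 ?_ ?_ d hd x y hxy
  · intro a
    refine SkewMonoidAlgebra.induction_on' (p := fun a => cT χ (etaA ε hε a) = ∑ c, ((augA ε hε).comp (AK S N).subtype) (b.repr (b c * a) c)) a ?_ ?_
    · intro g s
      rw [etaA_single, cT_single, ← Equiv.sum_comp e]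
      simp only [b, Module.Basis.reindex_apply, Module.Basis.repr_reindex_apply, Equiv.symm_apply_apply]
      simp only [cosB_eps]
      rw [← Finset.sum_filter, Finset.sum_const, nsmul_eq_mul, mul_comm]
    · intro f g hf hg
      simp only [mul_add, map_add, Finsupp.add_apply, Finset.sum_add_distrib, hf, hg]
  · intro m M hM
    have hM' : M.map (etaA ε hε) * M.map (etaA ε hε) = M.map (etaA ε hε) := by
      rw [← Matrix.map_mul, hM]
    have k1 := formanek_class hΓ (M.map (etaA ε hε)) hM' χ (by
      intro g u
      simp only [χ]
      congr 1
      apply Finset.card_bij (fun c _ => u⁻¹ • c)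
      · intro c hc
        simp only [Finset.mem_filter, Finset.mem_univ, true_and] at hc ⊢
        rw [mul_smul, mul_smul] at hc
        conv_rhs => rw [← hc]
        simp
      · intro c _ c' _ h
        exact smul_left_cancel _ h
      · intro c hc
        simp only [Finset.mem_filter, Finset.mem_univ, true_and] at hc ⊢
        refine ⟨u • c, ?_, by simp⟩
        rw [mul_smul, mul_smul, inv_smul_smul, hc])
    have k2 : χ 1 = N.index := by
      simp only [χ, one_smul, Finset.filter_true, Finset.card_univ]
      rw [Subgroup.index, Nat.card_eq_fintype_card]
    have k3 : ∀ a, cT (fun _ => (1:k)) (etaA ε hε a) = augA ε hε a := by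
      intro a
      refine SkewMonoidAlgebra.induction_on' (p := fun a => cT (fun _ => (1:k)) (etaA ε hε a) = augA ε hε a) a ?_ ?_
      · intro g s
        rw [etaA_single, cT_single, augA_single, mul_one]
      · intro f g hf hg
        simp only [map_add, hf, hg]
    have hM2 : M.map (augA ε hε) * M.map (augA ε hε) = M.map (augA ε hε) := by
      rw [← Matrix.map_mul, hM]
    have k4 := trace_idem _ hM2
    rw [mT_apply, mT_apply, k2] at k1
    simp only [Matrix.map_apply, k3] at k1
    refine ⟨Module.finrank k (LinearMap.range (M.map (augA ε hε)).vecMulLinear), ?_⟩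
    rw [k1, ← k4]
    rfl
end

theorem zero_div_mv {k : Type u} [Field k] [CharZero k] {Γ : Type v} [Group Γ] (n : ℕ) [MulSemiringAction Γ (MvPolynomial (Fin n) k)]
    (ε : MvPolynomial (Fin n) k →+* k) (hε : ∀ (g : Γ) s, ε (g • s) = ε s) (hs : Function.Surjective ε)
    (N : Subgroup Γ) (hN : PZ N) [N.FiniteIndex]
    (hΓ : ∀ (h u : Γ) (r : ℕ), 2 ≤ r → u * h^r * u⁻¹ = h → h = 1) (x y : SkewMonoidAlgebra (MvPolynomial (Fin n) k) Γ) (hxy : x * y = 0) : x = 0 ∨ y = 0 := by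
  refine zero_div_skew ε hε hs ⟨n, fun Y _ _ => gl_mv k n Y⟩ N hN (MvPolynomial.C ((N.index : k)⁻¹)) ?_ hΓ x y hxy
  rw [← map_natCast (MvPolynomial.C : k →+* MvPolynomial (Fin n) k), ← map_mul, mul_inv_cancel₀, map_one]
  exact_mod_cast Subgroup.FiniteIndex.index_ne_zero
end GW

namespace GW
open Classical

lemma cond_T {G : Type*} [Group G] [WellFoundedGT (Subgroup G)] (htf : ∀ g : G, ∀ n:ℕ, 0<n → g^n=1 → g=1) :
    ∀ (h u : G) (r : ℕ), 2 ≤ r → u * h^r * u⁻¹ = h → h = 1 := by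
  intro h u r hr hu
  let H : ℕ → Subgroup G := fun i => Subgroup.zpowers (u^i * h * (u^i)⁻¹)
  have hconj : ∀ (a : G) (n : ℤ), (a * h * a⁻¹)^n = a * h^n * a⁻¹ := fun a n => conj_zpow
  have hmono : Monotone H := by
    refine monotone_nat_of_le_succ (fun i => ?_)
    rw [Subgroup.zpowers_le]
    refine ⟨r, ?_⟩
    show (u^(i+1) * h * (u^(i+1))⁻¹)^(r:ℤ) = _
    rw [hconj, zpow_natCast]
    conv_rhs => rw [← hu]
    rw [pow_succ]; group
  obtain ⟨n, hn⟩ := WellFoundedGT.monotone_chain_condition ⟨H, hmono⟩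
  have h1 : u^(n+1) * h * (u^(n+1))⁻¹ ∈ H n := by
    have h2 : H n = H (n+1) := hn (n+1) (by omega)
    rw [h2]; exact Subgroup.mem_zpowers _
  obtain ⟨m, hm⟩ := h1
  have hm : (u^n * h * (u^n)⁻¹)^m = u^(n+1) * h * (u^(n+1))⁻¹ := hm
  rw [hconj] at hm
  have h2 : h^m = u * h * u⁻¹ := by
    have : (u^n)⁻¹ * (u^n * h^m * (u^n)⁻¹) * u^n = (u^n)⁻¹ * (u^(n+1) * h * (u^(n+1))⁻¹) * u^n := by rw [hm]
    calc h^m = (u^n)⁻¹ * (u^n * h^m * (u^n)⁻¹) * u^n := by group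
      _ = _ := this
      _ = _ := by rw [pow_succ]; group
  have h3 : h^(m * r) = h := by
    rw [zpow_mul, h2, zpow_natCast, conj_pow, hu]
  have h4 : h^(m*r-1) = 1 := by
    rw [zpow_sub, h3, zpow_one, mul_inv_cancel]
  have hne : m * r - 1 ≠ 0 := by
    intro h0
    have h5 : m * (r:ℤ) = 1 := by omega
    have h6 : (r:ℤ) ∣ 1 := ⟨m, by rw [← h5]; ring⟩
    have := Int.le_of_dvd (by norm_num) h6
    omega
  apply htf h (m*r-1).natAbs (by omega)
  rcases Int.natAbs_eq (m*r-1) with h5 | h5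
  · rw [← zpow_natCast, ← h5, h4]
  · rw [h5, zpow_neg, inv_eq_one] at h4
    rw [← zpow_natCast, h4]

lemma PZ.prod {G : Type*} [Group G] {M N : Subgroup G} (hM : PZ M) (hN : PZ N) : PZ (M.prod N) := by
  induction hN with
  | bot =>
    have := hM.map (MonoidHom.inl G G) (fun a b h => (Prod.ext_iff.1 h).1)
    convert this using 1
    ext ⟨a, b⟩
    simp [Subgroup.mem_prod, Subgroup.mem_map]
    tauto
  | step K t _ hn hz ih =>
    have := PZ.step (M.prod K) ((1, t) : G × G) ih (by
      rintro ⟨a, b⟩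
      simp only [Subgroup.mem_prod, Prod.mk_mul_mk, Prod.inv_mk]
      rw [hn b]; simp) (by
      intro n h
      rw [Subgroup.mem_prod] at h
      exact hz n (by simpa using h.2))
    convert this using 1
    apply le_antisymm
    · rintro ⟨a, b⟩ ⟨ha, hb⟩
      have hN : Subgroup.zpowers t ≤ Subgroup.normalizer (K : Set G) := by
        rw [Subgroup.zpowers_le, Subgroup.mem_normalizer_iff]
        exact hn
      have hb' : b ∈ K ⊔ Subgroup.zpowers t := hb
      rw [sup_comm, ← SetLike.mem_coe, Subgroup.coe_mul_of_left_le_normalizer_right _ _ hN] at hb'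
      obtain ⟨_, ⟨i, rfl⟩, y, hy, rfl⟩ := hb'
      have e1 : ((a, t^i * y) : G × G) = ((1, t) : G × G)^i * (a, y) := by simp
      have e2 : ((a, (fun x => t ^ x) i * y) : G × G) = ((1, t) : G × G)^i * (a, y) := e1
      show ((a, (fun x => t ^ x) i * y) : G × G) ∈ _
      rw [e2]
      exact Subgroup.mul_mem _ (Subgroup.mem_sup_right ⟨i, rfl⟩) (Subgroup.mem_sup_left ⟨ha, hy⟩)
    · refine sup_le (Subgroup.prod_mono le_rfl le_sup_left) ?_
      rw [Subgroup.zpowers_le]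
      exact ⟨M.one_mem, Subgroup.mem_sup_right (Subgroup.mem_zpowers t)⟩

theorem grp_sq {G : Type*} [Group G] [WellFoundedGT (Subgroup G)] (htf : ∀ g : G, ∀ n:ℕ, 0<n → g^n=1 → g=1) (d : ℕ) (hPG : PG G d) :
    (∃ N : Subgroup (G × G), PZ N ∧ N.FiniteIndex) ∧ ∀ (h u : G × G) (r : ℕ), 2 ≤ r → u * h^r * u⁻¹ = h → h = 1 := by
  constructor
  · obtain ⟨N, h1, h2⟩ := gromov d G htf hPG
    refine ⟨N.prod N, h1.prod h1, ?_⟩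
    infer_instance
  · rintro ⟨h1, h2⟩ ⟨u1, u2⟩ r hr h
    simp only [Prod.pow_mk, Prod.mk_mul_mk, Prod.inv_mk, Prod.mk.injEq] at h
    exact Prod.ext (cond_T htf h1 u1 r hr h.1) (cond_T htf h2 u2 r hr h.2)
end GW

namespace GW
open Classical Pointwise

lemma gk_growth {k R : Type*} [Field k] [Ring R] [Algebra k R] (h : gkDim k R ≠ ⊤) : ∃ d : ℕ, ∀ V : Submodule k R, FiniteDimensional k V →
    ∃ C : ℝ, ∀ n : ℕ, 1 ≤ n → (Module.finrank k ↥(((1 : Submodule k R) ⊔ V) ^ n) : ℝ) ≤ C * (n:ℝ)^d := by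
  obtain ⟨d, hd⟩ := ENNReal.exists_nat_gt h
  refine ⟨d, fun V hV => ?_⟩
  have h1 : Filter.limsup (fun n : ℕ => ENNReal.ofReal
        (Real.log (Module.finrank k ↥(((1 : Submodule k R) ⊔ V) ^ n)) / Real.log n)) Filter.atTop < d := by
    refine lt_of_le_of_lt ?_ hd
    unfold gkDim
    exact le_iSup₂ (f := fun (V : Submodule k R) (_ : FiniteDimensional k ↥V) => Filter.limsup (fun n : ℕ => ENNReal.ofReal
        (Real.log (Module.finrank k ↥(((1 : Submodule k R) ⊔ V) ^ n)) / Real.log n)) Filter.atTop) V hV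
  have h2 := Filter.eventually_lt_of_limsup_lt h1
  obtain ⟨N, hN⟩ := Filter.eventually_atTop.1 h2
  set f : ℕ → ℝ := fun n => (Module.finrank k ↥(((1 : Submodule k R) ⊔ V) ^ n) : ℝ) with hf
  have hf0 : ∀ n, 0 ≤ f n := fun n => Nat.cast_nonneg _
  have h3 : ∀ n, max N 2 ≤ n → f n ≤ (n:ℝ)^d := by
    intro n hn
    have hn1 : N ≤ n := le_trans (le_max_left _ _) hn
    have hn2 : 2 ≤ n := le_trans (le_max_right _ _) hn
    have h4 := hN n hn1
    have hlog : 0 < Real.log n := Real.log_pos (by exact_mod_cast hn2)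
    have h5 : Real.log (f n) / Real.log n < d := by
      by_contra! hc
      have := ENNReal.ofReal_le_ofReal hc
      rw [ENNReal.ofReal_natCast] at this
      exact absurd h4 (not_lt.2 this)
    rw [div_lt_iff₀ hlog] at h5
    by_cases h0 : f n = 0
    · rw [h0]; positivity
    · have hpos : 0 < f n := lt_of_le_of_ne (hf0 n) (Ne.symm h0)
      rw [← Real.log_pow] at h5
      exact ((Real.log_lt_log_iff hpos (by positivity)).1 h5).le
  refine ⟨1 + ∑ i ∈ Finset.range (max N 2), f i, fun n hn => ?_⟩
  have hs : 0 ≤ ∑ i ∈ Finset.range (max N 2), f i := Finset.sum_nonneg fun i _ => hf0 i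
  have hp : (1:ℝ) ≤ (n:ℝ)^d := one_le_pow₀ (by exact_mod_cast hn)
  by_cases hc : max N 2 ≤ n
  · calc f n ≤ (n:ℝ)^d := h3 n hc
      _ ≤ _ := by nlinarith
  · have : f n ≤ ∑ i ∈ Finset.range (max N 2), f i :=
      Finset.single_le_sum (f := f) (fun i _ => hf0 i) (Finset.mem_range.2 (by omega))
    calc f n ≤ _ := this
      _ ≤ _ := by nlinarith

lemma fd_pow {k R : Type*} [Field k] [Ring R] [Algebra k R] (V : Submodule k R) (hV : FiniteDimensional k V) (n : ℕ) :
    FiniteDimensional k ↥(((1 : Submodule k R) ⊔ V) ^ n) := by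
  have h1 : V.FG := Module.Finite.iff_fg.1 hV
  have h2 : (1 : Submodule k R).FG := by
    rw [Submodule.one_eq_span]
    exact Submodule.fg_span_singleton 1
  exact Module.Finite.iff_fg.2 ((h2.sup h1).pow n)

lemma grp_PG {k R : Type*} [Field k] [Ring R] [HopfAlgebra k R] (d : ℕ) (h : ∀ V : Submodule k R, FiniteDimensional k V →
    ∃ C : ℝ, ∀ n : ℕ, 1 ≤ n → (Module.finrank k ↥(((1 : Submodule k R) ⊔ V) ^ n) : ℝ) ≤ C * (n:ℝ)^d) : PG (GroupLike k R) d := by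
  intro F
  let V : Submodule k R := Submodule.span k (GroupLike.val '' (F : Set (GroupLike k R)))
  have hV : FiniteDimensional k V := FiniteDimensional.span_of_finite k ((Finset.finite_toSet F).image _)
  obtain ⟨C, hC⟩ := h V hV
  refine ⟨C, fun n hn => le_trans ?_ (hC n hn)⟩
  have hfd := fd_pow V hV n
  have hmem : ∀ m, ∀ g ∈ F^m, g.val ∈ ((1 : Submodule k R) ⊔ V)^m := by
    intro m
    induction m with
    | zero =>
      intro g hg
      rw [pow_zero, Finset.mem_one] at hg
      subst hg
      rw [pow_zero]
      exact Submodule.one_le.1 le_rfl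
    | succ m ih =>
      intro g hg
      rw [pow_succ, Finset.mem_mul] at hg
      obtain ⟨a, ha, b, hb, rfl⟩ := hg
      rw [pow_succ, GroupLike.val_mul]
      exact Submodule.mul_mem_mul (ih a ha) (Submodule.mem_sup_right (Submodule.subset_span ⟨b, hb, rfl⟩))
  have hli : LinearIndependent k (fun g : (F^n : Finset (GroupLike k R)) => (⟨g.1.val, hmem n g.1 g.2⟩ : ↥(((1 : Submodule k R) ⊔ V)^n))) := by
    apply LinearIndependent.of_comp (Submodule.subtype _)
    exact (linearIndep_groupLikeVal (R := k) (A := R)).comp (fun g : (F^n : Finset (GroupLike k R)) => g.1) Subtype.val_injective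
  have := hli.fintype_card_le_finrank
  rw [Fintype.card_coe] at this
  exact_mod_cast this

lemma grp_tf {k R : Type*} [Field k] [CharZero k] [Ring R] [IsDomain R] [HopfAlgebra k R] (g : GroupLike k R) (n : ℕ) (hn : 0 < n) (hg : g^n = 1) : g = 1 := by
  by_contra hne
  have h1 : g.val ^ n = 1 := by rw [← GroupLike.val_pow, hg]; rfl
  have h2 : (∑ i ∈ Finset.range n, g.val^i) * (g.val - 1) = 0 := by rw [geom_sum_mul, h1, sub_self]
  have h3 : g.val - 1 ≠ 0 := fun h => hne (GroupLike.val_injective (sub_eq_zero.1 h))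
  have h4 := (mul_eq_zero.1 h2).resolve_right h3
  have h5 := congrArg (Coalgebra.counit (R := k)) h4
  simp at h5
  omega
end GW

open scoped TensorProduct
namespace GW
open Classical

/-- divided power -/
noncomputable def dpw (k : Type*) {R : Type*} [Field k] [Ring R] [Algebra k R] (x : R) (m : ℕ) : R := ((m.factorial : k)⁻¹) • x^m

section
variable {k R : Type*} [Field k] [CharZero k] [Ring R] [HopfAlgebra k R]

lemma comul_dpw (x : R) (hx : Coalgebra.comul (R := k) x = x ⊗ₜ 1 + 1 ⊗ₜ x) (m : ℕ) :
    Coalgebra.comul (R := k) (dpw k x m) = ∑ rs ∈ Finset.HasAntidiagonal.antidiagonal m, dpw k x rs.1 ⊗ₜ[k] dpw k x rs.2 := by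
  have hc : Commute (x ⊗ₜ[k] (1:R)) ((1:R) ⊗ₜ[k] x) := by
    simp [Commute, SemiconjBy, Algebra.TensorProduct.tmul_mul_tmul]
  rw [dpw, map_smul, Bialgebra.comul_pow, hx, hc.add_pow', Finset.smul_sum]
  refine Finset.sum_congr rfl (fun rs hrs => ?_)
  rw [Finset.HasAntidiagonal.mem_antidiagonal] at hrs
  rw [Algebra.TensorProduct.tmul_pow, Algebra.TensorProduct.tmul_pow, Algebra.TensorProduct.tmul_mul_tmul, one_pow, one_pow, one_mul, mul_one]
  rw [dpw, dpw, TensorProduct.smul_tmul_smul, ← Nat.cast_smul_eq_nsmul k, smul_smul]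
  congr 1
  have h1 : (rs.1.factorial : k) ≠ 0 := by exact_mod_cast rs.1.factorial_ne_zero
  have h2 : (rs.2.factorial : k) ≠ 0 := by exact_mod_cast rs.2.factorial_ne_zero
  have h3 : (m.factorial : k) ≠ 0 := by exact_mod_cast m.factorial_ne_zero
  have h4 : (m.choose rs.1 * rs.1.factorial * rs.2.factorial : k) = m.factorial := by
    have := Nat.choose_mul_factorial_mul_factorial (n := m) (k := rs.1) (by omega)
    rw [show m - rs.1 = rs.2 by omega] at this
    exact_mod_cast this
  field_simp
  rw [← h4]

variable {n : ℕ} (p : Fin n → R)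

/-- exponential series of one element -/
noncomputable def Es (k : Type*) {R : Type*} [Field k] [Ring R] [Algebra k R] {n : ℕ} (p : Fin n → R) (i : Fin n) : MvPowerSeries (Fin n) R :=
  fun a => if a = Finsupp.single i (a i) then dpw k (p i) (a i) else 0

lemma coeff_Es {k R : Type*} [Field k] [Ring R] [Algebra k R] {n : ℕ} (p : Fin n → R) (i : Fin n) (a : Fin n →₀ ℕ) : MvPowerSeries.coeff a (Es k p i) = if a = Finsupp.single i (a i) then dpw k (p i) (a i) else 0 := rfl

/-- ordered product of exponentials -/
noncomputable def Ep (k : Type*) {R : Type*} [Field k] [Ring R] [Algebra k R] {n : ℕ} (p : Fin n → R) (l : List (Fin n)) : MvPowerSeries (Fin n) R :=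
  (l.map (Es k p)).prod

/-- divided monomials -/
noncomputable def ee (k : Type*) {R : Type*} [Field k] [Ring R] [Algebra k R] {n : ℕ} (p : Fin n → R) (a : Fin n →₀ ℕ) : R :=
  MvPowerSeries.coeff a (Ep k p (List.finRange n))

/-- grouplike power series -/
def GLs (k : Type*) {R : Type*} [Field k] [Ring R] [HopfAlgebra k R] {n : ℕ} (E : MvPowerSeries (Fin n) R) : Prop :=
  MvPowerSeries.map (Bialgebra.comulAlgHom k R).toRingHom E = MvPowerSeries.map (Algebra.TensorProduct.includeLeftRingHom (R := k) (A := R) (B := R)) E *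
    MvPowerSeries.map (Algebra.TensorProduct.includeRight (R := k) (A := R) (B := R)).toRingHom E

lemma GLs_iff (E : MvPowerSeries (Fin n) R) : GLs k E ↔ ∀ a, Coalgebra.comul (R := k) (MvPowerSeries.coeff a E) =
    ∑ bc ∈ Finset.HasAntidiagonal.antidiagonal a, MvPowerSeries.coeff bc.1 E ⊗ₜ[k] MvPowerSeries.coeff bc.2 E := by
  unfold GLs
  rw [MvPowerSeries.ext_iff]
  refine forall_congr' (fun a => ?_)
  rw [MvPowerSeries.coeff_mul]
  simp only [MvPowerSeries.coeff_map]
  have : ∀ bc : (Fin n →₀ ℕ) × (Fin n →₀ ℕ), Algebra.TensorProduct.includeLeftRingHom (R := k) (A := R) (B := R) (MvPowerSeries.coeff bc.1 E) * (Algebra.TensorProduct.includeRight (R := k) (A := R) (B := R)).toRingHom (MvPowerSeries.coeff bc.2 E) = MvPowerSeries.coeff bc.1 E ⊗ₜ[k] MvPowerSeries.coeff bc.2 E := by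
    intro bc
    show (MvPowerSeries.coeff bc.1 E ⊗ₜ[k] (1:R)) * ((1:R) ⊗ₜ[k] MvPowerSeries.coeff bc.2 E) = _
    rw [Algebra.TensorProduct.tmul_mul_tmul, one_mul, mul_one]
  simp only [this]
  rfl

lemma GLs.mul {E F : MvPowerSeries (Fin n) R} (hE : GLs k E) (hF : GLs k F) : GLs k (E * F) := by
  unfold GLs at *
  rw [map_mul, hE, hF, map_mul, map_mul]
  have hc : Commute (MvPowerSeries.map (Algebra.TensorProduct.includeRight (R := k) (A := R) (B := R)).toRingHom E) (MvPowerSeries.map (Algebra.TensorProduct.includeLeftRingHom (R := k) (A := R) (B := R)) F) := by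
    show _ * _ = _ * _
    ext1 a
    rw [MvPowerSeries.coeff_mul, MvPowerSeries.coeff_mul]
    refine Finset.sum_equiv (Equiv.prodComm _ _) ?_ ?_
    · intro bc
      simp [Finset.HasAntidiagonal.mem_antidiagonal, add_comm]
    · intro bc _
      simp only [MvPowerSeries.coeff_map, Equiv.prodComm_apply, Prod.fst_swap, Prod.snd_swap]
      show ((1:R) ⊗ₜ[k] _) * (_ ⊗ₜ[k] (1:R)) = (_ ⊗ₜ[k] (1:R)) * ((1:R) ⊗ₜ[k] _)
      simp [Algebra.TensorProduct.tmul_mul_tmul]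
  rw [mul_assoc, ← mul_assoc (MvPowerSeries.map (Algebra.TensorProduct.includeRight (R := k) (A := R) (B := R)).toRingHom E), hc.eq]
  simp only [mul_assoc]

lemma GLs_Es (hp : ∀ i, Coalgebra.comul (R := k) (p i) = p i ⊗ₜ 1 + 1 ⊗ₜ p i) (i : Fin n) : GLs k (Es k p i) := by
  rw [GLs_iff]
  intro a
  by_cases ha : a = Finsupp.single i (a i)
  · rw [coeff_Es, if_pos ha, comul_dpw _ (hp i)]
    conv_rhs => rw [ha, Finsupp.antidiagonal_single, Finset.sum_map]
    refine Finset.sum_congr rfl (fun rs _ => ?_)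
    simp [coeff_Es]
  · rw [coeff_Es, if_neg ha, map_zero, Finset.sum_eq_zero]
    rintro ⟨b, c⟩ hbc
    rw [Finset.HasAntidiagonal.mem_antidiagonal] at hbc
    simp only [coeff_Es]
    split_ifs with h1 h2
    · exfalso; apply ha
      simp only at hbc
      rw [← hbc, h1, h2]
      simp [← Finsupp.single_add]
    all_goals simp

theorem comul_ee (hp : ∀ i, Coalgebra.comul (R := k) (p i) = p i ⊗ₜ 1 + 1 ⊗ₜ p i) (a : Fin n →₀ ℕ) :
    Coalgebra.comul (R := k) (ee k p a) = ∑ bc ∈ Finset.HasAntidiagonal.antidiagonal a, ee k p bc.1 ⊗ₜ[k] ee k p bc.2 := by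
  have : ∀ l, GLs k (Ep k p l) := by
    intro l
    induction l with
    | nil => simp [Ep, GLs]
    | cons i l ih =>
      rw [Ep, List.map_cons, List.prod_cons]
      exact (GLs_Es p hp i).mul ih
  exact (GLs_iff _).1 (this _) a
end

section
variable {k R : Type*} [Field k] [Ring R] [Algebra k R] {n : ℕ} (p : Fin n → R)

lemma coeff_Ep_zero (l : List (Fin n)) : ∀ (a : Fin n →₀ ℕ) (i : Fin n), i ∉ l → a i ≠ 0 → MvPowerSeries.coeff a (Ep k p l) = 0 := by
  induction l with
  | nil =>
    intro a i _ hi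
    rw [Ep, List.map_nil, List.prod_nil, MvPowerSeries.coeff_one, if_neg]
    rintro rfl; simp at hi
  | cons j l ih =>
    intro a i hil hi
    rw [List.mem_cons, not_or] at hil
    rw [Ep, List.map_cons, List.prod_cons, MvPowerSeries.coeff_mul, Finset.sum_eq_zero]
    rintro ⟨b, c⟩ hbc
    rw [Finset.HasAntidiagonal.mem_antidiagonal] at hbc
    simp only at hbc ⊢
    by_cases hc : c i = 0
    · have hb : b i ≠ 0 := by
        rw [← hbc, Finsupp.add_apply, hc, add_zero] at hi; exact hi
      rw [coeff_Es, if_neg, zero_mul]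
      intro h
      rw [h, Finsupp.single_apply, if_neg (Ne.symm hil.1)] at hb
      exact hb rfl
    · rw [show (List.map (Es k p) l).prod = Ep k p l from rfl, ih c i hil.2 hc, mul_zero]

lemma coeff_Ep (l : List (Fin n)) (hl : l.Nodup) : ∀ (a : Fin n →₀ ℕ), (∀ i, a i ≠ 0 → i ∈ l) → MvPowerSeries.coeff a (Ep k p l) = (l.map (fun i => dpw k (p i) (a i))).prod := by
  induction l with
  | nil =>
    intro a h
    have : a = 0 := by
      ext i
      by_contra hi
      simpa using h i hi
    rw [Ep, List.map_nil, List.prod_nil, MvPowerSeries.coeff_one, if_pos this]; simp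
  | cons j l ih =>
    intro a h
    rw [List.nodup_cons] at hl
    rw [Ep, List.map_cons, List.prod_cons, MvPowerSeries.coeff_mul, List.map_cons, List.prod_cons]
    have key : ∀ c : Fin n →₀ ℕ, a = Finsupp.single j (a j) + c → c j = 0 := by
      intro c hc
      have := DFunLike.congr_fun hc j
      simp at this; exact this
    have hdec : Finsupp.single j (a j) + a.erase j = a := Finsupp.single_add_erase j a
    rw [Finset.sum_eq_single (Finsupp.single j (a j), a.erase j)]
    · have h1 : MvPowerSeries.coeff (Finsupp.single j (a j)) (Es k p j) = dpw k (p j) (a j) := by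
        show (if _ then _ else _) = _
        simp
      simp only
      rw [h1]
      congr 1
      rw [show (List.map (Es k p) l).prod = Ep k p l from rfl, ih hl.2]
      · congr 1
        apply List.map_congr_left
        intro i hi
        rw [Finsupp.erase_ne]
        rintro rfl; exact hl.1 hi
      · intro i hi
        by_cases hij : i = j
        · subst hij; simp at hi
        · rw [Finsupp.erase_ne hij] at hi
          have := h i hi
          rw [List.mem_cons] at this
          exact this.resolve_left hij
    · rintro ⟨b, c⟩ hbc hne
      rw [Finset.HasAntidiagonal.mem_antidiagonal] at hbc
      simp only at hbc ⊢
      by_cases hb : b = Finsupp.single j (b j)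
      · by_cases hc : c j = 0
        · exfalso; apply hne
          have h1 : b j = a j := by rw [← hbc, Finsupp.add_apply, hc, add_zero]
          rw [h1] at hb
          have h2 : c = a.erase j := by
            rw [hb] at hbc
            exact add_left_cancel (hbc.trans hdec.symm)
          rw [hb, h2]
        · rw [show (List.map (Es k p) l).prod = Ep k p l from rfl, coeff_Ep_zero p l c j hl.1 hc, mul_zero]
      · rw [coeff_Es, if_neg hb, zero_mul]
    · intro hn
      exfalso; apply hn
      rw [Finset.HasAntidiagonal.mem_antidiagonal]
      exact hdec

/-- ordered monomials -/
def mon {R : Type*} [Ring R] {n : ℕ} (p : Fin n → R) (a : Fin n →₀ ℕ) : R := ((List.finRange n).map (fun i => p i ^ a i)).prod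

lemma ee_mon [CharZero k] (a : Fin n →₀ ℕ) : ∃ c : k, c ≠ 0 ∧ ee k p a = c • mon p a := by
  rw [ee, coeff_Ep p _ (List.nodup_finRange n) a (fun i _ => List.mem_finRange i), mon]
  generalize List.finRange n = l
  induction l with
  | nil => exact ⟨1, one_ne_zero, by simp⟩
  | cons i l ih =>
    obtain ⟨c, hc, h⟩ := ih
    refine ⟨((a i).factorial : k)⁻¹ * c, mul_ne_zero (inv_ne_zero (by exact_mod_cast (a i).factorial_ne_zero)) hc, ?_⟩
    rw [List.map_cons, List.prod_cons, h, List.map_cons, List.prod_cons, dpw, smul_mul_smul_comm]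

lemma ee_zero : ee k p 0 = 1 := by
  rw [ee, coeff_Ep p _ (List.nodup_finRange n) 0 (by simp)]
  apply List.prod_eq_one
  intro x hx
  rw [List.mem_map] at hx
  obtain ⟨i, _, rfl⟩ := hx
  simp [dpw]

lemma ee_single (i : Fin n) : ee k p (Finsupp.single i 1) = p i := by
  rw [ee, coeff_Ep p _ (List.nodup_finRange n) _ (fun i _ => List.mem_finRange i)]
  have : ∀ l : List (Fin n), l.Nodup → (l.map (fun j => dpw k (p j) (Finsupp.single i 1 j))).prod = if i ∈ l then p i else 1 := by
    intro l hl
    induction l with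
    | nil => simp
    | cons j l ih =>
      rw [List.nodup_cons] at hl
      rw [List.map_cons, List.prod_cons, ih hl.2]
      by_cases hij : i = j
      · subst hij
        simp [hl.1, dpw]
      · simp [hij, dpw, Finsupp.single_apply]
  rw [this _ (List.nodup_finRange n), if_pos (List.mem_finRange i)]
end
end GW

open scoped TensorProduct
namespace GW
open Classical

lemma exists_dual_li {k X ι : Type*} [Field k] [AddCommGroup X] [Module k X] {v : ι → X} {s : Set ι} (hv : LinearIndepOn k v s) (φ : ι → k) :
    ∃ f : X →ₗ[k] k, ∀ i ∈ s, f (v i) = φ i := by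
  have h : LinearIndependent k (fun i : s => v i) := hv
  obtain ⟨g, hg⟩ := LinearMap.exists_leftInverse_of_injective (Finsupp.linearCombination k (fun i : s => v i)) (LinearMap.ker_eq_bot.2 h)
  refine ⟨(Finsupp.linearCombination k (fun i : s => φ i)) ∘ₗ g, fun i hi => ?_⟩
  have := LinearMap.congr_fun hg (Finsupp.single (⟨i, hi⟩ : s) 1)
  simp at this
  simp [this]

section
variable {k R : Type*} [Field k] [Ring R] [HopfAlgebra k R]

/-- slicing by a functional -/
noncomputable def Lop (f : R →ₗ[k] k) : R →ₗ[k] R := (TensorProduct.lid k R).toLinearMap ∘ₗ f.rTensor R ∘ₗ Coalgebra.comul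

lemma Lop_def (f : R →ₗ[k] k) (x : R) : Lop f x = TensorProduct.lid k R (f.rTensor R (Coalgebra.comul x)) := rfl

lemma Lop_grp (f : R →ₗ[k] k) (g : GroupLike k R) : Lop f g.val = f g.val • g.val := by
  rw [Lop_def, g.isGroupLikeElem_val.comul_eq_tmul_self]; simp

lemma Lop_prim (f : R →ₗ[k] k) (x : R) (hx : Coalgebra.comul (R := k) x = x ⊗ₜ 1 + 1 ⊗ₜ x) : Lop f x = f x • 1 + f 1 • x := by
  rw [Lop_def, hx]; simp

lemma prim_span_G (x : R) (hx : Coalgebra.comul (R := k) x = x ⊗ₜ 1 + 1 ⊗ₜ x)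
    (h : x ∈ Submodule.span k (Set.range (GroupLike.val : GroupLike k R → R))) : x = 0 := by
  have hli : LinearIndependent k (GroupLike.val : GroupLike k R → R) := linearIndep_groupLikeVal
  obtain ⟨f, hf⟩ := exists_dual_li (s := Set.univ) (linearIndepOn_univ_iff.2 hli) (fun g => if g = 1 then 1 else 0)
  have key : ∀ y ∈ Submodule.span k (Set.range (GroupLike.val : GroupLike k R → R)), Lop f y = f y • 1 := by
    intro y hy
    induction hy using Submodule.span_induction with
    | mem y hy =>
      obtain ⟨g, rfl⟩ := hy
      rw [Lop_grp, hf g trivial]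
      split_ifs with hg
      · rw [hg, GroupLike.val_one]
      · simp
    | zero => simp
    | add y z _ _ h1 h2 => rw [map_add, h1, h2, map_add, add_smul]
    | smul c y _ h1 => rw [map_smul, h1, map_smul, smul_assoc]
  have h1 := key x h
  rw [Lop_prim f x hx] at h1
  have h2 : f 1 = 1 := by
    have := hf 1 trivial
    rw [GroupLike.val_one, if_pos rfl] at this; exact this
  rw [h2, one_smul] at h1
  simpa using h1

variable {n : ℕ} (p : Fin n → R)

/-- the candidate basis -/
noncomputable def bb (k : Type*) {R : Type*} [Field k] [Ring R] [HopfAlgebra k R] {n : ℕ} (p : Fin n → R) (x : (Fin n →₀ ℕ) × GroupLike k R) : R := ee k p x.1 * x.2.val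

variable [CharZero k]

lemma comul_bb (hp : ∀ i, Coalgebra.comul (R := k) (p i) = p i ⊗ₜ 1 + 1 ⊗ₜ p i) (a : Fin n →₀ ℕ) (g : GroupLike k R) :
    Coalgebra.comul (R := k) (bb k p (a, g)) = ∑ bc ∈ Finset.HasAntidiagonal.antidiagonal a, bb k p (bc.1, g) ⊗ₜ[k] bb k p (bc.2, g) := by
  rw [bb, Bialgebra.comul_mul, comul_ee p hp, g.isGroupLikeElem_val.comul_eq_tmul_self, Finset.sum_mul]
  simp [bb, Algebra.TensorProduct.tmul_mul_tmul]

/-- action on coefficients -/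
noncomputable def hact (p : Fin n → R) (f : R →ₗ[k] k) : (((Fin n →₀ ℕ) × GroupLike k R) →₀ k) →ₗ[k] (((Fin n →₀ ℕ) × GroupLike k R) →₀ k) :=
  Finsupp.linearCombination k (fun x => ∑ bc ∈ Finset.HasAntidiagonal.antidiagonal x.1, Finsupp.single (bc.2, x.2) (f (bb k p (bc.1, x.2))))

lemma Lop_Phi (hp : ∀ i, Coalgebra.comul (R := k) (p i) = p i ⊗ₜ 1 + 1 ⊗ₜ p i) (f : R →ₗ[k] k) (c : ((Fin n →₀ ℕ) × GroupLike k R) →₀ k) :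
    Lop f (Finsupp.linearCombination k (bb k p) c) = Finsupp.linearCombination k (bb k p) (hact p f c) := by
  induction c using Finsupp.induction_linear with
  | zero => simp
  | add c d h1 h2 => simp only [map_add, h1, h2]
  | single x r =>
    obtain ⟨a, g⟩ := x
    simp only [hact, Finsupp.linearCombination_single, map_smul, _root_.map_sum]
    rw [Lop_def, comul_bb p hp]
    simp

lemma hact_apply (f : R →ₗ[k] k) (c : ((Fin n →₀ ℕ) × GroupLike k R) →₀ k) (d : Fin n →₀ ℕ) (g : GroupLike k R) :
    hact p f c (d, g) = ∑ x ∈ c.support, c x * ∑ bc ∈ Finset.HasAntidiagonal.antidiagonal x.1, if bc.2 = d ∧ x.2 = g then f (bb k p (bc.1, x.2)) else 0 := by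
  rw [hact, Finsupp.linearCombination_apply, Finsupp.sum, Finsupp.finsetSum_apply]
  refine Finset.sum_congr rfl (fun x _ => ?_)
  rw [Finsupp.smul_apply, Finsupp.finsetSum_apply, smul_eq_mul]
  congr 1
  refine Finset.sum_congr rfl (fun bc _ => ?_)
  rw [Finsupp.single_apply]
  simp only [Prod.mk.injEq]

lemma bb_zero (g : GroupLike k R) : bb k p (0, g) = g.val := by rw [bb, ee_zero, one_mul]
lemma bb_single (i : Fin n) (g : GroupLike k R) : bb k p (Finsupp.single i 1, g) = p i * g.val := by rw [bb, ee_single]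

lemma deg_le_one (a : Fin n →₀ ℕ) (h : a.degree ≤ 1) : a = 0 ∨ ∃ i, a = Finsupp.single i 1 := by
  by_cases h0 : a = 0
  · exact Or.inl h0
  right
  obtain ⟨i, hi⟩ := Finsupp.ne_iff.1 h0
  refine ⟨i, ?_⟩
  have h1 : Finsupp.single i 1 ≤ a := by
    rw [Finsupp.single_le_iff]
    have : a i ≠ 0 := hi
    omega
  obtain ⟨b, rfl⟩ := exists_add_of_le h1
  rw [map_add, Finsupp.degree_single] at h
  have : b = 0 := by rw [← Finsupp.degree_eq_zero_iff]; omega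
  rw [this, add_zero]

lemma anti_single (i : Fin n) : Finset.HasAntidiagonal.antidiagonal (Finsupp.single i 1) = ({(0, Finsupp.single i 1), (Finsupp.single i 1, 0)} : Finset ((Fin n →₀ ℕ) × (Fin n →₀ ℕ))) := by
  ext ⟨b, c⟩
  rw [Finset.HasAntidiagonal.mem_antidiagonal, Finset.mem_insert, Finset.mem_singleton, Prod.mk.injEq, Prod.mk.injEq]
  constructor
  · intro h
    simp only at h
    have hd := congrArg Finsupp.degree h
    rw [map_add, Finsupp.degree_single] at hd
    by_cases hb : b = 0
    · left; subst hb; simpa using h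
    · right
      have h1 : b.degree ≠ 0 := fun h => hb ((Finsupp.degree_eq_zero_iff b).1 h)
      have : c = 0 := by rw [← Finsupp.degree_eq_zero_iff]; omega
      subst this; simpa using h
  · rintro (⟨rfl, rfl⟩ | ⟨rfl, rfl⟩) <;> simp

lemma li_one (hp : ∀ i, Coalgebra.comul (R := k) (p i) = p i ⊗ₜ 1 + 1 ⊗ₜ p i) (hli : LinearIndependent k p) :
    LinearIndepOn k (bb k p) {x | x.1.degree ≤ 1} := by
  have hliG : LinearIndependent k (GroupLike.val : GroupLike k R → R) := linearIndep_groupLikeVal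
  rw [linearIndepOn_iff]
  intro c hc h0
  have hc' : ∀ x, 1 < x.1.degree → c x = 0 := by
    intro x hx
    by_contra h
    have := hc (Finsupp.mem_support_iff.2 h)
    simp at this; omega
  have hq : ∀ i g, c (Finsupp.single i 1, g) = 0 := by
    intro i0 g0
    obtain ⟨f, hf⟩ := exists_dual_li (s := Set.univ) (linearIndepOn_univ_iff.2 hliG) (fun g => if g = g0 then 1 else 0)
    have h1 := Lop_Phi p hp f c
    rw [h0, map_zero] at h1
    -- q = sum
    set q : R := ∑ i, c (Finsupp.single i 1, g0) • p i with hqd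
    have h2 : ∀ c : ((Fin n →₀ ℕ) × GroupLike k R) →₀ k, (∀ x, 1 < x.1.degree → c x = 0) → Finsupp.linearCombination k (bb k p) (hact p f c) - (∑ i, c (Finsupp.single i 1, g0) • p i) * g0.val ∈ Submodule.span k (Set.range (GroupLike.val : GroupLike k R → R)) := by
      intro c hc
      rw [← Lop_Phi p hp, Finsupp.linearCombination_apply, Finsupp.sum, _root_.map_sum]
      have h3 : (∑ i, c (Finsupp.single i 1, g0) • p i) * g0.val = ∑ x ∈ c.support, c x • (if x.1.degree = 1 ∧ x.2 = g0 then bb k p x else 0) := by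
        rw [Finset.sum_mul]
        refine Finset.sum_bij_ne_zero (fun i _ _ => (Finsupp.single i 1, g0)) ?_ ?_ ?_ ?_
        · intro i _ h
          rw [Finsupp.mem_support_iff]
          intro h'; rw [h'] at h; simp at h
        · intro i _ _ j _ _ h
          simp only [Prod.mk.injEq, and_true] at h
          exact (Finsupp.single_left_inj one_ne_zero).1 h
        · intro x hx hne
          have hx1 : x.1.degree = 1 ∧ x.2 = g0 := by
            by_contra h; rw [if_neg h] at hne; simp at hne
          obtain ⟨a, g⟩ := x
          simp only at hx1
          obtain ⟨hd, rfl⟩ := hx1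
          rcases deg_le_one a (by omega) with rfl | ⟨i, rfl⟩
          · simp at hd
          · refine ⟨i, Finset.mem_univ _, ?_, rfl⟩
            rw [if_pos ⟨by simp, rfl⟩, bb_single] at hne
            rw [smul_mul_assoc]; exact hne
        · intro i _ _
          simp [bb_single]
      rw [h3, ← Finset.sum_sub_distrib]
      refine Submodule.sum_mem _ (fun x hx => ?_)
      rw [map_smul, ← smul_sub]
      refine Submodule.smul_mem _ _ ?_
      obtain ⟨a, g⟩ := x
      have hG : ∀ g : GroupLike k R, g.val ∈ Submodule.span k (Set.range (GroupLike.val : GroupLike k R → R)) := fun g => Submodule.subset_span ⟨g, rfl⟩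
      have ha : a.degree ≤ 1 := by
        by_contra h
        exact (Finsupp.mem_support_iff.1 hx) (hc _ (by simpa using h))
      rcases deg_le_one a ha with rfl | ⟨i, rfl⟩
      · rw [bb_zero, Lop_grp, if_neg (by simp), sub_zero]
        exact Submodule.smul_mem _ _ (hG g)
      · rw [Lop_def, comul_bb p hp, anti_single, Finset.sum_pair (by simp)]
        simp only [map_add, LinearMap.rTensor_tmul, TensorProduct.lid_tmul, bb_zero]
        rw [hf g trivial]
        by_cases hg : g = g0
        · rw [if_pos hg, if_pos ⟨by simp, hg⟩, one_smul, add_sub_cancel_left]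
          exact Submodule.smul_mem _ _ (hG g)
        · rw [if_neg hg, if_neg (fun h => hg h.2), zero_smul, zero_add, sub_zero]
          exact Submodule.smul_mem _ _ (hG g)
    have h3 := h2 c hc'
    rw [← h1, zero_sub, neg_mem_iff, ← hqd] at h3
    have h4 : q ∈ Submodule.span k (Set.range (GroupLike.val : GroupLike k R → R)) := by
      have : ∀ y ∈ Submodule.span k (Set.range (GroupLike.val : GroupLike k R → R)), y * (g0⁻¹).val ∈ Submodule.span k (Set.range (GroupLike.val : GroupLike k R → R)) := by
        intro y hy
        induction hy using Submodule.span_induction with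
        | mem y hy =>
          obtain ⟨g, rfl⟩ := hy
          rw [← GroupLike.val_mul]; exact Submodule.subset_span ⟨_, rfl⟩
        | zero => simp
        | add y z _ _ h1 h2 => rw [add_mul]; exact add_mem h1 h2
        | smul c y _ h1 => rw [smul_mul_assoc]; exact Submodule.smul_mem _ _ h1
      have h5 := this _ h3
      rwa [mul_assoc, ← GroupLike.val_mul, mul_inv_cancel, GroupLike.val_one, mul_one] at h5
    have h5 : q = 0 := by
      refine prim_span_G q ?_ h4
      rw [hqd, _root_.map_sum, TensorProduct.sum_tmul, TensorProduct.tmul_sum, ← Finset.sum_add_distrib]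
      refine Finset.sum_congr rfl (fun i _ => ?_)
      rw [map_smul, hp, smul_add, TensorProduct.smul_tmul', TensorProduct.tmul_smul]
    exact (Fintype.linearIndependent_iff.1 hli) _ h5 i0
  -- now only group part
  have hz : ∀ x : (Fin n →₀ ℕ) × GroupLike k R, x.1 ≠ 0 → c x = 0 := by
    rintro ⟨a, g⟩ hx
    by_cases h : a.degree ≤ 1
    · rcases deg_le_one a h with rfl | ⟨i, rfl⟩
      · exact absurd rfl hx
      · exact hq i g
    · exact hc' _ (by simpa using h)
  ext ⟨a, g0⟩
  by_cases ha : a = 0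
  · subst ha
    obtain ⟨f, hf⟩ := exists_dual_li (s := Set.univ) (linearIndepOn_univ_iff.2 hliG) (fun g => if g = g0 then 1 else 0)
    have h6 := congrArg f h0
    rw [map_zero, Finsupp.linearCombination_apply, Finsupp.sum, _root_.map_sum, Finset.sum_eq_single (0, g0)] at h6
    · rw [map_smul, bb_zero, hf g0 trivial, if_pos rfl] at h6
      simpa using h6
    · rintro ⟨b, g⟩ hb hne
      have hb0 : b = 0 := by
        by_contra h
        exact Finsupp.mem_support_iff.1 hb (hz _ h)
      subst hb0
      rw [map_smul, bb_zero, hf g trivial, if_neg, smul_zero]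
      rintro rfl; exact hne rfl
    · intro h
      rw [Finsupp.notMem_support_iff] at h
      rw [h]; simp
  · exact hz _ ha

set_option maxHeartbeats 800000 in
lemma li_step (hp : ∀ i, Coalgebra.comul (R := k) (p i) = p i ⊗ₜ 1 + 1 ⊗ₜ p i) (hli : LinearIndependent k p) (m : ℕ) (hm : 1 ≤ m)
    (ih : LinearIndepOn k (bb k p) {x | x.1.degree ≤ m}) : LinearIndepOn k (bb k p) {x | x.1.degree ≤ m + 1} := by
  have hsup : ∀ (m : ℕ) (c : ((Fin n →₀ ℕ) × GroupLike k R) →₀ k), c ∈ Finsupp.supported k k {x : (Fin n →₀ ℕ) × GroupLike k R | x.1.degree ≤ m} ↔ ∀ x, m < x.1.degree → c x = 0 := by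
    intro m c
    rw [Finsupp.mem_supported']
    simp
  rw [linearIndepOn_iff] at ih ⊢
  intro c hc h0
  rw [hsup] at hc
  refine ih c ?_ h0
  rw [hsup]
  rintro ⟨a, g0⟩ ha
  simp only at ha
  by_cases ha' : m + 1 < a.degree
  · exact hc _ ha'
  have ha1 : a.degree = m + 1 := by omega
  have ha0 : a ≠ 0 := by rintro rfl; simp at ha1
  obtain ⟨i, hi⟩ := Finsupp.ne_iff.1 ha0
  have h1 : Finsupp.single i 1 ≤ a := by
    rw [Finsupp.single_le_iff]
    have : a i ≠ 0 := hi
    omega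
  obtain ⟨d, rfl⟩ := exists_add_of_le h1
  rw [map_add, Finsupp.degree_single] at ha1
  obtain ⟨f, hf⟩ := exists_dual_li (li_one p hp hli) (fun x => if x = (Finsupp.single i 1, g0) then 1 else 0)
  have hf0 : ∀ g, f (bb k p (0, g)) = 0 := by
    intro g
    rw [hf _ (by simp), if_neg]
    intro h
    have := congrArg (fun x => x.1.degree) h
    simp at this
  have hL := Lop_Phi p hp f c
  rw [h0, map_zero] at hL
  have hz := ih (hact p f c) (by
    rw [hsup]
    rintro ⟨e, g⟩ he
    rw [hact_apply]
    refine Finset.sum_eq_zero (fun x hx => ?_)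
    rw [Finset.sum_eq_zero, mul_zero]
    rintro ⟨b, e'⟩ hb
    rw [Finset.HasAntidiagonal.mem_antidiagonal] at hb
    simp only at hb ⊢
    split_ifs with h
    · obtain ⟨rfl, rfl⟩ := h
      have hxd : x.1.degree ≤ m + 1 := by
        by_contra h
        exact Finsupp.mem_support_iff.1 hx (hc x (by omega))
      rw [← hb, map_add] at hxd
      simp only at he
      have hb0 : b = 0 := by rw [← Finsupp.degree_eq_zero_iff]; omega
      rw [hb0, hf0]
    · rfl) hL.symm
  have hv := DFunLike.congr_fun hz (d, g0)
  rw [hact_apply, Finset.sum_eq_single (Finsupp.single i 1 + d, g0)] at hv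
  · rw [Finset.sum_eq_single (Finsupp.single i 1, d)] at hv
    · rw [if_pos ⟨rfl, rfl⟩, hf _ (by simp), if_pos rfl, mul_one] at hv
      exact hv
    · rintro ⟨b, e⟩ hb hne
      rw [Finset.HasAntidiagonal.mem_antidiagonal] at hb
      rw [if_neg]
      rintro ⟨h1, _⟩
      simp only at h1 hb
      subst h1
      exact hne (by rw [add_right_cancel hb])
    · intro h
      rw [Finset.HasAntidiagonal.mem_antidiagonal] at h
      exact (h (by simp only)).elim
  · intro x hx hne
    rw [Finset.sum_eq_zero, mul_zero]
    rintro ⟨b, e⟩ hb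
    rw [Finset.HasAntidiagonal.mem_antidiagonal] at hb
    simp only at hb ⊢
    split_ifs with h
    · obtain ⟨rfl, rfl⟩ := h
      have hxd : x.1.degree ≤ m + 1 := by
        by_contra h
        exact Finsupp.mem_support_iff.1 hx (hc x (by omega))
      rw [← hb, map_add] at hxd
      rw [hf _ (by simp; omega), if_neg]
      intro h
      rw [Prod.mk.injEq] at h
      apply hne
      ext1
      · simp only; rw [← hb, h.1]
      · rfl
    · rfl
  · intro h
    rw [Finsupp.notMem_support_iff] at h
    rw [h, zero_mul]

theorem li_bb (hp : ∀ i, Coalgebra.comul (R := k) (p i) = p i ⊗ₜ 1 + 1 ⊗ₜ p i) (hli : LinearIndependent k p) :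
    LinearIndependent k (bb k p) := by
  have h : ∀ m, LinearIndepOn k (bb k p) {x | x.1.degree ≤ m + 1} := by
    intro m
    induction m with
    | zero => exact li_one p hp hli
    | succ m ih => exact li_step p hp hli (m+1) (by omega) ih
  rw [linearIndependent_iff]
  intro c hc
  refine linearIndepOn_iff.1 (h (c.support.sup (fun x => x.1.degree))) c ?_ hc
  intro x hx
  have := Finset.le_sup (f := fun x : (Fin n →₀ ℕ) × GroupLike k R => x.1.degree) hx
  simp only [Set.mem_ofPred_eq]; omega
end
end GW

open scoped TensorProduct
namespace GW
open Classical

/-- primitive elements -/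
def Prim (k R : Type*) [Field k] [Ring R] [HopfAlgebra k R] : Submodule k R where
  carrier := {x | Coalgebra.comul (R := k) x = x ⊗ₜ 1 + 1 ⊗ₜ x}
  add_mem' := (by
    intro x y hx hy
    show _ = _
    rw [map_add, hx, hy, TensorProduct.add_tmul, TensorProduct.tmul_add]; abel)
  zero_mem' := (by
    show _ = _
    simp)
  smul_mem' := (by
    intro c x hx
    show _ = _
    rw [map_smul, hx, smul_add, TensorProduct.smul_tmul', TensorProduct.tmul_smul])

lemma mem_Prim {k R : Type*} [Field k] [Ring R] [HopfAlgebra k R] {x : R} : x ∈ Prim k R ↔ Coalgebra.comul (R := k) x = x ⊗ₜ 1 + 1 ⊗ₜ x := Iff.rfl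

lemma mon_mem_pow {k R : Type*} [Field k] [Ring R] [Algebra k R] {n : ℕ} (p : Fin n → R) (V : Submodule k R) (hV : ∀ i, p i ∈ V) (a : Fin n →₀ ℕ) :
    mon p a ∈ ((1 : Submodule k R) ⊔ V)^a.degree := by
  have hd : a.degree = ((List.finRange n).map a).sum := by
    rw [Finsupp.degree_eq_sum, ← List.ofFn_eq_map, List.sum_ofFn]
  rw [hd, mon]
  generalize List.finRange n = l
  induction l with
  | nil => simpa using ⟨1, by simp⟩
  | cons i l ih =>
    simp only [List.map_cons, List.prod_cons, List.sum_cons, pow_add]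
    exact Submodule.mul_mem_mul (Submodule.pow_mem_pow _ (Submodule.mem_sup_right (hV i)) _) ih

lemma pow_le_pow_one {k R : Type*} [Field k] [Ring R] [Algebra k R] (V : Submodule k R) {m n : ℕ} (h : m ≤ n) :
    ((1 : Submodule k R) ⊔ V)^m ≤ ((1 : Submodule k R) ⊔ V)^n := by
  obtain ⟨t, rfl⟩ := exists_add_of_le h
  rw [pow_add]
  intro x hx
  have h1 : (1:R) ∈ ((1 : Submodule k R) ⊔ V)^t := by
    have := Submodule.pow_mem_pow ((1 : Submodule k R) ⊔ V) (x := 1) (Submodule.mem_sup_left (Submodule.one_le.1 le_rfl)) t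
    rwa [one_pow] at this
  simpa using Submodule.mul_mem_mul hx h1

lemma prim_card {k R : Type*} [Field k] [CharZero k] [Ring R] [HopfAlgebra k R] (d : ℕ)
    (hd : ∀ V : Submodule k R, FiniteDimensional k V → ∃ C : ℝ, ∀ n : ℕ, 1 ≤ n → (Module.finrank k ↥(((1 : Submodule k R) ⊔ V)^n) : ℝ) ≤ C * (n:ℝ)^d)
    {n : ℕ} (p : Fin n → R) (hp : ∀ i, Coalgebra.comul (R := k) (p i) = p i ⊗ₜ 1 + 1 ⊗ₜ p i) (hli : LinearIndependent k p) : n ≤ d := by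
  by_contra hn
  push Not at hn
  set V := Submodule.span k (Set.range p) with hV
  have hVf : FiniteDimensional k V := FiniteDimensional.span_of_finite k (Set.finite_range p)
  obtain ⟨C, hC⟩ := hd V hVf
  have key : ∀ q : ℕ, 1 ≤ q → ((q:ℝ)+1)^n ≤ C * ((n * q : ℕ) : ℝ)^d := by
    intro q hq
    refine le_trans ?_ (hC (n*q) (Nat.mul_pos (by omega) hq))
    have : FiniteDimensional k ↥(((1 : Submodule k R) ⊔ V)^(n*q)) := fd_pow V hVf _
    let A : (Fin n → Fin (q+1)) → (Fin n →₀ ℕ) := fun t => Finsupp.equivFunOnFinite.symm (fun i => (t i : ℕ))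
    have hA : Function.Injective A := by
      intro s t h
      funext i
      have := DFunLike.congr_fun h i
      simp [A] at this
      exact Fin.ext this
    have hmem : ∀ t, ee k p (A t) ∈ ((1 : Submodule k R) ⊔ V)^(n*q) := by
      intro t
      obtain ⟨c, _, hc⟩ := ee_mon (k := k) p (A t)
      rw [hc]
      refine Submodule.smul_mem _ _ (pow_le_pow_one V ?_ (mon_mem_pow p V (fun i => Submodule.subset_span ⟨i, rfl⟩) _))
      rw [Finsupp.degree_eq_sum]
      calc ∑ i, A t i ≤ ∑ i : Fin n, q := Finset.sum_le_sum (fun i _ => by simp [A]; omega)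
        _ = n * q := by simp
    have hli2 : LinearIndependent k (fun t => ee k p (A t)) := by
      have h1 := (li_bb p hp hli).comp (fun t => (A t, 1)) (fun s t h => hA (by simpa using h))
      convert h1 using 1
      funext t
      simp [bb]
    have hli3 : LinearIndependent k (fun t => (⟨ee k p (A t), hmem t⟩ : ↥(((1 : Submodule k R) ⊔ V)^(n*q)))) := by
      apply LinearIndependent.of_comp (Submodule.subtype _)
      exact hli2
    have := hli3.fintype_card_le_finrank
    simp at this
    exact_mod_cast this
  have hC0 : 0 ≤ C * (n:ℝ)^d := by
    have := key 1 le_rfl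
    simp at this
    refine le_trans ?_ this
    positivity
  obtain ⟨q, hq⟩ := exists_nat_gt (C * (n:ℝ)^d)
  have hq1 : 1 ≤ q := by
    have : (0:ℝ) < q := lt_of_le_of_lt hC0 hq
    exact_mod_cast this
  have h1 := key q hq1
  have hq1' : (1:ℝ) ≤ q := by exact_mod_cast hq1
  have h2 : (q:ℝ)^(d+1) ≤ ((q:ℝ)+1)^n := by
    calc (q:ℝ)^(d+1) ≤ ((q:ℝ)+1)^(d+1) := by gcongr; linarith
      _ ≤ _ := pow_le_pow_right₀ (by linarith) (by omega)
  push_cast at h1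
  rw [mul_pow, ← mul_assoc] at h1
  have h3 : (q:ℝ) * q^d ≤ (C * (n:ℝ)^d) * q^d := by
    calc (q:ℝ) * q^d = q^(d+1) := by ring
      _ ≤ _ := h2.trans h1
  have := le_of_mul_le_mul_right h3 (by positivity)
  linarith

theorem prim_fd {k R : Type*} [Field k] [CharZero k] [Ring R] [HopfAlgebra k R] (d : ℕ)
    (hd : ∀ V : Submodule k R, FiniteDimensional k V → ∃ C : ℝ, ∀ n : ℕ, 1 ≤ n → (Module.finrank k ↥(((1 : Submodule k R) ⊔ V)^n) : ℝ) ≤ C * (n:ℝ)^d) :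
    FiniteDimensional k (Prim k R) := by
  by_contra h
  have h1 : ¬ Module.rank k (Prim k R) < Cardinal.aleph0 := fun h' => h (Module.rank_lt_aleph0_iff.1 h')
  push Not at h1
  have h2 : ((d+1 : ℕ) : Cardinal) ≤ Module.rank k (Prim k R) := (Cardinal.natCast_lt_aleph0.le).trans h1
  rw [le_rank_iff_exists_linearIndependent_finset] at h2
  obtain ⟨s, hs, hli⟩ := h2
  let e := s.equivFin.symm
  have := prim_card d hd (fun i => ((e i : Prim k R) : R)) (fun i => (e i : Prim k R).2) (by
    have h3 := (hli.comp e e.injective).map' (Submodule.subtype _) (Submodule.ker_subtype _)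
    exact h3)
  omega
end GW

open scoped TensorProduct
namespace GW
open Classical

lemma simul_eig {k X ι : Type*} [Field k] [IsAlgClosed k] [AddCommGroup X] [Module k X] (T : ι → X →ₗ[k] X)
    (hT : ∀ i j x, T i (T j x) = T j (T i x)) : ∀ (N : ℕ) (W : Submodule k X), FiniteDimensional k W → Module.finrank k W ≤ N → W ≠ ⊥ →
    (∀ i, ∀ x ∈ W, T i x ∈ W) → ∃ x ∈ W, x ≠ 0 ∧ ∀ i, ∃ l : k, T i x = l • x := by
  intro N
  induction N with
  | zero =>
    intro W hW h0 hne _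
    exact absurd (Submodule.finrank_eq_zero.1 (Nat.le_zero.1 h0)) hne
  | succ N ih =>
    intro W hW hN hne hst
    by_cases hsc : ∀ i, ∃ l : k, ∀ x ∈ W, T i x = l • x
    · obtain ⟨x, hx, hx0⟩ := Submodule.exists_mem_ne_zero_of_ne_bot hne
      exact ⟨x, hx, hx0, fun i => (hsc i).imp (fun l h => h x hx)⟩
    push Not at hsc
    obtain ⟨i, hi⟩ := hsc
    have hnt : Nontrivial W := (Submodule.nontrivial_iff_ne_bot).2 hne
    obtain ⟨μ, hμ⟩ := Module.End.exists_eigenvalue ((T i).restrict (hst i))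
    obtain ⟨v, hv⟩ := hμ.exists_hasEigenvector
    have hv1 : T i v = μ • (v : X) := by
      have := congrArg (Subtype.val) hv.apply_eq_smul
      simpa using this
    obtain ⟨w, hw, hwne⟩ := hi μ
    let W' : Submodule k X := W ⊓ LinearMap.ker (T i - μ • LinearMap.id)
    have hW'm : ∀ x, x ∈ W' ↔ x ∈ W ∧ T i x = μ • x := by
      intro x
      simp [W', sub_eq_zero]
    have hlt : W' < W := by
      refine lt_of_le_of_ne inf_le_left (fun h => ?_)
      rw [← h] at hw
      exact hwne ((hW'm w).1 hw).2
    have hW'f : FiniteDimensional k W' := Submodule.finiteDimensional_of_le hlt.le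
    have hfr := Submodule.finrank_lt_finrank_of_lt hlt
    obtain ⟨x, hx, h1, h2⟩ := ih W' hW'f (by omega) (by
      intro h
      have : (v : X) ∈ W' := (hW'm _).2 ⟨v.2, hv1⟩
      rw [h, Submodule.mem_bot] at this
      exact hv.2 (Subtype.ext this)) (by
      intro j x hx
      rw [hW'm] at hx ⊢
      refine ⟨hst j x hx.1, ?_⟩
      rw [hT, hx.2, map_smul])
    exact ⟨x, hlt.le hx, h1, h2⟩

section
variable {k R : Type*} [Field k] [Ring R] [HopfAlgebra k R]

/-- convolution of functionals -/
noncomputable def conv (f g : R →ₗ[k] k) : R →ₗ[k] k := (TensorProduct.lid k k).toLinearMap ∘ₗ TensorProduct.map f g ∘ₗ Coalgebra.comul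

lemma conv_def (f g : R →ₗ[k] k) (x : R) : conv f g x = TensorProduct.lid k k (TensorProduct.map f g (Coalgebra.comul x)) := rfl

lemma conv_Lop (f g : R →ₗ[k] k) (x : R) : conv f g x = g (Lop f x) := by
  rw [conv_def, Lop_def]
  generalize Coalgebra.comul (R := k) x = t
  induction t using TensorProduct.induction_on with
  | zero => simp
  | tmul a b => simp
  | add a b h1 h2 => simp only [map_add, h1, h2]

lemma Lop_Lop (f g : R →ₗ[k] k) (x : R) : Lop f (Lop g x) = Lop (conv g f) x := by
  have h := Coalgebra.coassoc_apply (R := k) x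
  have h1 : ∀ t : R ⊗[k] R, Lop f (TensorProduct.lid k R (g.rTensor R t)) = TensorProduct.lid k R (f.rTensor R (TensorProduct.lid k (R ⊗[k] R) (g.rTensor (R ⊗[k] R) (Coalgebra.comul.lTensor R t)))) := by
    intro t
    induction t using TensorProduct.induction_on with
    | zero => simp
    | tmul a b => simp [Lop_def]
    | add a b h1 h2 => simp only [map_add, h1, h2]
  have h2 : ∀ t : R ⊗[k] R, TensorProduct.lid k R ((conv g f).rTensor R t) = TensorProduct.lid k R (f.rTensor R (TensorProduct.lid k (R ⊗[k] R) (g.rTensor (R ⊗[k] R) (TensorProduct.assoc k R R R (Coalgebra.comul.rTensor R t))))) := by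
    intro t
    induction t using TensorProduct.induction_on with
    | zero => simp
    | tmul a b =>
      simp only [LinearMap.rTensor_tmul, TensorProduct.lid_tmul, conv_def]
      generalize Coalgebra.comul (R := k) a = u
      induction u using TensorProduct.induction_on with
      | zero => simp
      | tmul c d => simp [smul_smul]
      | add c d h1 h2 => simp only [map_add, h1, h2, add_smul, TensorProduct.add_tmul]
    | add a b h1 h2 => simp only [map_add, h1, h2]
  rw [Lop_def g x, h1, Lop_def (conv g f), h2, h]

lemma Lop_counit (x : R) : Lop (Coalgebra.counit (R := k)) x = x := by
  rw [Lop_def, Coalgebra.rTensor_counit_comul]; simp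

lemma conv_comm (hcc : ∀ r : R, TensorProduct.comm k R R (Coalgebra.comul r) = Coalgebra.comul r) (f g : R →ₗ[k] k) : conv f g = conv g f := by
  ext x
  rw [conv_def, conv_def]
  conv_lhs => rw [← hcc x]
  generalize Coalgebra.comul (R := k) x = t
  induction t using TensorProduct.induction_on with
  | zero => simp
  | tmul a b => simp [mul_comm]
  | add a b h1 h2 => simp only [map_add, h1, h2]

lemma conv_assoc (f g h : R →ₗ[k] k) : conv (conv f g) h = conv f (conv g h) := by
  ext x
  rw [conv_Lop, conv_Lop, conv_Lop, Lop_Lop]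

lemma conv_one (f g : R →ₗ[k] k) : conv f g 1 = f 1 * g 1 := by
  rw [conv_def, Bialgebra.comul_one, Algebra.TensorProduct.one_def]; simp

/-- slices separate -/
lemma slice_sep (z : R ⊗[k] R) (h : ∀ f : R →ₗ[k] k, TensorProduct.lid k R (f.rTensor R z) = 0) : z = 0 := by
  let b := Module.Free.chooseBasis k R
  apply (b.tensorProduct b).ext_elem
  rintro ⟨i, j⟩
  have h1 := congrArg (b.coord j) (h (b.coord i))
  have h2 : ∀ z : R ⊗[k] R, b.coord j (TensorProduct.lid k R ((b.coord i).rTensor R z)) = (b.tensorProduct b).repr z (i, j) := by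
    intro z
    induction z using TensorProduct.induction_on with
    | zero => simp
    | tmul a b => simp [mul_comm]
    | add a b h1 h2 => simp only [map_add, h1, h2, Finsupp.add_apply]
  rw [← h2, h1]; simp

lemma Lop_fd (x : R) : ∃ W : Submodule k R, FiniteDimensional k W ∧ ∀ f : R →ₗ[k] k, Lop f x ∈ W := by
  simp only [Lop_def]
  generalize Coalgebra.comul (R := k) x = t
  induction t using TensorProduct.induction_on with
  | zero => exact ⟨⊥, inferInstance, by simp⟩
  | tmul a b =>
    refine ⟨Submodule.span k {b}, inferInstance, fun f => ?_⟩
    simp only [LinearMap.rTensor_tmul, TensorProduct.lid_tmul]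
    exact Submodule.smul_mem _ _ (Submodule.mem_span_singleton_self b)
  | add a b h1 h2 =>
    obtain ⟨W1, f1, h1⟩ := h1
    obtain ⟨W2, f2, h2⟩ := h2
    refine ⟨W1 ⊔ W2, inferInstance, fun f => ?_⟩
    simp only [map_add]
    exact Submodule.add_mem_sup (h1 f) (h2 f)

lemma Lop_mul_grp (f : R →ₗ[k] k) (x : R) (g : GroupLike k R) : Lop f (x * g.val) = Lop (f ∘ₗ LinearMap.mulRight k g.val) x * g.val := by
  rw [Lop_def, Lop_def, Bialgebra.comul_mul, g.isGroupLikeElem_val.comul_eq_tmul_self]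
  generalize Coalgebra.comul (R := k) x = t
  induction t using TensorProduct.induction_on with
  | zero => simp
  | tmul a b => simp
  | add a b h1 h2 => simp only [map_add, h1, h2, add_mul]

/-- a non-trivial stable subspace misses an almost-primitive element -/
theorem exists_almost_prim [IsAlgClosed k] (hcc : ∀ r : R, TensorProduct.comm k R R (Coalgebra.comul r) = Coalgebra.comul r)
    (B : Submodule k R) (hB : ∀ (f : R →ₗ[k] k), ∀ x ∈ B, Lop f x ∈ B) (hBg : ∀ x ∈ B, ∀ g : GroupLike k R, x * g.val ∈ B) (hne : B ≠ ⊤) :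
    ∃ x, x ∉ B ∧ ∀ f : R →ₗ[k] k, Lop f x - f 1 • x ∈ B := by
  obtain ⟨x0, hx0⟩ : ∃ x, x ∉ B := by
    by_contra h
    push Not at h
    exact hne (by ext; simp [h])
  obtain ⟨W0, hW0, hW0x⟩ := Lop_fd (k := k) x0
  let W : Submodule k R := Submodule.span k (Set.range (fun f : R →ₗ[k] k => Lop f x0))
  have hWf : FiniteDimensional k W := by
    refine Submodule.finiteDimensional_of_le (S₂ := W0) ?_
    rw [Submodule.span_le]
    rintro _ ⟨f, rfl⟩
    exact hW0x f
  have hWs : ∀ f : R →ₗ[k] k, ∀ x ∈ W, Lop f x ∈ W := by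
    intro f x hx
    induction hx using Submodule.span_induction with
    | mem y hy =>
      obtain ⟨g, rfl⟩ := hy
      simp only [Lop_Lop]
      exact Submodule.subset_span ⟨_, rfl⟩
    | zero => simp
    | add y z _ _ h1 h2 => rw [map_add]; exact add_mem h1 h2
    | smul c y _ h1 => rw [map_smul]; exact Submodule.smul_mem _ _ h1
  have hx0W : x0 ∈ W := Submodule.subset_span ⟨Coalgebra.counit, Lop_counit x0⟩
  let T : (R →ₗ[k] k) → (R ⧸ B) →ₗ[k] (R ⧸ B) := fun f => B.mapQ B (Lop f) (hB f)
  have hT : ∀ f x, T f (B.mkQ x) = B.mkQ (Lop f x) := fun f x => rfl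
  obtain ⟨xb, hxb, hxb0, hxbl⟩ := simul_eig T (by
    intro f g x
    obtain ⟨x, rfl⟩ := B.mkQ_surjective x
    simp only [hT, Lop_Lop]
    rw [conv_comm hcc]) _ (W.map B.mkQ) inferInstance le_rfl (by
      intro h
      have : B.mkQ x0 ∈ W.map B.mkQ := Submodule.mem_map_of_mem hx0W
      rw [h, Submodule.mem_bot] at this
      exact hx0 (by simpa using this)) (by
      rintro f _ ⟨x, hx, rfl⟩
      rw [hT]
      exact Submodule.mem_map_of_mem (hWs f x hx))
  obtain ⟨x, rfl⟩ := B.mkQ_surjective xb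
  have hxB : x ∉ B := by simpa using hxb0
  choose l hl using hxbl
  obtain ⟨φ, hφx, hφB⟩ := Submodule.exists_le_ker_of_notMem hxB
  -- normalise
  have hφB' : ∀ b ∈ B, φ b = 0 := fun b hb => hφB hb
  have hmem : ∀ f, Lop f x - l f • x ∈ B := by
    intro f
    have := hl f
    rw [hT, ← map_smul, ← sub_eq_zero, ← map_sub] at this
    exact (Submodule.Quotient.mk_eq_zero B).1 this
  let ψ : R →ₗ[k] k := (φ x)⁻¹ • φ
  have hψx : ψ x = 1 := by simp [ψ, hφx]
  have hψB : ∀ b ∈ B, ψ b = 0 := fun b hb => by simp [ψ, hφB' b hb]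
  have hlψ : ∀ f, l f = ψ (Lop f x) := by
    intro f
    have := hψB _ (hmem f)
    rw [map_sub, map_smul, hψx, sub_eq_zero] at this
    rw [this]; simp
  -- the grouplike
  let y : R := Lop ψ x
  have hly : ∀ f, l f = f y := by
    intro f
    rw [hlψ, ← conv_Lop, conv_comm hcc, conv_Lop]
  have hyg : IsGroupLikeElem k y := by
    constructor
    · rw [← hly, hlψ, Lop_counit, hψx]
    · rw [← sub_eq_zero]
      apply slice_sep
      intro f
      rw [map_sub, map_sub, ← Lop_def]
      simp only [LinearMap.rTensor_tmul, TensorProduct.lid_tmul]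
      rw [sub_eq_zero]
      -- separate by functionals
      by_contra hne
      obtain ⟨g, hg⟩ := (show ∃ g : R →ₗ[k] k, g (Lop f y) ≠ g (f y • y) from by
        by_contra h
        push Not at h
        apply hne
        rw [← sub_eq_zero, ← Module.forall_dual_apply_eq_zero_iff k]
        intro g
        rw [map_sub, h g, sub_self])
      apply hg
      rw [← conv_Lop, ← hly, map_smul, smul_eq_mul, ← hly g, hlψ (conv f g), ← Lop_Lop, hlψ g]
      have h1 : Lop g (Lop f x) = l f • Lop g x + Lop g (Lop f x - l f • x) := by simp
      rw [h1, map_add, hψB _ (hB g _ (hmem f)), add_zero, map_smul, smul_eq_mul, hly f]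
  let Y : GroupLike k R := ⟨y, hyg⟩
  refine ⟨x * (Y⁻¹).val, fun h => ?_, fun f => ?_⟩
  · have := hBg _ h Y
    rw [mul_assoc, ← GroupLike.val_mul, inv_mul_cancel, GroupLike.val_one, mul_one] at this
    exact hxB this
  · rw [Lop_mul_grp]
    have h1 := hBg _ (hmem (f ∘ₗ LinearMap.mulRight k (Y⁻¹).val)) Y⁻¹
    rw [hly, sub_mul] at h1
    have h2 : (f ∘ₗ LinearMap.mulRight k (Y⁻¹).val) y = f 1 := by
      show f (Y.val * (Y⁻¹).val) = f 1
      rw [← GroupLike.val_mul, mul_inv_cancel, GroupLike.val_one]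
    rw [h2, smul_mul_assoc] at h1
    exact h1
end
end GW

open scoped TensorProduct
namespace GW
open Classical

theorem cocycle_solve {k G : Type*} [Field k] [One G] {n : ℕ} (z : (Fin n →₀ ℕ) × G → (Fin n →₀ ℕ) × G → k)
    (hs : ∀ A B, z A B = z B A)
    (hc : ∀ a b c g h l, (if g = h then z (a+b, g) (c, l) else 0) + (if (c, l) = ((0, 1) : (Fin n →₀ ℕ) × G) then z (a, g) (b, h) else 0) =
      (if h = l then z (a, g) (b + c, h) else 0) + (if (a, g) = ((0, 1) : (Fin n →₀ ℕ) × G) then z (b, h) (c, l) else 0))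
    (S : Finset ((Fin n →₀ ℕ) × G)) (hS : ∀ A, A ∉ S → ∀ B, z A B = 0) :
    ∃ β : ((Fin n →₀ ℕ) × G) →₀ k, ∀ a g b h, z (a, g) (b, h) = (if g = h then β (a + b, g) else 0) -
      (if (b, h) = ((0, 1) : (Fin n →₀ ℕ) × G) then β (a, g) else 0) - (if (a, g) = ((0, 1) : (Fin n →₀ ℕ) × G) then β (b, h) else 0) := by
  -- choice of index
  have hch : ∀ b : Fin n →₀ ℕ, ∃ e d : Fin n →₀ ℕ, b ≠ 0 → (b = e + d ∧ ∃ i, e = Finsupp.single i 1) := by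
    intro b
    by_cases hb : b = 0
    · exact ⟨0, 0, fun h => absurd hb h⟩
    · obtain ⟨i, hi⟩ := Finsupp.ne_iff.1 hb
      have h1 : Finsupp.single i 1 ≤ b := by
        rw [Finsupp.single_le_iff]
        have : b i ≠ 0 := hi
        omega
      obtain ⟨d, hd⟩ := exists_add_of_le h1
      exact ⟨_, d, fun _ => ⟨hd, i, rfl⟩⟩
  choose e d hed using hch
  let β0 : (Fin n →₀ ℕ) × G → k := fun x => if x.2 = 1 ∧ x.1 ≠ 0 then (if d x.1 = 0 then 0 else z (e x.1, 1) (d x.1, 1)) else - z (0, 1) x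
  have hfin : (Function.support β0).Finite := by
    refine ((S ∪ (S ×ˢ S).image (fun AB => (AB.1.1 + AB.2.1, (1 : G)))).finite_toSet).subset ?_
    rintro ⟨b, h⟩ hx
    rw [Function.mem_support] at hx
    rw [Finset.mem_coe, Finset.mem_union]
    simp only [β0] at hx
    split_ifs at hx with h1 h2
    · exact absurd rfl hx
    · right
      rw [Finset.mem_image]
      refine ⟨((e b, 1), (d b, 1)), ?_, ?_⟩
      · rw [Finset.mem_product]
        constructor
        · by_contra hn; exact hx (hS _ hn _)
        · by_contra hn; exact hx (by rw [hs]; exact hS _ hn _)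
      · obtain ⟨rfl, hb⟩ := h1
        simp only [← (hed b hb).1]
    · left
      by_contra hn
      apply hx
      rw [hs, hS _ hn, neg_zero]
  let β : ((Fin n →₀ ℕ) × G) →₀ k := Finsupp.ofSupportFinite β0 hfin
  have hβ : ∀ x, β x = β0 x := fun x => rfl
  refine ⟨β, ?_⟩
  -- facts
  have f1 : ∀ b : Fin n →₀ ℕ, b ≠ 0 → z (0, 1) (b, 1) = 0 := by
    intro b hb
    have := hc 0 0 b (1 : G) 1 1
    simp only [if_true, zero_add] at this
    rw [if_neg (by simp [hb])] at this
    simpa using this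
  have hone : ∀ b h, z (0, 1) (b, h) = (if (1 : G) = h then β (0 + b, 1) else 0) -
      (if (b, h) = ((0, 1) : (Fin n →₀ ℕ) × G) then β (0, 1) else 0) - β (b, h) := by
    intro b h
    rw [zero_add]
    by_cases hh : (1 : G) = h
    · subst hh
      by_cases hb : b = 0
      · subst hb
        simp [hβ, β0]
      · simp [hb, f1 b hb]
    · rw [if_neg hh, if_neg (fun h' => hh (by simpa using (congrArg Prod.snd h').symm)), hβ]
      simp only [β0]
      rw [if_neg (fun h' => hh h'.1.symm)]
      simp
  have f2 : ∀ a b c : Fin n →₀ ℕ, a ≠ 0 → c ≠ 0 → z (a + b, (1:G)) (c, 1) = z (a, 1) (b + c, 1) := by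
    intro a b c ha hcn
    have := hc a b c (1:G) 1 1
    simpa [ha, hcn] using this
  intro a g b h
  by_cases hA : (a, g) = ((0, 1) : (Fin n →₀ ℕ) × G)
  · rw [Prod.mk.injEq] at hA
    obtain ⟨rfl, rfl⟩ := hA
    rw [if_pos rfl]
    exact hone b h
  by_cases hB : (b, h) = ((0, 1) : (Fin n →₀ ℕ) × G)
  · rw [if_pos hB, if_neg hA]
    rw [Prod.mk.injEq] at hB
    obtain ⟨rfl, rfl⟩ := hB
    rw [hs, hone, if_neg hA, zero_add, add_zero]
    by_cases hg : g = 1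
    · subst hg; simp
    · rw [if_neg hg, if_neg (fun h => hg h.symm)]; simp
  rw [if_neg hA, if_neg hB, sub_zero, sub_zero]
  by_cases hgh : g = h
  · subst hgh
    rw [if_pos rfl]
    by_cases hg : g = 1
    · subst hg
      have ha : a ≠ 0 := fun h => hA (by rw [h])
      have hb : b ≠ 0 := fun h => hB (by rw [h])
      have hab : a + b ≠ 0 := by
        intro h0
        have h2 := congrArg Finsupp.degree h0
        rw [map_add, map_zero] at h2
        exact ha ((Finsupp.degree_eq_zero_iff a).1 (by omega))
      obtain ⟨h3, i, h4⟩ := hed (a+b) hab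
      have hd0 : d (a+b) ≠ 0 := by
        intro h0
        have h2 := congrArg Finsupp.degree h3
        rw [map_add, map_add, h4, h0, Finsupp.degree_single, map_zero] at h2
        have h5 : a.degree ≠ 0 := fun h => ha ((Finsupp.degree_eq_zero_iff a).1 h)
        have h6 : b.degree ≠ 0 := fun h => hb ((Finsupp.degree_eq_zero_iff b).1 h)
        omega
      rw [hβ]
      simp only [β0]
      rw [if_pos (by simp only [true_and]; exact hab), if_neg hd0]
      have main : ∀ a b : Fin n →₀ ℕ, a ≠ 0 → b ≠ 0 → a i ≠ 0 → ∀ d, a + b = Finsupp.single i 1 + d → z (a, (1:G)) (b, 1) = z (Finsupp.single i 1, 1) (d, 1) := by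
        intro a b ha hb hai d hd
        have h1 : Finsupp.single i 1 ≤ a := by
          rw [Finsupp.single_le_iff]; omega
        obtain ⟨a', rfl⟩ := exists_add_of_le h1
        rw [f2 _ _ _ (by simp) hb]
        rw [add_assoc] at hd
        rw [add_left_cancel hd]
      rw [h4]
      rw [h4] at h3
      by_cases hai : a i = 0
      · have hbi : b i ≠ 0 := by
          have := DFunLike.congr_fun h3 i
          simp [hai] at this
          omega
        rw [hs]
        exact main b a hb ha hbi _ (by rw [add_comm]; exact h3)
      · exact main a b ha hb hai _ h3
    · have := hc 0 a b 1 g g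
      simp only [if_true] at this
      rw [if_neg (fun h => hg h.symm), if_neg hB, add_zero] at this
      rw [hβ]
      simp only [β0]
      rw [if_neg (fun h => hg h.1)]
      linear_combination -this
  · rw [if_neg hgh]
    have := hc a 0 b g g h
    rw [if_pos rfl, if_neg hB, if_neg hgh, if_neg hA] at this
    simpa using this

section
variable {k R : Type*} [Field k] [Ring R] [HopfAlgebra k R]

/-- coboundary -/
noncomputable def zz (x : R) (f g : R →ₗ[k] k) : k := conv f g x - f x * g 1 - f 1 * g x

lemma zz_eq (x : R) (f g : R →ₗ[k] k) : zz x f g = g (Lop f x - f x • 1 - f 1 • x) := by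
  rw [zz, conv_Lop]; simp

lemma zz_symm (hcc : ∀ r : R, TensorProduct.comm k R R (Coalgebra.comul r) = Coalgebra.comul r) (x : R) (f g : R →ₗ[k] k) : zz x f g = zz x g f := by
  rw [zz, zz, conv_comm hcc]; ring

lemma zz_cocycle (x : R) (f g h : R →ₗ[k] k) : zz x (conv f g) h + zz x f g * h 1 = zz x f (conv g h) + f 1 * zz x g h := by
  simp only [zz, conv_one, conv_assoc]; ring

lemma prim_of_zz (x : R) (h : ∀ f g : R →ₗ[k] k, zz x f g = 0) : Coalgebra.comul (R := k) x = x ⊗ₜ 1 + 1 ⊗ₜ x := by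
  rw [← sub_eq_zero]
  apply slice_sep
  intro f
  rw [← Module.forall_dual_apply_eq_zero_iff k]
  intro g
  have := h f g
  rw [zz_eq] at this
  rw [map_sub, map_sub, ← Lop_def]
  simp only [map_add, LinearMap.rTensor_tmul, TensorProduct.lid_tmul, map_sub] at this ⊢
  rw [← sub_sub]; exact this

variable [CharZero k] {n : ℕ} (p : Fin n → R)

theorem span_bb_top [IsAlgClosed k] (hcc : ∀ r : R, TensorProduct.comm k R R (Coalgebra.comul r) = Coalgebra.comul r)
    (hp : ∀ i, Coalgebra.comul (R := k) (p i) = p i ⊗ₜ 1 + 1 ⊗ₜ p i) (hli : LinearIndependent k p)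
    (hsp : Prim k R ≤ Submodule.span k (Set.range p)) : Submodule.span k (Set.range (bb k p)) = ⊤ := by
  by_contra hne
  set B := Submodule.span k (Set.range (bb k p)) with hBd
  have hBr : B = LinearMap.range (Finsupp.linearCombination k (bb k p)) := (Finsupp.range_linearCombination k).symm
  have hB : ∀ (f : R →ₗ[k] k), ∀ x ∈ B, Lop f x ∈ B := by
    intro f x hx
    rw [hBr] at hx ⊢
    obtain ⟨c, rfl⟩ := hx
    rw [Lop_Phi p hp]
    exact ⟨_, rfl⟩
  have hBg : ∀ x ∈ B, ∀ g : GroupLike k R, x * g.val ∈ B := by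
    intro x hx g
    induction hx using Submodule.span_induction with
    | mem y hy =>
      obtain ⟨⟨a, h⟩, rfl⟩ := hy
      refine Submodule.subset_span ⟨(a, h * g), ?_⟩
      simp [bb, mul_assoc]
    | zero => simp
    | add y z _ _ h1 h2 => rw [add_mul]; exact add_mem h1 h2
    | smul c y _ h1 => rw [smul_mul_assoc]; exact Submodule.smul_mem _ _ h1
  have h1b : bb k p (0, 1) = 1 := by rw [bb_zero, GroupLike.val_one]
  have h1B : (1 : R) ∈ B := Submodule.subset_span ⟨(0, 1), h1b⟩
  obtain ⟨x, hxB, hx⟩ := exists_almost_prim hcc B hB hBg hne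
  -- coordinates
  obtain ⟨Ψ, hΨ⟩ := LinearMap.exists_leftInverse_of_injective (Finsupp.linearCombination k (bb k p)) (LinearMap.ker_eq_bot.2 (li_bb p hp hli))
  let co : (Fin n →₀ ℕ) × GroupLike k R → R →ₗ[k] k := fun A => Finsupp.lapply A ∘ₗ Ψ
  have hco : ∀ A C, co A (bb k p C) = if C = A then 1 else 0 := by
    intro A C
    have := LinearMap.congr_fun hΨ (Finsupp.single C 1)
    simp at this
    simp [co, this, Finsupp.single_apply]
  have hco1 : ∀ A, co A 1 = if A = (0, 1) then 1 else 0 := by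
    intro A
    rw [← h1b, hco]
    simp [eq_comm]
  have hcoΦ : ∀ A c, co A (Finsupp.linearCombination k (bb k p) c) = c A := by
    intro A c
    have := LinearMap.congr_fun hΨ c
    simp at this
    simp [co, this]
  have hcoB : ∀ w ∈ B, (∀ A, co A w = 0) → w = 0 := by
    intro w hw h0
    rw [hBr] at hw
    obtain ⟨c, rfl⟩ := hw
    have : c = 0 := by
      ext A
      rw [← hcoΦ, h0]; rfl
    rw [this, map_zero]
  have hconv : ∀ a g b h, ∀ w ∈ B, conv (co (a, g)) (co (b, h)) w = if g = h then co (a + b, g) w else 0 := by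
    intro a g b h w hw
    induction hw using Submodule.span_induction with
    | mem y hy =>
      obtain ⟨⟨c, l⟩, rfl⟩ := hy
      rw [conv_def, comul_bb p hp, hco]
      simp only [_root_.map_sum, TensorProduct.map_tmul, TensorProduct.lid_tmul, hco]
      by_cases hcl : g = h ∧ l = g ∧ c = a + b
      · obtain ⟨rfl, rfl, rfl⟩ := hcl
        rw [if_pos rfl, if_pos rfl, Finset.sum_eq_single (a, b)]
        · simp
        · rintro ⟨a', b'⟩ _ hne
          rw [smul_eq_mul]
          by_contra hn
          apply hne
          have h1 : ¬ (((a', l) : (Fin n →₀ ℕ) × GroupLike k R) ≠ (a, l)) := by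
            intro h'; rw [if_neg h', zero_mul] at hn; exact hn rfl
          have h2 : ¬ (((b', l) : (Fin n →₀ ℕ) × GroupLike k R) ≠ (b, l)) := by
            intro h'; rw [if_neg h', mul_zero] at hn; exact hn rfl
          simp only [ne_eq, not_not, Prod.mk.injEq, and_true] at h1 h2
          rw [h1, h2]
        · intro hn
          rw [Finset.HasAntidiagonal.mem_antidiagonal] at hn
          exact absurd rfl hn
      · have : (if g = h then (if ((c, l) : (Fin n →₀ ℕ) × GroupLike k R) = (a + b, g) then (1:k) else 0) else 0) = 0 := by
          split_ifs with h1 h2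
          · rw [Prod.mk.injEq] at h2
            exact absurd ⟨h1, h2.2, h2.1⟩ hcl
          · rfl
          · rfl
        rw [this]
        refine Finset.sum_eq_zero ?_
        rintro ⟨a', b'⟩ hab
        rw [Finset.HasAntidiagonal.mem_antidiagonal] at hab
        simp only at hab ⊢
        rw [smul_eq_mul]
        by_contra hn
        apply hcl
        have h1 : ¬ (((a', l) : (Fin n →₀ ℕ) × GroupLike k R) ≠ (a, g)) := by
          intro h'; rw [if_neg h', zero_mul] at hn; exact hn rfl
        have h2 : ¬ (((b', l) : (Fin n →₀ ℕ) × GroupLike k R) ≠ (b, h)) := by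
          intro h'; rw [if_neg h', mul_zero] at hn; exact hn rfl
        simp only [ne_eq, not_not, Prod.mk.injEq] at h1 h2
        refine ⟨h1.2.symm.trans h2.2, h1.2, ?_⟩
        rw [← hab, h1.1, h2.1]
    | zero => simp
    | add y z _ _ h1 h2 => rw [map_add, h1, h2]; split_ifs <;> simp
    | smul c y _ h1 => rw [map_smul, h1]; split_ifs <;> simp
  -- zz depends only on restriction to B
  have hzB : ∀ y : R, (∀ f : R →ₗ[k] k, Lop f y - f 1 • y ∈ B) → ∀ f : R →ₗ[k] k, Lop f y - f y • 1 - f 1 • y ∈ B := by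
    intro y hy f
    rw [sub_right_comm]
    exact sub_mem (hy f) (Submodule.smul_mem _ _ h1B)
  have hzr : ∀ y : R, (∀ f : R →ₗ[k] k, Lop f y - f 1 • y ∈ B) → ∀ f g g' : R →ₗ[k] k, (∀ w ∈ B, g w = g' w) → zz y f g = zz y f g' := by
    intro y hy f g g' h
    rw [zz_eq, zz_eq]
    exact h _ (hzB y hy f)
  have hzl : ∀ y : R, (∀ f : R →ₗ[k] k, Lop f y - f 1 • y ∈ B) → ∀ f g g' : R →ₗ[k] k, (∀ w ∈ B, g w = g' w) → zz y g f = zz y g' f := by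
    intro y hy f g g' h
    rw [zz_symm hcc, zz_symm hcc y g']
    exact hzr y hy f g g' h
  have hz0 : ∀ (y : R) (f : R →ₗ[k] k), zz y f 0 = 0 := by
    intro y f; rw [zz_eq]; rfl
  have hifl : ∀ (P : Prop) (f g : R →ₗ[k] k), zz x f (if P then g else 0) = if P then zz x f g else 0 := by
    intro P f g
    split_ifs
    · rfl
    · exact hz0 x f
  -- finiteness
  have hfinS : ∀ t : R ⊗[k] R, ∃ S : Finset ((Fin n →₀ ℕ) × GroupLike k R), ∀ A, A ∉ S → ∀ g : R →ₗ[k] k, TensorProduct.lid k k (TensorProduct.map (co A) g t) = 0 := by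
    intro t
    induction t using TensorProduct.induction_on with
    | zero => exact ⟨∅, by simp⟩
    | tmul a b =>
      refine ⟨(Ψ a).support, fun A hA g => ?_⟩
      rw [Finsupp.notMem_support_iff] at hA
      have : co A a = 0 := hA
      simp [this]
    | add a b h1 h2 =>
      obtain ⟨S1, h1⟩ := h1
      obtain ⟨S2, h2⟩ := h2
      refine ⟨S1 ∪ S2, fun A hA g => ?_⟩
      rw [Finset.mem_union, not_or] at hA
      rw [map_add, map_add, h1 A hA.1, h2 A hA.2, add_zero]
  obtain ⟨S, hS⟩ := hfinS (Coalgebra.comul (R := k) x - x ⊗ₜ 1 - 1 ⊗ₜ x)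
  obtain ⟨β, hβ⟩ := cocycle_solve (fun A C => zz x (co A) (co C)) (fun A C => zz_symm hcc _ _ _) (by
      intro a b c g h l
      have e1 : zz x (conv (co (a, g)) (co (b, h))) (co (c, l)) = if g = h then zz x (co (a + b, g)) (co (c, l)) else 0 := by
        rw [zz_symm hcc x (co (a+b, g)), ← hifl, zz_symm hcc]
        refine hzr x hx _ _ _ (fun w hw => ?_)
        rw [hconv a g b h w hw]
        split_ifs <;> rfl
      have e2 : zz x (co (a, g)) (conv (co (b, h)) (co (c, l))) = if h = l then zz x (co (a, g)) (co (b + c, h)) else 0 := by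
        rw [← hifl]
        refine hzr x hx _ _ _ (fun w hw => ?_)
        rw [hconv b h c l w hw]
        split_ifs <;> rfl
      have e3 := zz_cocycle x (co (a, g)) (co (b, h)) (co (c, l))
      rw [e1, e2, hco1, hco1] at e3
      simpa using e3) S (by
      intro A hA C
      have := hS A hA (co C)
      simp only [map_sub, TensorProduct.map_tmul, TensorProduct.lid_tmul] at this
      rw [← conv_def] at this
      exact this)
  set y := Finsupp.linearCombination k (bb k p) β with hy
  have hyB : y ∈ B := by rw [hBr]; exact ⟨β, rfl⟩
  have hxy : ∀ f : R →ₗ[k] k, Lop f (x - y) - f 1 • (x - y) ∈ B := by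
    intro f
    have h2 := sub_mem (hx f) (sub_mem (hB f y hyB) (Submodule.smul_mem B (f 1) hyB))
    rw [map_sub, smul_sub]
    convert h2 using 1
    abel
  have hzero : ∀ A C, zz (x - y) (co A) (co C) = 0 := by
    rintro ⟨a, g⟩ ⟨b, h⟩
    have e1 : zz (x - y) (co (a, g)) (co (b, h)) = zz x (co (a, g)) (co (b, h)) - zz y (co (a, g)) (co (b, h)) := by
      simp only [zz, map_sub]; ring
    rw [e1, hβ a g b h, zz, hconv a g b h y hyB, hco1, hco1, hy, hcoΦ, hcoΦ, hcoΦ]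
    split_ifs <;> simp
  have hz2 : ∀ f A, zz (x - y) f (co A) = 0 := by
    intro f A
    rw [zz_symm hcc, zz_eq, hcoB _ (hzB _ hxy (co A)), map_zero]
    intro C
    rw [← zz_eq]; exact hzero A C
  have hz3 : ∀ f g : R →ₗ[k] k, zz (x - y) f g = 0 := by
    intro f g
    rw [zz_eq, hcoB _ (hzB _ hxy f), map_zero]
    intro C
    rw [← zz_eq]; exact hz2 f C
  have hprim : x - y ∈ Prim k R := prim_of_zz _ hz3
  have hpB : Submodule.span k (Set.range p) ≤ B := by
    rw [Submodule.span_le]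
    rintro _ ⟨i, rfl⟩
    refine Submodule.subset_span ⟨(Finsupp.single i 1, 1), ?_⟩
    rw [bb_single, GroupLike.val_one, mul_one]
  have := add_mem (hpB (hsp hprim)) hyB
  rw [sub_add_cancel] at this
  exact hxB this
end
end GW

namespace GW
open Classical
open MvPolynomial (X monomial)

section
variable {k H : Type*} [Field k] [Ring H] [Algebra k H] {m : ℕ} (p : Fin m → H)

/-- the filtration -/
noncomputable def FF (k : Type*) {H : Type*} [Field k] [Ring H] [Algebra k H] {m : ℕ} (p : Fin m → H) (r : ℕ) : Submodule k H := ((1 : Submodule k H) ⊔ Submodule.span k (Set.range p))^r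

/-- the strictly lower part -/
noncomputable def FFl (k : Type*) {H : Type*} [Field k] [Ring H] [Algebra k H] {m : ℕ} (p : Fin m → H) : ℕ → Submodule k H
  | 0 => ⊥
  | r+1 => FF k p r

lemma FF_mono {r s : ℕ} (h : r ≤ s) : FF k p r ≤ FF k p s := pow_le_pow_one _ h

lemma FF_mul (r s : ℕ) : FF k p r * FF k p s = FF k p (r + s) := (pow_add _ _ _).symm

lemma FF_mul_mem {r s : ℕ} {x y : H} (hx : x ∈ FF k p r) (hy : y ∈ FF k p s) : x * y ∈ FF k p (r + s) := by
  rw [← FF_mul]; exact Submodule.mul_mem_mul hx hy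

lemma FFl_le (r : ℕ) : FFl k p r ≤ FF k p r := by
  cases r with
  | zero => exact bot_le
  | succ r => exact FF_mono p (Nat.le_succ r)

lemma FFl_mul_mem {r s : ℕ} {x y : H} (hx : x ∈ FFl k p r) (hy : y ∈ FF k p s) : x * y ∈ FFl k p (r + s) := by
  cases r with
  | zero =>
    have : x = 0 := hx
    rw [this, zero_mul]; exact zero_mem _
  | succ r =>
    rw [Nat.succ_add]
    exact FF_mul_mem p hx hy

lemma FF_mul_FFl_mem {r s : ℕ} {x y : H} (hx : x ∈ FF k p r) (hy : y ∈ FFl k p s) : x * y ∈ FFl k p (r + s) := by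
  cases s with
  | zero =>
    have : y = 0 := hy
    rw [this, mul_zero]; exact zero_mem _
  | succ s =>
    exact FF_mul_mem p hx hy

lemma one_mem_FF (r : ℕ) : (1 : H) ∈ FF k p r := by
  refine FF_mono p (Nat.zero_le r) ?_
  rw [FF, pow_zero]; exact Submodule.one_le.1 le_rfl

lemma p_mem_FF (i : Fin m) : p i ∈ FF k p 1 := by
  rw [FF, pow_one]; exact Submodule.mem_sup_right (Submodule.subset_span ⟨i, rfl⟩)

lemma mon_mem_FF (a : Fin m →₀ ℕ) : mon p a ∈ FF k p a.degree := mon_mem_pow p (Submodule.span k (Set.range p)) (fun i => Submodule.subset_span ⟨i, rfl⟩) a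

lemma V_le_FF : Submodule.span k (Set.range p) ≤ FF k p 1 := by
  rw [FF, pow_one]; exact le_sup_right

/-- induction for the filtration -/
lemma FF_succ_induction (r : ℕ) (P : H → Prop) (h0 : ∀ x ∈ FF k p r, P x) (h1 : ∀ i, ∀ x ∈ FF k p r, P (p i * x))
    (hs : ∀ (c : k) x, P x → P (c • x)) (ha : ∀ x y, P x → P y → P (x + y)) (x : H) (hx : x ∈ FF k p (r+1)) : P x := by
  rw [add_comm, ← FF_mul] at hx
  induction hx using Submodule.mul_induction_on' with
  | mem_mul_mem v hv w hw =>
    rw [FF, pow_one] at hv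
    obtain ⟨c, hc, v', hv', rfl⟩ := Submodule.mem_sup.1 hv
    clear hv
    rw [add_mul]
    refine ha _ _ ?_ ?_
    · obtain ⟨c, rfl⟩ := Submodule.mem_one.1 hc
      rw [← Algebra.smul_def]
      exact hs _ _ (h0 _ hw)
    · induction hv' using Submodule.span_induction with
      | mem y hy => obtain ⟨i, rfl⟩ := hy; exact h1 i w hw
      | zero => rw [zero_mul]; exact h0 0 (zero_mem _)
      | add y z _ _ h1 h2 => rw [add_mul]; exact ha _ _ h1 h2
      | smul c y _ h1 => rw [smul_mul_assoc]; exact hs _ _ h1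
  | add x _ y _ h1 h2 => exact ha _ _ h1 h2

lemma FF_comm (hcomm : ∀ i j, p i * p j - p j * p i ∈ Submodule.span k (Set.range p)) (i : Fin m) (r : ℕ) :
    ∀ w ∈ FF k p r, p i * w - w * p i ∈ FF k p r := by
  induction r with
  | zero =>
    intro w hw
    rw [FF, pow_zero] at hw
    obtain ⟨c, rfl⟩ := Submodule.mem_one.1 hw
    rw [Algebra.commutes, sub_self]; exact zero_mem _
  | succ r ih =>
    refine FF_succ_induction p r _ ?_ ?_ ?_ ?_
    · intro x hx; exact FF_mono p (Nat.le_succ r) (ih x hx)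
    · intro j x hx
      have h1 : p i * (p j * x) - p j * x * p i = (p i * p j - p j * p i) * x + p j * (p i * x - x * p i) := by noncomm_ring
      rw [h1, add_comm r 1]
      exact add_mem (FF_mul_mem p (V_le_FF p (hcomm i j)) hx) (FF_mul_mem p (p_mem_FF p j) (ih x hx))
    · intro c x hx
      rw [mul_smul_comm, smul_mul_assoc, ← smul_sub]; exact Submodule.smul_mem _ _ hx
    · intro x y hx hy
      rw [mul_add, add_mul, add_sub_add_comm]; exact add_mem hx hy

lemma mon_cons (hcomm : ∀ i j, p i * p j - p j * p i ∈ Submodule.span k (Set.range p)) (i : Fin m) (a : Fin m →₀ ℕ) :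
    p i * mon p a - mon p (Finsupp.single i 1 + a) ∈ FF k p a.degree := by
  have hd : a.degree = ((List.finRange m).map a).sum := by
    rw [Finsupp.degree_eq_sum, ← List.ofFn_eq_map, List.sum_ofFn]
  rw [hd, mon, mon]
  have hmem : ∀ l : List (Fin m), (l.map (fun i => p i ^ a i)).prod ∈ FF k p (l.map a).sum := by
    intro l
    induction l with
    | nil => simpa using one_mem_FF p 0
    | cons i l ih =>
      simp only [List.map_cons, List.prod_cons, List.sum_cons]
      refine FF_mul_mem p ?_ ih
      have := Submodule.pow_mem_pow (FF k p 1) (p_mem_FF p i) (a i)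
      rwa [FF, pow_one] at this
  have key : ∀ l : List (Fin m), l.Nodup → i ∈ l → p i * (l.map (fun j => p j ^ a j)).prod - (l.map (fun j => p j ^ ((Finsupp.single i 1 + a : Fin m →₀ ℕ) j))).prod ∈ FF k p (l.map a).sum := by
    intro l
    induction l with
    | nil => intro _ h; simp at h
    | cons j l ih =>
      intro hl hi
      rw [List.nodup_cons] at hl
      simp only [List.map_cons, List.prod_cons, List.sum_cons]
      by_cases hij : i = j
      · subst hij
        have h1 : l.map (fun j => p j ^ ((Finsupp.single i 1 + a : Fin m →₀ ℕ) j)) = l.map (fun j => p j ^ a j) := by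
          apply List.map_congr_left
          intro j hj
          have : i ≠ j := by rintro rfl; exact hl.1 hj
          simp [Finsupp.single_apply, this]
        rw [h1]
        have h2 : p i ^ ((Finsupp.single i 1 + a : Fin m →₀ ℕ) i) = p i * p i ^ a i := by
          simp [add_comm 1, pow_succ']
        rw [h2, mul_assoc, sub_self]; exact zero_mem _
      · have hi' : i ∈ l := (List.mem_cons.1 hi).resolve_left hij
        have h2 : (Finsupp.single i 1 + a : Fin m →₀ ℕ) j = a j := by simp [Finsupp.single_apply, hij]
        rw [h2]
        set P := (l.map (fun j => p j ^ a j)).prod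
        set P' := (l.map (fun j => p j ^ ((Finsupp.single i 1 + a : Fin m →₀ ℕ) j))).prod
        have h3 : p i * (p j ^ a j * P) - p j ^ a j * P' = (p i * p j ^ a j - p j ^ a j * p i) * P + p j ^ a j * (p i * P - P') := by noncomm_ring
        rw [h3]
        have h4 : p j ^ a j ∈ FF k p (a j) := by
          have := Submodule.pow_mem_pow (FF k p 1) (p_mem_FF p j) (a j)
          rwa [FF, pow_one] at this
        exact add_mem (FF_mul_mem p (FF_comm p hcomm i _ _ h4) (hmem l)) (FF_mul_mem p h4 (ih hl.2 hi'))
  exact key _ (List.nodup_finRange m) (List.mem_finRange i)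

lemma FF_le_span (hcomm : ∀ i j, p i * p j - p j * p i ∈ Submodule.span k (Set.range p)) (r : ℕ) :
    FF k p r ≤ Submodule.span k (mon p '' {a | a.degree ≤ r}) := by
  induction r with
  | zero =>
    intro w hw
    rw [FF, pow_zero] at hw
    obtain ⟨c, rfl⟩ := Submodule.mem_one.1 hw
    rw [Algebra.algebraMap_eq_smul_one]
    refine Submodule.smul_mem _ _ (Submodule.subset_span ⟨0, by simp, by simp [mon]⟩)
  | succ r ih =>
    have hle : Submodule.span k (mon p '' {a | a.degree ≤ r}) ≤ Submodule.span k (mon p '' {a | a.degree ≤ r + 1}) := by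
      apply Submodule.span_mono
      apply Set.image_mono
      intro a ha
      have ha' : a.degree ≤ r := ha
      show a.degree ≤ r + 1
      omega
    refine FF_succ_induction p r _ ?_ ?_ ?_ ?_
    · intro x hx; exact hle (ih hx)
    · intro i x hx
      have hx' := ih hx
      clear hx
      induction hx' using Submodule.span_induction with
      | mem y hy =>
        obtain ⟨a, ha, rfl⟩ := hy
        have ha' : a.degree ≤ r := ha
        have h1 := mon_cons p hcomm i a
        rw [← sub_add_cancel (p i * mon p a) (mon p (Finsupp.single i 1 + a))]
        refine add_mem (hle (ih (FF_mono p ha' h1))) (Submodule.subset_span ⟨_, ?_, rfl⟩)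
        show (Finsupp.single i 1 + a).degree ≤ r + 1
        rw [map_add, Finsupp.degree_single]; omega
      | zero => rw [mul_zero]; exact zero_mem _
      | add y z _ _ h1 h2 => rw [mul_add]; exact add_mem h1 h2
      | smul c y _ h1 => rw [mul_smul_comm]; exact Submodule.smul_mem _ _ h1
    · intro c x hx; exact Submodule.smul_mem _ _ hx
    · intro x y hx hy; exact add_mem hx hy

/-- symmetrisation-type map sending monomials to ordered monomials -/
noncomputable def sy (k : Type*) {H : Type*} [Field k] [Ring H] [Algebra k H] {m : ℕ} (p : Fin m → H) : MvPolynomial (Fin m) k →ₗ[k] H := (MvPolynomial.basisMonomials (Fin m) k).constr k (mon p)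

lemma sy_monomial (a : Fin m →₀ ℕ) (c : k) : sy k p (monomial a c) = c • mon p a := by
  have h1 : monomial a c = c • (MvPolynomial.basisMonomials (Fin m) k a) := by
    rw [MvPolynomial.coe_basisMonomials, MvPolynomial.smul_monomial]; simp
  rw [h1, map_smul, sy, Module.Basis.constr_basis]

lemma mon_zero : mon p 0 = 1 := by simp [mon]

lemma mon_single (i : Fin m) : mon p (Finsupp.single i 1) = p i := by
  have : ∀ l : List (Fin m), l.Nodup → (l.map (fun j => p j ^ (Finsupp.single i 1 j))).prod = if i ∈ l then p i else 1 := by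
    intro l hl
    induction l with
    | nil => simp
    | cons j l ih =>
      rw [List.nodup_cons] at hl
      rw [List.map_cons, List.prod_cons, ih hl.2]
      by_cases hij : i = j
      · subst hij; simp [hl.1]
      · simp [hij]
  rw [mon, this _ (List.nodup_finRange m), if_pos (List.mem_finRange i)]

lemma sy_X (i : Fin m) : sy k p (X i) = p i := by
  rw [MvPolynomial.X, sy_monomial, one_smul, mon_single]

lemma sy_one : sy k p 1 = 1 := by
  rw [show (1 : MvPolynomial (Fin m) k) = monomial 0 1 from rfl, sy_monomial, one_smul, mon_zero]

lemma hom_ind (d : ℕ) (P : MvPolynomial (Fin m) k → Prop) (h0 : P 0) (ha : ∀ f g, P f → P g → P (f + g))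
    (hm : ∀ a c, a.degree = d → P (monomial a c)) (f : MvPolynomial (Fin m) k) (hf : f.IsHomogeneous d) : P f := by
  rw [f.as_sum]
  refine Finset.sum_induction _ P ha h0 (fun a has => hm a _ ?_)
  have := hf (MvPolynomial.mem_support_iff.1 has)
  rw [Finsupp.degree_eq_weight_one]; exact this

lemma sy_mem (d : ℕ) (f : MvPolynomial (Fin m) k) (hf : f.IsHomogeneous d) : sy k p f ∈ FF k p d := by
  refine hom_ind d (fun f => sy k p f ∈ FF k p d) (by simp) ?_ ?_ f hf
  · intro f g h1 h2
    rw [map_add]; exact add_mem h1 h2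
  · intro a c hac
    rw [sy_monomial]
    exact Submodule.smul_mem _ _ (hac ▸ mon_mem_FF p a)

lemma sy_X_mul (hcomm : ∀ i j, p i * p j - p j * p i ∈ Submodule.span k (Set.range p)) (i : Fin m) (d : ℕ) (f : MvPolynomial (Fin m) k) (hf : f.IsHomogeneous d) :
    p i * sy k p f - sy k p (X i * f) ∈ FFl k p (d+1) := by
  refine hom_ind d (fun f => p i * sy k p f - sy k p (X i * f) ∈ FFl k p (d+1)) (by simp) ?_ ?_ f hf
  · intro f g h1 h2
    rw [map_add, mul_add, mul_add, map_add, add_sub_add_comm]; exact add_mem h1 h2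
  · intro a c hac
    rw [MvPolynomial.X, MvPolynomial.monomial_mul, one_mul, sy_monomial, sy_monomial, mul_smul_comm, ← smul_sub]
    exact Submodule.smul_mem _ _ (hac ▸ mon_cons p hcomm i a)

/-- induction on homogeneous polynomials by multiplying by variables -/
lemma hom_ind2 (P : ℕ → MvPolynomial (Fin m) k → Prop) (h0 : ∀ d, P d 0) (ha : ∀ d f g, P d f → P d g → P d (f + g))
    (hs : ∀ d (c : k) f, P d f → P d (c • f)) (h1 : P 0 1) (hX : ∀ d i f, f.IsHomogeneous d → P d f → P (d+1) (X i * f)) (d : ℕ) (f : MvPolynomial (Fin m) k) (hf : f.IsHomogeneous d) : P d f := by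
  have key : ∀ d, ∀ a : Fin m →₀ ℕ, a.degree = d → P d (monomial a 1) := by
    intro d
    induction d with
    | zero =>
      intro a ha0
      rw [Finsupp.degree_eq_zero_iff] at ha0
      rw [ha0]; exact h1
    | succ d ih =>
      intro a had
      have hne : a ≠ 0 := by rintro rfl; simp at had
      obtain ⟨i, hi⟩ := Finsupp.ne_iff.1 hne
      have h2 : Finsupp.single i 1 ≤ a := by
        rw [Finsupp.single_le_iff]
        have : a i ≠ 0 := hi
        omega
      obtain ⟨b, rfl⟩ := exists_add_of_le h2
      rw [map_add, Finsupp.degree_single] at had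
      have h3 : monomial (Finsupp.single i 1 + b) (1:k) = X i * monomial b 1 := by
        rw [MvPolynomial.X, MvPolynomial.monomial_mul, one_mul]
      rw [h3]
      exact hX d i _ (MvPolynomial.isHomogeneous_monomial _ (by omega)) (ih b (by omega))
  refine hom_ind d (P d) (h0 d) (ha d) (fun a c hac => ?_) f hf
  have : monomial a c = c • monomial a (1:k) := by rw [MvPolynomial.smul_monomial]; simp
  rw [this]
  exact hs d c _ (key d a hac)

lemma sy_mul (hcomm : ∀ i j, p i * p j - p j * p i ∈ Submodule.span k (Set.range p)) (d e : ℕ) (f g : MvPolynomial (Fin m) k) (hf : f.IsHomogeneous d) (hg : g.IsHomogeneous e) :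
    sy k p f * sy k p g - sy k p (f * g) ∈ FFl k p (d+e) := by
  refine hom_ind2 (fun d f => sy k p f * sy k p g - sy k p (f * g) ∈ FFl k p (d+e)) ?_ ?_ ?_ ?_ ?_ d f hf
  · intro d; simp
  · intro d f1 f2 h1 h2
    rw [map_add, add_mul, add_mul, map_add, add_sub_add_comm]; exact add_mem h1 h2
  · intro d c f h1
    rw [map_smul, smul_mul_assoc, smul_mul_assoc, map_smul, ← smul_sub]; exact Submodule.smul_mem _ _ h1
  · rw [sy_one, one_mul, one_mul, sub_self]; exact zero_mem _
  · intro d i f hf ih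
    have e1 := FFl_mul_mem p (sy_X_mul p hcomm i d f hf) (sy_mem p e g hg)
    have e2 := FF_mul_FFl_mem p (p_mem_FF p i) ih
    have e3 := sy_X_mul p hcomm i (d+e) (f*g) (hf.mul hg)
    have h4 : sy k p (X i * f) * sy k p g - sy k p (X i * f * g) = -((p i * sy k p f - sy k p (X i * f)) * sy k p g) + p i * (sy k p f * sy k p g - sy k p (f * g)) + (p i * sy k p (f * g) - sy k p (X i * (f * g))) := by
      rw [mul_assoc (X i)]; noncomm_ring
    rw [h4, show d + 1 + e = d + e + 1 by ring]
    rw [show d + 1 + e = d + e + 1 by ring] at e1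
    rw [show 1 + (d + e) = d + e + 1 by ring] at e2
    exact add_mem (add_mem (neg_mem e1) e2) e3
end
end GW

namespace GW
open Classical
open MvPolynomial (X monomial)

section
variable {k H Γ : Type*} [Field k] [Ring H] [Algebra k H] [Group Γ] {m : ℕ} (p : Fin m → H) (u : Γ →* H)

/-- conjugation by `u γ` -/
noncomputable def om (k : Type*) {H Γ : Type*} [Field k] [Ring H] [Algebra k H] [Group Γ] (u : Γ →* H) (γ : Γ) : H →ₐ[k] H :=
  AlgHom.ofLinearMap (LinearMap.mulLeft k (u γ) ∘ₗ LinearMap.mulRight k (u γ⁻¹)) (by simp [← map_mul]) (fun x y => by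
    have h : u γ⁻¹ * u γ = 1 := by rw [← map_mul, inv_mul_cancel, map_one]
    simp only [LinearMap.comp_apply, LinearMap.mulLeft_apply, LinearMap.mulRight_apply]
    calc u γ * (x * y * u γ⁻¹) = u γ * x * 1 * y * u γ⁻¹ := by noncomm_ring
      _ = _ := by rw [← h]; noncomm_ring)

lemma om_apply (γ : Γ) (x : H) : om k u γ x = u γ * (x * u γ⁻¹) := rfl

lemma om_mul (γ : Γ) (x : H) : u γ * x = om k u γ x * u γ := by
  have h : u γ⁻¹ * u γ = 1 := by rw [← map_mul, inv_mul_cancel, map_one]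
  rw [om_apply, mul_assoc, mul_assoc, h, mul_one]

lemma om_FF (hV : ∀ γ i, om k u γ (p i) ∈ Submodule.span k (Set.range p)) (γ : Γ) (r : ℕ) (x : H) (hx : x ∈ FF k p r) : om k u γ x ∈ FF k p r := by
  have h : (FF k p r).map (om k u γ).toLinearMap ≤ FF k p r := by
    rw [FF, Submodule.map_pow, Submodule.map_sup, Submodule.map_one]
    refine pow_le_pow_left₀ zero_le (sup_le_sup_left ?_ _) r
    rw [Submodule.map_span, Submodule.span_le]
    rintro _ ⟨_, ⟨i, rfl⟩, rfl⟩
    exact hV γ i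
  exact h ⟨x, hx, rfl⟩

lemma om_FFl (hV : ∀ γ i, om k u γ (p i) ∈ Submodule.span k (Set.range p)) (γ : Γ) (r : ℕ) (x : H) (hx : x ∈ FFl k p r) : om k u γ x ∈ FFl k p r := by
  cases r with
  | zero => rw [show x = 0 from hx, map_zero]; exact zero_mem _
  | succ r => exact om_FF p u hV γ r x hx

/-- `F` times the span of the group -/
noncomputable def FU {k H Γ : Type*} [Field k] [Ring H] [Algebra k H] [Group Γ] (u : Γ →* H) (F : Submodule k H) : Submodule k H := F * Submodule.span k (Set.range u)

lemma mem_FU (F : Submodule k H) (x : H) (hx : x ∈ F) (γ : Γ) : x * u γ ∈ FU u F := Submodule.mul_mem_mul hx (Submodule.subset_span ⟨γ, rfl⟩)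

lemma FU_ind (F : Submodule k H) (P : H → Prop) (h0 : P 0) (ha : ∀ x y, P x → P y → P (x + y)) (h : ∀ x ∈ F, ∀ γ, P (x * u γ)) (y : H) (hy : y ∈ FU u F) : P y := by
  induction hy using Submodule.mul_induction_on' with
  | mem_mul_mem v hv w hw =>
    have : ∀ v ∈ F, P (v * w) := by
      induction hw using Submodule.span_induction with
      | mem y hy => obtain ⟨γ, rfl⟩ := hy; exact fun v hv => h v hv γ
      | zero => intro v _; rwa [mul_zero]
      | add y z _ _ h1 h2 => intro v hv; rw [mul_add]; exact ha _ _ (h1 v hv) (h2 v hv)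
      | smul c y _ h1 => intro v hv; rw [mul_smul_comm, ← smul_mul_assoc]; exact h1 _ (F.smul_mem c hv)
    exact this v hv
  | add x _ y _ h1 h2 => exact ha _ _ h1 h2

lemma FU_mul (F F' F'' : Submodule k H) (h1 : ∀ x ∈ F, ∀ y ∈ F', x * y ∈ F'') (h2 : ∀ (γ : Γ), ∀ x ∈ F', om k u γ x ∈ F') {x y : H} (hx : x ∈ FU u F) (hy : y ∈ FU u F') : x * y ∈ FU u F'' := by
  refine FU_ind u F (fun x => x * y ∈ FU u F'') (by simp) (fun a b ha hb => by rw [add_mul]; exact add_mem ha hb) (fun a ha γ => ?_) x hx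
  refine FU_ind u F' (fun y => a * u γ * y ∈ FU u F'') (by simp) (fun a b ha hb => by rw [mul_add]; exact add_mem ha hb) (fun b hb δ => ?_) y hy
  have : a * u γ * (b * u δ) = (a * om k u γ b) * u (γ * δ) := by
    rw [mul_assoc, ← mul_assoc (u γ), om_mul (k := k), map_mul u]; noncomm_ring
  rw [this]
  exact mem_FU u _ _ (h1 _ ha _ (h2 γ b hb)) _

variable [MulSemiringAction Γ (MvPolynomial (Fin m) k)]

lemma om_sy (hcomm : ∀ i j, p i * p j - p j * p i ∈ Submodule.span k (Set.range p)) (hV : ∀ γ i, om k u γ (p i) ∈ Submodule.span k (Set.range p))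
    (hX : ∀ γ i, om k u γ (p i) = sy k p (γ • X i)) (hsm : ∀ (γ : Γ) (c : k) (f : MvPolynomial (Fin m) k), γ • (c • f) = c • (γ • f))
    (hal : ∀ (γ : Γ) d (f : MvPolynomial (Fin m) k), f.IsHomogeneous d → (γ • f).IsHomogeneous d) (γ : Γ) (d : ℕ) (f : MvPolynomial (Fin m) k) (hf : f.IsHomogeneous d) :
    om k u γ (sy k p f) - sy k p (γ • f) ∈ FFl k p d := by
  refine hom_ind2 (fun d f => om k u γ (sy k p f) - sy k p (γ • f) ∈ FFl k p d) ?_ ?_ ?_ ?_ ?_ d f hf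
  · intro d; simp
  · intro d f1 f2 h1 h2
    rw [map_add, map_add, smul_add, map_add, add_sub_add_comm]; exact add_mem h1 h2
  · intro d c f h1
    rw [map_smul, map_smul, hsm, map_smul, ← smul_sub]; exact Submodule.smul_mem _ _ h1
  · rw [sy_one, map_one, smul_one, sy_one, sub_self]; exact zero_mem _
  · intro d i f hf ih
    have hx1 := hal γ 1 (X i) (MvPolynomial.isHomogeneous_X k i)
    have e1 := om_FFl p u hV γ _ _ (sy_X_mul p hcomm i d f hf)
    have e2 := FF_mul_FFl_mem p (sy_mem p 1 _ hx1) ih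
    have e3 := sy_mul p hcomm 1 d _ _ hx1 (hal γ d f hf)
    rw [map_sub, map_mul, hX] at e1
    rw [add_comm 1 d] at e2 e3
    have h4 : om k u γ (sy k p (X i * f)) - sy k p (γ • (X i * f)) =
      -(sy k p (γ • X i) * om k u γ (sy k p f) - om k u γ (sy k p (X i * f))) + sy k p (γ • X i) * (om k u γ (sy k p f) - sy k p (γ • f)) + (sy k p (γ • X i) * sy k p (γ • f) - sy k p (γ • X i * γ • f)) := by
      rw [smul_mul']; noncomm_ring
    rw [h4]
    exact add_mem (add_mem (neg_mem e1) e2) e3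

/-- symbol map of the skew group ring -/
noncomputable def Th (k : Type*) {H Γ : Type*} [Field k] [Ring H] [Algebra k H] [Group Γ] {m : ℕ} (p : Fin m → H) (u : Γ →* H) : SkewMonoidAlgebra (MvPolynomial (Fin m) k) Γ →+ H :=
  SkewMonoidAlgebra.liftNC (sy k p).toAddMonoidHom u

lemma Th_single (γ : Γ) (f : MvPolynomial (Fin m) k) : Th k p u (SkewMonoidAlgebra.single γ f) = sy k p f * u γ := SkewMonoidAlgebra.liftNC_single _ _ _ _

/-- homogeneous elements of the skew group ring -/
noncomputable def Hs (k Γ : Type*) [Field k] (m d : ℕ) : AddSubmonoid (SkewMonoidAlgebra (MvPolynomial (Fin m) k) Γ) :=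
  AddSubmonoid.closure {x | ∃ γ f, f.IsHomogeneous d ∧ x = SkewMonoidAlgebra.single γ f}

lemma Hs_coeff (d : ℕ) (x : SkewMonoidAlgebra (MvPolynomial (Fin m) k) Γ) (hx : x ∈ Hs k Γ m d) (γ : Γ) : (x.coeff γ).IsHomogeneous d := by
  induction hx using AddSubmonoid.closure_induction with
  | mem x hx =>
    obtain ⟨δ, f, hf, rfl⟩ := hx
    rw [SkewMonoidAlgebra.coeff_single_apply]
    split_ifs
    · exact hf
    · exact MvPolynomial.isHomogeneous_zero _ _ _
  | zero => exact MvPolynomial.isHomogeneous_zero _ _ _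
  | add x y _ _ h1 h2 => rw [SkewMonoidAlgebra.coeff_add]; exact h1.add h2

lemma Th_mem (d : ℕ) (x : SkewMonoidAlgebra (MvPolynomial (Fin m) k) Γ) (hx : x ∈ Hs k Γ m d) : Th k p u x ∈ FU u (FF k p d) := by
  induction hx using AddSubmonoid.closure_induction with
  | mem x hx =>
    obtain ⟨δ, f, hf, rfl⟩ := hx
    rw [Th_single]; exact mem_FU u _ _ (sy_mem p d f hf) δ
  | zero => rw [map_zero]; exact zero_mem _
  | add x y _ _ h1 h2 => rw [map_add]; exact add_mem h1 h2

lemma Th_mul (hcomm : ∀ i j, p i * p j - p j * p i ∈ Submodule.span k (Set.range p)) (hV : ∀ γ i, om k u γ (p i) ∈ Submodule.span k (Set.range p))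
    (hX : ∀ γ i, om k u γ (p i) = sy k p (γ • X i)) (hsm : ∀ (γ : Γ) (c : k) (f : MvPolynomial (Fin m) k), γ • (c • f) = c • (γ • f))
    (hal : ∀ (γ : Γ) d (f : MvPolynomial (Fin m) k), f.IsHomogeneous d → (γ • f).IsHomogeneous d) (d e : ℕ)
    (x y : SkewMonoidAlgebra (MvPolynomial (Fin m) k) Γ) (hx : x ∈ Hs k Γ m d) (hy : y ∈ Hs k Γ m e) :
    x * y ∈ Hs k Γ m (d + e) ∧ Th k p u x * Th k p u y - Th k p u (x * y) ∈ FU u (FFl k p (d + e)) := by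
  induction hx using AddSubmonoid.closure_induction with
  | mem x hx =>
    obtain ⟨γ, f, hf, rfl⟩ := hx
    induction hy using AddSubmonoid.closure_induction with
    | mem y hy =>
      obtain ⟨δ, g, hg, rfl⟩ := hy
      rw [SkewMonoidAlgebra.single_mul_single]
      refine ⟨AddSubmonoid.subset_closure ⟨_, _, hf.mul (hal γ e g hg), rfl⟩, ?_⟩
      rw [Th_single, Th_single, Th_single]
      have h1 : sy k p f * u γ * (sy k p g * u δ) - sy k p (f * γ • g) * u (γ * δ) =
        (sy k p f * (om k u γ (sy k p g) - sy k p (γ • g)) + (sy k p f * sy k p (γ • g) - sy k p (f * γ • g))) * u (γ * δ) := by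
        rw [mul_assoc, ← mul_assoc (u γ), om_mul (k := k), map_mul u]; noncomm_ring
      rw [h1]
      exact mem_FU u _ _ (add_mem (FF_mul_FFl_mem p (sy_mem p d f hf) (om_sy p u hcomm hV hX hsm hal γ e g hg)) (sy_mul p hcomm d e _ _ hf (hal γ e g hg))) _
    | zero => simp
    | add x y _ _ h1 h2 =>
      rw [mul_add, map_add, map_add, mul_add, add_sub_add_comm]
      exact ⟨add_mem h1.1 h2.1, add_mem h1.2 h2.2⟩
  | zero => simp
  | add x y _ _ h1 h2 =>
    rw [add_mul, map_add, map_add, add_mul, add_sub_add_comm]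
    exact ⟨add_mem h1.1 h2.1, add_mem h1.2 h2.2⟩

variable (b : Module.Basis ((Fin m →₀ ℕ) × Γ) k H)

lemma Th_repr (hb : ∀ a γ, b (a, γ) = mon p a * u γ) (x : SkewMonoidAlgebra (MvPolynomial (Fin m) k) Γ) (a : Fin m →₀ ℕ) (γ : Γ) :
    b.repr (Th k p u x) (a, γ) = MvPolynomial.coeff a (x.coeff γ) := by
  induction x using SkewMonoidAlgebra.induction_on with
  | zero => simp
  | add x y h1 h2 => rw [map_add, map_add, Finsupp.add_apply, h1, h2, SkewMonoidAlgebra.coeff_add, Finsupp.add_apply, MvPolynomial.coeff_add]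
  | single δ f =>
    rw [Th_single]
    induction f using MvPolynomial.induction_on' with
    | monomial e c =>
      rw [sy_monomial, smul_mul_assoc, ← hb, map_smul, b.repr_self, SkewMonoidAlgebra.coeff_single_apply, Finsupp.smul_apply, Finsupp.single_apply]
      by_cases h1 : e = a <;> by_cases h2 : δ = γ <;> simp [h1, h2, MvPolynomial.coeff_monomial]
    | add f g h1 h2 =>
      rw [map_add, add_mul, map_add, Finsupp.add_apply, h1, h2, SkewMonoidAlgebra.single_add, SkewMonoidAlgebra.coeff_add, Finsupp.add_apply, MvPolynomial.coeff_add]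

lemma FU_repr (hcomm : ∀ i j, p i * p j - p j * p i ∈ Submodule.span k (Set.range p)) (hb : ∀ a γ, b (a, γ) = mon p a * u γ)
    (d : ℕ) (x : H) (hx : x ∈ FU u (FFl k p d)) (a : Fin m →₀ ℕ) (had : d ≤ a.degree) (γ : Γ) : b.repr x (a, γ) = 0 := by
  refine FU_ind u _ (fun x => b.repr x (a, γ) = 0) (by simp) (fun x y h1 h2 => by rw [map_add, Finsupp.add_apply, h1, h2, add_zero]) (fun y hy δ => ?_) x hx
  cases d with
  | zero => rw [show y = 0 from hy]; simp
  | succ d =>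
    have := FF_le_span p hcomm d hy
    clear hy
    induction this using Submodule.span_induction with
    | mem z hz =>
      obtain ⟨e, he, rfl⟩ := hz
      have he' : e.degree ≤ d := he
      rw [← hb, b.repr_self, Finsupp.single_apply, if_neg]
      intro h
      rw [Prod.mk.injEq] at h
      rw [h.1] at he'; omega
    | zero => simp
    | add y z _ _ h1 h2 => rw [add_mul, map_add, Finsupp.add_apply, h1, h2, add_zero]
    | smul c y _ h1 => rw [smul_mul_assoc, map_smul, Finsupp.smul_apply, h1, smul_zero]

lemma lead (hcomm : ∀ i j, p i * p j - p j * p i ∈ Submodule.span k (Set.range p)) (hb : ∀ a γ, b (a, γ) = mon p a * u γ) (x : H) (hx : x ≠ 0) :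
    ∃ d, ∃ y ∈ Hs k Γ m d, y ≠ 0 ∧ x - Th k p u y ∈ FU u (FFl k p d) := by
  have hne : (b.repr x).support.Nonempty := by
    rw [Finsupp.support_nonempty_iff]; simpa using hx
  obtain ⟨z, hz, hmax⟩ := Finset.exists_max_image _ (fun z => z.1.degree) hne
  set d := z.1.degree with hd
  set S := (b.repr x).support with hS
  let y : SkewMonoidAlgebra (MvPolynomial (Fin m) k) Γ := ∑ w ∈ S with w.1.degree = d, SkewMonoidAlgebra.single w.2 (monomial w.1 (b.repr x w))
  have h1 : x - Th k p u y ∈ FU u (FFl k p d) := by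
    have h2 : x = ∑ w ∈ S, b.repr x w • b w := by
      conv_lhs => rw [← b.linearCombination_repr x, Finsupp.linearCombination_apply, Finsupp.sum]
    have h3 : Th k p u y = ∑ w ∈ S with w.1.degree = d, b.repr x w • b w := by
      rw [map_sum]
      refine Finset.sum_congr rfl (fun w _ => ?_)
      rw [Th_single, sy_monomial, smul_mul_assoc, ← hb]
    have h4 : x - Th k p u y = ∑ w ∈ S with ¬ w.1.degree = d, b.repr x w • b w := by
      rw [h3, sub_eq_iff_eq_add']
      conv_lhs => rw [h2]
      exact (Finset.sum_filter_add_sum_filter_not S _ _).symm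
    rw [h4]
    refine Submodule.sum_mem _ (fun w hw => Submodule.smul_mem _ _ ?_)
    rw [Finset.mem_filter] at hw
    have h5 : w.1.degree < d := lt_of_le_of_ne (hmax w hw.1) hw.2
    rw [show b w = mon p w.1 * u w.2 from hb w.1 w.2]
    refine mem_FU u _ _ ?_ _
    obtain ⟨r, hr⟩ : ∃ r, d = r + 1 := ⟨d - 1, by omega⟩
    rw [hr]
    exact FF_mono p (by omega) (mon_mem_FF p w.1)
  refine ⟨d, y, sum_mem (fun w hw => AddSubmonoid.subset_closure ⟨_, _, MvPolynomial.isHomogeneous_monomial _ (Finset.mem_filter.1 hw).2, rfl⟩), ?_, h1⟩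
  intro h0
  rw [h0, map_zero, sub_zero] at h1
  exact Finsupp.mem_support_iff.1 hz (FU_repr p u b hcomm hb d x h1 z.1 le_rfl z.2)

theorem dom_abs (hcomm : ∀ i j, p i * p j - p j * p i ∈ Submodule.span k (Set.range p)) (hV : ∀ γ i, om k u γ (p i) ∈ Submodule.span k (Set.range p))
    (hX : ∀ γ i, om k u γ (p i) = sy k p (γ • X i)) (hsm : ∀ (γ : Γ) (c : k) (f : MvPolynomial (Fin m) k), γ • (c • f) = c • (γ • f))
    (hal : ∀ (γ : Γ) d (f : MvPolynomial (Fin m) k), f.IsHomogeneous d → (γ • f).IsHomogeneous d) (hb : ∀ a γ, b (a, γ) = mon p a * u γ)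
    (hdom : ∀ x y : SkewMonoidAlgebra (MvPolynomial (Fin m) k) Γ, x * y = 0 → x = 0 ∨ y = 0) : NoZeroDivisors H := by
  refine ⟨fun {x y} hxy => ?_⟩
  by_contra hne
  push Not at hne
  obtain ⟨d, x', hx', hx0, hx1⟩ := lead p u b hcomm hb x hne.1
  obtain ⟨e, y', hy', hy0, hy1⟩ := lead p u b hcomm hb y hne.2
  obtain ⟨h1, h2⟩ := Th_mul p u hcomm hV hX hsm hal d e x' y' hx' hy'
  have h3 : y ∈ FU u (FF k p e) := by
    rw [← sub_add_cancel y (Th k p u y')]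
    exact add_mem (mul_le_mul_left (FFl_le p e) _ hy1) (Th_mem p u e y' hy')
  have e1 := FU_mul u _ _ (FFl k p (d+e)) (fun x hx y hy => FFl_mul_mem p hx hy) (fun γ x => om_FF p u hV γ e x) hx1 h3
  have e2 := FU_mul u _ _ (FFl k p (d+e)) (fun x hx y hy => FF_mul_FFl_mem p hx hy) (fun γ x => om_FFl p u hV γ e x) (Th_mem p u d x' hx') hy1
  have h4 : Th k p u (x' * y') ∈ FU u (FFl k p (d+e)) := by
    have : Th k p u (x' * y') = x * y - ((x - Th k p u x') * y + Th k p u x' * (y - Th k p u y') + (Th k p u x' * Th k p u y' - Th k p u (x' * y'))) := by noncomm_ring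
    rw [this, hxy, zero_sub]
    exact neg_mem (add_mem (add_mem e1 e2) h2)
  have h5 : x' * y' = 0 := by
    refine SkewMonoidAlgebra.ext (fun γ => MvPolynomial.ext _ _ (fun a => ?_))
    rw [SkewMonoidAlgebra.coeff_zero, Finsupp.zero_apply, MvPolynomial.coeff_zero]
    by_contra h6
    have h7 := Hs_coeff (d+e) _ h1 γ h6
    replace h7 : a.degree = d + e := by rw [Finsupp.degree_eq_weight_one]; exact h7
    exact h6 (by rw [← Th_repr p u b hb]; exact FU_repr p u b hcomm hb _ _ h4 a h7.ge γ)
  rcases hdom _ _ h5 with h | h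
  · exact hx0 h
  · exact hy0 h
end
end GW

namespace GW
open Classical
open MvPolynomial (X monomial)
universe uk uh ug

theorem dom_main {k : Type uk} {H : Type uh} {Γ : Type ug} [Field k] [CharZero k] [Ring H] [Algebra k H] [Group Γ] {m : ℕ} (p : Fin m → H) (u : Γ →* H)
    (b : Module.Basis ((Fin m →₀ ℕ) × Γ) k H) (hcomm : ∀ i j, p i * p j - p j * p i ∈ Submodule.span k (Set.range p))
    (hV : ∀ γ i, u γ * (p i * u γ⁻¹) ∈ Submodule.span k (Set.range p)) (hb : ∀ a γ, b (a, γ) = mon p a * u γ)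
    (N : Subgroup Γ) (hN : PZ N) [N.FiniteIndex] (hΓ : ∀ (h u : Γ) (r : ℕ), 2 ≤ r → u * h^r * u⁻¹ = h → h = 1) : NoZeroDivisors H := by
  let L : H →ₗ[k] MvPolynomial (Fin m) k := b.constr k (fun w => monomial w.1 1)
  change ∀ γ i, om k u γ (p i) ∈ _ at hV
  have hL : ∀ i, L (p i) = X i := by
    intro i
    have h1 : p i = b (Finsupp.single i 1, 1) := by rw [hb, mon_single, map_one, mul_one]
    rw [h1, Module.Basis.constr_basis]; rfl
  have hVi : ∀ P : H → Prop, P 0 → (∀ x y, P x → P y → P (x + y)) → (∀ (c : k) x, P x → P (c • x)) → (∀ i, P (p i)) → ∀ v ∈ Submodule.span k (Set.range p), P v := by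
    intro P h0 ha hs hp v hv
    induction hv using Submodule.span_induction with
    | mem y hy => obtain ⟨i, rfl⟩ := hy; exact hp i
    | zero => exact h0
    | add y z _ _ h1 h2 => exact ha _ _ h1 h2
    | smul c y _ h1 => exact hs _ _ h1
  have hsy : ∀ v ∈ Submodule.span k (Set.range p), sy k p (L v) = v :=
    hVi _ (by simp) (fun x y h1 h2 => by rw [map_add, map_add, h1, h2]) (fun c x h1 => by rw [map_smul, map_smul, h1]) (fun i => by rw [hL, sy_X])
  have hhom : ∀ v ∈ Submodule.span k (Set.range p), (L v).IsHomogeneous 1 :=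
    hVi _ (by rw [map_zero]; exact MvPolynomial.isHomogeneous_zero _ _ _) (fun x y h1 h2 => by rw [map_add]; exact h1.add h2)
      (fun c x h1 => by rw [map_smul, MvPolynomial.smul_eq_C_mul]; simpa using (MvPolynomial.isHomogeneous_C (Fin m) c).mul h1) (fun i => by rw [hL]; exact MvPolynomial.isHomogeneous_X k i)
  let al : Γ → MvPolynomial (Fin m) k →ₐ[k] MvPolynomial (Fin m) k := fun γ => MvPolynomial.aeval (fun i => L (om k u γ (p i)))
  have halX : ∀ γ i, al γ (X i) = L (om k u γ (p i)) := fun γ i => MvPolynomial.aeval_X _ _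
  have halL : ∀ γ, ∀ v ∈ Submodule.span k (Set.range p), al γ (L v) = L (om k u γ v) := fun γ =>
    hVi _ (by simp) (fun x y h1 h2 => by rw [map_add, map_add, map_add, map_add, h1, h2]) (fun c x h1 => by rw [map_smul, map_smul, map_smul, map_smul, h1]) (fun i => by rw [hL, halX])
  have h1 : al 1 = AlgHom.id k _ := by
    refine MvPolynomial.algHom_ext (fun i => ?_)
    rw [halX, om_apply, inv_one, map_one, one_mul, mul_one, hL]; rfl
  have h2 : ∀ γ δ, al (γ * δ) = (al γ).comp (al δ) := by
    intro γ δ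
    refine MvPolynomial.algHom_ext (fun i => ?_)
    rw [AlgHom.comp_apply, halX, halX, halL γ _ (hV δ i)]
    congr 1
    rw [om_apply, om_apply, om_apply, mul_inv_rev, map_mul, map_mul]; noncomm_ring
  let _ : MulSemiringAction Γ (MvPolynomial (Fin m) k) :=
    { smul := fun γ f => al γ f
      one_smul := (fun f => by change al 1 f = f; rw [h1]; rfl)
      mul_smul := (fun γ δ f => by change al (γ * δ) f = al γ (al δ f); rw [h2]; rfl)
      smul_zero := (fun γ => map_zero (al γ))
      smul_add := (fun γ => map_add (al γ))
      smul_one := (fun γ => map_one (al γ))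
      smul_mul := (fun γ => map_mul (al γ)) }
  have hdef : ∀ (γ : Γ) (f : MvPolynomial (Fin m) k), γ • f = al γ f := fun _ _ => rfl
  refine dom_abs p u b hcomm hV (fun γ i => ?_) (fun γ c f => ?_) (fun γ d f hf => ?_) hb ?_
  · rw [hdef, halX, hsy _ (hV γ i)]
  · rw [hdef, map_smul]; rfl
  · have := hf.aeval (fun i => L (om k u γ (p i))) (n := 1) (fun i => hhom _ (hV γ i))
    rw [one_mul] at this; exact this
  · refine zero_div_mv m MvPolynomial.constantCoeff (fun γ s => ?_) (fun c => ⟨MvPolynomial.C c, by simp⟩) N hN hΓ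
    have h3 : (MvPolynomial.constantCoeff (R := k)).comp (al γ).toRingHom = MvPolynomial.constantCoeff := by
      refine MvPolynomial.ringHom_ext (fun c => ?_) (fun i => ?_)
      · have : al γ (MvPolynomial.C c) = MvPolynomial.C c := (al γ).commutes c
        simp [this]
      · have h4 : MvPolynomial.constantCoeff (al γ (X i)) = 0 := by
          rw [halX, MvPolynomial.constantCoeff_eq]
          exact (hhom _ (hV γ i)).coeff_eq_zero (by simp)
        simpa using h4
    exact congrArg (fun f => f s) h3

/-- subgroups satisfy the ascending chain condition -/
theorem acc_grp {k R : Type*} [Field k] [CharZero k] [Ring R] [HopfAlgebra k R] [IsNoetherianRing R] {n : ℕ} (p : Fin n → R)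
    (b : Module.Basis ((Fin n →₀ ℕ) × GroupLike k R) k R) (hb : ∀ w, b w = bb k p w) : WellFoundedGT (Subgroup (GroupLike k R)) := by
  let I : Subgroup (GroupLike k R) → Submodule R R := fun K => Submodule.span R ((fun h => h.val - 1) '' (K : Set (GroupLike k R)))
  have hmono : Monotone I := fun K K' h => Submodule.span_mono (Set.image_mono h)
  have key : ∀ K g, (g.val - 1 : R) ∈ I K → g ∈ K := by
    intro K g hg
    let φ : R →ₗ[k] k := b.constr k (fun w => if w.1 = 0 ∧ w.2 ∈ K then 1 else 0)
    have hφ : ∀ w, φ (bb k p w) = if w.1 = 0 ∧ w.2 ∈ K then 1 else 0 := fun w => by rw [← hb, Module.Basis.constr_basis]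
    have hm : ∀ h ∈ K, ∀ c, φ (c * h.val) = φ c := by
      intro h hh c
      have : φ ∘ₗ LinearMap.mulRight k h.val = φ := by
        refine b.ext (fun w => ?_)
        have e1 : bb k p w * h.val = bb k p (w.1, w.2 * h) := by rw [bb, bb, mul_assoc, GroupLike.val_mul]
        rw [LinearMap.comp_apply, LinearMap.mulRight_apply, hb, e1, hφ, hφ, K.mul_mem_cancel_right hh]
      exact LinearMap.congr_fun this c
    have h1 : ∀ x ∈ I K, ∀ c, φ (c * x) = 0 := by
      intro x hx
      induction hx using Submodule.span_induction with
      | zero => intro c; rw [mul_zero, map_zero]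
      | add y z _ _ h1 h2 => intro c; rw [mul_add, map_add, h1, h2, add_zero]
      | mem y hy =>
        obtain ⟨h, hh, rfl⟩ := hy
        intro c
        rw [mul_sub, mul_one, map_sub, hm h hh, sub_self]
      | smul c y _ h1 => intro c'; rw [smul_eq_mul, ← mul_assoc]; exact h1 _
    by_contra hgK
    have h2 := h1 _ hg 1
    rw [one_mul] at h2
    have e1 := hφ (0, g)
    have e2 := hφ (0, 1)
    rw [bb_zero] at e1 e2
    rw [GroupLike.val_one] at e2
    rw [map_sub, e1, e2] at h2
    simp [K.one_mem, hgK] at h2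
  refine StrictMono.wellFoundedGT (f := I) (hmono.strictMono_of_injective (fun K K' h => le_antisymm ?_ ?_))
  · intro g hg; exact key K' g (h ▸ Submodule.subset_span ⟨g, hg, rfl⟩)
  · intro g hg; exact key K g (h ▸ Submodule.subset_span ⟨g, hg, rfl⟩)
end GW

namespace GW
open Classical
open scoped TensorProduct

lemma mon_map {A B : Type*} [Ring A] [Ring B] (φ : A →+* B) {n : ℕ} (p : Fin n → A) (a : Fin n →₀ ℕ) : mon (fun i => φ (p i)) a = φ (mon p a) := by
  rw [mon, mon, map_list_prod, List.map_map]
  congr 1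
  exact List.map_congr_left (fun i _ => by simp)

lemma mon_append {A : Type*} [Ring A] {n m : ℕ} (p : Fin n → A) (q : Fin m → A) (a : Fin n →₀ ℕ) (b : Fin m →₀ ℕ) (c : Fin (n + m) →₀ ℕ)
    (h1 : ∀ i, c (Fin.castAdd m i) = a i) (h2 : ∀ i, c (Fin.natAdd n i) = b i) : mon (Fin.append p q) c = mon p a * mon q b := by
  simp only [mon, ← List.ofFn_eq_map]
  rw [List.ofFn_add, List.prod_append]
  congr 2
  · congr 1; funext i
    exact congrArg₂ (· ^ ·) (Fin.append_left p q i) (h1 i)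
  · simp [h2]

lemma grp_mul_inv {k R : Type*} [Field k] [Ring R] [HopfAlgebra k R] (g : GroupLike k R) : g.val * g⁻¹.val = 1 := by
  rw [← GroupLike.val_mul, mul_inv_cancel, GroupLike.val_one]

lemma Prim_comm {k R : Type*} [Field k] [Ring R] [HopfAlgebra k R] {x y : R} (hx : x ∈ Prim k R) (hy : y ∈ Prim k R) : x * y - y * x ∈ Prim k R := by
  rw [mem_Prim] at *
  rw [map_sub, Bialgebra.comul_mul, Bialgebra.comul_mul, hx, hy]
  simp only [add_mul, mul_add, Algebra.TensorProduct.tmul_mul_tmul, one_mul, mul_one, TensorProduct.sub_tmul, TensorProduct.tmul_sub]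
  abel

lemma Prim_conj {k R : Type*} [Field k] [Ring R] [HopfAlgebra k R] {x : R} (hx : x ∈ Prim k R) (g : GroupLike k R) : g.val * (x * g⁻¹.val) ∈ Prim k R := by
  rw [mem_Prim] at *
  rw [Bialgebra.comul_mul, Bialgebra.comul_mul, hx, g.2.comul_eq_tmul_self, (g⁻¹).2.comul_eq_tmul_self]
  simp only [add_mul, mul_add, Algebra.TensorProduct.tmul_mul_tmul, one_mul, grp_mul_inv]

/-- the group of grouplikes of the tensor square -/
noncomputable def uu (k R : Type*) [Field k] [Ring R] [HopfAlgebra k R] : GroupLike k R × GroupLike k R →* R ⊗[k] R where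
  toFun g := g.1.val ⊗ₜ g.2.val
  map_one' := (by simp [Algebra.TensorProduct.one_def])
  map_mul' g h := (by simp)

theorem tensor_dom {k R : Type*} [Field k] [IsAlgClosed k] [CharZero k] [Ring R] [HopfAlgebra k R] [IsNoetherianRing R] [IsDomain R]
    (hcocomm : ∀ r : R, TensorProduct.comm k R R (Coalgebra.comul r) = Coalgebra.comul r)
    (hGK : gkDim k R ≠ ⊤) : IsDomain (R ⊗[k] R) := by
  obtain ⟨d, hd⟩ := gk_growth hGK
  have hfd := prim_fd d hd
  obtain ⟨n, ⟨B⟩⟩ : ∃ n, Nonempty (Module.Basis (Fin n) k (Prim k R)) := ⟨_, ⟨Module.finBasis k (Prim k R)⟩⟩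
  let p : Fin n → R := fun i => (B i : R)
  have hp : ∀ i, p i ∈ Prim k R := fun i => (B i).2
  have hli : LinearIndependent k p := B.linearIndependent.map' (Prim k R).subtype (Submodule.ker_subtype _)
  have hsp : Prim k R ≤ Submodule.span k (Set.range p) := by
    have h1 := congrArg (Submodule.map (Prim k R).subtype) B.span_eq
    rw [Submodule.map_span, Submodule.map_subtype_top, ← Set.range_comp] at h1
    exact h1.ge
  let b0 : Module.Basis ((Fin n →₀ ℕ) × GroupLike k R) k R := Module.Basis.mk (li_bb p hp hli) (span_bb_top p hcocomm hp hli hsp).ge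
  have hacc := acc_grp p b0 (fun w => by simp [b0])
  obtain ⟨⟨N, hN, hNf⟩, hΓ⟩ := grp_sq (G := GroupLike k R) grp_tf d (grp_PG d hd)
  choose c hc0 hc using ee_mon (k := k) p
  let b1 := b0.isUnitSMul (w := fun w => (c w.1)⁻¹) (fun w => (inv_ne_zero (hc0 w.1)).isUnit)
  have hb1 : ∀ w, b1 w = mon p w.1 * w.2.val := by
    intro w
    rw [Module.Basis.isUnitSMul_apply, Module.Basis.mk_apply, bb, hc, smul_mul_assoc, inv_smul_smul₀ (hc0 _)]
  let E : (Fin (n + n) →₀ ℕ) ≃ (Fin n →₀ ℕ) × (Fin n →₀ ℕ) := (Finsupp.domCongr finSumFinEquiv.symm).toEquiv.trans Finsupp.sumFinsuppEquivProdFinsupp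
  let b2 := (b1.tensorProduct b1).reindex ((Equiv.prodProdProdComm _ _ _ _).trans (Equiv.prodCongr E.symm (Equiv.refl _)))
  let q : Fin (n + n) → R ⊗[k] R := Fin.append (fun i => (Algebra.TensorProduct.includeLeft : R →ₐ[k] R ⊗[k] R) (p i)) (fun i => (Algebra.TensorProduct.includeRight : R →ₐ[k] R ⊗[k] R) (p i))
  have hq1 : ∀ i, q (Fin.castAdd n i) = p i ⊗ₜ 1 := fun i => Fin.append_left _ _ _
  have hq2 : ∀ i, q (Fin.natAdd n i) = 1 ⊗ₜ p i := fun i => Fin.append_right _ _ _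
  have hm1 : ∀ x ∈ Prim k R, x ⊗ₜ[k] (1:R) ∈ Submodule.span k (Set.range q) := by
    intro x hx
    refine (Submodule.span_le (p := (Submodule.span k (Set.range q)).comap (Algebra.TensorProduct.includeLeft : R →ₐ[k] R ⊗[k] R).toLinearMap)).2 ?_ (hsp hx)
    rintro _ ⟨i, rfl⟩
    exact Submodule.subset_span ⟨_, hq1 i⟩
  have hm2 : ∀ x ∈ Prim k R, (1:R) ⊗ₜ[k] x ∈ Submodule.span k (Set.range q) := by
    intro x hx
    refine (Submodule.span_le (p := (Submodule.span k (Set.range q)).comap (Algebra.TensorProduct.includeRight : R →ₐ[k] R ⊗[k] R).toLinearMap)).2 ?_ (hsp hx)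
    rintro _ ⟨i, rfl⟩
    exact Submodule.subset_span ⟨_, hq2 i⟩
  have hnz : NoZeroDivisors (R ⊗[k] R) := by
    refine dom_main q (uu k R) b2 (fun i j => ?_) (fun γ i => ?_) (fun a γ => ?_) N hN hΓ
    · refine Fin.addCases (fun i => ?_) (fun i => ?_) i <;> refine Fin.addCases (fun j => ?_) (fun j => ?_) j <;>
        simp only [hq1, hq2, Algebra.TensorProduct.tmul_mul_tmul, one_mul, mul_one, sub_self, zero_mem]
      · rw [← TensorProduct.sub_tmul]; exact hm1 _ (Prim_comm (hp i) (hp j))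
      · rw [← TensorProduct.tmul_sub]; exact hm2 _ (Prim_comm (hp i) (hp j))
    · have hu : ∀ γ, uu k R γ = γ.1.val ⊗ₜ γ.2.val := fun _ => rfl
      refine Fin.addCases (fun i => ?_) (fun i => ?_) i <;>
        simp only [hq1, hq2, hu, Algebra.TensorProduct.tmul_mul_tmul, one_mul, mul_one, Prod.fst_inv, Prod.snd_inv, grp_mul_inv]
      · exact hm1 _ (Prim_conj (hp i) _)
      · exact hm2 _ (Prim_conj (hp i) _)
    · have h1 : b2 (a, γ) = b1 ((E a).1, γ.1) ⊗ₜ b1 ((E a).2, γ.2) := by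
        rw [Module.Basis.reindex_apply]
        exact Module.Basis.tensorProduct_apply _ _ _ _
      have h2 : mon q a = mon _ (E a).1 * mon _ (E a).2 := mon_append _ _ (E a).1 (E a).2 a (fun i => rfl) (fun i => rfl)
      have h3 := mon_map (Algebra.TensorProduct.includeLeft : R →ₐ[k] R ⊗[k] R).toRingHom p (E a).1
      have h4 := mon_map (Algebra.TensorProduct.includeRight : R →ₐ[k] R ⊗[k] R).toRingHom p (E a).2
      rw [h1, hb1, hb1, h2]
      refine Eq.trans ?_ (congrArg₂ (fun x y => x * y * uu k R γ) h3 h4).symm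
      change _ = mon p (E a).1 ⊗ₜ[k] (1:R) * (1:R) ⊗ₜ[k] mon p (E a).2 * γ.1.val ⊗ₜ[k] γ.2.val
      simp only [Algebra.TensorProduct.tmul_mul_tmul, one_mul, mul_one]
  have hnt : Nontrivial (R ⊗[k] R) := ⟨b2 (0, 1), 0, b2.ne_zero _⟩
  exact NoZeroDivisors.to_isDomain _
end GW

/-- **Theorem 1.3.** Let `k` be an algebraically closed field of characteristic zero and let
`R` be a noetherian cocommutative Hopf `k`-algebra of finite Gelfand–Kirillov dimension that
is a domain.  Then `R ⊗ₖ R` is a domain. -/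
theorem stmt1 {k R : Type*} [Field k] [IsAlgClosed k] [CharZero k]
    [Ring R] [HopfAlgebra k R] [IsNoetherianRing R] [IsDomain R]
    (hcocomm : ∀ r : R, TensorProduct.comm k R R (Coalgebra.comul r) = Coalgebra.comul r)
    (hGK : gkDim k R ≠ ⊤) :
    IsDomain (R ⊗[k] R) := by
  exact GW.tensor_dom hcocomm hGK
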